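/- Let k ≥ 1, α₁,…,α_k : Fˣ → ℂˣ characters, and let y₁ ∈ GL_{a₁}(F),…,y_s ∈ GL_{a_s}(F) be regular elliptic elements whose characteristic polynomials are pairwise coprime. Let b₁,…,b_s ≥ 1 with n = Σ_j a_j·b_j. For each j, let E_j be a degree-a_j extension of F, η_j ∈ E_j a root of the characteristic polynomial of y_j, and suppose ω_{j,1},…,ω_{j,k} ∈ ℂ satisfy Σ_{i=1}^k ω_{j,i}^m = (-1)^{k-1} K_{E_{j,m}}(α,ψ,η_{j,m}) for every m ≥ 1. Let y = diag(J_{(b₁)}(y₁),…,J_{(b_s)}(y_s)) ∈ GL_n(F). Then K(α,ψ,y) = (-1)^{(k-1)n} · q^{(k-1)·n(n-1)/2} · ∏_{j=1}^s h_{b_j}(ω_{j,1},…,ω_{j,k}), where h_b(ω₁,…,ω_k) = Σ over d : {1,…,k} → ℕ with Σ d_i = b of ω₁^{d₁}⋯ω_k^{d_k} is the complete homogeneous symmetric polynomial of degree b. -/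

import Mathlib

open scoped BigOperators

/-- The twisted matrix Kloosterman sum
`K(α,ψ,x) = Σ_{g₁⋯g_k = x} (∏ αᵢ(det gᵢ)) ψ(tr(g₁+⋯+g_k))`. -/
noncomputable def matrixKloosterman {F : Type} [Field F] [Fintype F] [DecidableEq F]
    {ι : Type} [Fintype ι] [DecidableEq ι] {k : ℕ}
    (α : Fin k → Fˣ →* ℂˣ) (ψ : AddChar F ℂ) (x : Matrix ι ι F) : ℂ :=
  ∑ g : Fin k → (Matrix ι ι F)ˣ,
    if ((List.ofFn g).prod : Matrix ι ι F) = x then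
      (∏ i, (α i (Units.map (Matrix.detMonoidHom) (g i)) : ℂ)) *
        ψ (Matrix.trace (∑ i, ((g i : Matrix ι ι F))))
    else 0

/-- The twisted Kloosterman sum over a finite extension `E` of `F`:
`K_E(α,ψ,ξ) = Σ_{t₁⋯t_k = ξ} (∏ αᵢ(N_{E/F}(tᵢ))) ψ(Tr_{E/F}(t₁+⋯+t_k))`. -/
noncomputable def fieldKloosterman {F : Type} [Field F] [Fintype F] {k : ℕ}
    (α : Fin k → Fˣ →* ℂˣ) (ψ : AddChar F ℂ)
    (E : Type) [Field E] [Fintype E] [DecidableEq E] [Algebra F E] (ξ : E) : ℂ :=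
  ∑ t : Fin k → Eˣ,
    if ((∏ i, t i : Eˣ) : E) = ξ then
      (∏ i, (α i (Units.map (Algebra.norm F : E →* F) (t i)) : ℂ)) *
        ψ (Algebra.trace F E (∑ i, (t i : E)))
    else 0

/-- `J_{(m)}(y)`: block matrix with `m` copies of the `a×a` matrix `y` on the block diagonal
and identity blocks on the block superdiagonal. -/
def jordanBlock {F : Type} [Zero F] [One F] {a : ℕ}
    (y : Matrix (Fin a) (Fin a) F) (m : ℕ) :
    Matrix (Fin m × Fin a) (Fin m × Fin a) F :=
  fun p q =>
    if p.1 = q.1 then y p.2 q.2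
    else if (p.1 : ℕ) + 1 = (q.1 : ℕ) then (if p.2 = q.2 then 1 else 0) else 0

set_option linter.all false

section
open scoped BigOperators
namespace MK

/-! ### q-combinatorics -/

/-- signed coefficient `∏_{1≤i≤j} 1/(1-Q^i)` -/
noncomputable def qe (Q : ℂ) (j : ℕ) : ℂ := ∏ i ∈ Finset.range j, (1 - Q ^ (i + 1))⁻¹

/-- frame number -/
noncomputable def qN (Q L : ℂ) (j : ℕ) : ℂ := ∏ i ∈ Finset.range j, (L - Q ^ i)

/-- `Δ(l)=∏_{1≤i<l}(1-Q^i)` -/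
noncomputable def qD (Q : ℂ) (l : ℕ) : ℂ := ∏ i ∈ Finset.range (l - 1), (1 - Q ^ (i + 1))

lemma qN_shift (Q L : ℂ) (j : ℕ) : qN Q (Q * L) (j + 1) = (Q * L - 1) * Q ^ j * qN Q L j := by
  unfold qN
  rw [Finset.prod_range_succ']
  have : ∀ i, Q * L - Q ^ (i + 1) = Q * (L - Q ^ i) := fun i => by ring
  simp only [this, Finset.prod_mul_distrib, Finset.prod_const, Finset.card_range]
  ring

lemma qN_zero_of_lt (Q : ℂ) {l j : ℕ} (h : l < j) : qN Q (Q ^ l) j = 0 :=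
  Finset.prod_eq_zero (Finset.mem_range.mpr h) (sub_self _)

lemma qT_rec (Q : ℂ) (hQ : ∀ i : ℕ, (1 - Q ^ (i + 1)) ≠ 0) (L : ℂ) (j : ℕ) :
    qe Q (j + 1) * qN Q (Q * L) (j + 1)
      = Q ^ (j + 1) * (qe Q (j + 1) * qN Q L (j + 1)) - Q ^ j * (qe Q j * qN Q L j) := by
  have h1 : qe Q j = qe Q (j + 1) * (1 - Q ^ (j + 1)) := by
    unfold qe; rw [Finset.prod_range_succ]; field_simp [hQ j]
  have h2 : qN Q L (j + 1) = qN Q L j * (L - Q ^ j) := by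
    unfold qN; rw [Finset.prod_range_succ]
  rw [qN_shift, h1, h2]; ring

lemma qS_eq (Q : ℂ) (hQ : ∀ i : ℕ, (1 - Q ^ (i + 1)) ≠ 0) (l : ℕ) : ∀ (M : ℕ) (_ : l < M) (z : ℂ),
    ∑ j ∈ Finset.range M, qe Q j * z ^ j * qN Q (Q ^ l) j
      = ∏ i ∈ Finset.range l, (1 - Q ^ i * z) := by
  induction l with
  | zero =>
    intro M hM z
    rw [Finset.sum_eq_single_of_mem 0 (Finset.mem_range.mpr hM)]
    · simp [qe, qN]
    · intro j _ hj
      rw [qN_zero_of_lt Q (Nat.pos_of_ne_zero hj)]; simp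
  | succ l ih =>
    intro M hM z
    obtain ⟨M, rfl⟩ : ∃ M', M = M' + 1 := ⟨M - 1, by omega⟩
    have hM' : l < M := by omega
    rw [Finset.sum_range_succ']
    have e : ∀ j, qe Q (j + 1) * z ^ (j + 1) * qN Q (Q ^ (l + 1)) (j + 1)
        = (qe Q (j + 1) * (Q * z) ^ (j + 1) * qN Q (Q ^ l) (j + 1))
          - z * (qe Q j * (Q * z) ^ j * qN Q (Q ^ l) j) := by
      intro j
      have := qT_rec Q hQ (Q ^ l) j
      rw [pow_succ' Q l]
      calc _ = z ^ (j + 1) * (qe Q (j + 1) * qN Q (Q * Q ^ l) (j + 1)) := by ring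
        _ = _ := by rw [this]; ring
    simp only [e, Finset.sum_sub_distrib, ← Finset.mul_sum]
    have h1 := ih (M + 1) (by omega) (Q * z)
    rw [Finset.sum_range_succ'] at h1
    have h2 := ih M hM' (Q * z)
    have h3 : qe Q 0 * z ^ 0 * qN Q (Q ^ (l + 1)) 0 = qe Q 0 * (Q * z) ^ 0 * qN Q (Q ^ l) 0 := by
      simp [qe, qN]
    rw [h3, h2, Finset.prod_range_succ']
    have h4 : ∏ i ∈ Finset.range l, (1 - Q ^ (i + 1) * z) = ∏ i ∈ Finset.range l, (1 - Q ^ i * (Q * z)) :=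
      Finset.prod_congr rfl fun i _ => by ring
    rw [h4]
    linear_combination h1

lemma qD_eq (Q : ℂ) (hQ : ∀ i : ℕ, (1 - Q ^ (i + 1)) ≠ 0) (l M : ℕ) (hl : 1 ≤ l) (hM : l < M) :
    qD Q l = - ∑ j ∈ Finset.range M, (j : ℂ) * qe Q j * qN Q (Q ^ l) j := by
  obtain ⟨l, rfl⟩ : ∃ l', l = l' + 1 := ⟨l - 1, by omega⟩
  obtain ⟨M, rfl⟩ : ∃ M', M = M' + 1 := ⟨M - 1, by omega⟩
  have hM' : l < M := by omega
  rw [Finset.sum_range_succ']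
  have e : ∀ j : ℕ, ((j + 1 : ℕ) : ℂ) * qe Q (j + 1) * qN Q (Q ^ (l + 1)) (j + 1)
      = (((j + 1 : ℕ) : ℂ) * (Q ^ (j + 1) * (qe Q (j + 1) * qN Q (Q ^ l) (j + 1)))
        - (j : ℂ) * (Q ^ j * (qe Q j * qN Q (Q ^ l) j))) - qe Q j * Q ^ j * qN Q (Q ^ l) j := by
    intro j
    have := qT_rec Q hQ (Q ^ l) j
    rw [pow_succ' Q l, mul_assoc, this]; push_cast; ring
  simp only [e, Finset.sum_sub_distrib]
  have h5 := qS_eq Q hQ l M hM' Q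
  have h6 := Finset.sum_range_sub (fun j : ℕ => (j : ℂ) * (Q ^ j * (qe Q j * qN Q (Q ^ l) j))) M
  rw [Finset.sum_sub_distrib] at h6
  rw [h6, h5, qN_zero_of_lt Q hM']
  have h7 : qD Q (l + 1) = ∏ i ∈ Finset.range l, (1 - Q ^ i * Q) := by
    unfold qD; simp only [Nat.add_sub_cancel]
    exact Finset.prod_congr rfl fun i _ => by ring
  rw [h7]; simp

lemma one_sub_pow_ne {Q : ℕ} (hQ : 2 ≤ Q) (i : ℕ) : (1 - (Q : ℂ) ^ (i + 1)) ≠ 0 := by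
  intro h
  have h1 : ((Q ^ (i + 1) : ℕ) : ℂ) = ((1 : ℕ) : ℂ) := by push_cast; linear_combination -h
  have h2 := Nat.cast_injective h1
  have : 1 < Q ^ (i + 1) := Nat.one_lt_pow (by omega) (by omega)
  omega

end MK

end

section
open scoped BigOperators
namespace MK

variable {F : Type} [Field F]
variable {ι μ δ ν : Type} [Fintype ι] [Fintype μ] [Fintype δ] [Fintype ν]
  [DecidableEq ι] [DecidableEq μ] [DecidableEq δ] [DecidableEq ν]

/-- number of intertwiners -/
noncomputable def Ho (h : Matrix μ μ F) (g : Matrix ι ι F) : ℕ :=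
  Nat.card {A : Matrix ι μ F // g * A = A * h}

/-- number of injective intertwiners -/
noncomputable def Fr (h : Matrix μ μ F) (g : Matrix ι ι F) : ℕ :=
  Nat.card {A : Matrix ι μ F // Function.Injective A.mulVec ∧ g * A = A * h}

lemma mulVec_inj_iff (A : Matrix ι μ F) :
    Function.Injective A.mulVec ↔ ∀ z, A.mulVec z = 0 → z = 0 := by
  constructor
  · intro h z hz; exact h (by rw [hz, Matrix.mulVec_zero])
  · intro h x y hxy
    have := h (x - y) (by rw [Matrix.mulVec_sub]; exact sub_eq_zero.mpr hxy)
    exact sub_eq_zero.mp this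

lemma cyc_dvd {c : Matrix δ δ F} (hc : Irreducible c.charpoly) {e : δ → F} (he : e ≠ 0)
    (h : Polynomial F) : (Polynomial.aeval c h).mulVec e = 0 ↔ c.charpoly ∣ h := by
  constructor
  · intro h0
    by_contra hnd
    have hcop : IsCoprime c.charpoly h := (Irreducible.coprime_iff_not_dvd hc).mpr hnd
    obtain ⟨u, v, huv⟩ := hcop
    apply he
    have := congrArg (fun p => (Polynomial.aeval c p).mulVec e) huv
    simp only [map_add, map_mul, Matrix.aeval_self_charpoly, mul_zero, zero_add, map_one,
      Matrix.one_mulVec, ← Matrix.mulVec_mulVec, h0, Matrix.mulVec_zero] at this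
    exact this.symm
  · rintro ⟨w, rfl⟩
    simp [Matrix.aeval_self_charpoly]

lemma cyc_surj {c : Matrix δ δ F} (hc : Irreducible c.charpoly) {e : δ → F} (he : e ≠ 0)
    (z : δ → F) : ∃ h : Polynomial F, (Polynomial.aeval c h).mulVec e = z := by
  let Φ : Polynomial F →ₗ[F] (δ → F) :=
    { toFun := fun h => (Polynomial.aeval c h).mulVec e
      map_add' := fun a b => by simp [Matrix.add_mulVec]
      map_smul' := fun a b => by simp [Matrix.smul_mulVec] }
  let Ψ : (Fin (Fintype.card δ) → F) →ₗ[F] (δ → F) :=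
    Φ ∘ₗ (Polynomial.degreeLT F (Fintype.card δ)).subtype ∘ₗ
      (Polynomial.degreeLTEquiv F (Fintype.card δ)).symm.toLinearMap
  have hinj : Function.Injective Ψ := by
    rw [injective_iff_map_eq_zero]
    intro a ha
    have h1 := (cyc_dvd hc he _).mp ha
    have h2 := ((Polynomial.degreeLTEquiv F (Fintype.card δ)).symm a).2
    rw [Polynomial.mem_degreeLT] at h2
    have h3 := Polynomial.eq_zero_of_dvd_of_degree_lt h1 (by
      refine lt_of_lt_of_le h2 ?_
      rw [Matrix.charpoly_degree_eq_dim])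
    have h4 : (Polynomial.degreeLTEquiv F (Fintype.card δ)).symm a = 0 := Subtype.ext h3
    simpa using h4
  have hsurj : Function.Surjective Ψ :=
    (LinearMap.injective_iff_surjective_of_finrank_eq_finrank (by simp)).mp hinj
  obtain ⟨a, ha⟩ := hsurj z
  exact ⟨_, ha⟩

lemma aeval_intertwine {c : Matrix μ μ F} {g : Matrix ι ι F} {A : Matrix ι μ F}
    (h : g * A = A * c) (p : Polynomial F) :
    (Polynomial.aeval g p) * A = A * (Polynomial.aeval c p) := by
  induction p using Polynomial.induction_on' with
  | add p q hp hq => simp [Matrix.add_mul, Matrix.mul_add, hp, hq]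
  | monomial n a =>
    have : ∀ n : ℕ, g ^ n * A = A * c ^ n := by
      intro n
      induction n with
      | zero => simp
      | succ n ih => rw [pow_succ, Matrix.mul_assoc, h, ← Matrix.mul_assoc, ih, Matrix.mul_assoc, pow_succ]
    simp [Polynomial.aeval_monomial, Matrix.mul_assoc, this, Algebra.algebraMap_eq_smul_one]

lemma nonempty_of_irr {c : Matrix δ δ F} (hc : Irreducible c.charpoly) : Nonempty δ := by
  by_contra h
  rw [not_nonempty_iff] at h
  apply hc.not_isUnit
  have : c.charpoly = 1 := by
    unfold Matrix.charpoly; exact Matrix.det_isEmpty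
  rw [this]; exact isUnit_one

lemma exists_ne_vec {c : Matrix δ δ F} (hc : Irreducible c.charpoly) : ∃ e : δ → F, e ≠ 0 := by
  obtain ⟨i⟩ := nonempty_of_irr hc
  exact ⟨Pi.single i 1, by simp⟩

lemma irr_invariant {c : Matrix δ δ F} (hc : Irreducible c.charpoly) (p : (δ → F) → Prop)
    (h0 : p 0) (hadd : ∀ x y, p x → p y → p (x + y)) (hs : ∀ (a : F) x, p x → p (a • x))
    (hm : ∀ x, p x → p (c.mulVec x)) {e : δ → F} (he : e ≠ 0) (hpe : p e) (z : δ → F) : p z := by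
  obtain ⟨h, rfl⟩ := cyc_surj hc he z
  have hpow : ∀ n : ℕ, p ((c ^ n).mulVec e) := by
    intro n
    induction n with
    | zero => simpa using hpe
    | succ n ih => rw [pow_succ', ← Matrix.mulVec_mulVec]; exact hm _ ih
  induction h using Polynomial.induction_on' with
  | add u v hu hv => rw [map_add, Matrix.add_mulVec]; exact hadd _ _ hu hv
  | monomial n a =>
    rw [Polynomial.aeval_monomial, Algebra.algebraMap_eq_smul_one, smul_mul_assoc, one_mul,
      Matrix.smul_mulVec]
    exact hs _ _ (hpow n)

lemma matrix_ext_mulVec {A B : Matrix ι μ F} (h : ∀ z, A.mulVec z = B.mulVec z) : A = B := by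
  apply Matrix.toLin'.injective
  apply LinearMap.ext
  intro z
  simpa using h z

lemma Ho_self [Fintype F] {c : Matrix δ δ F} (hc : Irreducible c.charpoly) :
    Ho c c = Fintype.card F ^ Fintype.card δ := by
  obtain ⟨e, he⟩ := exists_ne_vec hc
  have : Function.Bijective (fun A : {A : Matrix δ δ F // c * A = A * c} => A.1.mulVec e) := by
    constructor
    · rintro ⟨A, hA⟩ ⟨B, hB⟩ hAB
      apply Subtype.ext
      apply matrix_ext_mulVec
      intro z
      obtain ⟨h, rfl⟩ := cyc_surj hc he z
      simp only at hAB ⊢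
      rw [Matrix.mulVec_mulVec, Matrix.mulVec_mulVec, ← aeval_intertwine hA, ← aeval_intertwine hB,
        ← Matrix.mulVec_mulVec, ← Matrix.mulVec_mulVec, hAB]
    · intro z
      obtain ⟨h, hh⟩ := cyc_surj hc he z
      refine ⟨⟨Polynomial.aeval c h, ?_⟩, hh⟩
      have := congrArg (Polynomial.aeval c) (mul_comm Polynomial.X h)
      simpa using this
  unfold Ho
  rw [Nat.card_eq_of_bijective _ this]
  simp [Nat.card_eq_fintype_card]

/-- existence of a nonzero intertwiner -/
lemma exists_intertwiner' {c : Matrix δ δ F} (hc : Irreducible c.charpoly) (g : Matrix ι ι F)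
    {v : ι → F} (hPv : (Polynomial.aeval g c.charpoly).mulVec v = 0) :
    ∃ (A : Matrix ι δ F) (e : δ → F), e ≠ 0 ∧ A.mulVec e = v ∧ g * A = A * c := by
  obtain ⟨e, he⟩ := exists_ne_vec hc
  let Φ : Polynomial F →ₗ[F] (δ → F) :=
    { toFun := fun h => (Polynomial.aeval c h).mulVec e
      map_add' := fun a b => by simp [Matrix.add_mulVec]
      map_smul' := fun a b => by simp [Matrix.smul_mulVec] }
  let Ψ : Polynomial F →ₗ[F] (ι → F) :=
    { toFun := fun h => (Polynomial.aeval g h).mulVec v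
      map_add' := fun a b => by simp [Matrix.add_mulVec]
      map_smul' := fun a b => by simp [Matrix.smul_mulVec] }
  have hΦ : LinearMap.range Φ = ⊤ := LinearMap.range_eq_top.mpr fun z => cyc_surj hc he z
  obtain ⟨s, hs⟩ := Φ.exists_rightInverse_of_surjective hΦ
  have hs' : ∀ z, (Polynomial.aeval c (s z)).mulVec e = z := fun z => LinearMap.congr_fun hs z
  have hker : ∀ h : Polynomial F, (Polynomial.aeval c h).mulVec e = 0 → (Polynomial.aeval g h).mulVec v = 0 := by
    intro h hh
    obtain ⟨w, rfl⟩ := (cyc_dvd hc he h).mp hh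
    rw [mul_comm, map_mul, ← Matrix.mulVec_mulVec, hPv, Matrix.mulVec_zero]
  refine ⟨LinearMap.toMatrix' (Ψ ∘ₗ s), e, he, ?_, ?_⟩
  · rw [LinearMap.toMatrix'_mulVec]
    change (Polynomial.aeval g (s e)).mulVec v = v
    have := hker (s e - 1) (by simp [Matrix.sub_mulVec, hs'])
    simpa [Matrix.sub_mulVec, sub_eq_zero] using this
  · apply matrix_ext_mulVec
    intro z
    rw [← Matrix.mulVec_mulVec, ← Matrix.mulVec_mulVec, LinearMap.toMatrix'_mulVec,
      LinearMap.toMatrix'_mulVec]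
    change g.mulVec ((Polynomial.aeval g (s z)).mulVec v) = (Polynomial.aeval g (s (c.mulVec z))).mulVec v
    have := hker (Polynomial.X * s z - s (c.mulVec z)) (by
      simp [Matrix.sub_mulVec, hs', ← Matrix.mulVec_mulVec])
    simpa [Matrix.sub_mulVec, sub_eq_zero, ← Matrix.mulVec_mulVec] using this

lemma exists_intertwiner {c : Matrix δ δ F} (hc : Irreducible c.charpoly) (g : Matrix ι ι F)
    {v : ι → F} (hv : v ≠ 0) (hPv : (Polynomial.aeval g c.charpoly).mulVec v = 0) :
    ∃ A : Matrix ι δ F, A ≠ 0 ∧ g * A = A * c := by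
  obtain ⟨A, e, he, hAe, hA⟩ := exists_intertwiner' hc g hPv
  refine ⟨A, ?_, hA⟩
  rintro rfl
  rw [Matrix.zero_mulVec] at hAe
  exact hv hAe.symm

lemma inj_of_ne_zero {c : Matrix δ δ F} (hc : Irreducible c.charpoly) {g : Matrix ι ι F}
    {A : Matrix ι δ F} (hA : A ≠ 0) (h : g * A = A * c) : Function.Injective A.mulVec := by
  rw [mulVec_inj_iff]
  intro z hz
  by_contra hz0
  apply hA
  apply matrix_ext_mulVec
  intro w
  rw [Matrix.zero_mulVec]
  refine irr_invariant hc (fun w => A.mulVec w = 0) (by simp) ?_ ?_ ?_ hz0 hz w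
  · intro x y hx hy; simp only [Matrix.mulVec_add, hx, hy, add_zero]
  · intro a x hx; simp only [Matrix.mulVec_smul, hx, smul_zero]
  · intro x hx
    rw [Matrix.mulVec_mulVec, ← h, ← Matrix.mulVec_mulVec, hx, Matrix.mulVec_zero]

lemma fromCols_mulVec' (a : Matrix ι δ F) (A : Matrix ι μ F) (x : δ ⊕ μ → F) :
    (Matrix.fromCols a A).mulVec x = a.mulVec (x ∘ Sum.inl) + A.mulVec (x ∘ Sum.inr) := by
  rw [Matrix.fromCols_mulVec]

/-- number of intertwiners with a property -/
noncomputable def HoP (p : Matrix ι μ F → Prop) (h : Matrix μ μ F) (g : Matrix ι ι F) : ℕ :=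
  Nat.card {A : Matrix ι μ F // g * A = A * h ∧ p A}

/-- number of injective intertwiners with a property -/
noncomputable def FrP (p : Matrix ι μ F → Prop) (h : Matrix μ μ F) (g : Matrix ι ι F) : ℕ :=
  Nat.card {A : Matrix ι μ F // (Function.Injective A.mulVec ∧ g * A = A * h) ∧ p A}

lemma HoP_true (h : Matrix μ μ F) (g : Matrix ι ι F) : HoP (fun _ => True) h g = Ho h g := by
  unfold HoP Ho; simp

lemma FrP_true (h : Matrix μ μ F) (g : Matrix ι ι F) : FrP (fun _ => True) h g = Fr h g := by
  unfold FrP Fr; simp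

/-- recursion for frames -/
lemma FrP_rec [Finite F] {c : Matrix δ δ F} (hc : Irreducible c.charpoly) (h' : Matrix μ μ F)
    (g : Matrix ι ι F) (p1 : Matrix ι δ F → Prop) (p' : Matrix ι μ F → Prop)
    (pp : Matrix ι (δ ⊕ μ) F → Prop) (hpp : ∀ a A, pp (Matrix.fromCols a A) ↔ p1 a ∧ p' A)
    (hpt : ∀ (A : Matrix ι μ F) (t : Matrix μ δ F), p' A → h' * t = t * c → p1 (A * t)) :
    FrP pp (Matrix.fromBlocks c 0 0 h') g + FrP p' h' g * Ho c h' = FrP p' h' g * HoP p1 c g := by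
  classical
  let T := {A : Matrix ι μ F // (Function.Injective A.mulVec ∧ g * A = A * h') ∧ p' A} ×
      {A : Matrix ι δ F // g * A = A * c ∧ p1 A}
  let p : T → Prop := fun t => Function.Injective (Matrix.fromCols t.2.1 t.1.1).mulVec
  have e1 : {A : Matrix ι (δ ⊕ μ) F // (Function.Injective A.mulVec ∧
      g * A = A * Matrix.fromBlocks c 0 0 h') ∧ pp A} ≃ {t : T // p t} :=
    { toFun := fun A => by
        have hA : A.1 = Matrix.fromCols A.1.toCols₁ A.1.toCols₂ := (Matrix.fromCols_toCols _).symm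
        have h2 := A.2.1.2
        have h1 := A.2.1.1
        have h4 := A.2.2
        rw [hA, hpp] at h4
        rw [hA, Matrix.mul_fromCols, Matrix.fromCols_mul_fromBlocks] at h2
        simp only [Matrix.mul_zero, add_zero, zero_add] at h2
        have h3 := Matrix.fromCols_inj h2
        refine ⟨⟨⟨A.1.toCols₂, ⟨?_, h3.2⟩, h4.2⟩, ⟨A.1.toCols₁, h3.1, h4.1⟩⟩, ?_⟩
        · rw [mulVec_inj_iff] at h1 ⊢
          intro z hz
          have := h1 (Sum.elim 0 z) (by rw [hA, fromCols_mulVec']; simp [hz])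
          funext i
          exact congrFun this (Sum.inr i)
        · change Function.Injective (Matrix.fromCols A.1.toCols₁ A.1.toCols₂).mulVec
          rw [← hA]; exact h1
      invFun := fun t => ⟨Matrix.fromCols t.1.2.1 t.1.1.1, ⟨t.2, by
        rw [Matrix.mul_fromCols, Matrix.fromCols_mul_fromBlocks]
        simp only [Matrix.mul_zero, add_zero, zero_add]
        rw [t.1.1.2.1.2, t.1.2.2.1]⟩, (hpp _ _).mpr ⟨t.1.2.2.2, t.1.1.2.2⟩⟩
      left_inv := fun A => by apply Subtype.ext; simp
      right_inv := fun t => by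
        apply Subtype.ext; apply Prod.ext <;> apply Subtype.ext <;> simp }
  have hb : Function.Bijective (fun s : {A : Matrix ι μ F // (Function.Injective A.mulVec ∧ g * A = A * h') ∧ p' A}
      × {A : Matrix μ δ F // h' * A = A * c} =>
      (⟨(s.1, ⟨s.1.1 * s.2.1, by
        rw [← Matrix.mul_assoc, s.1.2.1.2, Matrix.mul_assoc, s.2.2, Matrix.mul_assoc],
          hpt _ _ s.1.2.2 s.2.2⟩), by
          intro hinj
          obtain ⟨e, he⟩ := exists_ne_vec hc
          have hinj' := (mulVec_inj_iff _).mp hinj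
          have := hinj' (Sum.elim e (-(s.2.1.mulVec e))) (by
            rw [fromCols_mulVec']
            simp only [Sum.elim_comp_inl, Sum.elim_comp_inr]
            rw [← Matrix.mulVec_mulVec, Matrix.mulVec_neg, add_neg_cancel])
          apply he
          funext i
          exact congrFun this (Sum.inl i)⟩ : {t : T // ¬ p t})) := by
    constructor
    · rintro ⟨⟨A, hA, hpA⟩, ⟨t, ht⟩⟩ ⟨⟨A', hA', hpA'⟩, ⟨t', ht'⟩⟩ h
      have h1 : A = A' := congrArg (fun x : {t : T // ¬ p t} => x.1.1.1) h
      have h2 : A * t = A' * t' := congrArg (fun x : {t : T // ¬ p t} => x.1.2.1) h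
      subst h1
      have h3 : t = t' := ?_
      · subst h3; rfl
      apply matrix_ext_mulVec
      intro z
      apply hA.1
      rw [Matrix.mulVec_mulVec, Matrix.mulVec_mulVec, h2]
    · rintro ⟨⟨⟨A, hA, hpA⟩, ⟨a, ha, hpa⟩⟩, hn⟩
      have hn' : ¬ Function.Injective (Matrix.fromCols a A).mulVec := hn
      rw [mulVec_inj_iff] at hn'
      push Not at hn'
      obtain ⟨x, hx, hx0⟩ := hn'
      rw [fromCols_mulVec'] at hx
      have hAinj := (mulVec_inj_iff A).mp hA.1
      have hxl : x ∘ Sum.inl ≠ 0 := by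
        intro h0
        rw [h0, Matrix.mulVec_zero, zero_add] at hx
        apply hx0
        have h1 := hAinj _ hx
        funext i
        rcases i with i | i
        · exact congrFun h0 i
        · exact congrFun h1 i
      have hall : ∀ z, ∃ w, A.mulVec w = a.mulVec z := by
        intro z
        refine irr_invariant hc (fun z => ∃ w, A.mulVec w = a.mulVec z) ⟨0, by simp⟩ ?_ ?_ ?_ hxl
          ⟨-(x ∘ Sum.inr), by rw [Matrix.mulVec_neg]; exact (eq_neg_of_add_eq_zero_left hx).symm⟩ z
        · rintro x y ⟨w, hw⟩ ⟨w', hw'⟩; exact ⟨w + w', by simp [Matrix.mulVec_add, hw, hw']⟩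
        · rintro b x ⟨w, hw⟩; exact ⟨b • w, by simp [Matrix.mulVec_smul, hw]⟩
        · rintro x ⟨w, hw⟩
          refine ⟨h'.mulVec w, ?_⟩
          rw [Matrix.mulVec_mulVec, ← hA.2, ← Matrix.mulVec_mulVec, hw, Matrix.mulVec_mulVec, ha,
            Matrix.mulVec_mulVec]
      choose w hw using hall
      let t : Matrix μ δ F := Matrix.of fun i j => w (Pi.single j 1) i
      have hat : A * t = a := by
        ext i j
        have := congrFun (hw (Pi.single j 1)) i
        rw [Matrix.mulVec_single_one] at this
        simpa [Matrix.mul_apply, Matrix.mulVec, dotProduct, t] using this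
      refine ⟨⟨⟨A, hA, hpA⟩, ⟨t, ?_⟩⟩, ?_⟩
      · apply matrix_ext_mulVec
        intro z
        apply hA.1
        rw [Matrix.mulVec_mulVec, Matrix.mulVec_mulVec, ← Matrix.mul_assoc, ← hA.2, Matrix.mul_assoc,
          hat, ha, ← Matrix.mul_assoc, hat]
      · apply Subtype.ext; apply Prod.ext
        · rfl
        · apply Subtype.ext; exact hat
  have hT : Nat.card T = FrP p' h' g * HoP p1 c g := by
    simp only [T, Nat.card_prod]; rfl
  have hn := Nat.card_eq_of_bijective _ hb
  rw [Nat.card_prod] at hn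
  rw [← hT, ← Nat.card_congr (Equiv.sumCompl p), Nat.card_sum, ← Nat.card_congr e1, ← hn]
  rfl

lemma Ho_blocks [Finite F] (c : Matrix δ δ F) (h : Matrix ι ι F) (h' : Matrix μ μ F) :
    Ho c (Matrix.fromBlocks h 0 0 h') = Ho c h * Ho c h' := by
  unfold Ho
  rw [← Nat.card_prod]
  apply Nat.card_congr
  exact
    { toFun := fun A => by
        have h2 := A.2
        rw [← Matrix.fromRows_toRows A.1, Matrix.fromBlocks_mul_fromRows, Matrix.fromRows_mul] at h2
        simp only [Matrix.zero_mul, add_zero, zero_add] at h2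
        have h3 := Matrix.fromRows_inj h2
        exact ⟨⟨A.1.toRows₁, h3.1⟩, ⟨A.1.toRows₂, h3.2⟩⟩
      invFun := fun t => ⟨Matrix.fromRows t.1.1 t.2.1, by
        rw [Matrix.fromBlocks_mul_fromRows, Matrix.fromRows_mul]
        simp only [Matrix.zero_mul, add_zero, zero_add]
        rw [t.1.2, t.2.2]⟩
      left_inv := fun A => by apply Subtype.ext; simp
      right_inv := fun t => by apply Prod.ext <;> apply Subtype.ext <;> simp }

/-- the index type of `j` copies of `δ` -/
def Pw (δ : Type) : ℕ → Type
  | 0 => Empty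
  | j + 1 => δ ⊕ Pw δ j

instance instFintypePw (δ : Type) [Fintype δ] : ∀ j, Fintype (Pw δ j)
  | 0 => inferInstanceAs (Fintype Empty)
  | j + 1 => by
      have := instFintypePw δ j
      exact inferInstanceAs (Fintype (δ ⊕ Pw δ j))

instance instDecEqPw (δ : Type) [DecidableEq δ] : ∀ j, DecidableEq (Pw δ j)
  | 0 => inferInstanceAs (DecidableEq Empty)
  | j + 1 => by
      have := instDecEqPw δ j
      exact inferInstanceAs (DecidableEq (δ ⊕ Pw δ j))

lemma card_Pw (δ : Type) [Fintype δ] (j : ℕ) : Fintype.card (Pw δ j) = Fintype.card δ * j := by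
  induction j with
  | zero => rfl
  | succ j ih =>
    have : Fintype.card (Pw δ (j + 1)) = Fintype.card δ + Fintype.card (Pw δ j) := Fintype.card_sum
    rw [this, ih]; ring

/-- `j` diagonal copies of `c` -/
def hz (c : Matrix δ δ F) : (j : ℕ) → Matrix (Pw δ j) (Pw δ j) F
  | 0 => fun i => i.elim
  | j + 1 => Matrix.fromBlocks c 0 0 (hz c j)

lemma Ho_hz [Fintype F] {c : Matrix δ δ F} (hc : Irreducible c.charpoly) (j : ℕ) :
    Ho c (hz c j) = (Fintype.card F ^ Fintype.card δ) ^ j := by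
  induction j with
  | zero =>
    have : Subsingleton (Matrix (Pw δ 0) δ F) := ⟨fun a b => by ext i; exact i.elim⟩
    unfold Ho
    rw [pow_zero, Nat.card_eq_one_iff_unique]
    exact ⟨inferInstance, ⟨0, Subsingleton.elim _ _⟩⟩
  | succ j ih =>
    have : Ho c (hz c (j + 1)) = Ho c c * Ho c (hz c j) := Ho_blocks c c (hz c j)
    rw [this, ih, Ho_self hc]; ring

lemma FrP_hz [Fintype F] {c : Matrix δ δ F} (hc : Irreducible c.charpoly) (g : Matrix ι ι F)
    (p : (j : ℕ) → Matrix ι (Pw δ j) F → Prop) (p1 : Matrix ι δ F → Prop) (h0 : ∀ A, p 0 A)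
    (hpp : ∀ (j : ℕ) (a : Matrix ι δ F) (A : Matrix ι (Pw δ j) F),
      p (j + 1) (Matrix.fromCols a A : Matrix ι (δ ⊕ Pw δ j) F) ↔ p1 a ∧ p j A)
    (hpt : ∀ (j : ℕ) (A : Matrix ι (Pw δ j) F) (t : Matrix (Pw δ j) δ F),
      p j A → hz c j * t = t * c → p1 (A * t)) (j : ℕ) :
    (FrP (p j) (hz c j) g : ℂ)
      = qN ((Fintype.card F ^ Fintype.card δ : ℕ) : ℂ) (HoP p1 c g) j := by
  induction j with
  | zero =>
    have : Subsingleton (Matrix ι (Pw δ 0) F) := ⟨fun a b => by ext i k; exact k.elim⟩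
    have hs : Subsingleton (Pw δ 0 → F) := ⟨fun a b => by ext i; exact i.elim⟩
    have h1 : FrP (p 0) (hz c 0) g = 1 := by
      unfold FrP
      rw [Nat.card_eq_one_iff_unique]
      exact ⟨inferInstance, ⟨0, ⟨fun a b _ => Subsingleton.elim _ _, Subsingleton.elim _ _⟩, h0 _⟩⟩
    simp [h1, qN]
  | succ j ih =>
    have h1 : FrP (p (j + 1)) (hz c (j + 1)) g + FrP (p j) (hz c j) g * Ho c (hz c j)
        = FrP (p j) (hz c j) g * HoP p1 c g :=
      FrP_rec hc (hz c j) g p1 (p j) (p (j + 1)) (hpp j) (hpt j)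
    rw [Ho_hz hc] at h1
    have h2 := congrArg (Nat.cast : ℕ → ℂ) h1
    have h3 : qN ((Fintype.card F ^ Fintype.card δ : ℕ) : ℂ) (HoP p1 c g) (j + 1) =
      qN ((Fintype.card F ^ Fintype.card δ : ℕ) : ℂ) (HoP p1 c g) j *
        ((HoP p1 c g : ℂ) - ((Fintype.card F ^ Fintype.card δ : ℕ) : ℂ) ^ j) := by
      unfold qN; rw [Finset.prod_range_succ]
    rw [h3, ← ih]
    push_cast at h2 ⊢
    linear_combination h2

lemma Fr_hz [Fintype F] {c : Matrix δ δ F} (hc : Irreducible c.charpoly) (g : Matrix ι ι F) (j : ℕ) :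
    (Fr (hz c j) g : ℂ) = qN ((Fintype.card F ^ Fintype.card δ : ℕ) : ℂ) (Ho c g) j := by
  have := FrP_hz hc g (fun _ _ => True) (fun _ => True) (by simp) (by simp) (by simp) j
  rwa [FrP_true, HoP_true] at this

lemma Fr_zero_of_card [Finite F] (h : Matrix μ μ F) (g : Matrix ι ι F)
    (hlt : Fintype.card ι < Fintype.card μ) : Fr h g = 0 := by
  unfold Fr
  rw [Nat.card_eq_zero]
  left
  constructor
  rintro ⟨A, hA, -⟩
  have := LinearMap.finrank_le_finrank_of_injective (f := A.mulVecLin) hA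
  simp at this
  omega

lemma FrP_zero_of_card [Finite F] (p : Matrix ι μ F → Prop) (h : Matrix μ μ F) (g : Matrix ι ι F)
    (hlt : Fintype.card ι < Fintype.card μ) : FrP p h g = 0 := by
  unfold FrP
  rw [Nat.card_eq_zero]
  left
  constructor
  rintro ⟨A, ⟨hA, -⟩, -⟩
  have := LinearMap.finrank_le_finrank_of_injective (f := A.mulVecLin) hA
  simp at this
  omega

lemma exists_lP [Fintype F] {c : Matrix δ δ F} (hc : Irreducible c.charpoly) (g : Matrix ι ι F)
    (p : (j : ℕ) → Matrix ι (Pw δ j) F → Prop) (p1 : Matrix ι δ F → Prop) (h0 : ∀ A, p 0 A)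
    (hpp : ∀ (j : ℕ) (a : Matrix ι δ F) (A : Matrix ι (Pw δ j) F),
      p (j + 1) (Matrix.fromCols a A : Matrix ι (δ ⊕ Pw δ j) F) ↔ p1 a ∧ p j A)
    (hpt : ∀ (j : ℕ) (A : Matrix ι (Pw δ j) F) (t : Matrix (Pw δ j) δ F),
      p j A → hz c j * t = t * c → p1 (A * t)) :
    ∃ l, l ≤ Fintype.card ι ∧ HoP p1 c g = (Fintype.card F ^ Fintype.card δ) ^ l := by
  have hd := nonempty_of_irr hc
  have h1 : FrP (p (Fintype.card ι + 1)) (hz c (Fintype.card ι + 1)) g = 0 := by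
    apply FrP_zero_of_card
    rw [card_Pw]
    have : 1 ≤ Fintype.card δ := Fintype.card_pos
    nlinarith
  have h2 := FrP_hz hc g p p1 h0 hpp hpt (Fintype.card ι + 1)
  rw [h1, qN] at h2
  simp only [Nat.cast_zero] at h2
  obtain ⟨l, hl, h3⟩ := Finset.prod_eq_zero_iff.mp h2.symm
  refine ⟨l, by simpa [Nat.lt_succ_iff] using hl, ?_⟩
  rw [sub_eq_zero] at h3
  exact_mod_cast h3

lemma exists_l [Fintype F] {c : Matrix δ δ F} (hc : Irreducible c.charpoly) (g : Matrix ι ι F) :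
    ∃ l, l ≤ Fintype.card ι ∧ Ho c g = (Fintype.card F ^ Fintype.card δ) ^ l := by
  have := exists_lP hc g (fun _ _ => True) (fun _ => True) (by simp) (by simp) (by simp)
  rwa [HoP_true] at this

end MK

end

section
open scoped BigOperators
namespace MK

variable {F : Type} [Field F]
variable {ι μ δ ν : Type} [Fintype ι] [Fintype μ] [Fintype δ] [Fintype ν]
  [DecidableEq ι] [DecidableEq μ] [DecidableEq δ] [DecidableEq ν]

/-- conjugation invariance -/
def CI (X : Matrix ι ι F → ℂ) : Prop :=
  ∀ B B' g : Matrix ι ι F, B * B' = 1 → B' * B = 1 → X (B' * g * B) = X g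

/-- number of injective matrices -/
noncomputable def injc (F : Type) [Field F] (ι μ : Type) [Fintype ι] [Fintype μ] : ℕ :=
  Nat.card {A : Matrix ι μ F // Function.Injective A.mulVec}

lemma exists_extend (A : Matrix (μ ⊕ ν) μ F) (hA : Function.Injective A.mulVec) :
    ∃ B B' : Matrix (μ ⊕ ν) (μ ⊕ ν) F, B * B' = 1 ∧ B' * B = 1 ∧
      B * (Matrix.fromRows 1 0 : Matrix (μ ⊕ ν) μ F) = A := by
  classical
  have hli : LinearIndependent F A.col := Matrix.mulVec_injective_iff.mp hA
  let b := Module.Basis.sumExtend hli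
  have hfin : Fintype (Module.Basis.sumExtendIndex hli) := by
    have : Finite (μ ⊕ Module.Basis.sumExtendIndex hli) := Module.Finite.finite_basis b
    have := Finite.of_injective (Sum.inr : Module.Basis.sumExtendIndex hli → μ ⊕ Module.Basis.sumExtendIndex hli) Sum.inr_injective
    exact Fintype.ofFinite _
  have hcard : Fintype.card (Module.Basis.sumExtendIndex hli) = Fintype.card ν := by
    have h1 := Module.finrank_eq_card_basis b
    rw [Module.finrank_fintype_fun_eq_card, Fintype.card_sum, Fintype.card_sum] at h1
    omega
  let e := Fintype.equivOfCardEq hcard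
  let b' := b.reindex (Equiv.sumCongr (Equiv.refl μ) e)
  refine ⟨(Pi.basisFun F (μ ⊕ ν)).toMatrix b', b'.toMatrix (Pi.basisFun F (μ ⊕ ν)),
    Module.Basis.toMatrix_mul_toMatrix_flip _ _, Module.Basis.toMatrix_mul_toMatrix_flip _ _, ?_⟩
  have : (Pi.basisFun F (μ ⊕ ν)).toMatrix b' = Matrix.fromCols A (Matrix.of fun i k => b' (Sum.inr k) i) := by
    ext i (k | k)
    · rw [Matrix.fromCols_apply_inl, Module.Basis.toMatrix_apply, Pi.basisFun_repr]
      have : b' (Sum.inl k) = b (Sum.inl k) := by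
        rw [Module.Basis.reindex_apply]; rfl
      rw [this]
      have h2 : b (Sum.inl k) = A.col k := by
        simp [b, Module.Basis.sumExtend]
        rfl
      rw [h2]; rfl
    · rw [Matrix.fromCols_apply_inr, Module.Basis.toMatrix_apply, Pi.basisFun_repr]
      rfl
  rw [this, Matrix.fromCols_mul_fromRows]
  simp

lemma L3 [Fintype F] [DecidableEq F] (X : Matrix (μ ⊕ ν) (μ ⊕ ν) F → ℂ) (hX : CI X) (h : Matrix μ μ F) :
    ∑ g, X g * (Fr h g : ℂ) = (injc F (μ ⊕ ν) μ : ℂ) *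
      ∑ u : Matrix μ ν F, ∑ x : Matrix ν ν F, X (Matrix.fromBlocks h u 0 x) := by
  classical
  have h1 : ∀ g : Matrix (μ ⊕ ν) (μ ⊕ ν) F, (Fr h g : ℂ) =
      ∑ A : Matrix (μ ⊕ ν) μ F, if Function.Injective A.mulVec then
        (if g * A = A * h then 1 else 0) else 0 := by
    intro g
    unfold Fr
    rw [Nat.card_eq_fintype_card, Fintype.card_subtype, Finset.card_filter]
    push_cast
    refine Finset.sum_congr rfl fun A _ => ?_
    by_cases h1 : Function.Injective A.mulVec <;> by_cases h2 : g * A = A * h <;> simp [h1, h2]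
  have h2 : ∀ A : Matrix (μ ⊕ ν) μ F, Function.Injective A.mulVec →
      ∑ g, X g * (if g * A = A * h then 1 else 0) =
      ∑ u : Matrix μ ν F, ∑ x : Matrix ν ν F, X (Matrix.fromBlocks h u 0 x) := by
    intro A hA
    obtain ⟨B, B', hBB, hBB', hBA⟩ := exists_extend A hA
    have hBA' : B' * A = (Matrix.fromRows 1 0 : Matrix (μ ⊕ ν) μ F) := by
      rw [← hBA, ← Matrix.mul_assoc, hBB', Matrix.one_mul]
    let e : Matrix (μ ⊕ ν) (μ ⊕ ν) F ≃ Matrix (μ ⊕ ν) (μ ⊕ ν) F :=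
      { toFun := fun g => B * g * B'
        invFun := fun g => B' * g * B
        left_inv := fun g => by
          simp only [Matrix.mul_assoc, hBB', Matrix.mul_one]
          rw [← Matrix.mul_assoc, hBB', Matrix.one_mul]
        right_inv := fun g => by
          simp only [Matrix.mul_assoc, hBB, Matrix.mul_one]
          rw [← Matrix.mul_assoc, hBB, Matrix.one_mul] }
    rw [← e.sum_comp]
    let e2 : (Matrix μ ν F × Matrix ν ν F) × (Matrix μ μ F × Matrix ν μ F) ≃ Matrix (μ ⊕ ν) (μ ⊕ ν) F :=
      { toFun := fun t => Matrix.fromBlocks t.2.1 t.1.1 t.2.2 t.1.2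
        invFun := fun g => ((g.toBlocks₁₂, g.toBlocks₂₂), (g.toBlocks₁₁, g.toBlocks₂₁))
        left_inv := fun t => by simp
        right_inv := fun g => by simp [Matrix.fromBlocks_toBlocks] }
    rw [← e2.sum_comp, Fintype.sum_prod_type, Fintype.sum_prod_type]
    refine Finset.sum_congr rfl fun u _ => Finset.sum_congr rfl fun x _ => ?_
    rw [Finset.sum_eq_single (h, 0)]
    · have : e (e2 ((u, x), (h, 0))) * A = A * h := by
        show B * Matrix.fromBlocks h u 0 x * B' * A = A * h
        rw [Matrix.mul_assoc, hBA', Matrix.mul_assoc, Matrix.fromBlocks_mul_fromRows]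
        rw [← hBA, Matrix.mul_assoc, Matrix.fromRows_mul]
        simp
      rw [if_pos this, mul_one]
      exact hX B' B _ hBB' hBB
    · rintro ⟨a, w⟩ - hne
      rw [if_neg, mul_zero]
      intro hcon
      apply hne
      have h3 : B * Matrix.fromBlocks a u w x * B' * A = A * h := hcon
      have h4 : B' * (B * Matrix.fromBlocks a u w x * B' * A) = B' * (A * h) := by rw [h3]
      rw [← Matrix.mul_assoc B' A, hBA', Matrix.mul_assoc, Matrix.mul_assoc, hBA', ← Matrix.mul_assoc,
        ← Matrix.mul_assoc, hBB', Matrix.one_mul, Matrix.fromBlocks_mul_fromRows, Matrix.fromRows_mul] at h4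
      simp only [Matrix.mul_one, Matrix.mul_zero, add_zero, Matrix.one_mul, Matrix.zero_mul] at h4
      have := Matrix.fromRows_inj h4
      exact Prod.ext this.1 this.2
    · simp
  simp only [h1]
  rw [Finset.sum_congr rfl (fun g _ => Finset.mul_sum _ _ _)]
  rw [Finset.sum_comm]
  have h3 : (injc F (μ ⊕ ν) μ : ℂ) =
      ∑ A : Matrix (μ ⊕ ν) μ F, if Function.Injective A.mulVec then 1 else 0 := by
    unfold injc
    rw [Nat.card_eq_fintype_card, Fintype.card_subtype, Finset.card_filter]
    push_cast; rfl
  rw [h3, Finset.sum_mul]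
  refine Finset.sum_congr rfl fun A _ => ?_
  by_cases hA : Function.Injective A.mulVec
  · simp only [hA, if_true, one_mul]
    have := h2 A hA
    simp only [mul_ite, mul_one, mul_zero] at this ⊢
    rw [this]
  · simp [hA]

end MK

end

section
open scoped BigOperators
namespace MK

variable {F : Type} [Field F]
variable {ι μ δ ν κ : Type} [Fintype ι] [Fintype μ] [Fintype δ] [Fintype ν] [Fintype κ]
  [DecidableEq ι] [DecidableEq μ] [DecidableEq δ] [DecidableEq ν] [DecidableEq κ]

lemma Ho_reindex (h : Matrix μ μ F) (g : Matrix ι ι F) (e : ι ≃ κ) :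
    Ho h (Matrix.reindex e e g) = Ho h g := by
  unfold Ho
  apply Nat.card_congr
  refine (Equiv.subtypeEquiv (Matrix.reindex e (Equiv.refl μ)) ?_).symm
  intro A
  have h1 : Matrix.reindex e (Equiv.refl μ) (g * A) = Matrix.reindex e e g * Matrix.reindex e (Equiv.refl μ) A := by
    simp [Matrix.submatrix_mul_equiv]
  have h2 : Matrix.reindex e (Equiv.refl μ) (A * h) = Matrix.reindex e (Equiv.refl μ) A * h := by
    ext i j; simp [Matrix.mul_apply]
  rw [← h1, ← h2, (Matrix.reindex e (Equiv.refl μ)).injective.eq_iff]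

lemma inj_reindex (A : Matrix ι μ F) (e : ι ≃ κ) (e' : μ ≃ ν) :
    Function.Injective (Matrix.reindex e e' A).mulVec ↔ Function.Injective A.mulVec := by
  have : (Matrix.reindex e e' A).mulVec = (fun v => v ∘ e.symm) ∘ A.mulVec ∘ (fun v => v ∘ e') := by
    ext v i
    simp [Matrix.mulVec, dotProduct]
    rw [← e'.sum_comp]; simp
  rw [this]
  rw [Function.Injective.of_comp_iff (Function.Surjective.injective_comp_right e.symm.surjective)]
  constructor
  · intro h x y hxy
    have := @h (x ∘ e'.symm) (y ∘ e'.symm) (by simpa [Function.comp_def] using hxy)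
    funext i
    simpa using congrFun this (e' i)
  · intro h
    exact h.comp (Function.Surjective.injective_comp_right e'.surjective)

lemma Fr_reindex (h : Matrix μ μ F) (g : Matrix ι ι F) (e : ι ≃ κ) :
    Fr h (Matrix.reindex e e g) = Fr h g := by
  unfold Fr
  apply Nat.card_congr
  refine (Equiv.subtypeEquiv (Matrix.reindex e (Equiv.refl μ)) ?_).symm
  intro A
  have h1 : Matrix.reindex e (Equiv.refl μ) (g * A) = Matrix.reindex e e g * Matrix.reindex e (Equiv.refl μ) A := by
    simp [Matrix.submatrix_mul_equiv]
  have h2 : Matrix.reindex e (Equiv.refl μ) (A * h) = Matrix.reindex e (Equiv.refl μ) A * h := by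
    ext i j; simp [Matrix.mul_apply]
  rw [← h1, ← h2, (Matrix.reindex e (Equiv.refl μ)).injective.eq_iff, inj_reindex]

lemma injc_congr (e : ι ≃ κ) (e' : μ ≃ ν) : injc F ι μ = injc F κ ν := by
  unfold injc
  apply Nat.card_congr
  refine Equiv.subtypeEquiv (Matrix.reindex e e') ?_
  intro A
  rw [inj_reindex]

lemma injc_eq [Fintype F] : (injc F ι μ : ℂ) =
    qN (Fintype.card F) ((Fintype.card F : ℂ) ^ Fintype.card ι) (Fintype.card μ) := by
  let c : Matrix Unit Unit F := 0
  have hc : Irreducible c.charpoly := by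
    have : c.charpoly = Polynomial.X := by simp [c, Matrix.charpoly, Matrix.charmatrix]
    rw [this]; exact Polynomial.irreducible_X
  have e : μ ≃ Pw Unit (Fintype.card μ) := Fintype.equivOfCardEq (by rw [card_Pw]; simp)
  rw [injc_congr (Equiv.refl ι) e]
  have h0 : ∀ j, hz c j = 0 := by
    intro j
    induction j with
    | zero => ext i; exact i.elim
    | succ j ih =>
      show Matrix.fromBlocks c 0 0 (hz c j) = 0
      rw [ih]; exact Matrix.fromBlocks_zero
  have h1 := Fr_hz hc (0 : Matrix ι ι F) (Fintype.card μ)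
  have h2 : Fr (hz c (Fintype.card μ)) (0 : Matrix ι ι F) = injc F ι (Pw Unit (Fintype.card μ)) := by
    unfold Fr injc
    rw [h0]; simp
  have h3 : Ho c (0 : Matrix ι ι F) = Fintype.card F ^ Fintype.card ι := by
    unfold Ho
    simp only [c, Matrix.zero_mul, Matrix.mul_zero]
    have : Nat.card {A : Matrix ι Unit F // True} = Nat.card (Matrix ι Unit F) := by
      apply Nat.card_congr
      exact Equiv.subtypeUnivEquiv (fun _ => trivial)
    rw [this]
    unfold Matrix
    simp
  rw [← h2, h1, h3]
  simp

/-- order of `GL_n` -/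
noncomputable def glc (q : ℂ) (n : ℕ) : ℂ := qN q (q ^ n) n

lemma qN_split (q : ℂ) (m k : ℕ) :
    glc q (m + k) = qN q (q ^ (m + k)) m * (q ^ (m * k) * glc q k) := by
  unfold glc qN
  rw [Finset.prod_range_add]
  congr 1
  have : ∀ i, q ^ (m + k) - q ^ (m + i) = q ^ m * (q ^ k - q ^ i) := fun i => by ring
  simp only [this, Finset.prod_mul_distrib, Finset.prod_const, Finset.card_range]
  ring

lemma glc_ne {q : ℕ} (hq : 2 ≤ q) (n : ℕ) : glc (q : ℂ) n ≠ 0 := by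
  unfold glc qN
  rw [Finset.prod_ne_zero_iff]
  intro i hi h
  rw [sub_eq_zero] at h
  have h1 : q ^ n = q ^ i := by exact_mod_cast h
  have := Nat.pow_right_injective hq h1
  simp at hi; omega

lemma CI.reindex {X : Matrix ι ι F → ℂ} (hX : CI X) (e : κ ≃ ι) :
    CI (fun g : Matrix κ κ F => X (Matrix.reindex e e g)) := by
  intro B B' g h1 h2
  have h3 : ∀ A B : Matrix κ κ F, Matrix.reindex e e (A * B) = Matrix.reindex e e A * Matrix.reindex e e B := by
    intro A B; simp [Matrix.submatrix_mul_equiv]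
  show X (Matrix.reindex e e (B' * g * B)) = X (Matrix.reindex e e g)
  rw [h3, h3]
  apply hX
  · rw [← h3, h1]; simp
  · rw [← h3, h2]; simp

lemma two_le_card [Fintype F] : 2 ≤ Fintype.card F := Fintype.one_lt_card

lemma L3' [Fintype F] [DecidableEq F] (X : Matrix ι ι F → ℂ) (hX : CI X) (h : Matrix μ μ F)
    (e : μ ⊕ ν ≃ ι) :
    ∑ g, X g * (Fr h g : ℂ) = (glc (Fintype.card F) (Fintype.card ι) /
      ((Fintype.card F : ℂ) ^ (Fintype.card μ * Fintype.card ν) * glc (Fintype.card F) (Fintype.card ν))) *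
      ∑ u : Matrix μ ν F, ∑ x : Matrix ν ν F, X (Matrix.reindex e e (Matrix.fromBlocks h u 0 x)) := by
  have h1 := L3 (fun g : Matrix (μ ⊕ ν) (μ ⊕ ν) F => X (Matrix.reindex e e g)) (hX.reindex e) h
  have hn : Fintype.card ι = Fintype.card μ + Fintype.card ν := by
    rw [← Fintype.card_congr e, Fintype.card_sum]
  have h2 : (injc F (μ ⊕ ν) μ : ℂ) = (glc (Fintype.card F) (Fintype.card ι) /
      ((Fintype.card F : ℂ) ^ (Fintype.card μ * Fintype.card ν) * glc (Fintype.card F) (Fintype.card ν))) := by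
    have hq : (Fintype.card F : ℂ) ≠ 0 := by
      have := two_le_card (F := F); exact_mod_cast (by omega)
    rw [injc_eq, hn, qN_split, Fintype.card_sum, mul_div_assoc, div_self, mul_one]
    exact mul_ne_zero (pow_ne_zero _ hq) (glc_ne two_le_card _)
  rw [← h2, ← h1, ← (Matrix.reindex e e).sum_comp]
  refine Finset.sum_congr rfl fun g _ => ?_
  rw [Fr_reindex]

/-- primary -/
def prim (c : Matrix δ δ F) (g : Matrix ι ι F) : Prop := ∃ r : ℕ, g.charpoly = c.charpoly ^ r

lemma prim_reindex (c : Matrix δ δ F) (g : Matrix ι ι F) (e : ι ≃ κ) :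
    prim c (Matrix.reindex e e g) ↔ prim c g := by
  unfold prim; rw [Matrix.charpoly_reindex]

lemma charpoly_conj {B B' g : Matrix ι ι F} (h1 : B * B' = 1) :
    (B' * g * B).charpoly = g.charpoly := by
  rw [Matrix.charpoly_mul_comm, ← Matrix.mul_assoc, h1, Matrix.one_mul]

lemma Ho_conj (c : Matrix δ δ F) {B B' g : Matrix ι ι F} (h1 : B * B' = 1) (h2 : B' * B = 1) :
    Ho c (B' * g * B) = Ho c g := by
  unfold Ho
  apply Nat.card_congr
  exact
    { toFun := fun A => ⟨B * A.1, by
        have := congrArg (fun t => B * t) A.2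
        simp only [← Matrix.mul_assoc, h1, Matrix.one_mul] at this ⊢
        exact this⟩
      invFun := fun A => ⟨B' * A.1, by
        have : B' * (g * A.1) = B' * (A.1 * c) := by rw [A.2]
        rw [Matrix.mul_assoc (B' * g), ← Matrix.mul_assoc B B', h1, Matrix.one_mul, Matrix.mul_assoc, this,
          Matrix.mul_assoc]⟩
      left_inv := fun A => by
        apply Subtype.ext
        simp only [← Matrix.mul_assoc, h2, Matrix.one_mul]
      right_inv := fun A => by
        apply Subtype.ext
        simp only [← Matrix.mul_assoc, h1, Matrix.one_mul] }

lemma charpoly_hz (c : Matrix δ δ F) (j : ℕ) : (hz c j).charpoly = c.charpoly ^ j := by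
  induction j with
  | zero =>
    rw [pow_zero]
    unfold Matrix.charpoly
    exact Matrix.det_isEmpty (n := Empty)
  | succ j ih =>
    have : (hz c (j + 1)).charpoly = c.charpoly * (hz c j).charpoly :=
      Matrix.charpoly_fromBlocks_zero₁₂ (M₁₁ := c) (M₂₁ := 0) (M₂₂ := hz c j)
    rw [this, ih, pow_succ']

lemma charpoly_block (c : Matrix δ δ F) (j : ℕ) (u : Matrix (Pw δ j) ν F) (x : Matrix ν ν F) :
    (Matrix.fromBlocks (hz c j) u 0 x).charpoly = c.charpoly ^ j * x.charpoly := by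
  rw [Matrix.charpoly_fromBlocks_zero₂₁, charpoly_hz]

lemma pow_dvd_aux {P R : Polynomial F} (hP : Irreducible P) (hPm : P.Monic) (hR : R.Monic) {j r : ℕ}
    (h : P ^ j * R = P ^ r) : ∃ r', R = P ^ r' := by
  have h1 : R ∣ P ^ r := ⟨P ^ j, by rw [← h, mul_comm]⟩
  obtain ⟨i, -, hi⟩ := (dvd_prime_pow hP.prime r).mp h1
  exact ⟨i, Polynomial.eq_of_monic_of_associated hR (hPm.pow i) hi⟩

lemma prim_block {c : Matrix δ δ F} (hc : Irreducible c.charpoly) (j : ℕ) (u : Matrix (Pw δ j) ν F)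
    (x : Matrix ν ν F) : prim c (Matrix.fromBlocks (hz c j) u 0 x) ↔ prim c x := by
  unfold prim
  rw [charpoly_block]
  constructor
  · rintro ⟨r, hr⟩
    exact pow_dvd_aux hc (Matrix.charpoly_monic c) (Matrix.charpoly_monic x) hr
  · rintro ⟨r, hr⟩
    exact ⟨j + r, by rw [hr, pow_add]⟩

lemma prim_card {c : Matrix δ δ F} {g : Matrix ι ι F} {r : ℕ} (h : g.charpoly = c.charpoly ^ r) :
    Fintype.card ι = Fintype.card δ * r := by
  have := congrArg Polynomial.natDegree h
  rw [Matrix.charpoly_natDegree_eq_dim, (Matrix.charpoly_monic c).natDegree_pow,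
    Matrix.charpoly_natDegree_eq_dim] at this
  rw [this, mul_comm]

/-- the dimension of the socle -/
noncomputable def lf [Fintype F] (c : Matrix δ δ F) (g : Matrix ι ι F) : ℕ :=
  Nat.log (Fintype.card F ^ Fintype.card δ) (Ho c g)

lemma two_le_Q [Fintype F] {c : Matrix δ δ F} (hc : Irreducible c.charpoly) :
    2 ≤ Fintype.card F ^ Fintype.card δ := by
  have := nonempty_of_irr hc
  have h1 : 1 ≤ Fintype.card δ := Fintype.card_pos
  calc 2 ≤ Fintype.card F := two_le_card
    _ = Fintype.card F ^ 1 := (pow_one _).symm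
    _ ≤ _ := Nat.pow_le_pow_right (by have := two_le_card (F := F); omega) h1

lemma lf_eq [Fintype F] {c : Matrix δ δ F} (hc : Irreducible c.charpoly) {g : Matrix ι ι F} {l : ℕ}
    (h : Ho c g = (Fintype.card F ^ Fintype.card δ) ^ l) : lf c g = l := by
  unfold lf
  rw [h]
  exact Nat.log_pow (two_le_Q hc) l

lemma Ho_lf [Fintype F] {c : Matrix δ δ F} (hc : Irreducible c.charpoly) (g : Matrix ι ι F) :
    Ho c g = (Fintype.card F ^ Fintype.card δ) ^ lf c g := by
  obtain ⟨l, -, h⟩ := exists_l hc g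
  rw [lf_eq hc h, h]

lemma lf_le [Fintype F] {c : Matrix δ δ F} (hc : Irreducible c.charpoly) (g : Matrix ι ι F) :
    lf c g ≤ Fintype.card ι := by
  obtain ⟨l, h', h⟩ := exists_l hc g
  rwa [lf_eq hc h]

lemma lf_pos [Fintype F] {c : Matrix δ δ F} (hc : Irreducible c.charpoly) {g : Matrix ι ι F}
    (hg : prim c g) [Nonempty ι] : 1 ≤ lf c g := by
  classical
  obtain ⟨r, hr⟩ := hg
  have h0 : (Polynomial.aeval g c.charpoly) ^ r = 0 := by
    rw [← map_pow, ← hr, Matrix.aeval_self_charpoly]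
  have h1 : ∃ v : ι → F, v ≠ 0 ∧ (Polynomial.aeval g c.charpoly).mulVec v = 0 := by
    have hdet : (Polynomial.aeval g c.charpoly).det = 0 := by
      have := congrArg Matrix.det h0
      rw [Matrix.det_pow, Matrix.det_zero] at this
      exact eq_zero_of_pow_eq_zero this
    exact Matrix.exists_mulVec_eq_zero_iff.mpr hdet
  obtain ⟨v, hv, hv'⟩ := h1
  obtain ⟨A, hA, hA'⟩ := exists_intertwiner hc g hv hv'
  by_contra hcon
  have h2 : lf c g = 0 := by omega
  have h3 := Ho_lf hc g
  rw [h2, pow_zero] at h3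
  unfold Ho at h3
  rw [Nat.card_eq_one_iff_unique] at h3
  have := h3.1
  have := Subsingleton.elim (⟨A, hA'⟩ : {A : Matrix ι δ F // g * A = A * c}) ⟨0, by simp⟩
  exact hA (congrArg Subtype.val this)

lemma Fr_lf [Fintype F] {c : Matrix δ δ F} (hc : Irreducible c.charpoly) (g : Matrix ι ι F) (j : ℕ) :
    (Fr (hz c j) g : ℂ) = qN ((Fintype.card F ^ Fintype.card δ : ℕ) : ℂ)
      (((Fintype.card F ^ Fintype.card δ : ℕ) : ℂ) ^ lf c g) j := by
  rw [Fr_hz hc, Ho_lf hc g]; push_cast; rfl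

end MK

end

section
open scoped BigOperators
namespace MK

variable {F : Type} [Field F]
variable {ι μ δ ν κ : Type} [Fintype ι] [Fintype μ] [Fintype δ] [Fintype ν] [Fintype κ]
  [DecidableEq ι] [DecidableEq μ] [DecidableEq δ] [DecidableEq ν] [DecidableEq κ]

lemma Ho_cols [Finite F] (c : Matrix δ δ F) (h' : Matrix μ μ F) (g : Matrix ι ι F) :
    Ho (Matrix.fromBlocks c 0 0 h') g = Ho c g * Ho h' g := by
  unfold Ho
  rw [← Nat.card_prod]
  apply Nat.card_congr
  exact
    { toFun := fun A => by
        have h2 := A.2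
        rw [← Matrix.fromCols_toCols A.1, Matrix.fromCols_mul_fromBlocks, Matrix.mul_fromCols] at h2
        simp only [Matrix.mul_zero, add_zero, zero_add] at h2
        have h3 := Matrix.fromCols_inj h2
        exact ⟨⟨A.1.toCols₁, h3.1⟩, ⟨A.1.toCols₂, h3.2⟩⟩
      invFun := fun t => ⟨Matrix.fromCols t.1.1 t.2.1, by
        rw [Matrix.fromCols_mul_fromBlocks, Matrix.mul_fromCols]
        simp only [Matrix.mul_zero, add_zero, zero_add]
        rw [t.1.2, t.2.2]⟩
      left_inv := fun A => by apply Subtype.ext; simp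
      right_inv := fun t => by apply Prod.ext <;> apply Subtype.ext <;> simp }

lemma Ho_hz_hz [Fintype F] {c : Matrix δ δ F} (hc : Irreducible c.charpoly) (i j : ℕ) :
    Ho (hz c i) (hz c j) = (Fintype.card F ^ Fintype.card δ) ^ (j * i) := by
  induction i with
  | zero =>
    have : Subsingleton (Matrix (Pw δ j) (Pw δ 0) F) := ⟨fun a b => by ext i k; exact k.elim⟩
    unfold Ho
    rw [mul_zero, pow_zero, Nat.card_eq_one_iff_unique]
    exact ⟨inferInstance, ⟨0, Subsingleton.elim _ _⟩⟩
  | succ i ih =>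
    have : Ho (hz c (i + 1)) (hz c j) = Ho c (hz c j) * Ho (hz c i) (hz c j) := Ho_cols c (hz c i) (hz c j)
    rw [this, ih, Ho_hz hc]; ring

lemma count_aux {M U : Type} [AddCommGroup M] [AddCommGroup U] [Finite M] [Finite U]
    (ad : M →+ M) (s : U →+ M) (hs : Function.Surjective s) :
    Nat.card {m // ad m = 0} * Nat.card {u // ∃ m, ad m = s u} = Nat.card U := by
  have h1 : ad.range.index = Nat.card ad.ker := by
    have e1 := ad.ker.card_mul_index
    have e2 := ad.range.card_mul_index
    rw [AddSubgroup.index_ker] at e1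
    have : 0 < Nat.card ad.range := Nat.card_pos
    have e3 : Nat.card ad.range * ad.range.index = Nat.card ad.range * Nat.card ad.ker := by
      rw [e2, ← e1, mul_comm]
    exact Nat.eq_of_mul_eq_mul_left this e3
  have h2 := (ad.range.comap s).card_mul_index
  rw [AddSubgroup.index_comap_of_surjective _ hs, h1] at h2
  rw [← h2, mul_comm]
  rfl

/-- the predicate: obstruction vanishes -/
def pob (h0 : Matrix κ κ F) (h : Matrix μ μ F) (u : Matrix κ ν F) (A : Matrix ν μ F) : Prop :=
  ∃ A1 : Matrix κ μ F, A1 * h - h0 * A1 = u * A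

lemma Ho_block [Finite F] (c : Matrix δ δ F) (h0 : Matrix κ κ F) (u : Matrix κ ν F) (x : Matrix ν ν F) :
    Ho c (Matrix.fromBlocks h0 u 0 x) = Ho c h0 * HoP (pob h0 c u) c x := by
  classical
  unfold Ho HoP
  have hex : ∀ A : {A : Matrix ν δ F // x * A = A * c ∧ pob h0 c u A},
      ∃ A1 : Matrix κ δ F, u * A.1 = A1 * c - h0 * A1 := by
    rintro ⟨A, -, A1, h⟩
    exact ⟨A1, h.symm⟩
  choose ch hch using hex
  have hT : ∀ A : {A : Matrix (κ ⊕ ν) δ F // Matrix.fromBlocks h0 u 0 x * A = A * c},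
      h0 * A.1.toRows₁ + u * A.1.toRows₂ = A.1.toRows₁ * c ∧ x * A.1.toRows₂ = A.1.toRows₂ * c := by
    intro A
    have h2 := A.2
    rw [← Matrix.fromRows_toRows A.1, Matrix.fromBlocks_mul_fromRows, Matrix.fromRows_mul] at h2
    simp only [Matrix.zero_mul, zero_add] at h2
    simpa using Matrix.fromRows_inj h2
  let f2 : {A : Matrix (κ ⊕ ν) δ F // Matrix.fromBlocks h0 u 0 x * A = A * c} →
      {A : Matrix ν δ F // x * A = A * c ∧ pob h0 c u A} := fun A =>
    ⟨A.1.toRows₂, (hT A).2, A.1.toRows₁, by rw [← (hT A).1]; simp⟩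
  have e : {A : Matrix (κ ⊕ ν) δ F // Matrix.fromBlocks h0 u 0 x * A = A * c} ≃
      {A : Matrix κ δ F // h0 * A = A * c} × {A : Matrix ν δ F // x * A = A * c ∧ pob h0 c u A} :=
    { toFun := fun A => ⟨⟨A.1.toRows₁ - ch (f2 A), by
          have h1 := (hT A).1
          have h2 : u * A.1.toRows₂ = _ := hch (f2 A)
          rw [h2] at h1
          rw [Matrix.mul_sub, Matrix.sub_mul, ← h1]; abel⟩, f2 A⟩
      invFun := fun t => ⟨Matrix.fromRows (t.1.1 + ch t.2) t.2.1, by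
        rw [Matrix.fromBlocks_mul_fromRows, Matrix.fromRows_mul]
        simp only [Matrix.zero_mul, zero_add]
        rw [t.2.2.1, Matrix.mul_add, Matrix.add_mul, t.1.2, hch t.2]
        congr 1; abel⟩
      left_inv := fun A => by apply Subtype.ext; simp [f2]
      right_inv := fun t => by
        apply Prod.ext
        · apply Subtype.ext; simp [f2]
        · apply Subtype.ext; simp [f2] }
  rw [Nat.card_congr e, Nat.card_prod]

lemma qD_add (Q : ℂ) (j k : ℕ) (hj : 1 ≤ j) :
    qD Q (j + k) = qD Q j * ∏ i ∈ Finset.range k, (1 - Q ^ i * Q ^ j) := by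
  obtain ⟨j, rfl⟩ : ∃ j', j = j' + 1 := ⟨j - 1, by omega⟩
  unfold qD
  have : j + 1 + k - 1 = j + k := by omega
  rw [this, Finset.prod_range_add]
  congr 1
  refine Finset.prod_congr rfl fun i _ => ?_
  ring

lemma surj_of_inj (A : Matrix ν μ F) (hA : Function.Injective A.mulVec) (w : Matrix κ μ F) :
    ∃ u : Matrix κ ν F, u * A = w := by
  obtain ⟨g, hg⟩ := A.mulVecLin.exists_leftInverse_of_injective (LinearMap.ker_eq_bot.mpr hA)
  refine ⟨w * LinearMap.toMatrix' g, ?_⟩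
  have : LinearMap.toMatrix' g * A = 1 := by
    have h2 := congrArg LinearMap.toMatrix' hg
    rw [LinearMap.toMatrix'_comp, LinearMap.toMatrix'_id] at h2
    rwa [← Matrix.toLin'_apply', LinearMap.toMatrix'_toLin'] at h2
  rw [Matrix.mul_assoc, this, Matrix.mul_one]

lemma PL [Fintype F] [DecidableEq F] {c : Matrix δ δ F} (hc : Irreducible c.charpoly) (j : ℕ) (hj : 1 ≤ j)
    (x : Matrix ν ν F) (hx : prim c x) [Nonempty ν] :
    ∑ u : Matrix (Pw δ j) ν F, qD ((Fintype.card F ^ Fintype.card δ : ℕ) : ℂ)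
      (lf c (Matrix.fromBlocks (hz c j) u 0 x)) = 0 := by
  classical
  set Q : ℕ := Fintype.card F ^ Fintype.card δ with hQ
  have hQ2 := two_le_Q hc
  rw [← hQ] at hQ2
  have hQn := one_sub_pow_ne hQ2
  have key : ∀ u : Matrix (Pw δ j) ν F, qD (Q : ℂ) (lf c (Matrix.fromBlocks (hz c j) u 0 x)) =
      qD Q j * ∑ i ∈ Finset.range (Fintype.card ν + 1), qe Q i * ((Q : ℂ) ^ j) ^ i *
        (FrP (pob (hz c j) (hz c i) u) (hz c i) x : ℂ) := by
    intro u
    have h0 : ∀ A : Matrix ν (Pw δ 0) F, pob (hz c j) (hz c 0) u A := fun A =>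
      ⟨0, by ext i k; exact k.elim⟩
    have hpp : ∀ (i : ℕ) (a : Matrix ν δ F) (A : Matrix ν (Pw δ i) F),
      pob (hz c j) (hz c (i + 1)) u (Matrix.fromCols a A : Matrix ν (δ ⊕ Pw δ i) F) ↔
        pob (hz c j) c u a ∧ pob (hz c j) (hz c i) u A := by
      intro i a A
      constructor
      · rintro ⟨A1, hA1⟩
        change Matrix (Pw δ j) (δ ⊕ Pw δ i) F at A1
        change A1 * Matrix.fromBlocks c 0 0 (hz c i) - hz c j * A1 = u * Matrix.fromCols a A at hA1
        rw [← Matrix.fromCols_toCols A1, Matrix.fromCols_mul_fromBlocks, Matrix.mul_fromCols,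
          Matrix.mul_fromCols] at hA1
        simp only [Matrix.mul_zero, add_zero, zero_add] at hA1
        have hA2 := eq_add_of_sub_eq hA1
        constructor
        · refine ⟨A1.toCols₁, ?_⟩
          rw [sub_eq_iff_eq_add]
          ext p r
          simpa using congrFun (congrFun hA2 p) (Sum.inl r)
        · refine ⟨A1.toCols₂, ?_⟩
          rw [sub_eq_iff_eq_add]
          ext p r
          simpa using congrFun (congrFun hA2 p) (Sum.inr r)
      · rintro ⟨⟨a1, h1⟩, ⟨A1, h2⟩⟩
        refine ⟨(Matrix.fromCols a1 A1 : Matrix (Pw δ j) (δ ⊕ Pw δ i) F), ?_⟩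
        change Matrix.fromCols a1 A1 * Matrix.fromBlocks c 0 0 (hz c i) - hz c j * Matrix.fromCols a1 A1 = u * Matrix.fromCols a A
        rw [Matrix.fromCols_mul_fromBlocks, Matrix.mul_fromCols, Matrix.mul_fromCols, ← h1, ← h2]
        simp only [Matrix.mul_zero, add_zero, zero_add]
        ext p (r | r) <;> simp
    have hpt : ∀ (i : ℕ) (A : Matrix ν (Pw δ i) F) (t : Matrix (Pw δ i) δ F),
        pob (hz c j) (hz c i) u A → hz c i * t = t * c → pob (hz c j) c u (A * t) := by
      rintro i A t ⟨A1, h1⟩ ht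
      refine ⟨A1 * t, ?_⟩
      rw [← Matrix.mul_assoc u, ← h1, Matrix.sub_mul, Matrix.mul_assoc A1 (hz c i), ht]
      simp only [Matrix.mul_assoc]
    obtain ⟨k, hk, hk'⟩ := exists_lP hc x (fun i => pob (hz c j) (hz c i) u) (pob (hz c j) c u) h0 hpp hpt
    have h3 : lf c (Matrix.fromBlocks (hz c j) u 0 x) = j + k := by
      apply lf_eq hc
      rw [Ho_block, Ho_hz hc, hk', pow_add]
    have h4 : ∀ i, (FrP (pob (hz c j) (hz c i) u) (hz c i) x : ℂ) = qN Q ((Q : ℂ) ^ k) i := by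
      intro i
      have := FrP_hz hc x (fun i => pob (hz c j) (hz c i) u) (pob (hz c j) c u) h0 hpp hpt i
      rw [this, hk', hQ]
      push_cast; rfl
    rw [h3, qD_add _ _ _ hj]
    simp only [h4]
    rw [qS_eq Q hQn k _ (by omega)]
  have key2 : ∀ i : ℕ, ((Q : ℂ) ^ j) ^ i * ∑ u : Matrix (Pw δ j) ν F, (FrP (pob (hz c j) (hz c i) u) (hz c i) x : ℂ) =
      (Nat.card (Matrix (Pw δ j) ν F) : ℂ) * (Fr (hz c i) x : ℂ) := by
    intro i
    have h1 : ∀ u : Matrix (Pw δ j) ν F, (FrP (pob (hz c j) (hz c i) u) (hz c i) x) =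
        ∑ A : {A : Matrix ν (Pw δ i) F // Function.Injective A.mulVec ∧ x * A = A * hz c i},
          if pob (hz c j) (hz c i) u A.1 then 1 else 0 := by
      intro u
      unfold FrP
      rw [← Finset.card_filter, ← Fintype.card_subtype, ← Nat.card_eq_fintype_card]
      exact Nat.card_congr (Equiv.subtypeSubtypeEquivSubtypeInter _ _).symm
    have h2 : ∀ A : {A : Matrix ν (Pw δ i) F // Function.Injective A.mulVec ∧ x * A = A * hz c i},
        Q ^ (j * i) * ∑ u : Matrix (Pw δ j) ν F, (if pob (hz c j) (hz c i) u A.1 then 1 else 0)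
          = Nat.card (Matrix (Pw δ j) ν F) := by
      rintro ⟨A, hA, -⟩
      let ad : Matrix (Pw δ j) (Pw δ i) F →+ Matrix (Pw δ j) (Pw δ i) F :=
        { toFun := fun A1 => A1 * hz c i - hz c j * A1
          map_zero' := by simp
          map_add' := fun a b => by rw [Matrix.add_mul, Matrix.mul_add]; abel }
      let s : Matrix (Pw δ j) ν F →+ Matrix (Pw δ j) (Pw δ i) F :=
        { toFun := fun u => u * A
          map_zero' := by simp
          map_add' := fun a b => by rw [Matrix.add_mul] }
      have h3 := count_aux ad s (surj_of_inj A hA)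
      rw [← h3, ← Ho_hz_hz hc i j, ← Finset.card_filter, ← Fintype.card_subtype, ← Nat.card_eq_fintype_card]
      unfold Ho
      congr 1
      apply Nat.card_congr
      apply Equiv.subtypeEquivRight
      intro B
      show _ ↔ B * hz c i - hz c j * B = 0
      rw [sub_eq_zero, eq_comm]
    have h3 : Q ^ (j * i) * ∑ u : Matrix (Pw δ j) ν F, FrP (pob (hz c j) (hz c i) u) (hz c i) x =
        Nat.card (Matrix (Pw δ j) ν F) * Fr (hz c i) x := by
      simp only [h1]
      rw [Finset.sum_comm, Finset.mul_sum]
      simp only [h2]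
      rw [Finset.sum_const, Finset.card_univ, smul_eq_mul, mul_comm, Fr, Nat.card_eq_fintype_card]
      congr 1
      rw [Nat.card_eq_fintype_card]
    have h4 := congrArg (Nat.cast : ℕ → ℂ) h3
    push_cast at h4
    rw [← pow_mul]
    exact h4
  simp only [key]
  rw [← Finset.mul_sum, Finset.sum_comm]
  have h5 : ∀ i ∈ Finset.range (Fintype.card ν + 1), ∑ u : Matrix (Pw δ j) ν F, qe (Q : ℂ) i * ((Q : ℂ) ^ j) ^ i *
        (FrP (pob (hz c j) (hz c i) u) (hz c i) x : ℂ) =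
        (Nat.card (Matrix (Pw δ j) ν F) : ℂ) * (qe Q i * 1 ^ i * qN Q ((Q : ℂ) ^ lf c x) i) := by
    intro i _
    rw [← Finset.mul_sum, mul_assoc, key2, Fr_lf hc, one_pow]
    ring
  rw [Finset.sum_congr rfl h5, ← Finset.mul_sum, qS_eq Q hQn _ _ (by have := lf_le hc x; omega)]
  have h6 : ∏ i ∈ Finset.range (lf c x), (1 - (Q : ℂ) ^ i * 1) = 0 := by
    apply Finset.prod_eq_zero (i := 0)
    · have := lf_pos hc hx; simp; omega
    · simp
  rw [h6]; simp

end MK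

end

section
open scoped BigOperators
namespace MK

variable {F : Type} [Field F]
variable {ι μ δ ν κ : Type} [Fintype ι] [Fintype μ] [Fintype δ] [Fintype ν] [Fintype κ]
  [DecidableEq ι] [DecidableEq μ] [DecidableEq δ] [DecidableEq ν] [DecidableEq κ]

open Classical in
/-- the Green type function -/
noncomputable def DD [Fintype F] (c : Matrix δ δ F) (g : Matrix ι ι F) : ℂ :=
  if prim c g then qD ((Fintype.card F ^ Fintype.card δ : ℕ) : ℂ) (lf c g) else 0

lemma DD_CI [Fintype F] (c : Matrix δ δ F) : CI (fun g : Matrix ι ι F => DD c g) := by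
  intro B B' g h1 h2
  have e1 : prim c (B' * g * B) ↔ prim c g := by unfold prim; rw [charpoly_conj h1]
  have e2 : lf c (B' * g * B) = lf c g := by unfold lf; rw [Ho_conj c h1 h2]
  show DD c (B' * g * B) = DD c g
  unfold DD
  rw [e2]
  by_cases h : prim c g
  · rw [if_pos h, if_pos (e1.mpr h)]
  · rw [if_neg h, if_neg (fun h' => h (e1.mp h'))]

lemma DD_reindex [Fintype F] (c : Matrix δ δ F) (g : Matrix ι ι F) (e : ι ≃ κ) :
    DD c (Matrix.reindex e e g) = DD c g := by
  have e2 : lf c (Matrix.reindex e e g) = lf c g := by unfold lf; rw [Ho_reindex]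
  have e1 := prim_reindex c g e
  unfold DD
  rw [e2]
  by_cases h : prim c g
  · rw [if_pos h, if_pos (e1.mpr h)]
  · rw [if_neg h, if_neg (fun h' => h (e1.mp h'))]

lemma lf_hz [Fintype F] {c : Matrix δ δ F} (hc : Irreducible c.charpoly) (j : ℕ) :
    lf c (hz c j) = j := lf_eq hc (Ho_hz hc j)

lemma lf_zero_of_empty [Fintype F] {c : Matrix δ δ F} (hc : Irreducible c.charpoly) [IsEmpty ν] (x : Matrix ν ν F) :
    lf c x = 0 := by
  have := lf_le hc x
  simpa using this

lemma Fr_hz_zero_of_lt [Fintype F] (c : Matrix δ δ F) (g : Matrix ι ι F) (j : ℕ)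
    (h : Fintype.card ι < Fintype.card δ * j) : Fr (hz c j) g = 0 := by
  apply Fr_zero_of_card
  rw [card_Pw]; exact h

lemma DD_Fr [Fintype F] [DecidableEq F] {c : Matrix δ δ F} (hc : Irreducible c.charpoly) (r : ℕ)
    (hr : Fintype.card ι = Fintype.card δ * r) (j : ℕ) (hj : 1 ≤ j) :
    ∑ g : Matrix ι ι F, DD c g * (Fr (hz c j) g : ℂ) =
      if j = r then glc (Fintype.card F) (Fintype.card ι) *
        qD ((Fintype.card F ^ Fintype.card δ : ℕ) : ℂ) r else 0 := by
  have hne := nonempty_of_irr hc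
  have hδ : 0 < Fintype.card δ := Fintype.card_pos
  have hq := two_le_card (F := F)
  rcases lt_trichotomy j r with h | h | h
  · rw [if_neg (by omega)]
    have hlt : Fintype.card δ * j < Fintype.card δ * r := Nat.mul_lt_mul_of_pos_left h hδ
    have e : Pw δ j ⊕ Fin (Fintype.card ι - Fintype.card δ * j) ≃ ι :=
      Fintype.equivOfCardEq (by rw [Fintype.card_sum, card_Pw, Fintype.card_fin]; omega)
    have : Nonempty (Fin (Fintype.card ι - Fintype.card δ * j)) := ⟨⟨0, by omega⟩⟩
    rw [L3' _ (DD_CI c) (hz c j) e, Finset.sum_comm]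
    have : ∀ x : Matrix (Fin (Fintype.card ι - Fintype.card δ * j)) (Fin (Fintype.card ι - Fintype.card δ * j)) F,
        ∑ u, DD c (Matrix.reindex e e (Matrix.fromBlocks (hz c j) u 0 x)) = 0 := by
      intro x
      by_cases hx : prim c x
      · rw [← PL hc j hj x hx]
        refine Finset.sum_congr rfl fun u _ => ?_
        rw [DD_reindex, DD, if_pos ((prim_block hc j u x).mpr hx)]
      · apply Finset.sum_eq_zero
        intro u _
        rw [DD_reindex, DD, if_neg (fun h => hx ((prim_block hc j u x).mp h))]
    rw [Finset.sum_eq_zero fun x _ => this x, mul_zero]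
  · subst h
    rw [if_pos rfl]
    have e : Pw δ j ⊕ Fin 0 ≃ ι :=
      Fintype.equivOfCardEq (by rw [Fintype.card_sum, card_Pw, Fintype.card_fin]; omega)
    rw [L3' _ (DD_CI c) (hz c j) e]
    have : ∀ (u : Matrix (Pw δ j) (Fin 0) F) (x : Matrix (Fin 0) (Fin 0) F), DD c (Matrix.reindex e e (Matrix.fromBlocks (hz c j) u 0 x)) =
        qD ((Fintype.card F ^ Fintype.card δ : ℕ) : ℂ) j := by
      intro u x
      rw [DD_reindex, DD, if_pos ((prim_block hc j u x).mpr ⟨0, by simp [Matrix.charpoly]⟩)]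
      congr 1
      apply lf_eq hc
      rw [Ho_block, Ho_hz hc]
      have : HoP (pob (hz c j) c u) c x = 1 := by
        unfold HoP
        rw [Nat.card_eq_one_iff_unique]
        exact ⟨inferInstance, ⟨⟨0, Subsingleton.elim _ _, ⟨0, by simp [Subsingleton.elim u 0]⟩⟩⟩⟩
      rw [this, mul_one]
    rw [Finset.sum_congr rfl fun u _ => Finset.sum_congr rfl fun x _ => this u x]
    have hcard : Fintype.card (Matrix (Pw δ j) (Fin 0) F) = 1 := Fintype.card_eq_one_iff_nonempty_unique.mpr ⟨⟨⟨0⟩, fun a => Subsingleton.elim _ _⟩⟩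
    have hcard2 : Fintype.card (Matrix (Fin 0) (Fin 0) F) = 1 := Fintype.card_eq_one_iff_nonempty_unique.mpr ⟨⟨⟨0⟩, fun a => Subsingleton.elim _ _⟩⟩
    simp only [Finset.sum_const, Finset.card_univ, hcard, hcard2]
    simp [glc, qN]
  · rw [if_neg (by omega)]
    apply Finset.sum_eq_zero
    intro g _
    rw [Fr_hz_zero_of_lt c g j (by rw [hr]; exact Nat.mul_lt_mul_of_pos_left h hδ)]; simp

lemma qe_qD (Q : ℂ) (hQ : ∀ i, 1 - Q ^ (i + 1) ≠ 0) (r : ℕ) (hr : 1 ≤ r) : qe Q r * qD Q r = (1 - Q ^ r)⁻¹ := by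
  obtain ⟨r, rfl⟩ : ∃ j', r = j' + 1 := ⟨r - 1, by omega⟩
  unfold qe qD
  rw [Finset.prod_range_succ]
  simp only [Nat.add_sub_cancel]
  rw [mul_right_comm, ← Finset.prod_mul_distrib]
  rw [Finset.prod_eq_one, one_mul]
  intro i _
  exact inv_mul_cancel₀ (hQ i)

lemma C1 [Fintype F] [DecidableEq F] {c : Matrix δ δ F} (hc : Irreducible c.charpoly) (r : ℕ) (hr1 : 1 ≤ r)
    (hr : Fintype.card ι = Fintype.card δ * r) :
    ∑ g : Matrix ι ι F, DD c g = glc (Fintype.card F) (Fintype.card ι) / ((Fintype.card F : ℂ) ^ Fintype.card ι - 1) := by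
  have hne := nonempty_of_irr hc
  have hδ : 0 < Fintype.card δ := Fintype.card_pos
  have : Nonempty ι := by
    rw [← Fintype.card_pos_iff, hr]; exact Nat.mul_pos hδ hr1
  have hQ2 := two_le_Q hc
  have hQn := one_sub_pow_ne hQ2
  have hrι : r ≤ Fintype.card ι := by rw [hr]; exact Nat.le_mul_of_pos_left r hδ
  have hE : (Fintype.card F : ℂ) ^ Fintype.card ι = ((Fintype.card F ^ Fintype.card δ : ℕ) : ℂ) ^ r := by
    push_cast; rw [hr, pow_mul]
  set Q : ℕ := Fintype.card F ^ Fintype.card δ with hQ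
  have h0 : ∀ g : Matrix ι ι F, DD c g * ∑ j ∈ Finset.range (Fintype.card ι + 1), qe Q j * 1 ^ j * (Fr (hz c j) g : ℂ) = 0 := by
    intro g
    by_cases hg : prim c g
    · have h1 := qS_eq Q hQn (lf c g) (Fintype.card ι + 1) (by have := lf_le hc g; omega) 1
      simp only [Fr_lf hc]
      rw [← hQ, h1, Finset.prod_eq_zero (i := 0), mul_zero]
      · have := lf_pos hc hg; simp; omega
      · simp
    · rw [DD, if_neg hg, zero_mul]
  have h1 : ∑ g : Matrix ι ι F, DD c g * ∑ j ∈ Finset.range (Fintype.card ι + 1), qe Q j * 1 ^ j * (Fr (hz c j) g : ℂ) = 0 :=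
    Finset.sum_eq_zero fun g _ => h0 g
  simp only [Finset.mul_sum] at h1
  rw [Finset.sum_comm, Finset.sum_range_succ'] at h1
  have h2 : ∀ i ∈ Finset.range (Fintype.card ι), ∑ g : Matrix ι ι F, DD c g * (qe (Q : ℂ) (i + 1) * 1 ^ (i + 1) * (Fr (hz c (i + 1)) g : ℂ)) =
      if i = r - 1 then qe (Q : ℂ) r * (glc (Fintype.card F) (Fintype.card ι) * qD Q r) else 0 := by
    intro i _
    have h3 := DD_Fr (ι := ι) hc r hr (i + 1) (by omega)
    have : ∀ g : Matrix ι ι F, DD c g * (qe (Q : ℂ) (i + 1) * 1 ^ (i + 1) * (Fr (hz c (i + 1)) g : ℂ)) = qe (Q : ℂ) (i + 1) * (DD c g * (Fr (hz c (i + 1)) g : ℂ)) := fun g => by ring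
    simp only [this]
    rw [← Finset.mul_sum, h3]
    by_cases hi : i + 1 = r
    · rw [if_pos hi, if_pos (by omega), hi]
    · rw [if_neg hi, if_neg (by omega), mul_zero]
  rw [Finset.sum_congr rfl h2, Finset.sum_ite_eq' , if_pos (by simp; omega)] at h1
  have h4 : ∀ g : Matrix ι ι F, (Fr (hz c 0) g : ℂ) = 1 := by
    intro g; rw [Fr_lf hc]; simp [qN]
  simp only [h4, qe, Finset.range_zero, Finset.prod_empty, pow_zero, mul_one] at h1
  rw [hE]
  have h5 := qe_qD Q hQn r hr1
  have h6 : ((Q : ℂ) ^ r - 1) ≠ 0 := by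
    have := hQn (r - 1)
    rw [Nat.sub_add_cancel hr1] at this
    intro h; apply this; rw [← neg_sub, h, neg_zero]
  have h7 : 1 - (Q : ℂ) ^ r ≠ 0 := by intro h; apply h6; rw [← neg_sub, h, neg_zero]
  rw [mul_left_comm, ← qe, h5] at h1
  rw [eq_div_iff h6]
  field_simp at h1
  linear_combination (-1 : ℂ) * h1

lemma C2 [Fintype F] [DecidableEq F] {c : Matrix δ δ F} (hc : Irreducible c.charpoly) (r : ℕ) (hr1 : 1 ≤ r)
    (hr : Fintype.card ι = Fintype.card δ * r) :
    ∑ g : Matrix ι ι F, DD c g ^ 2 = r * (glc (Fintype.card F) (Fintype.card ι) / ((Fintype.card F : ℂ) ^ Fintype.card ι - 1)) := by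
  have hne := nonempty_of_irr hc
  have hδ : 0 < Fintype.card δ := Fintype.card_pos
  have : Nonempty ι := by
    rw [← Fintype.card_pos_iff, hr]; exact Nat.mul_pos hδ hr1
  have hQ2 := two_le_Q hc
  have hQn := one_sub_pow_ne hQ2
  have hrι : r ≤ Fintype.card ι := by rw [hr]; exact Nat.le_mul_of_pos_left r hδ
  have hE : (Fintype.card F : ℂ) ^ Fintype.card ι = ((Fintype.card F ^ Fintype.card δ : ℕ) : ℂ) ^ r := by
    push_cast; rw [hr, pow_mul]
  set Q : ℕ := Fintype.card F ^ Fintype.card δ with hQ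
  have h0 : ∀ g : Matrix ι ι F, DD c g ^ 2 = - ∑ j ∈ Finset.range (Fintype.card ι + 1), ((j : ℂ) * qe Q j) * (DD c g * (Fr (hz c j) g : ℂ)) := by
    intro g
    by_cases hg : prim c g
    · have h1 := qD_eq Q hQn (lf c g) (Fintype.card ι + 1) (lf_pos hc hg) (by have := lf_le hc g; omega)
      rw [pow_two]
      nth_rewrite 2 [DD]
      rw [if_pos hg, ← hQ, h1, mul_neg, Finset.mul_sum]
      congr 1
      refine Finset.sum_congr rfl fun j _ => ?_
      rw [Fr_lf hc, ← hQ]; ring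
    · rw [DD, if_neg hg]; simp
  simp only [h0]
  rw [Finset.sum_neg_distrib, Finset.sum_comm, Finset.sum_range_succ']
  have h2 : ∀ i ∈ Finset.range (Fintype.card ι), ∑ g : Matrix ι ι F, (((i + 1 : ℕ) : ℂ) * qe (Q : ℂ) (i + 1)) * (DD c g * (Fr (hz c (i + 1)) g : ℂ)) =
      if i = r - 1 then r * (qe (Q : ℂ) r * (glc (Fintype.card F) (Fintype.card ι) * qD Q r)) else 0 := by
    intro i _
    have h3 := DD_Fr (ι := ι) hc r hr (i + 1) (by omega)
    rw [← Finset.mul_sum, h3]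
    by_cases hi : i + 1 = r
    · rw [if_pos hi, if_pos (by omega), hi]; ring
    · rw [if_neg hi, if_neg (by omega), mul_zero]
  rw [Finset.sum_congr rfl h2, Finset.sum_ite_eq' , if_pos (by simp; omega)]
  rw [hE]
  have h5 := qe_qD Q hQn r hr1
  have h6 : ((Q : ℂ) ^ r - 1) ≠ 0 := by
    have := hQn (r - 1)
    rw [Nat.sub_add_cancel hr1] at this
    intro h; apply this; rw [← neg_sub, h, neg_zero]
  have h7 : 1 - (Q : ℂ) ^ r ≠ 0 := by intro h; apply h6; rw [← neg_sub, h, neg_zero]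
  rw [mul_left_comm (qe (Q : ℂ) r), h5]
  simp only [Nat.cast_zero, zero_mul, Finset.sum_const_zero, add_zero]
  field_simp
  ring

end MK

end

section
open scoped BigOperators
namespace MK

variable {F : Type} [Field F]
variable {ι μ δ ν κ : Type} [Fintype ι] [Fintype μ] [Fintype δ] [Fintype ν] [Fintype κ]
  [DecidableEq ι] [DecidableEq μ] [DecidableEq δ] [DecidableEq ν] [DecidableEq κ]

/-- block triangularization along an injective intertwiner -/
lemma block_form (A : Matrix (μ ⊕ ν) μ F) {B B' : Matrix (μ ⊕ ν) (μ ⊕ ν) F}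
    (h2 : B' * B = 1) (h3 : B * (Matrix.fromRows 1 0 : Matrix (μ ⊕ ν) μ F) = A)
    (g : Matrix (μ ⊕ ν) (μ ⊕ ν) F) (h : Matrix μ μ F) (hg : g * A = A * h) :
    B' * g * B = Matrix.fromBlocks h (B' * g * B).toBlocks₁₂ 0 (B' * g * B).toBlocks₂₂ := by
  have h4 : (B' * g * B) * (Matrix.fromRows 1 0 : Matrix (μ ⊕ ν) μ F) = Matrix.fromRows h 0 := by
    rw [Matrix.mul_assoc, h3, Matrix.mul_assoc, hg, ← h3, Matrix.mul_assoc, ← Matrix.mul_assoc, h2,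
      Matrix.one_mul, Matrix.fromRows_mul]
    simp
  rw [← Matrix.fromBlocks_toBlocks (B' * g * B), Matrix.fromBlocks_mul_fromRows] at h4
  simp only [Matrix.mul_one, Matrix.mul_zero, add_zero] at h4
  have h5 := Matrix.fromRows_inj h4
  have h5a : (B' * g * B).toBlocks₁₁ = h := h5.1
  have h5b : (B' * g * B).toBlocks₂₁ = 0 := h5.2
  conv_lhs => rw [← Matrix.fromBlocks_toBlocks (B' * g * B), h5a, h5b]

lemma block_pow (h : Matrix μ μ F) (u : Matrix μ ν F) (x : Matrix ν ν F) (k : ℕ) :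
    ∃ w, (Matrix.fromBlocks h u 0 x) ^ k = Matrix.fromBlocks (h ^ k) w 0 (x ^ k) := by
  induction k with
  | zero => exact ⟨0, by simp⟩
  | succ k ih =>
    obtain ⟨w, hw⟩ := ih
    refine ⟨h ^ k * u + w * x, ?_⟩
    rw [pow_succ, hw, Matrix.fromBlocks_multiply]
    simp only [Matrix.mul_zero, Matrix.zero_mul, add_zero, zero_add, ← pow_succ]

lemma conj_pow' {B B' g : Matrix ι ι F} (h1 : B * B' = 1) (h2 : B' * B = 1) (k : ℕ) :
    (B' * g * B) ^ k = B' * g ^ k * B := by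
  induction k with
  | zero => simp [h2]
  | succ k ih =>
    rw [pow_succ, ih, pow_succ]
    calc B' * g ^ k * B * (B' * g * B) = B' * g ^ k * (B * B') * g * B := by simp only [Matrix.mul_assoc]
      _ = _ := by rw [h1]; simp only [Matrix.mul_assoc, Matrix.mul_one, Matrix.one_mul]

lemma trace_conj' {B B' g : Matrix ι ι F} (h1 : B * B' = 1) : (B' * g * B).trace = g.trace := by
  rw [Matrix.trace_mul_comm, ← Matrix.mul_assoc, h1, Matrix.one_mul]

/-- eigenvalue multiset for a matrix with `M ^ (m + 1) = M` -/
lemma eig_multiset (n : ℕ) : ∀ {κ : Type} [Fintype κ] [DecidableEq κ] (hκ : Fintype.card κ = n)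
    (M : Matrix κ κ ℂ) (m m' : ℕ) (hM : M ^ m = M ^ m'),
    ∃ s : Multiset ℂ, (∀ z ∈ s, z ^ m = z ^ m') ∧ ∀ k, (M ^ k).trace = (s.map (fun z => z ^ k)).sum := by
  induction n with
  | zero =>
    intro κ _ _ hκ M m m' hM
    have := Fintype.card_eq_zero_iff.mp hκ
    exact ⟨0, by simp, fun k => by simp [Matrix.trace]⟩
  | succ n ih =>
    intro κ _ _ hκ M m m' hM
    let e : Unit ⊕ Fin n ≃ κ := Fintype.equivOfCardEq (by simp [hκ]; omega)
    let M1 : Matrix (Unit ⊕ Fin n) (Unit ⊕ Fin n) ℂ := Matrix.reindexAlgEquiv ℂ ℂ e.symm M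
    have hM1p : ∀ k, M1 ^ k = Matrix.reindexAlgEquiv ℂ ℂ e.symm (M ^ k) := fun k => (map_pow _ _ _).symm
    have htr : ∀ k, (M ^ k).trace = (M1 ^ k).trace := by
      intro k
      rw [hM1p]
      simp only [Matrix.trace, Matrix.coe_reindexAlgEquiv, Matrix.reindex_apply, Matrix.diag_apply, Matrix.submatrix_apply, Equiv.symm_symm]
      exact (e.sum_comp (fun i => (M ^ k) i i)).symm
    have hM1 : M1 ^ m = M1 ^ m' := by rw [hM1p, hM, hM1p]
    obtain ⟨lam, hlam⟩ : ∃ lam, M1.charpoly.IsRoot lam := by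
      apply IsAlgClosed.exists_root
      rw [Matrix.charpoly_degree_eq_dim]
      simp only [Fintype.card_sum, Fintype.card_unit, Fintype.card_fin]
      exact_mod_cast (by omega : 1 + n ≠ 0)
    have hdet : (Matrix.scalar _ lam - M1).det = 0 := by rw [← Matrix.eval_charpoly]; exact hlam
    obtain ⟨v, hv0, hv⟩ := Matrix.exists_mulVec_eq_zero_iff.mpr hdet
    have hv' : M1.mulVec v = lam • v := by
      rw [Matrix.sub_mulVec, sub_eq_zero] at hv
      rw [← hv]
      ext i; simp [Matrix.mulVec_diagonal]
    let A : Matrix (Unit ⊕ Fin n) Unit ℂ := Matrix.of fun i _ => v i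
    have hA : Function.Injective A.mulVec := by
      rw [mulVec_inj_iff]
      intro z hz
      obtain ⟨i, hi⟩ := Function.ne_iff.mp hv0
      have := congrFun hz i
      simp [A, Matrix.mulVec, dotProduct] at this
      rcases this with h | h
      · exact absurd h hi
      · ext u; exact h
    obtain ⟨B, B', h1, h2, h3⟩ := exists_extend A hA
    have hMA : M1 * A = A * (Matrix.of fun _ _ => lam : Matrix Unit Unit ℂ) := by
      ext i u
      have := congrFun hv' i
      simp only [Matrix.mul_apply, A, Matrix.of_apply]
      simp only [Matrix.mulVec, dotProduct, Pi.smul_apply, smul_eq_mul] at this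
      rw [this]; simp [mul_comm]
    have h5 := block_form A h2 h3 M1 _ hMA
    set x := (B' * M1 * B).toBlocks₂₂ with hx
    set u := (B' * M1 * B).toBlocks₁₂ with hu
    have h6 : ∀ k, ∃ w, (B' * M1 * B) ^ k = Matrix.fromBlocks ((Matrix.of fun _ _ => lam : Matrix Unit Unit ℂ) ^ k) w 0 (x ^ k) := by
      intro k; rw [h5]; exact block_pow _ _ _ _
    have hlk : ∀ k, (Matrix.of fun _ _ => lam : Matrix Unit Unit ℂ) ^ k = Matrix.of fun _ _ => lam ^ k := by
      intro k
      induction k with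
      | zero => ext; simp
      | succ k ih => rw [pow_succ, ih]; ext; simp [Matrix.mul_apply, pow_succ]
    obtain ⟨w, hw⟩ := h6 m
    obtain ⟨w1, hw1⟩ := h6 m'
    rw [conj_pow' h1 h2, hM1, ← conj_pow' h1 h2, hw1] at hw
    have h7 := Matrix.fromBlocks_inj.mp hw
    obtain ⟨s, hs1, hs2⟩ := ih (κ := Fin n) (by simp) x m m' h7.2.2.2.symm
    refine ⟨lam ::ₘ s, ?_, ?_⟩
    · intro z hz
      rcases Multiset.mem_cons.mp hz with rfl | hz
      · have := congrFun (congrFun h7.1 ()) ()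
        rw [hlk, hlk] at this
        exact this.symm
      · exact hs1 z hz
    · intro k
      rw [htr k, ← trace_conj' h1 (B' := B'), ← conj_pow' h1 h2]
      obtain ⟨w', hw'⟩ := h6 k
      have hss := hs2 k
      simp only [Matrix.trace, Matrix.diag_apply] at hss
      rw [hw', hlk, Matrix.trace, Fintype.sum_sum_type]
      simp only [Matrix.diag_apply, Matrix.fromBlocks_apply₁₁, Matrix.fromBlocks_apply₂₂]
      rw [hss]
      simp

lemma trace_integral (M : Matrix κ κ ℂ) (m : ℕ) (hm : 1 ≤ m) (hM : M ^ (m + 1) = M) : IsIntegral ℤ M.trace := by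
  obtain ⟨s, hs, hk⟩ := eig_multiset _ rfl M (m + 1) 1 (by rw [hM, pow_one])
  have := hk 1
  simp only [pow_one, Multiset.map_id'] at this
  rw [this]
  apply IsIntegral.multiset_sum
  intro z hz
  have h1 := hs z hz
  rw [pow_one] at h1
  by_cases h0 : z = 0
  · rw [h0]; exact isIntegral_zero
  · have : z ^ m = 1 := by
      rw [pow_succ] at h1
      exact mul_right_cancel₀ h0 (by rw [h1, one_mul])
    exact IsIntegral.of_pow (n := m) (by omega) (by rw [this]; exact isIntegral_one)

/-- pairs of conjugate cyclotomic integers -/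
def CypI (N : ℕ) : AddSubgroup (ℂ × ℂ) := AddSubgroup.closure {p | p.1 ^ N = 1 ∧ p.2 = p.1⁻¹}

lemma CypI_lift (N : ℕ) (hN : 1 ≤ N) : ∃ (K : Type) (_ : Field K) (_ : NumberField K) (i : K →+* ℂ),
    ∀ p ∈ CypI N, ∃ a b : K, i a = p.1 ∧ ∀ φ : K →+* ℂ, φ b = (starRingEnd ℂ) (φ a) := by
  have : NeZero N := ⟨by omega⟩
  have : NeZero ((N : ℕ) : ℚ) := ⟨by exact_mod_cast (by omega : N ≠ 0)⟩
  have i : CyclotomicField N ℚ →+* ℂ := Classical.choice (inferInstance : Nonempty (CyclotomicField N ℚ →+* ℂ))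
  refine ⟨CyclotomicField N ℚ, inferInstance, inferInstance, i, ?_⟩
  intro p hp
  induction hp using AddSubgroup.closure_induction with
  | mem p hp =>
    obtain ⟨zt, hz⟩ := (CyclotomicField.isCyclotomicExtension N ℚ).exists_isPrimitiveRoot rfl (by omega)
    have hz' := hz.map_of_injective (f := i) i.injective
    obtain ⟨k, -, hk⟩ := hz'.eq_pow_of_pow_eq_one hp.1
    refine ⟨zt ^ k, (zt ^ k)⁻¹, by rw [map_pow, hk], ?_⟩
    intro φ
    rw [map_inv₀]
    apply Complex.inv_eq_conj
    apply Complex.norm_eq_one_of_pow_eq_one (n := N) _ (by omega)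
    rw [← map_pow, ← pow_mul, mul_comm, pow_mul, hz.pow_eq_one, one_pow, map_one]
  | zero => exact ⟨0, 0, by simp, by simp⟩
  | add x y _ _ hx hy =>
    obtain ⟨a, b, h1, h2⟩ := hx
    obtain ⟨a', b', h1', h2'⟩ := hy
    exact ⟨a + a', b + b', by simp [h1, h1'], fun φ => by simp [h2, h2']⟩
  | neg x _ hx =>
    obtain ⟨a, b, h1, h2⟩ := hx
    exact ⟨-a, -b, by simp [h1], fun φ => by simp [h2]⟩

variable {G : Type} [Group G] [Fintype G]

lemma char_CypI (N : ℕ) (hN : 1 ≤ N) (hG : ∀ g : G, g ^ N = 1) (ρ : G →* Matrix κ κ ℂ) (g : G) :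
    ((ρ g).trace, (ρ g⁻¹).trace) ∈ CypI N := by
  obtain ⟨s, hs, hk⟩ := eig_multiset _ rfl (ρ g) N 0 (by rw [← map_pow, hG, pow_zero, map_one])
  have h1 : (ρ g).trace = (s.map (fun z => z ^ 1)).sum := by rw [← hk]; simp
  have h2 : (ρ g⁻¹).trace = (s.map (fun z => z⁻¹)).sum := by
    have : g⁻¹ = g ^ (N - 1) := by
      rw [inv_eq_iff_mul_eq_one, ← pow_succ', Nat.sub_add_cancel hN, hG]
    rw [this, map_pow, hk]
    congr 1
    apply Multiset.map_congr rfl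
    intro z hz
    have := hs z hz
    rw [pow_zero] at this
    apply eq_inv_of_mul_eq_one_left
    rw [← pow_succ, Nat.sub_add_cancel hN, this]
  rw [h1, h2]
  clear hk h1 h2
  induction s using Multiset.induction_on with
  | empty => simp; exact (CypI N).zero_mem
  | cons a s ih =>
    simp only [Multiset.map_cons, Multiset.sum_cons]
    have := (CypI N).add_mem (x := (a ^ 1, a⁻¹)) (AddSubgroup.subset_closure ⟨by simpa using hs a (by simp), by simp⟩)
      (ih (fun z hz => hs z (by simp [hz])))
    exact this

lemma tri_split (ρ : G →* Matrix (μ ⊕ ν) (μ ⊕ ν) ℂ) (h : ∀ g, (ρ g).toBlocks₂₁ = 0) :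
    ∃ (ρ1 : G →* Matrix μ μ ℂ) (ρ2 : G →* Matrix ν ν ℂ), ∀ g, (ρ g).trace = (ρ1 g).trace + (ρ2 g).trace := by
  have h1 : ∀ g g', ρ (g * g') = Matrix.fromBlocks ((ρ g).toBlocks₁₁ * (ρ g').toBlocks₁₁)
      ((ρ g).toBlocks₁₁ * (ρ g').toBlocks₁₂ + (ρ g).toBlocks₁₂ * (ρ g').toBlocks₂₂) 0 ((ρ g).toBlocks₂₂ * (ρ g').toBlocks₂₂) := by
    intro g g'
    rw [map_mul]
    conv_lhs => rw [← Matrix.fromBlocks_toBlocks (ρ g), ← Matrix.fromBlocks_toBlocks (ρ g'), h, h,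
      Matrix.fromBlocks_multiply]
    simp
  refine ⟨{ toFun := fun g => (ρ g).toBlocks₁₁, map_one' := ?_, map_mul' := ?_ },
    { toFun := fun g => (ρ g).toBlocks₂₂, map_one' := ?_, map_mul' := ?_ }, ?_⟩
  · rw [map_one]; ext i j; simp [Matrix.toBlocks₁₁, Matrix.one_apply]
  · intro g g'; rw [h1]; simp
  · rw [map_one]; ext i j; simp [Matrix.toBlocks₂₂, Matrix.one_apply]
  · intro g g'; rw [h1]; simp
  · intro g
    simp [Matrix.trace, Matrix.toBlocks₁₁, Matrix.toBlocks₂₂]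

end MK

end

section
open scoped BigOperators
namespace MK

variable {F : Type} [Field F]
variable {ι μ δ ν κ : Type} [Fintype ι] [Fintype μ] [Fintype δ] [Fintype ν] [Fintype κ]
  [DecidableEq ι] [DecidableEq μ] [DecidableEq δ] [DecidableEq ν] [DecidableEq κ]
variable {G : Type} [Group G] [Fintype G]

lemma sub_split (ρ : G →* Matrix κ κ ℂ) (W : Submodule ℂ (κ → ℂ))
    (hW : ∀ g, ∀ w ∈ W, (ρ g).mulVec w ∈ W) (h0 : W ≠ ⊥) (h1 : W ≠ ⊤) :
    ∃ r1 r2 : ℕ, r1 < Fintype.card κ ∧ r2 < Fintype.card κ ∧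
      ∃ (ρ1 : G →* Matrix (Fin r1) (Fin r1) ℂ) (ρ2 : G →* Matrix (Fin r2) (Fin r2) ℂ),
        ∀ g, (ρ g).trace = (ρ1 g).trace + (ρ2 g).trace := by
  classical
  set r := Module.finrank ℂ W with hr
  have hr0 : 0 < r := by
    rw [hr, Module.finrank_pos_iff]; exact Submodule.nontrivial_iff_ne_bot.mpr h0
  have hrm : r < Fintype.card κ := by
    have := Submodule.finrank_lt h1
    simpa using this
  let bW := Module.finBasis ℂ W
  let e : Fin r ⊕ Fin (Fintype.card κ - r) ≃ κ := Fintype.equivOfCardEq (by simp; omega)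
  let A : Matrix (Fin r ⊕ Fin (Fintype.card κ - r)) (Fin r) ℂ := Matrix.of fun i j => (bW j : κ → ℂ) (e i)
  let h : G → Matrix (Fin r) (Fin r) ℂ := fun g => Matrix.of fun i j => bW.repr ⟨(ρ g).mulVec (bW j), hW g _ (bW j).2⟩ i
  let ρ' : G →* Matrix (Fin r ⊕ Fin (Fintype.card κ - r)) (Fin r ⊕ Fin (Fintype.card κ - r)) ℂ :=
    ((Matrix.reindexAlgEquiv ℂ ℂ e.symm : _ ≃ₐ[ℂ] _) : _ →* _).comp ρ
  have hρ' : ∀ g i j, ρ' g i j = ρ g (e i) (e j) := fun g i j => rfl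
  have hA : Function.Injective A.mulVec := by
    rw [mulVec_inj_iff]
    intro z hz
    have hli := bW.linearIndependent
    rw [Fintype.linearIndependent_iff] at hli
    ext i
    refine hli z ?_ i
    ext k
    have := congrFun hz (e.symm k)
    simp only [Matrix.mulVec, dotProduct, A, Matrix.of_apply, Equiv.apply_symm_apply, Pi.zero_apply] at this
    simp only [Submodule.coe_sum, Submodule.coe_smul, Finset.sum_apply, Pi.smul_apply, smul_eq_mul, Submodule.coe_zero, Pi.zero_apply]
    rw [← this]
    exact Finset.sum_congr rfl fun _ _ => mul_comm _ _
  have hgA : ∀ g, ρ' g * A = A * h g := by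
    intro g
    ext i j
    have h2 := bW.sum_repr ⟨(ρ g).mulVec (bW j), hW g _ (bW j).2⟩
    have h3 := congrFun (congrArg Subtype.val h2) (e i)
    simp only [Submodule.coe_sum, Submodule.coe_smul, Finset.sum_apply, Pi.smul_apply, smul_eq_mul] at h3
    simp only [Matrix.mul_apply, hρ', A, h, Matrix.of_apply]
    rw [e.sum_comp (fun k => ρ g (e i) k * (bW j : κ → ℂ) k)]
    refine Eq.trans h3.symm (Finset.sum_congr rfl fun _ _ => mul_comm _ _)
  obtain ⟨B, B', h1, h2, h3⟩ := exists_extend A hA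
  let ρ'' : G →* Matrix (Fin r ⊕ Fin (Fintype.card κ - r)) (Fin r ⊕ Fin (Fintype.card κ - r)) ℂ :=
    { toFun := fun g => B' * ρ' g * B
      map_one' := by rw [map_one, Matrix.mul_one, h2]
      map_mul' := fun x y => by
        rw [map_mul]
        calc B' * (ρ' x * ρ' y) * B = B' * ρ' x * 1 * ρ' y * B := by simp only [Matrix.mul_assoc, Matrix.one_mul]
          _ = _ := by rw [← h1]; simp only [Matrix.mul_assoc] }
  obtain ⟨ρ1, ρ2, h12⟩ := tri_split ρ'' (fun g => by
    have := block_form A h2 h3 (ρ' g) (h g) (hgA g)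
    change (B' * ρ' g * B).toBlocks₂₁ = 0
    rw [this]; simp)
  refine ⟨r, Fintype.card κ - r, hrm, by omega, ρ1, ρ2, fun g => ?_⟩
  rw [← h12]
  change _ = (B' * ρ' g * B).trace
  rw [trace_conj' h1]
  simp only [Matrix.trace, Matrix.diag_apply, hρ']
  exact (e.sum_comp (fun i => (ρ g) i i)).symm

/-- existence of an irreducible constituent pairing non trivially with `R` -/
lemma exists_irr (R : G → ℂ) (hR1 : R 1 ≠ 0) : ∃ (m : ℕ) (ρ : G →* Matrix (Fin m) (Fin m) ℂ),
    ∑ g, R g * (ρ g).trace ≠ 0 ∧ ∀ T, (∀ g, T * ρ g = ρ g * T) → ∃ c : ℂ, T = c • 1 := by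
  classical
  let P : ℕ → Prop := fun m => ∃ ρ : G →* Matrix (Fin m) (Fin m) ℂ, ∑ g, R g * (ρ g).trace ≠ 0
  have hP : ∃ m, P m := by
    let e := Fintype.equivFin G
    refine ⟨Fintype.card G, { toFun := fun g => Matrix.of fun i j => if e.symm i = g * e.symm j then 1 else 0, map_one' := ?_, map_mul' := ?_ }, ?_⟩
    · ext i j
      simp [Matrix.one_apply]
    · intro x y
      ext i j
      simp only [Matrix.of_apply, Matrix.mul_apply]
      rw [← e.sum_comp]
      simp only [Equiv.symm_apply_apply, mul_ite, mul_one, mul_zero, Finset.sum_ite_eq', Finset.mem_univ, if_true]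
      simp [mul_assoc]
    · simp only [Matrix.trace, Matrix.diag_apply, MonoidHom.coe_mk, OneHom.coe_mk, Matrix.of_apply]
      rw [Finset.sum_eq_single 1]
      · simp [hR1]
      · intro g _ hg
        rw [Finset.sum_eq_zero, mul_zero]
        intro i _
        rw [if_neg]
        intro h
        exact hg (by simpa using h)
      · simp
  obtain ⟨m, ⟨ρ, hρ⟩, hmin⟩ : ∃ m, P m ∧ ∀ k, k < m → ¬ P k :=
    ⟨Nat.find hP, Nat.find_spec hP, fun k hk => Nat.find_min hP hk⟩
  refine ⟨m, ρ, hρ, ?_⟩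
  intro T hT
  have hm0 : m ≠ 0 := by
    intro h0
    apply hρ
    have : IsEmpty (Fin m) := by rw [h0]; infer_instance
    simp [Matrix.trace]
  obtain ⟨lam, hlam⟩ : ∃ lam, T.charpoly.IsRoot lam := by
    apply IsAlgClosed.exists_root
    rw [Matrix.charpoly_degree_eq_dim]
    simpa using hm0
  have hdet : (Matrix.scalar _ lam - T).det = 0 := by rw [← Matrix.eval_charpoly]; exact hlam
  obtain ⟨v, hv0, hv⟩ := Matrix.exists_mulVec_eq_zero_iff.mpr hdet
  refine ⟨lam, ?_⟩
  by_contra hne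
  let W : Submodule ℂ (Fin m → ℂ) := LinearMap.ker (Matrix.toLin' (Matrix.scalar _ lam - T))
  have hWm : ∀ w, w ∈ W ↔ (Matrix.scalar _ lam - T).mulVec w = 0 := fun w => by
    rw [LinearMap.mem_ker, Matrix.toLin'_apply]
  obtain ⟨r1, r2, hr1, hr2, ρ1, ρ2, h12⟩ := sub_split ρ W (by
      intro g w hw
      rw [hWm] at hw ⊢
      have : (Matrix.scalar _ lam - T) * ρ g = ρ g * (Matrix.scalar _ lam - T) := by
        rw [sub_mul, mul_sub, hT, (Matrix.scalar_commute lam (fun r => mul_comm _ _) (ρ g)).eq]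
      rw [Matrix.mulVec_mulVec, this, ← Matrix.mulVec_mulVec, hw, Matrix.mulVec_zero])
    (by
      intro h
      apply hv0
      have : v ∈ W := (hWm v).mpr hv
      rw [h] at this
      simpa using this)
    (by
      intro h
      apply hne
      have : Matrix.toLin' (Matrix.scalar _ lam - T) = 0 := LinearMap.ker_eq_top.mp h
      have h2 : Matrix.scalar _ lam - T = 0 := Matrix.toLin'.injective (by rw [this, map_zero])
      rw [← sub_eq_zero.mp h2]
      ext i j; simp [Matrix.one_apply, Matrix.diagonal_apply])
  rw [Fintype.card_fin] at hr1 hr2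
  have e1 : ∑ g, R g * (ρ1 g).trace = 0 := by
    by_contra h; exact hmin r1 hr1 ⟨ρ1, h⟩
  have e2 : ∑ g, R g * (ρ2 g).trace = 0 := by
    by_contra h; exact hmin r2 hr2 ⟨ρ2, h⟩
  apply hρ
  simp only [h12, mul_add, Finset.sum_add_distrib, e1, e2, add_zero]

lemma schur_norm (ρ : G →* Matrix κ κ ℂ) (hκ : Nonempty κ)
    (hs : ∀ T, (∀ g, T * ρ g = ρ g * T) → ∃ c : ℂ, T = c • 1) :
    ∑ g, (ρ g).trace * (ρ g⁻¹).trace = Fintype.card G := by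
  classical
  have key : ∀ a b i j, ∑ g, ρ g i a * ρ g⁻¹ b j = if i = j ∧ a = b then (Fintype.card G : ℂ) / Fintype.card κ else 0 := by
    intro a b
    let X : Matrix κ κ ℂ := Matrix.single a b 1
    obtain ⟨c, hc⟩ := hs (∑ g, ρ g * X * ρ g⁻¹) (by
      intro h
      rw [Finset.sum_mul, Finset.mul_sum]
      rw [← Equiv.sum_comp (Equiv.mulLeft h)]
      refine Finset.sum_congr rfl fun g _ => ?_
      simp only [Equiv.coe_mulLeft, mul_inv_rev, map_mul, mul_assoc]
      congr 4
      rw [← map_mul]; simp)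
    have hij : ∀ i j, ∑ g, ρ g i a * ρ g⁻¹ b j = (c • (1 : Matrix κ κ ℂ)) i j := by
      intro i j
      rw [← hc, Matrix.sum_apply]
      refine Finset.sum_congr rfl fun g _ => ?_
      rw [Matrix.mul_apply, Finset.sum_eq_single b]
      · congr 1
        simp [X, Matrix.mul_apply, Matrix.single_apply]
      · intro k _ hk
        simp [X, Matrix.mul_apply, Matrix.single_apply, hk.symm]
      · simp
    have htr := congrArg Matrix.trace hc
    rw [Matrix.trace_sum, Matrix.trace_smul, Matrix.trace_one] at htr
    have : ∀ g, (ρ g * X * ρ g⁻¹).trace = if a = b then 1 else 0 := by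
      intro g
      rw [Matrix.trace_mul_comm, ← mul_assoc, ← map_mul]
      simp only [inv_mul_cancel, map_one, one_mul, X]
      by_cases hab : a = b
      · subst hab; simp
      · simp [hab]
    simp only [this, Finset.sum_const, Finset.card_univ, nsmul_eq_mul, smul_eq_mul] at htr
    have hne : (Fintype.card κ : ℂ) ≠ 0 := by exact_mod_cast Fintype.card_ne_zero
    have hc' : c = if a = b then (Fintype.card G : ℂ) / Fintype.card κ else 0 := by
      rw [eq_div_of_mul_eq hne htr.symm]
      split_ifs <;> simp
    intro i j
    rw [hij, hc']
    by_cases h1 : i = j <;> by_cases h2 : a = b <;> simp [h1, h2, Matrix.one_apply]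
  simp only [Matrix.trace, Matrix.diag_apply, Finset.sum_mul_sum]
  rw [Finset.sum_comm]
  have hne : (Fintype.card κ : ℂ) ≠ 0 := by exact_mod_cast Fintype.card_ne_zero
  calc _ = ∑ i, ∑ j, ∑ g, ρ g i i * ρ g⁻¹ j j := Finset.sum_congr rfl fun i _ => Finset.sum_comm
    _ = ∑ i : κ, ∑ j : κ, if i = j then (Fintype.card G : ℂ) / Fintype.card κ else 0 := by
      refine Finset.sum_congr rfl fun i _ => Finset.sum_congr rfl fun j _ => ?_
      rw [key]; simp
    _ = _ := by simp; field_simp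

end MK

end

section
open scoped BigOperators
namespace MK

variable {κ : Type} [Fintype κ] [DecidableEq κ]
variable {G : Type} [Group G] [Fintype G]

lemma CypI_conj (N : ℕ) (hN : 1 ≤ N) (p : ℂ × ℂ) (hp : p ∈ CypI N) : p.2 = (starRingEnd ℂ) p.1 := by
  induction hp using AddSubgroup.closure_induction with
  | mem p hp =>
    obtain ⟨h1, h2⟩ := hp
    rw [h2]
    have := Complex.norm_eq_one_of_pow_eq_one h1 (by omega)
    exact Complex.inv_eq_conj this
  | zero => simp
  | add x y _ _ hx hy => simp [hx, hy]
  | neg x _ hx => simp [hx]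

lemma cs_bound {ι : Type} [Fintype ι] (a c : ι → ℂ) (M : ℝ) (ha : ∑ g, ‖a g‖ ^ 2 = M) (hc : ∑ g, ‖c g‖ ^ 2 = M) :
    ‖∑ g, a g * c g‖ ≤ M := by
  have h1 : ‖∑ g, a g * c g‖ ≤ ∑ g, ‖a g‖ * ‖c g‖ := by
    refine (norm_sum_le _ _).trans (le_of_eq ?_)
    simp
  have h2 : ∑ g, ‖a g‖ * ‖c g‖ ≤ ∑ g, (‖a g‖ ^ 2 + ‖c g‖ ^ 2) / 2 := by
    refine Finset.sum_le_sum fun g _ => ?_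
    nlinarith [sq_nonneg (‖a g‖ - ‖c g‖)]
  rw [← Finset.sum_div, Finset.sum_add_distrib, ha, hc] at h2
  linarith

lemma sum_conj_norm {ι : Type} [Fintype ι] (a : ι → ℂ) (M : ℝ) (h : ∑ g, a g * (starRingEnd ℂ) (a g) = M) :
    ∑ g, ‖a g‖ ^ 2 = M := by
  have : ((∑ g, ‖a g‖ ^ 2 : ℝ) : ℂ) = M := by
    rw [← h]; push_cast
    exact Finset.sum_congr rfl fun g _ => (Complex.mul_conj' _).symm
  exact_mod_cast this

theorem abstract_core (N : ℕ) (hN : 1 ≤ N) (hG : ∀ g : G, g ^ N = 1) (R : G → ℂ)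
    (hR : ∀ g, (R g, (starRingEnd ℂ) (R g)) ∈ CypI N) (hR1 : R 1 ≠ 0)
    (hnorm : ∑ g, R g * (starRingEnd ℂ) (R g) = Fintype.card G)
    (hInt : ∀ (m : ℕ) (ρ : G →* Matrix (Fin m) (Fin m) ℂ), IsIntegral ℤ ((∑ g, R g * (ρ g).trace) / Fintype.card G))
    (f : G → ℂ) (hf : ∀ x y, f (x * y) = f (y * x)) :
    ∃ c : ℂ, ∀ y, ∑ x, f x * R (x⁻¹ * y) = c * R y := by
  obtain ⟨m, ρ, hρ, hs⟩ := exists_irr R hR1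
  have hm : Nonempty (Fin m) := by
    by_contra h
    rw [not_nonempty_iff] at h
    exact hρ (by simp [Matrix.trace])
  have hχn := schur_norm ρ hm hs
  have hχc : ∀ g, (ρ g⁻¹).trace = (starRingEnd ℂ) (ρ g).trace := fun g => CypI_conj N hN _ (char_CypI N hN hG ρ g)
  have hGne : (Fintype.card G : ℂ) ≠ 0 := by exact_mod_cast Fintype.card_ne_zero
  obtain ⟨K, _, _, i, hi⟩ := CypI_lift N hN
  choose a b hia hab using fun g => hi _ (hR g)
  choose c d hic hcd using fun g => hi _ (char_CypI N hN hG ρ g)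
  simp only at hia hic
  have hii : Function.Injective i := i.injective
  have sab : ∑ g, a g * b g = Fintype.card G := by
    apply hii
    rw [map_sum, map_natCast, ← hnorm]
    exact Finset.sum_congr rfl fun g _ => by rw [map_mul, hab, hia]
  have scd : ∑ g, c g * d g = Fintype.card G := by
    apply hii
    rw [map_sum, map_natCast, ← hχn]
    exact Finset.sum_congr rfl fun g _ => by rw [map_mul, hcd, hic, hχc]
  set W : K := (∑ g, a g * c g) / Fintype.card G with hW
  set w : ℂ := (∑ g, R g * (ρ g).trace) / Fintype.card G with hw
  have hiW : i W = w := by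
    rw [hW, hw, map_div₀, map_sum, map_natCast]
    congr 1
    exact Finset.sum_congr rfl fun g _ => by rw [map_mul, hia, hic]
  have hw0 : w ≠ 0 := div_ne_zero hρ hGne
  have hW0 : W ≠ 0 := by
    intro h; apply hw0; rw [← hiW, h, map_zero]
  have hWi : IsIntegral ℤ W := by
    have := hInt m ρ
    rw [← hw, ← hiW] at this
    exact (isIntegral_algHom_iff (i.toIntAlgHom) hii).mp this
  have hWb : ∀ φ : K →+* ℂ, ‖φ W‖ ≤ 1 := by
    intro φ
    have ha : ∑ g, ‖φ (a g)‖ ^ 2 = (Fintype.card G : ℝ) := by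
      apply sum_conj_norm
      have := congrArg φ sab
      rw [map_sum, map_natCast] at this
      push_cast
      rw [← this]
      exact Finset.sum_congr rfl fun g _ => by rw [map_mul, hab]
    have hc : ∑ g, ‖φ (c g)‖ ^ 2 = (Fintype.card G : ℝ) := by
      apply sum_conj_norm
      have := congrArg φ scd
      rw [map_sum, map_natCast] at this
      push_cast
      rw [← this]
      exact Finset.sum_congr rfl fun g _ => by rw [map_mul, hcd]
    have h3 := cs_bound _ _ _ ha hc
    have hpos : (0 : ℝ) < Fintype.card G := by exact_mod_cast Fintype.card_pos
    rw [hW, map_div₀, map_sum, map_natCast, norm_div, Complex.norm_natCast, div_le_one hpos]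
    simpa using h3
  obtain ⟨n, hn, hWn⟩ := NumberField.Embeddings.pow_eq_one_of_norm_le_one K ℂ hW0 hWi hWb
  have hwn : ‖w‖ = 1 := by
    apply Complex.norm_eq_one_of_pow_eq_one (n := n)
    · rw [← hiW, ← map_pow, hWn, map_one]
    · omega
  have hww : w * (starRingEnd ℂ) w = 1 := by rw [Complex.mul_conj', hwn]; simp
  have hz : ∑ g, (R g - w * (starRingEnd ℂ) (ρ g).trace) * (starRingEnd ℂ) (R g - w * (starRingEnd ℂ) (ρ g).trace) = (0 : ℝ) := by
    have e1 : ∑ g, R g * (ρ g).trace = w * Fintype.card G := by rw [hw]; field_simp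
    have e2 : ∑ g, (starRingEnd ℂ) (R g) * (starRingEnd ℂ) (ρ g).trace = (starRingEnd ℂ) w * Fintype.card G := by
      have := congrArg (starRingEnd ℂ) e1
      simpa using this
    have e3 : ∑ g, (ρ g).trace * (starRingEnd ℂ) (ρ g).trace = Fintype.card G := by
      rw [← hχn]; exact Finset.sum_congr rfl fun g _ => by rw [hχc]
    calc _ = ∑ g, (R g * (starRingEnd ℂ) (R g) - (starRingEnd ℂ) w * (R g * (ρ g).trace)
          - w * ((starRingEnd ℂ) (R g) * (starRingEnd ℂ) (ρ g).trace)
          + w * (starRingEnd ℂ) w * ((ρ g).trace * (starRingEnd ℂ) (ρ g).trace)) := by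
          refine Finset.sum_congr rfl fun g _ => ?_
          simp only [map_sub, map_mul, Complex.conj_conj]
          ring
      _ = 0 := by
        rw [Finset.sum_add_distrib, Finset.sum_sub_distrib, Finset.sum_sub_distrib, ← Finset.mul_sum, ← Finset.mul_sum, ← Finset.mul_sum,
          hnorm, e1, e2, e3]
        linear_combination (-Fintype.card G : ℂ) * hww
      _ = _ := by simp
  have hz2 := sum_conj_norm _ _ hz
  have hRχ : ∀ g, R g = w * (ρ g⁻¹).trace := by
    intro g
    have := (Finset.sum_eq_zero_iff_of_nonneg (fun g _ => sq_nonneg _)).mp hz2 g (Finset.mem_univ _)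
    have h3 : R g - w * (starRingEnd ℂ) (ρ g).trace = 0 := by
      rw [← norm_eq_zero]; exact pow_eq_zero_iff (two_ne_zero) |>.mp this
    rw [hχc]; exact sub_eq_zero.mp h3
  obtain ⟨k, hk⟩ := hs (∑ x, f x • ρ x) (by
    intro g
    rw [Finset.sum_mul, Finset.mul_sum]
    refine Finset.sum_bij' (fun x _ => g⁻¹ * x * g) (fun x _ => g * x * g⁻¹) (by simp) (by simp) (by intro x _; group) (by intro x _; group) ?_
    intro x _
    rw [smul_mul_assoc, mul_smul_comm, ← map_mul, ← map_mul]
    have h1 : f (g⁻¹ * x * g) = f x := by rw [hf]; congr 1; group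
    rw [h1]; congr 2; group)
  refine ⟨k, fun y => ?_⟩
  have h1 : ∀ x, R (x⁻¹ * y) = w * (ρ y⁻¹ * ρ x).trace := by
    intro x; rw [hRχ, ← map_mul]; congr 3; group
  calc ∑ x, f x * R (x⁻¹ * y) = w * (ρ y⁻¹ * ∑ x, f x • ρ x).trace := by
        rw [Finset.mul_sum, Matrix.trace_sum, Finset.mul_sum]
        refine Finset.sum_congr rfl fun x _ => ?_
        rw [h1, mul_smul_comm, Matrix.trace_smul, smul_eq_mul]; ring
    _ = k * R y := by
      rw [hk, mul_smul_comm, mul_one, Matrix.trace_smul, hRχ, smul_eq_mul]; ring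

end MK

end

section
open scoped BigOperators
namespace MK

variable {F : Type} [Field F] [Fintype F] [DecidableEq F]
variable {ι μ δ ν κ : Type} [Fintype ι] [Fintype μ] [Fintype δ] [Fintype ν] [Fintype κ]
  [DecidableEq ι] [DecidableEq μ] [DecidableEq δ] [DecidableEq ν] [DecidableEq κ]

open Classical in
/-- indicator of primary elements -/
noncomputable def prm (c : Matrix δ δ F) (g : Matrix ι ι F) : ℂ := if prim c g then 1 else 0

/-- admissible pair -/
def okP (r : Matrix ι ι F →* Matrix κ κ ℂ) (B : Matrix κ κ ℂ) : Prop :=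
  (∀ x x', x * x' = 1 → r x * B = B * r x) ∧ ∃ m, 1 ≤ m ∧ B ^ (m + 1) = B

noncomputable def W7 (c : Matrix δ δ F) (r : Matrix ι ι F →* Matrix κ κ ℂ) (B : Matrix κ κ ℂ) : ℂ :=
  (∑ g, prm c g * (r g * B).trace) / glc (Fintype.card F) (Fintype.card ι)

lemma prm_CI (c : Matrix δ δ F) {B B' g : Matrix ι ι F} (h1 : B * B' = 1) : prm c (B' * g * B) = prm c g := by
  have e1 : prim c (B' * g * B) ↔ prim c g := by unfold prim; rw [charpoly_conj h1]
  unfold prm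
  by_cases h : prim c g
  · rw [if_pos h, if_pos (e1.mpr h)]
  · rw [if_neg h, if_neg (fun h' => h (e1.mp h'))]

lemma finite_order (h h' : Matrix μ μ F) (hh : h * h' = 1) : ∃ M, 1 ≤ M ∧ h ^ M = 1 := by
  let u : (Matrix μ μ F)ˣ := ⟨h, h', hh, by exact mul_eq_one_comm.mp ‹_›⟩
  refine ⟨orderOf u, orderOf_pos u, ?_⟩
  have := congrArg Units.val (pow_orderOf_eq_one u)
  rw [Units.val_pow_eq_pow_val] at this
  exact this

lemma W7_step {c : Matrix δ δ F} (hc : Irreducible c.charpoly) (j : ℕ) (h' : Matrix (Pw δ j) (Pw δ j) F)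
    (hh : hz c j * h' = 1) (e : Pw δ j ⊕ ν ≃ ι)
    (r : Matrix ι ι F →* Matrix κ κ ℂ) (B : Matrix κ κ ℂ) (hok : okP r B) :
    ∃ (r' : Matrix ν ν F →* Matrix κ κ ℂ) (B' : Matrix κ κ ℂ), okP r' B' ∧
      (∑ g, prm c g * (r g * B).trace * (Fr (hz c j) g : ℂ)) / glc (Fintype.card F) (Fintype.card ι) = W7 c r' B' := by
  set h := hz c j with hhdef
  let rr : Matrix (Pw δ j ⊕ ν) (Pw δ j ⊕ ν) F →* Matrix κ κ ℂ :=
    r.comp ((Matrix.reindexAlgEquiv F F e : _ ≃ₐ[F] _) : _ →* _)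
  have hrr : ∀ x, rr x = r (Matrix.reindex e e x) := fun x => rfl
  obtain ⟨hcomm, m, hm1, hBm⟩ := hok
  have hcom : ∀ x x', x * x' = 1 → rr x * B = B * rr x := by
    intro x x' hx
    apply hcomm _ (Matrix.reindex e e x')
    have := congrArg (Matrix.reindexAlgEquiv F F e) hx
    rw [map_mul, map_one] at this
    exact this
  have hh' : h' * h = 1 := by exact mul_eq_one_comm.mp ‹_›
  let U : Matrix (Pw δ j) ν F → Matrix κ κ ℂ := fun u => rr (Matrix.fromBlocks 1 u 0 1)
  have hU : ∀ u v, U u * U v = U (u + v) := by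
    intro u v
    simp only [U]
    rw [← map_mul, Matrix.fromBlocks_multiply]
    congr 1
    simp [add_comm]
  set qq : ℂ := (Fintype.card F : ℂ) ^ (Fintype.card (Pw δ j) * Fintype.card ν) with hqq
  have hcard : (Fintype.card (Matrix (Pw δ j) ν F) : ℂ) = qq := by
    have : Fintype.card (Matrix (Pw δ j) ν F) = Fintype.card F ^ (Fintype.card (Pw δ j) * Fintype.card ν) := by
      rw [← Nat.card_eq_fintype_card]; unfold Matrix
      simp [Nat.card_eq_fintype_card, ← pow_mul, mul_comm]
    rw [this, hqq]; push_cast; rfl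
  have hqq0 : qq ≠ 0 := by rw [← hcard]; exact_mod_cast Fintype.card_ne_zero
  let eU : Matrix κ κ ℂ := qq⁻¹ • ∑ u, U u
  have hUe : ∀ u, U u * eU = eU := by
    intro u
    simp only [eU]
    rw [mul_smul_comm, Finset.mul_sum, ← Equiv.sum_comp (Equiv.addLeft u) U]
    congr 1
    exact Finset.sum_congr rfl fun v _ => hU u v
  have hee : eU * eU = eU := by
    conv_lhs => rw [show eU = qq⁻¹ • ∑ u, U u from rfl, smul_mul_assoc, Finset.sum_mul]
    have : ∀ u, U u * (qq⁻¹ • ∑ u, U u) = eU := hUe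
    simp only [this, Finset.sum_const, Finset.card_univ, ← Nat.cast_smul_eq_nsmul ℂ, hcard, smul_smul]
    rw [inv_mul_cancel₀ hqq0, one_smul]
  let r' : Matrix ν ν F →* Matrix κ κ ℂ :=
    { toFun := fun x => rr (Matrix.fromBlocks 1 0 0 x)
      map_one' := by rw [Matrix.fromBlocks_one, map_one]
      map_mul' := fun x y => by rw [← map_mul, Matrix.fromBlocks_multiply]; simp }
  let dh := rr (Matrix.fromBlocks h 0 0 1)
  have hdhe : dh * eU = eU * dh := by
    simp only [eU]
    rw [mul_smul_comm, smul_mul_assoc, Finset.mul_sum, Finset.sum_mul]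
    congr 1
    refine Finset.sum_bij' (fun u _ => h * u) (fun u _ => h' * u) (by simp) (by simp)
      (by intro u _; rw [← Matrix.mul_assoc, hh', Matrix.one_mul]) (by intro u _; rw [← Matrix.mul_assoc, hh, Matrix.one_mul]) ?_
    intro u _
    simp only [dh, U]
    rw [← map_mul, ← map_mul, Matrix.fromBlocks_multiply, Matrix.fromBlocks_multiply]
    simp
  have hre : ∀ x x', x * x' = 1 → r' x * eU = eU * r' x := by
    intro x x' hx
    have hx' : x' * x = 1 := by exact mul_eq_one_comm.mp ‹_›
    simp only [eU]
    rw [mul_smul_comm, smul_mul_assoc, Finset.mul_sum, Finset.sum_mul]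
    congr 1
    refine Finset.sum_bij' (fun u _ => u * x') (fun u _ => u * x) (by simp) (by simp)
      (by intro u _; rw [Matrix.mul_assoc, hx', Matrix.mul_one]) (by intro u _; rw [Matrix.mul_assoc, hx, Matrix.mul_one]) ?_
    intro u _
    change rr (Matrix.fromBlocks 1 0 0 x) * rr _ = rr _ * rr (Matrix.fromBlocks 1 0 0 x)
    rw [← map_mul, ← map_mul, Matrix.fromBlocks_multiply, Matrix.fromBlocks_multiply]
    simp [Matrix.mul_assoc, hx']
  have hrd : ∀ x, r' x * dh = dh * r' x := by
    intro x
    change rr (Matrix.fromBlocks 1 0 0 x) * rr _ = rr _ * rr (Matrix.fromBlocks 1 0 0 x)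
    rw [← map_mul, ← map_mul, Matrix.fromBlocks_multiply, Matrix.fromBlocks_multiply]
    simp
  have hBU : ∀ u, U u * B = B * U u := by
    intro u
    apply hcom _ (Matrix.fromBlocks 1 (-u) 0 1)
    rw [Matrix.fromBlocks_multiply]; simp
  have hBe : eU * B = B * eU := by
    simp only [eU]
    rw [mul_smul_comm, smul_mul_assoc, Finset.mul_sum, Finset.sum_mul]
    congr 1
    exact Finset.sum_congr rfl fun u _ => hBU u
  have hBd : dh * B = B * dh := by
    apply hcom _ (Matrix.fromBlocks h' 0 0 1)
    rw [Matrix.fromBlocks_multiply]; simp [hh]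
  have hBr : ∀ x x', x * x' = 1 → r' x * B = B * r' x := by
    intro x x' hx
    apply hcom _ (Matrix.fromBlocks 1 0 0 x')
    rw [Matrix.fromBlocks_multiply]; simp [hx]
  refine ⟨r', dh * eU * B, ⟨?_, ?_⟩, ?_⟩
  · intro x x' hx
    have c1 : Commute (r' x) dh := hrd x
    have c2 : Commute (r' x) eU := hre x x' hx
    have c3 : Commute (r' x) B := hBr x x' hx
    exact (c1.mul_right c2).mul_right c3
  · obtain ⟨M, hM1, hM⟩ := finite_order h h' hh
    refine ⟨m * M, Nat.mul_pos hm1 hM1, ?_⟩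
    have c1 : Commute dh eU := hdhe
    have c2 : Commute (dh * eU) B := Commute.mul_left hBd hBe
    rw [c2.mul_pow, c1.mul_pow]
    have e1 : dh ^ (m * M + 1) = dh := by
      have : dh ^ M = 1 := by
        simp only [dh]
        rw [← map_pow]
        have : ∀ k, (Matrix.fromBlocks h 0 0 1 : Matrix (Pw δ j ⊕ ν) (Pw δ j ⊕ ν) F) ^ k = Matrix.fromBlocks (h ^ k) 0 0 1 := by
          intro k
          induction k with
          | zero => simp
          | succ k ih => rw [pow_succ, ih, Matrix.fromBlocks_multiply]; simp [pow_succ]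
        rw [this, hM, Matrix.fromBlocks_one, map_one]
      rw [pow_succ, mul_comm m M, pow_mul, this, one_pow, one_mul]
    have e2 : ∀ k, eU ^ (k + 1) = eU := by
      intro k
      induction k with
      | zero => simp
      | succ k ih => rw [pow_succ, ih, hee]
    have e3 : ∀ k, B ^ (m * k + 1) = B := by
      intro k
      induction k with
      | zero => simp
      | succ k ih =>
        rw [show m * (k + 1) + 1 = (m * k + 1) + m by ring, pow_add, ih, ← pow_succ', hBm]
    rw [e1, e2, e3]
  · rw [L3' (fun g => prm c g * (r g * B).trace) (by
      intro b b' g h1 h2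
      show prm c (b' * g * b) * (r (b' * g * b) * B).trace = prm c g * (r g * B).trace
      rw [prm_CI c h1]
      congr 1
      calc (r (b' * g * b) * B).trace = (r b' * r g * (r b * B)).trace := by
            rw [map_mul, map_mul, Matrix.mul_assoc]
        _ = (r b' * r g * B * r b).trace := by rw [hcomm b b' h1, ← Matrix.mul_assoc]
        _ = (r b * r b' * r g * B).trace := by rw [Matrix.trace_mul_comm]; simp only [Matrix.mul_assoc]
        _ = _ := by rw [← map_mul, h1, map_one, Matrix.one_mul]) h e]
    have hG := glc_ne (two_le_card (F := F)) (Fintype.card ι)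
    have hG' := glc_ne (two_le_card (F := F)) (Fintype.card ν)
    have key : ∀ (u : Matrix (Pw δ j) ν F) (x : Matrix ν ν F), prm c (Matrix.reindex e e (Matrix.fromBlocks h u 0 x)) * (r (Matrix.reindex e e (Matrix.fromBlocks h u 0 x)) * B).trace
        = prm c x * (r' x * dh * U (h' * u) * B).trace := by
      intro u x
      have h1 : prm c (Matrix.reindex e e (Matrix.fromBlocks h u 0 x)) = prm c x := by
        have e1 : prim c (Matrix.reindex e e (Matrix.fromBlocks h u 0 x)) ↔ prim c x := by
          rw [prim_reindex, prim_block hc]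
        unfold prm
        by_cases hp : prim c x
        · rw [if_pos hp, if_pos (e1.mpr hp)]
        · rw [if_neg hp, if_neg (fun h' => hp (e1.mp h'))]
      rw [h1, ← hrr]
      congr 3
      change _ = rr (Matrix.fromBlocks 1 0 0 x) * rr _ * rr _
      rw [← map_mul, ← map_mul, Matrix.fromBlocks_multiply, Matrix.fromBlocks_multiply]
      congr 1
      simp only [Matrix.mul_one, Matrix.one_mul, Matrix.mul_zero, Matrix.zero_mul, add_zero, zero_add]
      rw [← Matrix.mul_assoc, hh, Matrix.one_mul]
    simp only [key]
    rw [Finset.sum_comm]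
    have key2 : ∀ x : Matrix ν ν F, ∑ u : Matrix (Pw δ j) ν F, prm c x * (r' x * dh * U (h' * u) * B).trace = prm c x * (qq * (r' x * (dh * eU * B)).trace) := by
      intro x
      have e1 : ∑ u : Matrix (Pw δ j) ν F, U (h' * u) = qq • eU := by
        simp only [eU]
        rw [smul_smul, mul_inv_cancel₀ hqq0, one_smul]
        exact Finset.sum_bij' (fun u _ => h' * u) (fun u _ => h * u) (by simp) (by simp)
          (by intro u _; rw [← Matrix.mul_assoc, hh, Matrix.one_mul]) (by intro u _; rw [← Matrix.mul_assoc, hh', Matrix.one_mul]) (by simp)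
      rw [← Finset.mul_sum, ← Matrix.trace_sum, ← Finset.sum_mul, ← Finset.mul_sum, e1]
      rw [mul_smul_comm, smul_mul_assoc, Matrix.trace_smul, smul_eq_mul]
      simp only [Matrix.mul_assoc]
    simp only [key2]
    unfold W7
    have e3 : ∑ x, prm c x * (qq * (r' x * (dh * eU * B)).trace) = qq * ∑ x, prm c x * (r' x * (dh * eU * B)).trace := by
      rw [Finset.mul_sum]; exact Finset.sum_congr rfl fun x _ => by ring
    rw [e3, ← hqq]
    generalize (∑ x, prm c x * (r' x * (dh * eU * B)).trace) = S
    generalize glc (Fintype.card F : ℂ) (Fintype.card ι) = x1 at *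
    generalize glc (Fintype.card F : ℂ) (Fintype.card ν) = x2 at *
    clear_value qq
    field_simp

end MK

end

section
open scoped BigOperators
namespace MK

variable {F : Type} [Field F] [Fintype F] [DecidableEq F]
variable {ι μ δ ν κ : Type} [Fintype ι] [Fintype μ] [Fintype δ] [Fintype ν] [Fintype κ]
  [DecidableEq ι] [DecidableEq μ] [DecidableEq δ] [DecidableEq ν] [DecidableEq κ]

/-- integral away from divisors prime to `q` -/
def pInt (q : ℕ) (z : ℂ) : Prop := ∃ D : ℕ, D.Coprime q ∧ IsIntegral ℤ ((D : ℂ) * z)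

lemma isIntegral_natCast' (n : ℕ) : IsIntegral ℤ (n : ℂ) := by
  have := isIntegral_algebraMap (R := ℤ) (A := ℂ) (x := (n : ℤ))
  simpa using this

lemma pInt.of_int {q : ℕ} {z : ℂ} (h : IsIntegral ℤ z) : pInt q z := ⟨1, by simp, by simpa using h⟩

lemma pInt.add {q : ℕ} {z w : ℂ} (h : pInt q z) (h' : pInt q w) : pInt q (z + w) := by
  obtain ⟨D, hD, hz⟩ := h
  obtain ⟨D', hD', hw⟩ := h'
  refine ⟨D * D', Nat.Coprime.mul_left hD hD', ?_⟩
  have : ((D * D' : ℕ) : ℂ) * (z + w) = D' * (D * z) + D * (D' * w) := by push_cast; ring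
  rw [this]
  exact ((isIntegral_natCast' _).mul hz).add ((isIntegral_natCast' _).mul hw)

lemma pInt.mul_int {q : ℕ} {z w : ℂ} (h : pInt q z) (h' : IsIntegral ℤ w) : pInt q (w * z) := by
  obtain ⟨D, hD, hz⟩ := h
  refine ⟨D, hD, ?_⟩
  have : (D : ℂ) * (w * z) = w * (D * z) := by ring
  rw [this]
  exact h'.mul hz

lemma pInt.neg {q : ℕ} {z : ℂ} (h : pInt q z) : pInt q (-z) := by
  have := h.mul_int (w := -1) (isIntegral_one.neg)
  simpa using this

lemma pInt.sum {q : ℕ} {α : Type} (s : Finset α) (f : α → ℂ) (h : ∀ a ∈ s, pInt q (f a)) : pInt q (∑ a ∈ s, f a) := by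
  classical
  induction s using Finset.induction_on with
  | empty => simpa using pInt.of_int (q := q) isIntegral_zero
  | insert a s ha ih =>
    rw [Finset.sum_insert ha]
    exact (h a (by simp)).add (ih fun b hb => h b (by simp [hb]))

lemma pInt.qe {q d j : ℕ} (hd : 1 ≤ d) (hq : 2 ≤ q) {z : ℂ} (h : pInt q z) : pInt q (qe ((q ^ d : ℕ) : ℂ) j * z) := by
  induction j with
  | zero => simpa [MK.qe] using h
  | succ j ih =>
    obtain ⟨D, hD, hz⟩ := ih
    have hle : 1 ≤ q ^ (d * (j + 1)) := Nat.one_le_pow _ _ (by omega)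
    refine ⟨D * (q ^ (d * (j + 1)) - 1), Nat.Coprime.mul_left hD ?_, ?_⟩
    · have h1 : 1 ≤ d * (j + 1) := Nat.mul_pos hd (by omega)
      have h2 : q ∣ q ^ (d * (j + 1)) := dvd_pow_self _ (by omega)
      rw [Nat.coprime_iff_gcd_eq_one]
      have h3 := Nat.gcd_dvd_left (q ^ (d * (j + 1)) - 1) q
      have h4 := (Nat.gcd_dvd_right (q ^ (d * (j + 1)) - 1) q).trans h2
      have h5 := (Nat.dvd_sub h4 h3)
      rw [Nat.sub_sub_self hle] at h5
      exact Nat.dvd_one.mp h5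
    · have hne := one_sub_pow_ne (Q := q ^ d) (by
        calc 2 ≤ q := hq
          _ = q ^ 1 := (pow_one _).symm
          _ ≤ _ := Nat.pow_le_pow_right (by omega) hd) j
      have e : ((D * (q ^ (d * (j + 1)) - 1) : ℕ) : ℂ) * (MK.qe ((q ^ d : ℕ) : ℂ) (j + 1) * z)
          = - (D * (MK.qe ((q ^ d : ℕ) : ℂ) j * z)) := by
        have : MK.qe ((q ^ d : ℕ) : ℂ) (j + 1) = MK.qe ((q ^ d : ℕ) : ℂ) j * (1 - ((q ^ d : ℕ) : ℂ) ^ (j + 1))⁻¹ := by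
          unfold MK.qe; rw [Finset.prod_range_succ]
        rw [this]
        push_cast [hle]
        push_cast at hne
        rw [pow_mul]
        field_simp
        ring
      rw [e]
      exact hz.neg

lemma hz_mul (c c' : Matrix δ δ F) (h : c * c' = 1) (j : ℕ) : hz c j * hz c' j = 1 := by
  induction j with
  | zero => ext i; exact i.elim
  | succ j ih =>
    change (Matrix.fromBlocks c 0 0 (hz c j)) * (Matrix.fromBlocks c' 0 0 (hz c' j)) = 1
    rw [Matrix.fromBlocks_multiply, ih, h]
    simp [Matrix.fromBlocks_one]

lemma W7_Fr {c c' : Matrix δ δ F} (hc : Irreducible c.charpoly) (hcc : c * c' = 1)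
    (ih : ∀ k, k < Fintype.card ι → ∀ (r : Matrix (Fin k) (Fin k) F →* Matrix κ κ ℂ) (B : Matrix κ κ ℂ), okP r B →
      pInt (Fintype.card F) (W7 c r B))
    (r : Matrix ι ι F →* Matrix κ κ ℂ) (B : Matrix κ κ ℂ) (hok : okP r B) (j : ℕ) (hj : 1 ≤ j) :
    pInt (Fintype.card F) ((∑ g, prm c g * (r g * B).trace * (Fr (hz c j) g : ℂ)) / glc (Fintype.card F) (Fintype.card ι)) := by
  have hne := nonempty_of_irr hc
  have hδ : 0 < Fintype.card δ := Fintype.card_pos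
  by_cases hlt : Fintype.card ι < Fintype.card δ * j
  · have : ∀ g : Matrix ι ι F, Fr (hz c j) g = 0 := fun g => Fr_hz_zero_of_lt c g j hlt
    simp only [this, Nat.cast_zero, mul_zero, Finset.sum_const_zero, zero_div]
    exact pInt.of_int isIntegral_zero
  · push Not at hlt
    have hpos : 0 < Fintype.card δ * j := Nat.mul_pos hδ hj
    obtain ⟨r', B', hok', hE⟩ := W7_step (ν := Fin (Fintype.card ι - Fintype.card δ * j)) hc j (hz c' j) (hz_mul c c' hcc j)
      (Fintype.equivOfCardEq (by simp [card_Pw]; omega)) r B hok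
    rw [hE]
    exact ih _ (by omega) r' B' hok'

lemma prm_rel {c : Matrix δ δ F} (hc : Irreducible c.charpoly) [Nonempty ι] (g : Matrix ι ι F) :
    prm c g = - ∑ j ∈ Finset.range (Fintype.card ι), qe ((Fintype.card F ^ Fintype.card δ : ℕ) : ℂ) (j + 1) * (prm c g * (Fr (hz c (j + 1)) g : ℂ)) := by
  by_cases hp : prim c g
  · have h1 : prm c g = 1 := if_pos hp
    have hl := lf_pos hc hp
    have h2 := qS_eq ((Fintype.card F ^ Fintype.card δ : ℕ) : ℂ) (one_sub_pow_ne (two_le_Q hc)) (lf c g) (Fintype.card ι + 1)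
      (by have := lf_le hc g; omega) 1
    rw [Finset.prod_eq_zero (i := 0) (Finset.mem_range.mpr hl) (by simp), Finset.sum_range_succ'] at h2
    rw [h1]
    simp only [Fr_lf hc, one_mul]
    simp only [one_pow, mul_one] at h2
    have h3 : qe ((Fintype.card F ^ Fintype.card δ : ℕ) : ℂ) 0 * qN ((Fintype.card F ^ Fintype.card δ : ℕ) : ℂ) (((Fintype.card F ^ Fintype.card δ : ℕ) : ℂ) ^ lf c g) 0 = 1 := by
      simp [qe, qN]
    rw [h3] at h2
    linear_combination h2
  · have h1 : prm c g = 0 := if_neg hp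
    simp [h1]

lemma DD_rel {c : Matrix δ δ F} (hc : Irreducible c.charpoly) [Nonempty ι] (g : Matrix ι ι F) :
    DD c g = - ∑ j ∈ Finset.range (Fintype.card ι), ((j + 1 : ℕ) : ℂ) * (qe ((Fintype.card F ^ Fintype.card δ : ℕ) : ℂ) (j + 1) * (prm c g * (Fr (hz c (j + 1)) g : ℂ))) := by
  by_cases hp : prim c g
  · have h1 : prm c g = 1 := if_pos hp
    have hD : DD c g = qD ((Fintype.card F ^ Fintype.card δ : ℕ) : ℂ) (lf c g) := if_pos hp
    have hl := lf_pos hc hp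
    have h2 := qD_eq ((Fintype.card F ^ Fintype.card δ : ℕ) : ℂ) (one_sub_pow_ne (two_le_Q hc)) (lf c g) (Fintype.card ι + 1) hl
      (by have := lf_le hc g; omega)
    rw [Finset.sum_range_succ'] at h2
    rw [hD, h2, h1]
    simp only [Fr_lf hc, one_mul, Nat.cast_zero, zero_mul, add_zero, mul_assoc]
  · have h1 : prm c g = 0 := if_neg hp
    have hD : DD c g = 0 := if_neg hp
    simp [h1, hD]

theorem W7_int {c c' : Matrix δ δ F} (hc : Irreducible c.charpoly) (hcc : c * c' = 1) (n : ℕ) :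
    ∀ (r : Matrix (Fin n) (Fin n) F →* Matrix κ κ ℂ) (B : Matrix κ κ ℂ), okP r B →
      pInt (Fintype.card F) (W7 c r B) := by
  induction n using Nat.strong_induction_on with
  | _ n ih =>
    intro r B hok
    rcases Nat.eq_zero_or_pos n with rfl | hn
    · obtain ⟨-, m, hm, hB⟩ := hok
      have : W7 c r B = B.trace := by
        unfold W7
        rw [Fintype.sum_eq_single (1 : Matrix (Fin 0) (Fin 0) F) (fun x hx => absurd (Subsingleton.elim _ _) hx)]
        have : prm c (1 : Matrix (Fin 0) (Fin 0) F) = 1 := if_pos ⟨0, by rw [pow_zero]; exact Matrix.det_isEmpty⟩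
        rw [this, map_one]
        simp [glc, qN]
      rw [this]
      exact pInt.of_int (trace_integral B m hm hB)
    · have : Nonempty (Fin n) := ⟨⟨0, hn⟩⟩
      have hne := nonempty_of_irr hc
      have e : W7 c r B = - ∑ j ∈ Finset.range (Fintype.card (Fin n)), qe ((Fintype.card F ^ Fintype.card δ : ℕ) : ℂ) (j + 1) *
          ((∑ g, prm c g * (r g * B).trace * (Fr (hz c (j + 1)) g : ℂ)) / glc (Fintype.card F) (Fintype.card (Fin n))) := by
        unfold W7
        simp only [mul_div_assoc', ← Finset.sum_div, ← neg_div]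
        congr 1
        simp only [Finset.mul_sum]
        rw [Finset.sum_comm, ← Finset.sum_neg_distrib]
        refine Finset.sum_congr rfl fun g _ => ?_
        conv_lhs => rw [prm_rel hc g]
        rw [neg_mul, Finset.sum_mul]
        congr 1
        exact Finset.sum_congr rfl fun j _ => by ring
      rw [e]
      apply pInt.neg
      apply pInt.sum
      intro j _
      apply pInt.qe Fintype.card_pos two_le_card
      exact W7_Fr hc hcc (by simpa using ih) r B hok (j + 1) (by omega)

theorem DD_pInt {c c' : Matrix δ δ F} (hc : Irreducible c.charpoly) (hcc : c * c' = 1) [Nonempty ι]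
    (r : Matrix ι ι F →* Matrix κ κ ℂ) :
    pInt (Fintype.card F) ((∑ g, DD c g * (r g).trace) / glc (Fintype.card F) (Fintype.card ι)) := by
  have e : (∑ g, DD c g * (r g).trace) / glc (Fintype.card F) (Fintype.card ι) = - ∑ j ∈ Finset.range (Fintype.card ι), ((j + 1 : ℕ) : ℂ) * (qe ((Fintype.card F ^ Fintype.card δ : ℕ) : ℂ) (j + 1) *
      ((∑ g, prm c g * (r g * 1).trace * (Fr (hz c (j + 1)) g : ℂ)) / glc (Fintype.card F) (Fintype.card ι))) := by
    simp only [mul_div_assoc', ← Finset.sum_div, ← neg_div]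
    congr 1
    simp only [Finset.mul_sum]
    rw [Finset.sum_comm, ← Finset.sum_neg_distrib]
    refine Finset.sum_congr rfl fun g _ => ?_
    rw [DD_rel hc g, neg_mul, Finset.sum_mul]
    congr 1
    refine Finset.sum_congr rfl fun j _ => ?_
    rw [mul_one]; ring
  have hne := nonempty_of_irr hc
  rw [e]
  apply pInt.neg
  apply pInt.sum
  intro j _
  refine pInt.mul_int ?_ (isIntegral_natCast' _)
  apply pInt.qe Fintype.card_pos two_le_card
  exact W7_Fr hc hcc (fun k _ => W7_int hc hcc k) r 1 ⟨by simp, 1, le_refl _, by simp⟩ (j + 1) (by omega)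

end MK

end

section
open scoped BigOperators Kronecker
namespace MK

noncomputable def pmx {X : Type} [Fintype X] [DecidableEq X] : Equiv.Perm X →* Matrix X X ℂ where
  toFun e := Matrix.of (fun x y => if e y = x then (1:ℂ) else 0)
  map_one' := by
    ext x y
    simp [Matrix.one_apply, eq_comm]
  map_mul' a b := by
    ext x y
    simp [Matrix.mul_apply, Finset.sum_ite_eq]
    congr

theorem pmx_trace {X : Type} [Fintype X] [DecidableEq X] (e : Equiv.Perm X) :
    (pmx e).trace = ((Finset.univ.filter (fun x => e x = x)).card : ℂ) := by
  simp [pmx, Matrix.trace]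

theorem int_trace {H X κ : Type} [Group H] [Fintype H] [Fintype X] [DecidableEq X] [Fintype κ]
    [DecidableEq κ] (π : H →* Equiv.Perm X) (τ : Equiv.Perm X) (hτ : ∀ h, π h * τ = τ * π h)
    (σ : H →* Matrix κ κ ℂ) :
    IsIntegral ℤ ((∑ h, ((Finset.univ.filter (fun x => π h (τ x) = x)).card : ℂ) * (σ h).trace)
      / Fintype.card H) := by
  classical
  let A : H → Matrix (X × κ) (X × κ) ℂ := fun h => (pmx (π h)) ⊗ₖ (σ h)
  have hA : ∀ a b, A a * A b = A (a * b) := by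
    intro a b
    simp only [A, map_mul]
    exact (Matrix.mul_kronecker_mul _ _ _ _).symm
  let T : Matrix (X × κ) (X × κ) ℂ := (pmx τ) ⊗ₖ (1 : Matrix κ κ ℂ)
  let P : Matrix (X × κ) (X × κ) ℂ := (Fintype.card H : ℂ)⁻¹ • ∑ h, A h
  have hc : (Fintype.card H : ℂ) ≠ 0 := by simp [Fintype.card_ne_zero]
  have hPP : P * P = P := by
    simp only [P, Matrix.smul_mul, Matrix.mul_smul, Matrix.sum_mul, Matrix.mul_sum, hA]
    have : ∀ x : H, ∑ i, A (i * x) = ∑ i, A i := fun x => Equiv.sum_comp (Equiv.mulRight x) A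
    simp only [this]
    rw [Finset.sum_const, Finset.card_univ, ← Nat.cast_smul_eq_nsmul ℂ, smul_smul ((Fintype.card H : ℂ)⁻¹), inv_mul_cancel₀ hc, one_smul]
  have hTP : T * P = P * T := by
    simp only [P, Matrix.smul_mul, Matrix.mul_smul, Matrix.sum_mul, Matrix.mul_sum]
    congr 1
    refine Finset.sum_congr rfl fun h _ => ?_
    simp only [T, A]
    rw [← Matrix.mul_kronecker_mul, ← Matrix.mul_kronecker_mul, ← map_mul, ← map_mul, hτ, one_mul, mul_one]
  have hTpow : T ^ (orderOf τ) = 1 := by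
    have : ∀ m, T ^ m = (pmx (τ ^ m)) ⊗ₖ (1 : Matrix κ κ ℂ) := by
      intro m
      induction m with
      | zero => simp [Matrix.one_kronecker_one]
      | succ m ih => 
        rw [pow_succ, ih, pow_succ, map_mul]
        simp only [T]
        rw [← Matrix.mul_kronecker_mul, one_mul]
    rw [this, pow_orderOf_eq_one]
    simp [Matrix.one_kronecker_one]
  have hM : (P * T) ^ (orderOf τ + 1) = P * T := by
    have hcm : Commute P T := hTP.symm
    rw [hcm.mul_pow, pow_succ T, hTpow, one_mul]
    congr 1
    exact IsIdempotentElem.pow_succ_eq _ hPP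
  have key := trace_integral (P * T) (orderOf τ) (orderOf_pos τ) hM
  have : (P * T).trace = ((∑ h, ((Finset.univ.filter (fun x => π h (τ x) = x)).card : ℂ) * (σ h).trace)
      / Fintype.card H) := by
    simp only [P, Matrix.smul_mul, Matrix.sum_mul, Matrix.trace_smul, Matrix.trace_sum]
    rw [div_eq_inv_mul, smul_eq_mul]
    congr 1
    refine Finset.sum_congr rfl fun h _ => ?_
    simp only [T, A]
    rw [← Matrix.mul_kronecker_mul, ← map_mul, mul_one, ]
    rw [Matrix.trace_kronecker, pmx_trace]
    rfl
  rwa [this] at key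

end MK

end

section
open scoped BigOperators
namespace MK

variable {F : Type} [Field F] [Fintype F] [DecidableEq F]
variable {ι μ δ ν κ : Type} [Fintype ι] [Fintype μ] [Fintype δ] [Fintype ν] [Fintype κ]
  [DecidableEq ι] [DecidableEq μ] [DecidableEq δ] [DecidableEq ν] [DecidableEq κ]
variable {L : Type} [Field L] [Fintype L] [DecidableEq L] [Algebra F L]

/-- regular unipotent matrix -/
def Jn (L : Type) [Field L] (n : ℕ) : Matrix (Fin n) (Fin n) L :=
  Matrix.of fun i j => if i = j then 1 else if (i : ℕ) + 1 = j then 1 else 0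

lemma Jn_mul (n : ℕ) (Φ : Matrix (Fin n) ν L) (i : Fin n) :
    (Jn L n * Φ) i = Φ i + (if h : (i : ℕ) + 1 < n then Φ ⟨i + 1, h⟩ else 0) := by
  ext a
  rw [Matrix.mul_apply]
  have : ∀ j : Fin n, Jn L n i j * Φ j a = (if i = j then Φ j a else 0) +
      (if h : (i : ℕ) + 1 < n then (if (⟨i + 1, h⟩ : Fin n) = j then Φ j a else 0) else 0) := by
    intro j
    simp only [Jn, Matrix.of_apply]
    by_cases h1 : i = j
    · subst h1
      have : ∀ h : (i : ℕ) + 1 < n, ¬ (⟨i + 1, h⟩ : Fin n) = i := by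
        intro h e
        have := congrArg Fin.val e
        simp at this
      simp [this]
    · rw [if_neg h1, if_neg h1]
      by_cases h2 : (i : ℕ) + 1 = j
      · have h : (i : ℕ) + 1 < n := by rw [h2]; exact j.2
        have e : (⟨i + 1, h⟩ : Fin n) = j := Fin.ext h2
        rw [if_pos h2, dif_pos h, if_pos e]; simp
      · have : ∀ h : (i : ℕ) + 1 < n, ¬ (⟨i + 1, h⟩ : Fin n) = j := by
          intro h e
          exact h2 (congrArg Fin.val e)
        rw [if_neg h2]; simp [this]
  simp only [this, Finset.sum_add_distrib]
  by_cases h : (i : ℕ) + 1 < n <;> simp [h]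

lemma chain_card {V : Type} [AddCommGroup V] [Module L V] (K : Module.End L V) (n : ℕ) (hn : 1 ≤ n) :
    Nat.card {Φ : Fin n → V // ∀ i : Fin n, K (Φ i) = (if h : (i : ℕ) + 1 < n then Φ ⟨i + 1, h⟩ else 0)}
      = Nat.card {v : V // (K ^ n) v = 0} := by
  have key : ∀ (Φ : Fin n → V), (∀ i : Fin n, K (Φ i) = (if h : (i : ℕ) + 1 < n then Φ ⟨i + 1, h⟩ else 0)) →
      ∀ (i : ℕ) (h : i < n), Φ ⟨i, h⟩ = (K ^ i) (Φ ⟨0, hn⟩) := by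
    intro Φ hΦ i
    induction i with
    | zero => intro h; simp
    | succ i ih =>
      intro h
      have h1 := hΦ ⟨i, by omega⟩
      rw [dif_pos h] at h1
      rw [← h1, ih (by omega), pow_succ', Module.End.mul_apply]
  refine Nat.card_congr ⟨fun Φ => ⟨Φ.1 ⟨0, hn⟩, ?_⟩, fun v => ⟨fun i => (K ^ (i : ℕ)) v.1, ?_⟩, ?_, ?_⟩
  · obtain ⟨m, rfl⟩ : ∃ m, n = m + 1 := ⟨n - 1, by omega⟩
    have h1 := Φ.2 ⟨m, by omega⟩
    rw [dif_neg (by simp), key Φ.1 Φ.2] at h1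
    rw [pow_succ', Module.End.mul_apply, h1]
  · intro i
    rw [← Module.End.mul_apply, ← pow_succ']
    split_ifs with h
    · rfl
    · have : (i : ℕ) + 1 = n := by have := i.2; omega
      rw [this, v.2]
  · intro Φ
    apply Subtype.ext
    funext i
    exact (key Φ.1 Φ.2 i i.2).symm
  · intro v
    apply Subtype.ext
    simp

noncomputable def HoL (n : ℕ) (t : L) (x : Matrix ν ν F) : ℕ :=
  Nat.card {Φ : Matrix (Fin n) ν L // Φ * x.map (algebraMap F L) = t • (Jn L n * Φ)}

lemma rootMult_pow {P : Polynomial F} (hP : Irreducible P) {t : L} (ht : Polynomial.aeval t P = 0) (r : ℕ) :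
    ((P ^ r).map (algebraMap F L)).rootMultiplicity t = r := by
  have hsep : P.Separable := PerfectField.separable_of_irreducible hP
  have hsepL : (P.map (algebraMap F L)).Separable := hsep.map
  have h0 : P.map (algebraMap F L) ≠ 0 := hsepL.ne_zero
  have hr : (P.map (algebraMap F L)).rootMultiplicity t = 1 := by
    apply le_antisymm
    · exact Polynomial.rootMultiplicity_le_one_of_separable hsepL t
    · rw [Nat.one_le_iff_ne_zero, ← Nat.pos_iff_ne_zero, Polynomial.rootMultiplicity_pos h0]
      rw [Polynomial.IsRoot, Polynomial.eval_map_algebraMap, ht]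
  classical
  rw [Polynomial.map_pow, ← Polynomial.count_roots, Polynomial.roots_pow, Multiset.count_nsmul, Polynomial.count_roots, hr, mul_one]

lemma cntHom (n : ℕ) (hn : 1 ≤ n) (x : Matrix ν ν F) {P : Polynomial F} (hP : Irreducible P) {r : ℕ}
    (hx : x.charpoly = P ^ r) {t : L} (ht : Polynomial.aeval t P = 0) (ht0 : t ≠ 0)
    (hcard : Fintype.card ν ≤ n) : HoL n t x = Fintype.card L ^ r := by
  let f : Module.End L (ν → L) := Matrix.toLin' (x.map (algebraMap F L)).transpose
  let K : Module.End L (ν → L) := t⁻¹ • (f - t • 1)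
  have h1 : HoL n t x = Nat.card {Φ : Fin n → (ν → L) // ∀ i : Fin n, K (Φ i) = (if h : (i : ℕ) + 1 < n then Φ ⟨i + 1, h⟩ else 0)} := by
    unfold HoL
    refine Nat.card_congr (Equiv.subtypeEquivRight fun Φ => ?_)
    refine (funext_iff (f := Φ * x.map (algebraMap F L)) (g := t • (Jn L n * Φ))).trans ?_
    refine forall_congr' fun i => ?_
    have e1 : (Φ * x.map (algebraMap F L)) i = f (Φ i) := by
      simp only [f, Matrix.toLin'_apply, Matrix.mulVec_transpose]
      rfl
    have e2 : (t • (Jn L n * Φ)) i = t • ((Jn L n * Φ) i) := rfl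
    rw [e1, e2, Jn_mul]
    generalize (if h : (i : ℕ) + 1 < n then Φ ⟨i + 1, h⟩ else 0) = w
    simp only [K, LinearMap.smul_apply, LinearMap.sub_apply, Module.End.one_apply]
    rw [inv_smul_eq_iff₀ ht0, smul_add, sub_eq_iff_eq_add']
  rw [h1, chain_card K n hn]
  have h2 : Nat.card {v : ν → L // (K ^ n) v = 0} = Nat.card (f.genEigenspace t n) := by
    refine Nat.card_congr (Equiv.subtypeEquivRight fun v => ?_)
    rw [Module.End.mem_genEigenspace_nat, LinearMap.mem_ker]
    simp only [K, smul_pow, LinearMap.smul_apply]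
    rw [smul_eq_zero_iff_right (pow_ne_zero _ (inv_ne_zero ht0))]
  rw [h2]
  have h3 : f.genEigenspace t n = f.maxGenEigenspace t := by
    rw [Module.End.maxGenEigenspace_eq_genEigenspace_finrank]
    exact Module.End.genEigenspace_eq_genEigenspace_finrank_of_le f t (by simpa using hcard)
  rw [h3, Module.natCard_eq_pow_finrank (K := L), LinearMap.finrank_maxGenEigenspace_eq, Nat.card_eq_fintype_card]
  congr 1
  rw [show f.charpoly = (P ^ r).map (algebraMap F L) from ?_, rootMult_pow hP ht]
  rw [← hx, ← Matrix.charpoly_map]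
  simp only [f]
  rw [← LinearMap.charpoly_toMatrix _ (Pi.basisFun L ν)]
  rw [← Matrix.charpoly_transpose]
  congr 1
  rw [LinearMap.toMatrix_eq_toMatrix', LinearMap.toMatrix'_toLin', Matrix.transpose_transpose]

end MK

end

section
open scoped BigOperators
namespace MK

variable {F : Type} [Field F] [Fintype F] [DecidableEq F]
variable {ι μ δ ν κ : Type} [Fintype ι] [Fintype μ] [Fintype δ] [Fintype ν] [Fintype κ]
  [DecidableEq ι] [DecidableEq μ] [DecidableEq δ] [DecidableEq ν] [DecidableEq κ]
variable {L : Type} [Field L] [Fintype L] [DecidableEq L] [Algebra F L]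

lemma exists_extend' (A : Matrix ι μ F) (hA : Function.Injective A.mulVec) :
    ∃ (m : ℕ) (B : Matrix ι (μ ⊕ Fin m) F) (B' : Matrix (μ ⊕ Fin m) ι F), B * B' = 1 ∧ B' * B = 1 ∧
      B * (Matrix.fromRows 1 0 : Matrix (μ ⊕ Fin m) μ F) = A ∧
      ∀ g : Matrix ι ι F, (B' * g * B).charpoly = g.charpoly := by
  have hc : Fintype.card μ ≤ Fintype.card ι := by
    by_contra h
    have h1 := LinearMap.finrank_le_finrank_of_injective (f := A.mulVecLin) hA
    simp at h1
    omega
  have hcard : Fintype.card ι = Fintype.card (μ ⊕ Fin (Fintype.card ι - Fintype.card μ)) := by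
    simp; omega
  let e := Fintype.equivOfCardEq hcard
  have hA0 : Function.Injective (A.submatrix e.symm id).mulVec := by
    intro v w hvw
    apply hA
    funext i
    have := congrFun hvw (e i)
    simpa [Matrix.mulVec, dotProduct] using this
  obtain ⟨B, B', h1, h2, h3⟩ := exists_extend (A.submatrix e.symm id) hA0
  refine ⟨_, B.submatrix e id, B'.submatrix id e, ?_, ?_, ?_, ?_⟩
  · rw [Matrix.submatrix_mul _ _ _ _ _ Function.bijective_id |>.symm, h1]
    simp
  · rw [Matrix.submatrix_mul _ _ _ _ _ e.bijective |>.symm, h2]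
    simp
  · have := congrArg (fun M => Matrix.submatrix M e id) h3
    rw [Matrix.submatrix_mul _ _ _ id _ Function.bijective_id] at this
    simpa using this
  · intro g
    have : B'.submatrix id e * g * B.submatrix e id = B' * (Matrix.reindex e e g) * B := by
      have e1 : g = (Matrix.reindex e e g).submatrix e e := by ext; simp
      conv_lhs => rw [e1]
      rw [← Matrix.submatrix_mul _ _ _ _ _ e.bijective, ← Matrix.submatrix_mul _ _ _ _ _ e.bijective]
      simp
    rw [this, charpoly_conj h1, Matrix.charpoly_reindex]

lemma HoLA_aux {n m : ℕ} (J : Matrix (Fin n) (Fin n) L) (t : L) {X : Matrix ι ι L} {A : Matrix ι μ L}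
    {C : Matrix ι (μ ⊕ Fin m) L} {C' : Matrix (μ ⊕ Fin m) ι L} {h : Matrix μ μ L} {u : Matrix μ (Fin m) L}
    {x : Matrix (Fin m) (Fin m) L} (m1 : C * C' = 1) (m2 : C' * C = 1)
    (m3 : C * (Matrix.fromRows 1 0 : Matrix (μ ⊕ Fin m) μ L) = A)
    (mg : X * C = C * Matrix.fromBlocks h u 0 x) :
    Nat.card {Φ : Matrix (Fin n) ι L // Φ * X = t • (J * Φ) ∧ Φ * A = 0} =
      Nat.card {Φ : Matrix (Fin n) (Fin m) L // Φ * x = t • (J * Φ)} := by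
  have k1 : ∀ Φ : Matrix (Fin n) ι L, Φ * A = 0 → Φ * C = Matrix.fromCols 0 (Φ * C).toCols₂ := by
    intro Φ hΦ
    rw [← m3, ← Matrix.mul_assoc, ← Matrix.fromCols_toCols (Φ * C), Matrix.fromCols_mul_fromRows] at hΦ
    simp only [Matrix.mul_one, Matrix.mul_zero, add_zero] at hΦ
    conv_lhs => rw [← Matrix.fromCols_toCols (Φ * C), hΦ]
  have k2 : ∀ Y : Matrix (Fin n) (Fin m) L, (Matrix.fromCols 0 Y : Matrix (Fin n) (μ ⊕ Fin m) L) *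
      Matrix.fromBlocks h u 0 x = Matrix.fromCols 0 (Y * x) := by
    intro Y
    rw [Matrix.fromCols_mul_fromBlocks]; simp
  have k3 : ∀ Y : Matrix (Fin n) (Fin m) L, t • (J * (Matrix.fromCols 0 Y : Matrix (Fin n) (μ ⊕ Fin m) L))
      = Matrix.fromCols 0 (t • (J * Y)) := by
    intro Y
    rw [Matrix.mul_fromCols]
    ext i j; cases j <;> simp
  have k4 : ∀ Φ : Matrix (Fin n) ι L, Φ * C * C' = Φ := by
    intro Φ; rw [Matrix.mul_assoc, m1, Matrix.mul_one]
  have k5 : ∀ Φ : Matrix (Fin n) (μ ⊕ Fin m) L, Φ * C' * C = Φ := by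
    intro Φ; rw [Matrix.mul_assoc, m2, Matrix.mul_one]
  refine Nat.card_congr ⟨fun Φ => ⟨(Φ.1 * C).toCols₂, ?_⟩, fun Ψ => ⟨(Matrix.fromCols 0 Ψ.1 : Matrix (Fin n) (μ ⊕ Fin m) L) * C', ?_, ?_⟩, ?_, ?_⟩
  · have e1 := k1 Φ.1 Φ.2.2
    have e2 : (Φ.1 * C) * Matrix.fromBlocks h u 0 x = t • (J * (Φ.1 * C)) := by
      rw [Matrix.mul_assoc, ← mg, ← Matrix.mul_assoc, Φ.2.1, Matrix.smul_mul, Matrix.mul_assoc]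
    rw [e1, k2, k3] at e2
    exact (Matrix.fromCols_inj.eq_iff.mp e2).2
  · have e1 : X = C * Matrix.fromBlocks h u 0 x * C' := by rw [← mg, Matrix.mul_assoc, m1, Matrix.mul_one]
    rw [e1, ← Matrix.mul_assoc, ← Matrix.mul_assoc, k5, k2, Ψ.2, ← k3, Matrix.smul_mul, Matrix.mul_assoc]
  · rw [← m3, ← Matrix.mul_assoc, k5, Matrix.fromCols_mul_fromRows]; simp
  · intro Φ
    apply Subtype.ext
    simp only
    rw [← k1 Φ.1 Φ.2.2, k4]
  · intro Ψ
    apply Subtype.ext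
    simp only
    rw [k5, Matrix.toCols₂_fromCols]

lemma HoLA (n : ℕ) (t : L) (g : Matrix ι ι F) (A : Matrix ι μ F) (hA : Function.Injective A.mulVec)
    (h : Matrix μ μ F) (hg : g * A = A * h) :
    ∃ (m : ℕ) (x : Matrix (Fin m) (Fin m) F), g.charpoly = h.charpoly * x.charpoly ∧
      Nat.card {Φ : Matrix (Fin n) ι L // Φ * g.map (algebraMap F L) = t • (Jn L n * Φ) ∧
        Φ * A.map (algebraMap F L) = 0} = HoL n t x := by
  obtain ⟨m, B, B', h1, h2, h3, h4⟩ := exists_extend' A hA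
  set a := algebraMap F L
  let G := B' * g * B
  have hG1 : G * (Matrix.fromRows 1 0 : Matrix (μ ⊕ Fin m) μ F) = Matrix.fromRows h 0 := by
    have : B' * A = (Matrix.fromRows 1 0 : Matrix (μ ⊕ Fin m) μ F) := by
      rw [← h3, ← Matrix.mul_assoc, h2, Matrix.one_mul]
    simp only [G]
    rw [Matrix.mul_assoc, h3, Matrix.mul_assoc, hg, ← Matrix.mul_assoc, this, Matrix.fromRows_mul]
    simp
  have hG : G = Matrix.fromBlocks h G.toBlocks₁₂ 0 G.toBlocks₂₂ := by
    have e := Matrix.fromBlocks_toBlocks G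
    rw [← e, Matrix.fromBlocks_mul_fromRows] at hG1
    simp only [Matrix.mul_one, Matrix.mul_zero, add_zero, Matrix.fromRows_inj.eq_iff] at hG1
    conv_lhs => rw [← e, hG1.1, hG1.2]
  refine ⟨m, G.toBlocks₂₂, ?_, ?_⟩
  · rw [← h4 g]
    change G.charpoly = _
    conv_lhs => rw [hG]
    exact Matrix.charpoly_fromBlocks_zero₂₁ _ _ _
  · unfold HoL
    have m1 : B.map a * B'.map a = 1 := by rw [← Matrix.map_mul, h1]; simp
    have m2 : B'.map a * B.map a = 1 := by rw [← Matrix.map_mul, h2]; simp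
    have m3 : (B.map a) * (Matrix.fromRows 1 0 : Matrix (μ ⊕ Fin m) μ L) = A.map a := by
      rw [← h3, Matrix.map_mul]; congr 1
      ext i j; cases i <;> simp [Matrix.one_apply, apply_ite a]
    have mg : g.map a * B.map a = B.map a * (Matrix.fromBlocks h G.toBlocks₁₂ 0 G.toBlocks₂₂).map a := by
      rw [← Matrix.map_mul, ← Matrix.map_mul, ← hG]
      congr 1
      simp only [G]
      rw [← Matrix.mul_assoc, ← Matrix.mul_assoc, h1, Matrix.one_mul]
    rw [Matrix.fromBlocks_map] at mg
    have mg' : g.map a = B.map a * (Matrix.fromBlocks (h.map a) (G.toBlocks₁₂.map a) ((0 : Matrix (Fin m) μ F).map a) (G.toBlocks₂₂.map a)) * B'.map a := by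
      rw [← mg, Matrix.mul_assoc, m1, Matrix.mul_one]
    have z0 : (0 : Matrix (Fin m) μ F).map a = 0 := by simp
    rw [z0] at mg mg'
    exact HoLA_aux _ _ m1 m2 m3 mg

end MK

end

section
open scoped BigOperators
namespace MK

variable {F : Type} [Field F] [Fintype F] [DecidableEq F]
variable {ι μ δ ν κ : Type} [Fintype ι] [Fintype μ] [Fintype δ] [Fintype ν] [Fintype κ]
  [DecidableEq ι] [DecidableEq μ] [DecidableEq δ] [DecidableEq ν] [DecidableEq κ]
variable {L : Type} [Field L] [Fintype L] [DecidableEq L] [Algebra F L]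

open Classical in
lemma cardS {X : Type} [Fintype X] (p : X → Prop) :
    ((Nat.card {x // p x} : ℕ) : ℂ) = ∑ x, if p x then 1 else 0 := by
  rw [Nat.card_eq_fintype_card, Fintype.card_subtype]
  simp

/-- injective on `F`-vectors -/
def FI (L : Type) [Field L] [Algebra F L] {n : ℕ} (Φ : Matrix (Fin n) ι L) : Prop :=
  ∀ v : ι → F, Φ.mulVec (fun i => algebraMap F L (v i)) = 0 → v = 0

lemma mulVec_alg {n : ℕ} (Φ : Matrix (Fin n) ι L) (A : Matrix ι μ F) (z : μ → F) :
    Φ.mulVec (fun i => algebraMap F L (A.mulVec z i)) =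
      (Φ * A.map (algebraMap F L)).mulVec (fun i => algebraMap F L (z i)) := by
  rw [← Matrix.mulVec_mulVec]
  congr 1
  ext i
  simp [Matrix.mulVec, dotProduct]

lemma mul_map_zero_iff {n : ℕ} (Φ : Matrix (Fin n) ι L) (A : Matrix ι μ F) :
    Φ * A.map (algebraMap F L) = 0 ↔ ∀ z, Φ.mulVec (fun i => algebraMap F L (A.mulVec z i)) = 0 := by
  constructor
  · intro h z
    rw [mulVec_alg, h, Matrix.zero_mulVec]
  · intro h
    ext i j
    have := congrFun (h (Pi.single j 1)) i
    rw [Matrix.mulVec_single_one] at this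
    simpa [Matrix.mulVec, dotProduct, Matrix.mul_apply] using this

lemma sum_qe_FI {c : Matrix δ δ F} (hc : Irreducible c.charpoly) {g : Matrix ι ι F} {r : ℕ}
    (hg : g.charpoly = c.charpoly ^ r) {n : ℕ} {t : L} {J : Matrix (Fin n) (Fin n) L}
    {Φ : Matrix (Fin n) ι L} (hΦ : Φ * g.map (algebraMap F L) = t • (J * Φ)) [Decidable (FI (F := F) L Φ)] :
    ∑ j ∈ Finset.range (Fintype.card ι + 1), qe ((Fintype.card F ^ Fintype.card δ : ℕ) : ℂ) j *
      (FrP (fun A => Φ * A.map (algebraMap F L) = 0) (hz c j) g : ℂ) = if FI (F := F) L Φ then 1 else 0 := by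
  classical
  let p : (j : ℕ) → Matrix ι (Pw δ j) F → Prop := fun j A => Φ * A.map (algebraMap F L) = 0
  let p1 : Matrix ι δ F → Prop := fun A => Φ * A.map (algebraMap F L) = 0
  have h0 : ∀ A, p 0 A := by
    intro A
    ext i j
    exact j.elim
  have hpp : ∀ (j : ℕ) (a : Matrix ι δ F) (A : Matrix ι (Pw δ j) F),
      p (j + 1) (Matrix.fromCols a A : Matrix ι (δ ⊕ Pw δ j) F) ↔ p1 a ∧ p j A := by
    intro j a A
    have e : (Matrix.fromCols a A : Matrix ι (δ ⊕ Pw δ j) F).map (algebraMap F L) =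
        Matrix.fromCols (a.map (algebraMap F L)) (A.map (algebraMap F L)) := by
      ext i k; cases k <;> simp
    change Φ * (Matrix.fromCols a A : Matrix ι (δ ⊕ Pw δ j) F).map (algebraMap F L) = (0 : Matrix (Fin n) (δ ⊕ Pw δ j) L) ↔ _
    rw [e, Matrix.mul_fromCols, ← Matrix.fromCols_zero, Matrix.fromCols_inj.eq_iff]
  have hpt : ∀ (j : ℕ) (A : Matrix ι (Pw δ j) F) (t : Matrix (Pw δ j) δ F),
      p j A → hz c j * t = t * c → p1 (A * t) := by
    intro j A t h _
    simp only [p1, p] at h ⊢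
    rw [Matrix.map_mul, ← Matrix.mul_assoc, h, Matrix.zero_mul]
  obtain ⟨l, hl, hl'⟩ := exists_lP hc g p p1 h0 hpp hpt
  have hQ := two_le_Q hc
  have e1 : ∀ j, (FrP (fun A => Φ * A.map (algebraMap F L) = 0) (hz c j) g : ℂ) = 
      qN ((Fintype.card F ^ Fintype.card δ : ℕ) : ℂ) (((Fintype.card F ^ Fintype.card δ : ℕ) : ℂ) ^ l) j := by
    intro j
    have := FrP_hz hc g p p1 h0 hpp hpt j
    rw [hl'] at this
    push_cast at this ⊢
    exact this
  simp only [e1]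
  have e2 := qS_eq ((Fintype.card F ^ Fintype.card δ : ℕ) : ℂ) (one_sub_pow_ne hQ) l (Fintype.card ι + 1) (by omega) 1
  simp only [one_pow, mul_one] at e2
  rw [e2]
  have stab : ∀ v : ι → F, Φ.mulVec (fun i => algebraMap F L (v i)) = 0 → Φ.mulVec (fun i => algebraMap F L (g.mulVec v i)) = 0 := by
    intro v hv
    rw [mulVec_alg, hΦ, Matrix.smul_mulVec, ← Matrix.mulVec_mulVec, hv, Matrix.mulVec_zero, smul_zero]
  have hadd : ∀ v w : ι → F, Φ.mulVec (fun i => algebraMap F L (v i)) = 0 → Φ.mulVec (fun i => algebraMap F L (w i)) = 0 →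
      Φ.mulVec (fun i => algebraMap F L ((v + w) i)) = 0 := by
    intro v w hv hw
    have : (fun i => algebraMap F L ((v + w) i)) = (fun i => algebraMap F L (v i)) + (fun i => algebraMap F L (w i)) := by
      ext i; simp
    rw [this, Matrix.mulVec_add, hv, hw, add_zero]
  have hsm : ∀ (a : F) (v : ι → F), Φ.mulVec (fun i => algebraMap F L (v i)) = 0 → 
      Φ.mulVec (fun i => algebraMap F L ((a • v) i)) = 0 := by
    intro a v hv
    have : (fun i => algebraMap F L ((a • v) i)) = algebraMap F L a • (fun i => algebraMap F L (v i)) := by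
      ext i; simp
    rw [this, Matrix.mulVec_smul, hv, smul_zero]
  have spoly : ∀ (f : Polynomial F) (v : ι → F), Φ.mulVec (fun i => algebraMap F L (v i)) = 0 →
      Φ.mulVec (fun i => algebraMap F L ((Polynomial.aeval g f).mulVec v i)) = 0 := by
    intro f v hv
    have hpow : ∀ n : ℕ, Φ.mulVec (fun i => algebraMap F L ((g ^ n).mulVec v i)) = 0 := by
      intro n
      induction n with
      | zero => simpa using hv
      | succ n ih => rw [pow_succ', ← Matrix.mulVec_mulVec]; exact stab _ ih
    induction f using Polynomial.induction_on' with
    | add a b ha hb => rw [map_add, Matrix.add_mulVec]; exact hadd _ _ ha hb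
    | monomial n a =>
      rw [Polynomial.aeval_monomial, Algebra.algebraMap_eq_smul_one, Matrix.smul_mul, Matrix.one_mul, Matrix.smul_mulVec]
      exact hsm _ _ (hpow n)
  by_cases hF : FI (F := F) L Φ
  · rw [if_pos hF]
    have hl0 : l = 0 := by
      have h1 : HoP p1 c g = 1 := by
        unfold HoP
        rw [Nat.card_eq_one_iff_unique]
        refine ⟨⟨fun A B => ?_⟩, ⟨⟨0, by simp [p1]⟩⟩⟩
        have hz : ∀ A : {A : Matrix ι δ F // g * A = A * c ∧ p1 A}, A.1 = 0 := by
          intro A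
          apply matrix_ext_mulVec
          intro v
          rw [Matrix.zero_mulVec]
          exact hF _ ((mul_map_zero_iff Φ A.1).mp A.2.2 v)
        exact Subtype.ext ((hz A).trans (hz B).symm)
      rw [h1] at hl'
      by_contra hne
      have := Nat.one_lt_pow hne (show 1 < Fintype.card F ^ Fintype.card δ by omega)
      omega
    rw [hl0]; simp
  · rw [if_neg hF]
    have hl0 : l ≠ 0 := by
      intro hl0
      rw [hl0, pow_zero] at hl'
      unfold FI at hF
      push Not at hF
      obtain ⟨v, hv, hv0⟩ := hF
      have hnil : (Polynomial.aeval g c.charpoly) ^ r = 0 := by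
        rw [← map_pow, ← hg, Matrix.aeval_self_charpoly]
      have hex : ∃ i, ((Polynomial.aeval g c.charpoly) ^ i).mulVec v = 0 := ⟨r, by rw [hnil, Matrix.zero_mulVec]⟩
      have hi := Nat.find_spec hex
      have hi0 : Nat.find hex ≠ 0 := by
        intro h; rw [h] at hi; simp at hi; exact hv0 hi
      obtain ⟨i, hi1⟩ := Nat.exists_eq_succ_of_ne_zero hi0
      have hmin := Nat.find_min hex (m := i) (by omega)
      rw [hi1, pow_succ', ← Matrix.mulVec_mulVec] at hi
      have hw : Φ.mulVec (fun k => algebraMap F L (((Polynomial.aeval g c.charpoly) ^ i).mulVec v k)) = 0 := by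
        rw [← map_pow]; exact spoly _ _ hv
      obtain ⟨A, e, he, hAe, hA⟩ := exists_intertwiner' hc g hi
      have hpA : p1 A := by
        refine (mul_map_zero_iff Φ A).mpr fun z => ?_
        refine irr_invariant hc (fun z => Φ.mulVec (fun i => algebraMap F L (A.mulVec z i)) = 0) ?_ ?_ ?_ ?_ he ?_ z
        · simp; exact Matrix.mulVec_zero _
        · intro x y hx hy; simp only [Matrix.mulVec_add]; exact hadd _ _ hx hy
        · intro a x hx; simp only [Matrix.mulVec_smul]; exact hsm _ _ hx
        · intro x hx
          rw [Matrix.mulVec_mulVec, ← hA, ← Matrix.mulVec_mulVec]; exact stab _ hx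
        · rw [hAe]; exact hw
      unfold HoP at hl'
      rw [Nat.card_eq_one_iff_unique] at hl'
      have := hl'.1
      have := Subsingleton.elim (⟨A, hA, hpA⟩ : {A : Matrix ι δ F // g * A = A * c ∧ p1 A}) ⟨0, by simp [p1]⟩
      have hA0 : A = 0 := congrArg Subtype.val this
      rw [hA0, Matrix.zero_mulVec] at hAe
      exact hmin hAe.symm
    exact Finset.prod_eq_zero (Finset.mem_range.mpr (Nat.pos_of_ne_zero hl0)) (by simp)

lemma lf_le_r {c : Matrix δ δ F} (hc : Irreducible c.charpoly) {g : Matrix ι ι F} {r : ℕ}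
    (hg : g.charpoly = c.charpoly ^ r) : lf c g ≤ r := by
  by_contra hcon
  push Not at hcon
  have hd := nonempty_of_irr hc
  have h1 := Fr_hz_zero_of_lt c g (lf c g) (by
    rw [prim_card hg]; exact Nat.mul_lt_mul_of_pos_left hcon Fintype.card_pos)
  have h2 := Fr_lf hc g (lf c g)
  rw [h1, Nat.cast_zero] at h2
  exact glc_ne (two_le_Q hc) (lf c g) h2.symm

lemma cntInj {c : Matrix δ δ F} (hc : Irreducible c.charpoly) {g : Matrix ι ι F} {r : ℕ}
    (hg : g.charpoly = c.charpoly ^ r) {n : ℕ} (hn : 1 ≤ n) (hcard : Fintype.card ι ≤ n) {t : L} (ht : Polynomial.aeval t c.charpoly = 0)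
    (ht0 : t ≠ 0) :
    (Nat.card {Φ : Matrix (Fin n) ι L // FI (F := F) L Φ ∧ Φ * g.map (algebraMap F L) = t • (Jn L n * Φ)} : ℂ)
      = (Fintype.card L : ℂ) ^ r * ∏ i ∈ Finset.range (lf c g),
        (1 - ((Fintype.card F ^ Fintype.card δ : ℕ) : ℂ) ^ i * (Fintype.card L : ℂ)⁻¹) := by
  classical
  have hL0 : (Fintype.card L : ℂ) ≠ 0 := by simp
  have e0 : ∀ (j : ℕ) (A : Matrix ι (Pw δ j) F), Function.Injective A.mulVec ∧ g * A = A * hz c j →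
      ((Nat.card {Φ : Matrix (Fin n) ι L // Φ * g.map (algebraMap F L) = t • (Jn L n * Φ) ∧
        Φ * A.map (algebraMap F L) = 0} : ℕ) : ℂ) = (Fintype.card L : ℂ) ^ r * ((Fintype.card L : ℂ)⁻¹) ^ j := by
    rintro j A ⟨hA, hgA⟩
    obtain ⟨m, x, hx, hcnt⟩ := HoLA n t g A hA (hz c j) hgA
    rw [hcnt]
    rw [hg, charpoly_hz] at hx
    obtain ⟨r', hr'⟩ := pow_dvd_aux hc (Matrix.charpoly_monic c) (Matrix.charpoly_monic x) hx.symm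
    rw [hr', ← pow_add] at hx
    have hd := nonempty_of_irr hc
    have hrr : r = j + r' := by
      have := congrArg Polynomial.natDegree hx
      rw [(Matrix.charpoly_monic c).natDegree_pow, (Matrix.charpoly_monic c).natDegree_pow,
        Matrix.charpoly_natDegree_eq_dim] at this
      exact Nat.eq_of_mul_eq_mul_right Fintype.card_pos this
    have hm : Fintype.card (Fin m) ≤ n := by
      rw [prim_card hr']
      refine le_trans ?_ hcard
      rw [prim_card hg, hrr]
      exact Nat.mul_le_mul_left _ (by omega)
    rw [cntHom n hn x hc hr' ht ht0 hm, hrr, pow_add, Nat.cast_pow, inv_pow, mul_right_comm, mul_inv_cancel₀ (pow_ne_zero _ hL0), one_mul]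
  rw [cardS]
  have e1 : ∀ Φ : Matrix (Fin n) ι L, (if FI (F := F) L Φ ∧ Φ * g.map (algebraMap F L) = t • (Jn L n * Φ) then (1 : ℂ) else 0) =
      ∑ j ∈ Finset.range (Fintype.card ι + 1), qe ((Fintype.card F ^ Fintype.card δ : ℕ) : ℂ) j *
       ∑ A : Matrix ι (Pw δ j) F, (if Function.Injective A.mulVec ∧ g * A = A * hz c j then
        (if Φ * g.map (algebraMap F L) = t • (Jn L n * Φ) ∧ Φ * A.map (algebraMap F L) = 0 then (1:ℂ) else 0) else 0) := by
    intro Φ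
    by_cases hΦ : Φ * g.map (algebraMap F L) = t • (Jn L n * Φ)
    · simp only [hΦ, and_true, true_and]
      rw [← sum_qe_FI hc hg hΦ]
      refine Finset.sum_congr rfl fun j _ => ?_
      rw [FrP, cardS]
      congr 1
      refine Finset.sum_congr rfl fun A _ => ?_
      rw [← ite_and]
      congr
    · simp [hΦ]
  refine (Finset.sum_congr rfl fun Φ _ => (Eq.trans (by congr) (e1 Φ))).trans ?_
  rw [Finset.sum_comm]
  have e2 := qS_eq ((Fintype.card F ^ Fintype.card δ : ℕ) : ℂ) (one_sub_pow_ne (two_le_Q hc)) (lf c g) (Fintype.card ι + 1)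
    (by have := lf_le hc g; omega) (Fintype.card L : ℂ)⁻¹
  rw [← e2, Finset.mul_sum]
  refine Finset.sum_congr rfl fun j _ => ?_
  rw [← Finset.mul_sum, Finset.sum_comm, ← Fr_lf hc, Fr, cardS]
  rw [mul_assoc, mul_left_comm]
  congr 1
  rw [Finset.mul_sum, Finset.mul_sum]
  refine Finset.sum_congr rfl fun A _ => ?_
  by_cases hA : Function.Injective A.mulVec ∧ g * A = A * hz c j
  · simp only [if_pos hA]
    rw [mul_one, ← e0 j A hA, cardS]
    refine Finset.sum_congr rfl fun A _ => ?_
    congr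
  · simp only [if_neg hA]; simp

end MK

end

section
open scoped BigOperators
namespace MK

variable {F : Type} [Field F] [Fintype F] [DecidableEq F]
variable {ι μ δ ν κ : Type} [Fintype ι] [Fintype μ] [Fintype δ] [Fintype ν] [Fintype κ]
  [DecidableEq ι] [DecidableEq μ] [DecidableEq δ] [DecidableEq ν] [DecidableEq κ]
variable {L : Type} [Field L] [Fintype L] [DecidableEq L] [Algebra F L]

lemma charpoly_of_nilp {P : Polynomial F} (hP : Irreducible P) (hPm : P.Monic) (g : Matrix ι ι F) {n : ℕ}
    (h : (Polynomial.aeval g P) ^ n = 0) : ∃ r, g.charpoly = P ^ r := by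
  have hcm := Matrix.charpoly_monic g
  have hfin : FiniteMultiplicity P g.charpoly :=
    FiniteMultiplicity.of_not_isUnit hP.not_isUnit hcm.ne_zero
  obtain ⟨S, hS, hnd⟩ := hfin.exists_eq_pow_mul_and_not_dvd
  set r := multiplicity P g.charpoly
  refine ⟨r, ?_⟩
  have hSm : S.Monic := (hPm.pow r).of_mul_monic_left (hS ▸ hcm)
  have hSu : IsUnit S := by
    by_contra hu
    obtain ⟨R, hR, hRS⟩ := WfDvdMonoid.exists_irreducible_factor hu hSm.ne_zero
    apply hnd
    refine dvd_trans ?_ hRS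
    obtain ⟨z, hz⟩ := IsAlgClosed.exists_aeval_eq_zero (AlgebraicClosure F) R (by
      have := hR.natDegree_pos
      intro h0
      rw [Polynomial.natDegree_eq_of_degree_eq_some h0] at this
      exact lt_irrefl _ this)
    let a := algebraMap F (AlgebraicClosure F)
    have hroot : (g.map a).charpoly.IsRoot z := by
      rw [Matrix.charpoly_map, Polynomial.IsRoot, Polynomial.eval_map_algebraMap]
      have : R ∣ g.charpoly := hRS.trans (by conv_rhs => rw [hS]
                                             exact dvd_mul_left _ _)
      obtain ⟨w, hw⟩ := this
      rw [hw, map_mul, hz, zero_mul]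
    have hsp : z ∈ spectrum (AlgebraicClosure F) (g.map a) := Matrix.mem_spectrum_iff_isRoot_charpoly.mpr hroot
    have hsp2 := spectrum.subset_polynomial_aeval (g.map a) ((P ^ n).map a) ⟨z, hsp, rfl⟩
    have h0 : Polynomial.aeval (g.map a) ((P ^ n).map a) = 0 := by
      have e1 : g.map a = a.mapMatrix g := rfl
      rw [e1, Polynomial.aeval_def, Polynomial.eval₂_map]
      have e2 := Polynomial.hom_eval₂ (P ^ n) (algebraMap F (Matrix ι ι F)) (a.mapMatrix (m := ι)) g
      have e3 : (a.mapMatrix (m := ι)).comp (algebraMap F (Matrix ι ι F)) = (algebraMap (AlgebraicClosure F) (Matrix ι ι (AlgebraicClosure F))).comp a := by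
        ext x i j
        simp [Matrix.algebraMap_matrix_apply, apply_ite a]
      rw [e3] at e2
      rw [← e2, ← Polynomial.aeval_def, map_pow, h, map_zero]
    rw [h0] at hsp2
    have hPz : Polynomial.aeval z P = 0 := by
      have hne : Nontrivial (Matrix ι ι (AlgebraicClosure F)) := by
        by_contra hn
        rw [not_nontrivial_iff_subsingleton] at hn
        have := spectrum.of_subsingleton (R := AlgebraicClosure F) (g.map a)
        rw [this] at hsp
        exact hsp
      rw [spectrum.zero_eq, Set.mem_singleton_iff] at hsp2
      simp only [Polynomial.map_pow, Polynomial.eval_pow] at hsp2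
      have := eq_zero_of_pow_eq_zero hsp2
      rwa [Polynomial.eval_map_algebraMap] at this
    have h1 := minpoly.dvd F z hPz
    have h2 := minpoly.dvd F z hz
    have hni : ¬ IsUnit (minpoly F z) := minpoly.not_isUnit F z
    have a1 := (hP.dvd_iff.mp h1).resolve_left hni
    have a2 := (hR.dvd_iff.mp h2).resolve_left hni
    exact (a1.trans a2.symm).dvd
  rw [hS, hSm.eq_one_of_isUnit hSu, mul_one]

lemma Jn_charpoly (t : L) (n : ℕ) : (t • Jn L n).charpoly = (Polynomial.X - Polynomial.C t) ^ n := by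
  rw [Matrix.charpoly_of_upperTriangular]
  · simp [Jn]
  · intro i j hij
    simp only [Jn, Matrix.smul_apply, Matrix.of_apply]
    simp only [id] at hij
    have h1 : ¬ i = j := by rintro rfl; exact lt_irrefl _ hij
    have h2 : ¬ (i : ℕ) + 1 = j := by
      intro h
      have : (j : ℕ) < i := hij
      omega
    simp [h1, h2]

lemma FI_prim {n : ℕ} {t : L} {g : Matrix ι ι F} {Φ : Matrix (Fin n) ι L} (hF : FI (F := F) L Φ)
    (hΦ : Φ * g.map (algebraMap F L) = t • (Jn L n * Φ)) : ∃ r, g.charpoly = (minpoly F t) ^ r := by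
  have ht : IsIntegral F t := Algebra.IsIntegral.isIntegral t
  apply charpoly_of_nilp (minpoly.irreducible ht) (minpoly.monic ht) g (n := n)
  let a := algebraMap F L
  have h1 : ∀ f : Polynomial F, Φ * (Polynomial.aeval g f).map a = (Polynomial.aeval (t • Jn L n) f) * Φ := by
    intro f
    have hpow : ∀ m : ℕ, Φ * (g ^ m).map a = (t • Jn L n) ^ m * Φ := by
      intro m
      induction m with
      | zero => simp
      | succ m ih =>
        rw [pow_succ, Matrix.map_mul, ← Matrix.mul_assoc, ih, Matrix.mul_assoc, hΦ, ← Matrix.smul_mul, ← Matrix.mul_assoc,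
          pow_succ]
    induction f using Polynomial.induction_on' with
    | add p q hp hq =>
      rw [map_add, map_add, Matrix.add_mul, ← hp, ← hq, ← Matrix.mul_add]
      congr 1
      ext; simp
    | monomial m b =>
      have e1 : (Polynomial.aeval g) (Polynomial.monomial m b) = b • g ^ m := by
        rw [Polynomial.aeval_monomial, ← Algebra.smul_def]
      have e2 : (Polynomial.aeval (t • Jn L n)) (Polynomial.monomial m b) = b • (t • Jn L n) ^ m := by
        rw [Polynomial.aeval_monomial, ← Algebra.smul_def]
      rw [e1, e2, Matrix.smul_mul, ← hpow]
      ext i j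
      simp only [Matrix.mul_apply, Matrix.smul_apply, Matrix.map_apply, Finset.smul_sum]
      refine Finset.sum_congr rfl fun k _ => ?_
      rw [smul_eq_mul, map_mul, Algebra.smul_def]
      ring
  have h2 : Polynomial.aeval (t • Jn L n) ((minpoly F t) ^ n) = 0 := by
    have hd : (Polynomial.X - Polynomial.C t) ^ n ∣ ((minpoly F t) ^ n).map a := by
      rw [Polynomial.map_pow]
      apply pow_dvd_pow_of_dvd
      rw [Polynomial.dvd_iff_isRoot, Polynomial.IsRoot, Polynomial.eval_map_algebraMap, minpoly.aeval]
    obtain ⟨w, hw⟩ := hd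
    rw [← Polynomial.aeval_map_algebraMap L, hw, map_mul, ← Jn_charpoly, Matrix.aeval_self_charpoly, zero_mul]
  rw [← map_pow]
  have h3 := h1 ((minpoly F t) ^ n)
  rw [h2, Matrix.zero_mul, mul_map_zero_iff] at h3
  apply matrix_ext_mulVec
  intro v
  rw [Matrix.zero_mulVec]
  exact hF _ (h3 v)

end MK

end

section
open scoped BigOperators
namespace MK

variable {F : Type} [Field F] [Fintype F] [DecidableEq F]
variable {ι μ δ ν κ : Type} [Fintype ι] [Fintype μ] [Fintype δ] [Fintype ν] [Fintype κ]
  [DecidableEq ι] [DecidableEq μ] [DecidableEq δ] [DecidableEq ν] [DecidableEq κ]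
variable {L : Type} [Field L] [Fintype L] [DecidableEq L] [Algebra F L]
variable {E : Type} [Field E] [Fintype E] [DecidableEq E] [Algebra F E]

lemma exists_comp {P : Polynomial F} (hP : Irreducible P) (hm : P.Monic) :
    ∃ c : Matrix (Fin P.natDegree) (Fin P.natDegree) F, c.charpoly = P := by
  have : Fact (Irreducible P) := ⟨hP⟩
  let h := AdjoinRoot.powerBasis hP.ne_zero
  have h1 : h.dim = P.natDegree := AdjoinRoot.powerBasis_dim _
  have h2 := charpoly_leftMulMatrix h
  have h3 : minpoly F h.gen = P := by
    rw [AdjoinRoot.powerBasis_gen, AdjoinRoot.minpoly_root hP.ne_zero, hm.leadingCoeff]; simp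
  rw [h3] at h2
  refine ⟨Matrix.reindex (finCongr h1) (finCongr h1) (Algebra.leftMulMatrix h.basis h.gen), ?_⟩
  rw [Matrix.charpoly_reindex, h2]

/-- a matrix with characteristic polynomial the minimal polynomial of `ξ`. -/
noncomputable def cx (F : Type) [Field F] [Fintype F] [DecidableEq F] {E : Type} [Field E] [Fintype E] [Algebra F E] (ξ : E) :
    Matrix (Fin (minpoly F ξ).natDegree) (Fin (minpoly F ξ).natDegree) F :=
  Classical.choose (exists_comp (minpoly.irreducible (Algebra.IsIntegral.isIntegral (R := F) ξ))
    (minpoly.monic (Algebra.IsIntegral.isIntegral (R := F) ξ)))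

lemma cx_charpoly (ξ : E) : (cx F ξ).charpoly = minpoly F ξ :=
  Classical.choose_spec (exists_comp (minpoly.irreducible (Algebra.IsIntegral.isIntegral (R := F) ξ))
    (minpoly.monic (Algebra.IsIntegral.isIntegral (R := F) ξ)))

lemma cx_irr (ξ : E) : Irreducible (cx F ξ).charpoly := by
  rw [cx_charpoly]; exact minpoly.irreducible (Algebra.IsIntegral.isIntegral (R := F) ξ)

lemma cx_inv {ξ : E} (h : ξ ≠ 0) : ∃ c', cx F ξ * c' = 1 := by
  have hd : (cx F ξ).det ≠ 0 := by
    rw [Matrix.det_eq_sign_charpoly_coeff, cx_charpoly]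
    apply mul_ne_zero (pow_ne_zero _ (by simp))
    exact minpoly.coeff_zero_ne_zero (Algebra.IsIntegral.isIntegral (R := F) ξ) h
  exact ⟨(cx F ξ)⁻¹, Matrix.mul_nonsing_inv _ (Ne.isUnit hd)⟩

lemma deg_dvd (ξ : E) : (minpoly F ξ).natDegree ∣ Module.finrank F E :=
  minpoly.degree_dvd (Algebra.IsIntegral.isIntegral (R := F) ξ)

lemma root_in_E [Algebra E L] [IsScalarTower F E L] {t : L}
    (h : (minpoly F t).natDegree ∣ Module.finrank F E) : ∃ ξ : E, algebraMap E L ξ = t := by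
  have hi := minpoly.irreducible (Algebra.IsIntegral.isIntegral (R := F) t)
  have h1 := hi.natDegree_dvd_iff_dvd_X_pow_card_pow_sub_X.mp h
  obtain ⟨w, hw⟩ := h1
  have h2 := congrArg (Polynomial.aeval t) hw
  rw [map_mul, minpoly.aeval, zero_mul] at h2
  have hc : Nat.card F ^ Module.finrank F E = Fintype.card E := by
    rw [← Nat.card_eq_fintype_card, Module.natCard_eq_pow_finrank (K := F) (V := E)]
  rw [hc] at h2
  have h4 : (Polynomial.X ^ Fintype.card E - Polynomial.X : Polynomial E).Monic := by
    apply Polynomial.monic_X_pow_sub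
    rw [Polynomial.degree_X]
    exact_mod_cast Fintype.one_lt_card
  have h3 := Polynomial.prod_multiset_X_sub_C_of_monic_of_roots_card_eq h4 (by
    rw [FiniteField.roots_X_pow_card_sub_X, FiniteField.X_pow_card_sub_X_natDegree_eq _ Fintype.one_lt_card]
    rfl)
  rw [FiniteField.roots_X_pow_card_sub_X] at h3
  have h5 := congrArg (Polynomial.aeval t) h3
  have h6 : (∏ ξ : E, (t - algebraMap E L ξ)) = 0 := by
    have e : (Polynomial.aeval t) (∏ ξ : E, (Polynomial.X - Polynomial.C ξ)) = ∏ ξ : E, (t - algebraMap E L ξ) := by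
      simp
    rw [← e]
    refine h5.trans ?_
    simpa using h2
  obtain ⟨ξ, -, hξ⟩ := Finset.prod_eq_zero_iff.mp h6
  exact ⟨ξ, (sub_eq_zero.mp hξ).symm⟩

end MK

end

section
open scoped BigOperators
namespace MK

variable {F : Type} [Field F] [Fintype F] [DecidableEq F]
variable {ι μ δ ν κ : Type} [Fintype ι] [Fintype μ] [Fintype δ] [Fintype ν] [Fintype κ]
  [DecidableEq ι] [DecidableEq μ] [DecidableEq δ] [DecidableEq ν] [DecidableEq κ]
variable {L : Type} [Field L] [Fintype L] [DecidableEq L] [Algebra F L]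
variable {E : Type} [Field E] [Fintype E] [DecidableEq E] [Algebra F E]

open Classical in
/-- the interpolating polynomial -/
noncomputable def pE (ξ : E) (g : Matrix ι ι F) : Polynomial ℂ :=
  if prim (cx F ξ) g then
    Polynomial.X ^ (Fintype.card ι / (minpoly F ξ).natDegree - lf (cx F ξ) g) *
      ∏ i ∈ Finset.range (lf (cx F ξ) g - 1), (Polynomial.X - Polynomial.C
        (((Fintype.card F ^ Fintype.card (Fin (minpoly F ξ).natDegree) : ℕ) : ℂ) ^ (i + 1)))
  else 0

lemma pE_one (ξ : E) (g : Matrix ι ι F) : (pE ξ g).eval 1 = DD (cx F ξ) g := by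
  unfold pE DD
  by_cases h : prim (cx F ξ) g
  · rw [if_pos h, if_pos h, Polynomial.eval_mul, Polynomial.eval_pow, Polynomial.eval_X, one_pow, one_mul,
      Polynomial.eval_prod]
    simp [qD]
  · rw [if_neg h, if_neg h, Polynomial.eval_zero]

lemma pE_deg [Nonempty ι] (ξ : E) (g : Matrix ι ι F) : (pE ξ g).natDegree < Fintype.card ι := by
  unfold pE
  by_cases h : prim (cx F ξ) g
  · rw [if_pos h]
    have h1 := lf_pos (cx_irr ξ) h
    obtain ⟨r, hr⟩ := h
    have h2 := lf_le_r (cx_irr ξ) hr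
    have h3 : Fintype.card ι = r * (minpoly F ξ).natDegree := by
      have := congrArg Polynomial.natDegree hr
      rw [cx_charpoly, Polynomial.natDegree_pow, Matrix.charpoly_natDegree_eq_dim] at this
      exact this
    have h4 : 0 < (minpoly F ξ).natDegree := minpoly.natDegree_pos (Algebra.IsIntegral.isIntegral (R := F) ξ)
    have h5 : Fintype.card ι / (minpoly F ξ).natDegree = r := by
      rw [h3, Nat.mul_div_cancel _ h4]
    have h6 : r ≤ Fintype.card ι := by rw [h3]; exact Nat.le_mul_of_pos_right _ h4
    rw [h5]
    refine lt_of_le_of_lt (Polynomial.natDegree_mul_le) ?_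
    rw [Polynomial.natDegree_X_pow, Polynomial.natDegree_finset_prod_X_sub_C_eq_card, Finset.card_range]
    omega
  · rw [if_neg h, Polynomial.natDegree_zero]; exact Fintype.card_pos

lemma pE_cnt [Nonempty ι] [Algebra E L] [IsScalarTower F E L] {ξ : E} (h0 : ξ ≠ 0) (g : Matrix ι ι F) {n : ℕ}
    (hn : n = Fintype.card ι) :
    (Nat.card {Φ : Matrix (Fin n) ι L // FI (F := F) L Φ ∧ Φ * g.map (algebraMap F L) = algebraMap E L ξ • (Jn L n * Φ)} : ℂ)
      = ((Fintype.card L : ℂ) - 1) * (pE ξ g).eval (Fintype.card L : ℂ) := by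
  have hmin : minpoly F (algebraMap E L ξ) = minpoly F ξ := by
    rw [minpoly.algebraMap_eq (algebraMap E L).injective]
  by_cases h : prim (cx F ξ) g
  · have h1 := lf_pos (cx_irr ξ) h
    unfold pE
    rw [if_pos h]
    obtain ⟨r, hr⟩ := h
    have h2 := lf_le_r (cx_irr ξ) hr
    have h3 : Fintype.card ι = r * (minpoly F ξ).natDegree := by
      have := congrArg Polynomial.natDegree hr
      rw [cx_charpoly, Polynomial.natDegree_pow, Matrix.charpoly_natDegree_eq_dim] at this
      exact this
    have h4 : 0 < (minpoly F ξ).natDegree := minpoly.natDegree_pos (Algebra.IsIntegral.isIntegral (R := F) ξ)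
    have h5 : Fintype.card ι / (minpoly F ξ).natDegree = r := by
      rw [h3, Nat.mul_div_cancel _ h4]
    rw [cntInj (cx_irr ξ) hr (by rw [hn]; exact Fintype.card_pos) hn.ge (by
      rw [cx_charpoly, ← hmin, minpoly.aeval]) (by simpa using h0)]
    have hQ : (Fintype.card L : ℂ) ≠ 0 := by exact_mod_cast Fintype.card_ne_zero
    rw [h5]
    obtain ⟨l, hl⟩ : ∃ l, lf (cx F ξ) g = l + 1 := ⟨_, (Nat.sub_add_cancel h1).symm⟩
    rw [hl] at h2 ⊢
    obtain ⟨m, rfl⟩ := Nat.exists_eq_add_of_le h2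
    simp only [Polynomial.eval_mul, Polynomial.eval_pow, Polynomial.eval_X, Polynomial.eval_prod, Polynomial.eval_sub,
      Polynomial.eval_C]
    rw [Finset.prod_range_succ', Nat.add_sub_cancel_left, Nat.add_sub_cancel, pow_zero, one_mul]
    have e : ∏ i ∈ Finset.range l, ((Fintype.card L : ℂ) - ((Fintype.card F ^ Fintype.card (Fin (minpoly F ξ).natDegree) : ℕ) : ℂ) ^ (i + 1))
        = (Fintype.card L : ℂ) ^ l * ∏ i ∈ Finset.range l, (1 - ((Fintype.card F ^ Fintype.card (Fin (minpoly F ξ).natDegree) : ℕ) : ℂ) ^ (i + 1) * (Fintype.card L : ℂ)⁻¹) := by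
      conv_rhs => rw [← Finset.card_range l, ← Finset.prod_const, Finset.card_range, ← Finset.prod_mul_distrib]
      refine Finset.prod_congr rfl fun i _ => ?_
      field_simp
    rw [e]
    rw [pow_add, pow_succ]
    field_simp
  · unfold pE
    rw [if_neg h, Polynomial.eval_zero, mul_zero, Nat.cast_eq_zero, Nat.card_eq_zero]
    left
    refine ⟨fun ⟨Φ, h1, h2⟩ => h ?_⟩
    obtain ⟨r, hr⟩ := FI_prim h1 h2
    exact ⟨r, by rw [hr, cx_charpoly, hmin]⟩

end MK

end

section
open scoped BigOperators
namespace MK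

variable {F : Type} [Field F] [Fintype F] [DecidableEq F]
variable {ι μ δ ν κ : Type} [Fintype ι] [Fintype μ] [Fintype δ] [Fintype ν] [Fintype κ]
  [DecidableEq ι] [DecidableEq μ] [DecidableEq δ] [DecidableEq ν] [DecidableEq κ]
variable {L : Type} [Field L] [Fintype L] [DecidableEq L] [Algebra F L]
variable {E : Type} [Field E] [Fintype E] [DecidableEq E] [Algebra F E]

lemma Jn_det (n : ℕ) : (Jn L n).det ≠ 0 := by
  have h := Jn_charpoly (1 : L) n
  rw [one_smul] at h
  rw [Matrix.det_eq_sign_charpoly_coeff, h, Polynomial.coeff_zero_eq_eval_zero]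
  simp

/-- action -/
noncomputable def piX (F : Type) [Field F] [Fintype F] [DecidableEq F] (ι : Type) [Fintype ι] [DecidableEq ι]
    (L : Type) [Field L] [Fintype L] [DecidableEq L] [Algebra F L] (n : ℕ) :
    ((Matrix ι ι F)ˣ × Lˣ) →* Function.End {Φ : Matrix (Fin n) ι L // FI (F := F) L Φ} where
  toFun h := fun Φ => ⟨(h.2 : L) • (Φ.1 * ((h.1⁻¹ : (Matrix ι ι F)ˣ) : Matrix ι ι F).map (algebraMap F L)), by
    intro v hv
    rw [Matrix.smul_mulVec] at hv
    have h1 := (smul_eq_zero.mp hv).resolve_left h.2.ne_zero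
    rw [← mulVec_alg] at h1
    have h2 := Φ.2 _ h1
    have h3 := congrArg (Matrix.mulVec (h.1 : Matrix ι ι F)) h2
    rw [Matrix.mulVec_mulVec, Units.mul_inv, Matrix.one_mulVec, Matrix.mulVec_zero] at h3
    exact h3⟩
  map_one' := by
    funext Φ
    apply Subtype.ext
    show ((1 : Lˣ) : L) • (Φ.1 * _) = Φ.1
    simp
  map_mul' h h' := by
    funext Φ
    apply Subtype.ext
    show _ = (h.2 : L) • (((h'.2 : L) • (Φ.1 * _)) * _)
    simp only [Prod.fst_mul, Prod.snd_mul, mul_inv_rev, Units.val_mul, Matrix.map_mul, Matrix.smul_mul, smul_smul,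
      Matrix.mul_assoc]

/-- the commuting unipotent -/
noncomputable def tauX (F : Type) [Field F] [Fintype F] [DecidableEq F] (ι : Type) [Fintype ι] [DecidableEq ι]
    (L : Type) [Field L] [Fintype L] [DecidableEq L] [Algebra F L] (n : ℕ) :
    Equiv.Perm {Φ : Matrix (Fin n) ι L // FI (F := F) L Φ} :=
  Equiv.ofBijective (fun Φ => ⟨Jn L n * Φ.1, by
    intro v hv
    rw [← Matrix.mulVec_mulVec] at hv
    exact Φ.2 _ (Matrix.eq_zero_of_mulVec_eq_zero (Jn_det n) hv)⟩) (by
    rw [← Finite.injective_iff_bijective]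
    intro Φ Φ' h
    have h1 : Jn L n * Φ.1 = Jn L n * Φ'.1 := congrArg Subtype.val h
    apply Subtype.ext
    have hu : IsUnit (Jn L n).det := (Jn_det n).isUnit
    have := congrArg (fun A => (Jn L n)⁻¹ * A) h1
    simpa [← Matrix.mul_assoc, Matrix.nonsing_inv_mul _ hu] using this)

/-- scalar twist of a representation -/
noncomputable def sigX {G m : Type} [Group G] [Fintype m] [DecidableEq m] (ρ : G →* Matrix m m ℂ) (θ : Lˣ →* ℂˣ) : (G × Lˣ) →* Matrix m m ℂ where
  toFun h := (θ h.2 : ℂ) • ρ h.1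
  map_one' := by simp
  map_mul' h h' := by
    simp [Matrix.smul_mul, Matrix.mul_smul, smul_smul, mul_comm]

lemma Xi_int [Nonempty ι] [Algebra E L] [IsScalarTower F E L] (hE : Module.finrank F E = Fintype.card ι)
    (θ : Eˣ →* ℂˣ) (θ' : Lˣ →* ℂˣ) (hθ : ∀ u, θ' (Units.map (algebraMap E L : E →* L) u) = θ u) {m : ℕ}
    (ρ : (Matrix ι ι F)ˣ →* Matrix (Fin m) (Fin m) ℂ) :
    IsIntegral ℤ ((∑ g : (Matrix ι ι F)ˣ, (∑ u : Eˣ, (θ u : ℂ) * (pE (u : E) (g : Matrix ι ι F)).eval (Fintype.card L : ℂ)) *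
      (ρ g).trace) / Fintype.card (Matrix ι ι F)ˣ) := by
  classical
  set n := Fintype.card ι with hn
  have h := int_trace ((piX F ι L n).toHomPerm) (tauX F ι L n) (by
    intro h
    ext Φ : 2
    show (h.2 : L) • ((Jn L n * Φ.1) * _) = Jn L n * ((h.2 : L) • (Φ.1 * _))
    rw [Matrix.mul_smul, Matrix.mul_assoc]) (sigX ρ θ')
  have hfix : ∀ (g : (Matrix ι ι F)ˣ) (t : Lˣ), (Finset.univ.filter (fun x => (piX F ι L n).toHomPerm (g, t) (tauX F ι L n x) = x)).card
      = Nat.card {Φ : Matrix (Fin n) ι L // FI (F := F) L Φ ∧ Φ * (g : Matrix ι ι F).map (algebraMap F L) = (t : L) • (Jn L n * Φ)} := by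
    intro g t
    rw [← Fintype.card_subtype, ← Nat.card_eq_fintype_card]
    apply Nat.card_congr
    refine (Equiv.subtypeEquivRight ?_).trans (Equiv.subtypeSubtypeEquivSubtypeInter (fun Φ => FI (F := F) L Φ) (fun Φ => Φ * (g : Matrix ι ι F).map (algebraMap F L) = (t : L) • (Jn L n * Φ)))
    rintro ⟨Φ, hΦ⟩
    rw [Subtype.ext_iff]
    show (t : L) • ((Jn L n * Φ) * ((g⁻¹ : (Matrix ι ι F)ˣ) : Matrix ι ι F).map (algebraMap F L)) = Φ ↔ Φ * (g : Matrix ι ι F).map (algebraMap F L) = (t : L) • (Jn L n * Φ)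
    constructor
    · intro hh
      conv_lhs => rw [← hh]
      rw [Matrix.smul_mul, Matrix.mul_assoc, ← Matrix.map_mul, Units.inv_mul]
      simp
    · intro hh
      rw [← Matrix.smul_mul, ← hh, Matrix.mul_assoc, ← Matrix.map_mul, Units.mul_inv]
      simp
  have key : ∀ g : (Matrix ι ι F)ˣ, ∑ t : Lˣ, (Nat.card {Φ : Matrix (Fin n) ι L // FI (F := F) L Φ ∧ Φ * (g : Matrix ι ι F).map (algebraMap F L) = (t : L) • (Jn L n * Φ)} : ℂ) * (θ' t : ℂ)
      = ((Fintype.card L : ℂ) - 1) * ∑ u : Eˣ, (θ u : ℂ) * (pE (u : E) (g : Matrix ι ι F)).eval (Fintype.card L : ℂ) := by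
    intro g
    have hinj : Function.Injective (Units.map (algebraMap E L : E →* L)) := Units.map_injective (algebraMap E L).injective
    rw [Finset.mul_sum]
    symm
    rw [← Finset.sum_subset (Finset.subset_univ (Finset.univ.image (Units.map (algebraMap E L : E →* L)))),
      Finset.sum_image (fun a _ b _ h => hinj h)]
    · refine Finset.sum_congr rfl fun u _ => ?_
      have e := pE_cnt (L := L) (ξ := (u : E)) u.ne_zero (g : Matrix ι ι F) hn
      rw [hθ]
      have e2 : ((Units.map (algebraMap E L : E →* L) u : Lˣ) : L) = algebraMap E L (u : E) := rfl
      rw [e2, e]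
      ring
    · intro t _ ht
      have : IsEmpty {Φ : Matrix (Fin n) ι L // FI (F := F) L Φ ∧ Φ * (g : Matrix ι ι F).map (algebraMap F L) = (t : L) • (Jn L n * Φ)} := by
        refine ⟨fun ⟨Φ, h1, h2⟩ => ht ?_⟩
        obtain ⟨r, hr⟩ := FI_prim h1 h2
        have hd := congrArg Polynomial.natDegree hr
        rw [Polynomial.natDegree_pow, Matrix.charpoly_natDegree_eq_dim] at hd
        obtain ⟨ξ, hξ⟩ := root_in_E (F := F) (E := E) (t := (t : L)) (by rw [hE, hn, hd]; exact dvd_mul_left _ _)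
        have hξ0 : ξ ≠ 0 := by
          rintro rfl
          rw [map_zero] at hξ
          exact t.ne_zero hξ.symm
        rw [Finset.mem_image]
        exact ⟨Units.mk0 ξ hξ0, Finset.mem_univ _, Units.ext hξ⟩
      rw [Nat.card_of_isEmpty]
      simp
  have hQ : ((Fintype.card L : ℂ) - 1) ≠ 0 := by
    have : 1 < Fintype.card L := Fintype.one_lt_card
    rw [sub_ne_zero]
    exact_mod_cast this.ne'
  have hcL : (Fintype.card Lˣ : ℂ) = (Fintype.card L : ℂ) - 1 := by
    rw [Fintype.card_units, Nat.cast_sub Fintype.card_pos, Nat.cast_one]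
  convert h using 1
  rw [Fintype.card_prod, Nat.cast_mul, hcL, Fintype.sum_prod_type]
  have : ∀ g : (Matrix ι ι F)ˣ, ∑ t : Lˣ, ((Finset.univ.filter (fun x => (piX F ι L n).toHomPerm (g, t) (tauX F ι L n x) = x)).card : ℂ) * (sigX ρ θ' (g, t)).trace
     = ((Fintype.card L : ℂ) - 1) * ((∑ u : Eˣ, (θ u : ℂ) * (pE (u : E) (g : Matrix ι ι F)).eval (Fintype.card L : ℂ)) * (ρ g).trace) := by
    intro g
    rw [← mul_assoc, ← key, Finset.sum_mul]
    refine Finset.sum_congr rfl fun t _ => ?_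
    rw [hfix]
    show _ * ((θ' t : ℂ) • ρ g).trace = _
    rw [Matrix.trace_smul, smul_eq_mul, mul_assoc]
  rw [Finset.sum_congr rfl fun g _ => this g, ← Finset.mul_sum]
  field_simp

end MK

end

section
open scoped BigOperators
namespace MK

variable {F : Type} [Field F] [Fintype F] [DecidableEq F]
variable {ι μ δ ν κ : Type} [Fintype ι] [Fintype μ] [Fintype δ] [Fintype ν] [Fintype κ]
  [DecidableEq ι] [DecidableEq μ] [DecidableEq δ] [DecidableEq ν] [DecidableEq κ]
variable {E : Type} [Field E] [Fintype E] [DecidableEq E] [Algebra F E]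

lemma card_glc : (Fintype.card (Matrix ι ι F)ˣ : ℂ) = glc (Fintype.card F) (Fintype.card ι) := by
  let e := Fintype.equivFin ι
  have h1 : Fintype.card (Matrix ι ι F)ˣ = Nat.card (Matrix (Fin (Fintype.card ι)) (Fin (Fintype.card ι)) F)ˣ := by
    rw [← Nat.card_eq_fintype_card]
    exact Nat.card_congr (Units.mapEquiv (Matrix.reindexAlgEquiv F F e).toMulEquiv).toEquiv
  have h2 := Matrix.card_GL_field (𝔽 := F) (Fintype.card ι)
  rw [h1]
  have h3 : Nat.card (Matrix (Fin (Fintype.card ι)) (Fin (Fintype.card ι)) F)ˣ = ∏ i : Fin (Fintype.card ι), (Fintype.card F ^ Fintype.card ι - Fintype.card F ^ (i : ℕ)) := h2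
  rw [h3, glc, qN, Finset.prod_range, Nat.cast_prod]
  refine Finset.prod_congr rfl fun i _ => ?_
  rw [Nat.cast_sub (Nat.pow_le_pow_right Fintype.card_pos i.2.le)]
  push_cast
  rfl

lemma DD_sing {ξ : E} (h : ξ ≠ 0) {g : Matrix ι ι F} (hg : ¬ IsUnit g) : DD (cx F ξ) g = 0 := by
  unfold DD
  rw [if_neg]
  rintro ⟨r, hr⟩
  apply hg
  rw [Matrix.isUnit_iff_isUnit_det, isUnit_iff_ne_zero, Matrix.det_eq_sign_charpoly_coeff, hr, cx_charpoly,
    Polynomial.coeff_zero_eq_eval_zero, Polynomial.eval_pow, ← Polynomial.coeff_zero_eq_eval_zero]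
  apply mul_ne_zero (pow_ne_zero _ (by simp))
  exact pow_ne_zero _ (minpoly.coeff_zero_ne_zero (Algebra.IsIntegral.isIntegral (R := F) ξ) h)

lemma exists_extchar {A B : Type} [CommGroup A] [CommGroup B] [Finite B] (f : A →* B) (hf : Function.Injective f) (θ : A →* ℂˣ) :
    ∃ θ' : B →* ℂˣ, ∀ a, θ' (f a) = θ a := by
  have : HasEnoughRootsOfUnity ℂ (Monoid.exponent B) := by
    have : NeZero (Monoid.exponent B) := ⟨Monoid.exponent_ne_zero_of_finite⟩
    infer_instance
  let e := MonoidHom.ofInjective hf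
  obtain ⟨θ', h⟩ := MonoidHom.domRestrict_surjective (M := ℂ) f.range (θ.comp e.symm.toMonoidHom)
  refine ⟨θ', fun a => ?_⟩
  have := DFunLike.congr_fun h (e a)
  have e1 : ((e a : f.range) : B) = f a := rfl
  rw [← e1]
  simpa using this

lemma Xi_int' [Nonempty ι] (hE : Module.finrank F E = Fintype.card ι)
    (θ : Eˣ →* ℂˣ) {m : ℕ} (ρ : (Matrix ι ι F)ˣ →* Matrix (Fin m) (Fin m) ℂ) (N : ℕ) (hN : 1 ≤ N) :
    IsIntegral ℤ ((∑ g : (Matrix ι ι F)ˣ, (∑ u : Eˣ, (θ u : ℂ) * (pE (u : E) (g : Matrix ι ι F)).eval ((Fintype.card E : ℂ) ^ N)) *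
      (ρ g).trace) / Fintype.card (Matrix ι ι F)ˣ) := by
  classical
  obtain ⟨p, hp⟩ := CharP.exists E
  have hpp : Fact (Nat.Prime p) := ⟨CharP.char_is_prime E p⟩
  have hN' : NeZero N := ⟨by omega⟩
  let L := FiniteField.Extension E p N
  let i1 : Algebra F L := ((algebraMap E L).comp (algebraMap F E)).toAlgebra
  have i2 : IsScalarTower F E L := IsScalarTower.of_algebraMap_eq (fun x => rfl)
  have i5 : Finite L := Module.finite_of_finite E
  let i3 : Fintype L := Fintype.ofFinite L
  have hc : (Fintype.card L : ℂ) = (Fintype.card E : ℂ) ^ N := by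
    rw [← Nat.card_eq_fintype_card, FiniteField.natCard_extension, Nat.card_eq_fintype_card, Nat.cast_pow]
  obtain ⟨θ', hθ'⟩ := exists_extchar (Units.map (algebraMap E L : E →* L)) (Units.map_injective (algebraMap E L).injective) θ
  have := Xi_int (L := L) hE θ θ' hθ' ρ
  rw [hc] at this
  exact this

/-- the recurrence polynomial -/
noncomputable def rA (Y : ℤ) (n : ℕ) : Polynomial ℤ := ∏ j ∈ Finset.range n, (Polynomial.X - Polynomial.C (Y ^ j))

lemma rA_interp (Y : ℤ) (n : ℕ) (p : Polynomial ℂ) (hp : p.natDegree < n) :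
    ∑ i ∈ Finset.range (n + 1), ((rA Y n).coeff i : ℂ) * p.eval ((Y : ℂ) ^ i) = 0 := by
  have hdeg : (rA Y n).natDegree < n + 1 := by
    rw [rA, Polynomial.natDegree_finsetProd_X_sub_C_eq_card, Finset.card_range]
    omega
  simp only [Polynomial.eval_eq_sum_range' hp, Finset.mul_sum]
  rw [Finset.sum_comm]
  refine Finset.sum_eq_zero fun m hm => ?_
  have h1 : (rA Y n).eval (Y ^ m) = 0 := by
    rw [rA, Polynomial.eval_prod]
    exact Finset.prod_eq_zero hm (by simp)
  rw [Polynomial.eval_eq_sum_range' hdeg] at h1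
  have h2 : ((∑ i ∈ Finset.range (n + 1), (rA Y n).coeff i * (Y ^ m) ^ i : ℤ) : ℂ) = 0 := by rw [h1]; simp
  push_cast at h2
  calc _ = p.coeff m * ∑ i ∈ Finset.range (n + 1), ((rA Y n).coeff i : ℂ) * ((Y : ℂ) ^ m) ^ i := by
        rw [Finset.mul_sum]
        refine Finset.sum_congr rfl fun i _ => ?_
        ring
    _ = 0 := by rw [h2, mul_zero]

lemma rA_zero_coprime {D q e n : ℕ} (h : Nat.Coprime D q) : IsCoprime (D : ℤ) ((rA ((q : ℤ) ^ e) n).coeff 0) := by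
  rw [rA, Polynomial.coeff_zero_eq_eval_zero, Polynomial.eval_prod]
  apply IsCoprime.prod_right
  intro j _
  simp only [Polynomial.eval_sub, Polynomial.eval_X, Polynomial.eval_C, zero_sub]
  exact (((Nat.isCoprime_iff_coprime.mpr h).pow_right).pow_right).neg_right

open Classical in
/-- extension by zero of a representation to all matrices -/
noncomputable def extz {m : ℕ} (ρ : (Matrix ι ι F)ˣ →* Matrix (Fin m) (Fin m) ℂ) : Matrix ι ι F →* Matrix (Fin m) (Fin m) ℂ where
  toFun g := if h : IsUnit g then ρ h.unit else 0
  map_one' := by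
    have : (isUnit_one : IsUnit (1 : Matrix ι ι F)).unit = 1 := Units.ext rfl
    rw [dif_pos isUnit_one, this, map_one]
  map_mul' a b := by
    by_cases ha : IsUnit a
    · by_cases hb : IsUnit b
      · rw [dif_pos ha, dif_pos hb, dif_pos (ha.mul hb), ← map_mul]
        congr 1
        exact Units.ext rfl
      · rw [dif_neg hb, mul_zero, dif_neg]
        intro h
        apply hb
        rw [Matrix.isUnit_iff_isUnit_det, Matrix.det_mul] at h
        rw [Matrix.isUnit_iff_isUnit_det]
        exact isUnit_of_mul_isUnit_right h
    · rw [dif_neg ha, zero_mul, dif_neg]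
      intro h
      apply ha
      rw [Matrix.isUnit_iff_isUnit_det, Matrix.det_mul] at h
      rw [Matrix.isUnit_iff_isUnit_det]
      exact isUnit_of_mul_isUnit_left h

lemma extz_unit {m : ℕ} (ρ : (Matrix ι ι F)ˣ →* Matrix (Fin m) (Fin m) ℂ) (g : (Matrix ι ι F)ˣ) : extz ρ (g : Matrix ι ι F) = ρ g := by
  show dite _ _ _ = _
  rw [dif_pos g.isUnit]
  congr 1
  exact Units.ext rfl

lemma sum_units (f : Matrix ι ι F → ℂ) (hf : ∀ g, ¬ IsUnit g → f g = 0) : ∑ g, f g = ∑ g : (Matrix ι ι F)ˣ, f g := by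
  classical
  rw [← Finset.sum_subset (Finset.subset_univ (Finset.univ.image (Units.val : (Matrix ι ι F)ˣ → Matrix ι ι F))),
      Finset.sum_image (fun a _ b _ h => Units.ext h)]
  intro g _ hg
  apply hf
  rintro ⟨u, hu⟩
  exact hg (Finset.mem_image.mpr ⟨u, Finset.mem_univ _, hu⟩)

/-- the class function attached to a character -/
noncomputable def Rth (θ : Eˣ → ℂ) (g : Matrix ι ι F) : ℂ := ∑ u : Eˣ, θ u * DD (cx F (u : E)) g

lemma theta_int (θ : Eˣ →* ℂˣ) (u : Eˣ) : IsIntegral ℤ (θ u : ℂ) := by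
  apply IsIntegral.of_pow (n := Fintype.card Eˣ) Fintype.card_pos
  have : (θ u) ^ (Fintype.card Eˣ) = 1 := by rw [← map_pow, pow_card_eq_one, map_one]
  have h2 := congrArg (Units.val) this
  rw [Units.val_pow_eq_pow_val] at h2
  rw [h2]
  exact isIntegral_one

theorem R_int [Nonempty ι] (hE : Module.finrank F E = Fintype.card ι)
    (θ : Eˣ →* ℂˣ) {m : ℕ} (ρ : (Matrix ι ι F)ˣ →* Matrix (Fin m) (Fin m) ℂ) :
    IsIntegral ℤ ((∑ g : (Matrix ι ι F)ˣ, Rth (fun u : Eˣ => (θ u : ℂ)) (g : Matrix ι ι F) * (ρ g).trace) / Fintype.card (Matrix ι ι F)ˣ) := by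
  classical
  set w := (∑ g : (Matrix ι ι F)ˣ, Rth (fun u : Eˣ => (θ u : ℂ)) (g : Matrix ι ι F) * (ρ g).trace) / (Fintype.card (Matrix ι ι F)ˣ : ℂ) with hw
  have h1 : pInt (Fintype.card F) w := by
    have : w = ∑ u : Eˣ, (θ u : ℂ) * ((∑ g, DD (cx F (u : E)) g * (extz ρ g).trace) / glc (Fintype.card F) (Fintype.card ι)) := by
      rw [hw, card_glc]
      simp only [mul_div_assoc', ← Finset.sum_div]
      congr 1
      simp only [Rth, Finset.sum_mul]
      rw [Finset.sum_comm]
      refine Finset.sum_congr rfl fun u _ => ?_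
      rw [sum_units _ (fun g hg => by rw [DD_sing u.ne_zero hg, zero_mul]), Finset.mul_sum]
      refine Finset.sum_congr rfl fun g _ => ?_
      rw [extz_unit, mul_assoc]
    rw [this]
    apply pInt.sum
    intro u _
    obtain ⟨c', hc'⟩ := cx_inv (F := F) u.ne_zero
    exact (DD_pInt (cx_irr (u : E)) hc' (extz ρ)).mul_int (theta_int θ u)
  obtain ⟨D, hD, hDw⟩ := h1
  have hcE : (Fintype.card E : ℂ) = (((Fintype.card F : ℤ) ^ Fintype.card ι : ℤ) : ℂ) := by
    rw [← hE]
    have := Module.card_eq_pow_finrank (K := F) (V := E)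
    rw [this]
    push_cast
    rfl
  let A := rA ((Fintype.card F : ℤ) ^ Fintype.card ι) (Fintype.card ι)
  let Xi : ℕ → ℂ := fun N => (∑ g : (Matrix ι ι F)ˣ, (∑ u : Eˣ, (θ u : ℂ) * (pE (u : E) (g : Matrix ι ι F)).eval ((Fintype.card E : ℂ) ^ N)) *
      (ρ g).trace) / Fintype.card (Matrix ι ι F)ˣ
  have hX0 : Xi 0 = w := by
    simp only [Xi, hw, pow_zero, pE_one, Rth]
  have hsum : ∑ i ∈ Finset.range (Fintype.card ι + 1), (A.coeff i : ℂ) * Xi i = 0 := by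
    simp only [Xi, mul_div_assoc', ← Finset.sum_div]
    rw [div_eq_zero_iff]
    left
    simp only [Finset.mul_sum, Finset.sum_mul]
    rw [Finset.sum_comm]
    refine Finset.sum_eq_zero fun g _ => ?_
    rw [Finset.sum_comm]
    refine Finset.sum_eq_zero fun u _ => ?_
    have := rA_interp ((Fintype.card F : ℤ) ^ Fintype.card ι) (Fintype.card ι) _ (pE_deg (u : E) (g : Matrix ι ι F))
    rw [← hcE] at this
    calc _ = ((θ u : ℂ) * (ρ g).trace) * ∑ i ∈ Finset.range (Fintype.card ι + 1), (A.coeff i : ℂ) * (pE (u : E) (g : Matrix ι ι F)).eval ((Fintype.card E : ℂ) ^ i) := by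
          rw [Finset.mul_sum]
          refine Finset.sum_congr rfl fun i _ => ?_
          ring
      _ = 0 := by rw [this, mul_zero]
  have hA0 : IsIntegral ℤ ((A.coeff 0 : ℂ) * w) := by
    rw [Finset.sum_range_succ', hX0] at hsum
    have : (A.coeff 0 : ℂ) * w = - ∑ i ∈ Finset.range (Fintype.card ι), (A.coeff (i + 1) : ℂ) * Xi (i + 1) := by
      linear_combination hsum
    rw [this]
    apply IsIntegral.neg
    apply IsIntegral.sum
    intro i _
    exact (isIntegral_algebraMap (R := ℤ) (x := A.coeff (i + 1))).mul (Xi_int' hE θ ρ (i + 1) (by omega))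
  obtain ⟨x, y, hxy⟩ := rA_zero_coprime (D := D) (q := Fintype.card F) (e := Fintype.card ι) (n := Fintype.card ι) hD
  have hxy' : (x : ℂ) * D + (y : ℂ) * (A.coeff 0 : ℂ) = 1 := by exact_mod_cast congrArg (Int.cast : ℤ → ℂ) hxy
  have : w = (x : ℂ) * (D * w) + (y : ℂ) * ((A.coeff 0 : ℂ) * w) := by
    linear_combination - w * hxy'
  rw [this]
  exact ((isIntegral_algebraMap (R := ℤ) (x := x)).mul hDw).add ((isIntegral_algebraMap (R := ℤ) (x := y)).mul hA0)

end MK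

end

section
open scoped BigOperators
namespace MK

variable {F : Type} [Field F] [Fintype F] [DecidableEq F]
variable {ι μ δ ν κ : Type} [Fintype ι] [Fintype μ] [Fintype δ] [Fintype ν] [Fintype κ]
  [DecidableEq ι] [DecidableEq μ] [DecidableEq δ] [DecidableEq ν] [DecidableEq κ]
variable {E : Type} [Field E] [Fintype E] [DecidableEq E] [Algebra F E]

lemma similar {c : Matrix δ δ F} {c' : Matrix ν ν F} (hc : Irreducible c.charpoly) (h : c'.charpoly = c.charpoly) :
    ∃ (A : Matrix ν δ F) (A' : Matrix δ ν F), A' * A = 1 ∧ A * A' = 1 ∧ c' * A = A * c := by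
  have hc' : Irreducible c'.charpoly := by rw [h]; exact hc
  obtain ⟨e, he⟩ := exists_ne_vec hc'
  obtain ⟨A, hA, hAc⟩ := exists_intertwiner hc c' he (by rw [← h, Matrix.aeval_self_charpoly, Matrix.zero_mulVec])
  obtain ⟨A', hA'⟩ := surj_of_inj A (inj_of_ne_zero hc hA hAc) (1 : Matrix δ δ F)
  refine ⟨A, A', hA', ?_, hAc⟩
  rwa [Matrix.mul_eq_one_comm_of_card_eq]
  have := congrArg Polynomial.natDegree h
  rw [Matrix.charpoly_natDegree_eq_dim, Matrix.charpoly_natDegree_eq_dim] at this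
  first | exact this | exact this.symm

lemma Ho_congr {c : Matrix δ δ F} {c' : Matrix ν ν F} (hc : Irreducible c.charpoly) (h : c'.charpoly = c.charpoly)
    (g : Matrix ι ι F) : Ho c' g = Ho c g := by
  obtain ⟨A, A', h1, h2, h3⟩ := similar hc h
  unfold Ho
  apply Nat.card_congr
  exact
    { toFun := fun M => ⟨M.1 * A, by rw [← Matrix.mul_assoc, M.2, Matrix.mul_assoc, h3, ← Matrix.mul_assoc]⟩
      invFun := fun M => ⟨M.1 * A', by
        have h4 : c * A' = A' * c' := by
          calc c * A' = A' * (A * c) * A' := by rw [← Matrix.mul_assoc, h1, Matrix.one_mul]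
            _ = A' * (c' * A) * A' := by rw [h3]
            _ = A' * c' := by rw [Matrix.mul_assoc, Matrix.mul_assoc, h2, Matrix.mul_one]
        rw [← Matrix.mul_assoc, M.2, Matrix.mul_assoc, h4, ← Matrix.mul_assoc]⟩
      left_inv := fun M => Subtype.ext (by simp [Matrix.mul_assoc, h2])
      right_inv := fun M => Subtype.ext (by simp [Matrix.mul_assoc, h1]) }

lemma DD_congr {c : Matrix δ δ F} {c' : Matrix ν ν F} (hc : Irreducible c.charpoly) (h : c'.charpoly = c.charpoly)
    (g : Matrix ι ι F) : DD c' g = DD c g := by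
  have h1 : Fintype.card ν = Fintype.card δ := by
    have := congrArg Polynomial.natDegree h
    rwa [Matrix.charpoly_natDegree_eq_dim, Matrix.charpoly_natDegree_eq_dim] at this
  unfold DD lf prim
  rw [Ho_congr hc h, h1, h]

lemma DD_mul_zero [Nonempty ι] {u v : E} (h : minpoly F u ≠ minpoly F v) (g : Matrix ι ι F) :
    DD (cx F u) g * DD (cx F v) g = 0 := by
  unfold DD
  by_cases h1 : prim (cx F u) g
  · by_cases h2 : prim (cx F v) g
    · exfalso
      obtain ⟨r, hr⟩ := h1
      obtain ⟨s, hs⟩ := h2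
      rw [cx_charpoly] at hr hs
      have hu := minpoly.irreducible (Algebra.IsIntegral.isIntegral (R := F) u)
      have hv := minpoly.irreducible (Algebra.IsIntegral.isIntegral (R := F) v)
      have hr0 : r ≠ 0 := by
        rintro rfl
        have := congrArg Polynomial.natDegree hr
        rw [Matrix.charpoly_natDegree_eq_dim, pow_zero, Polynomial.natDegree_one] at this
        exact Fintype.card_ne_zero this
      have hd : minpoly F u ∣ minpoly F v ^ s := by
        rw [← hs, hr]; exact dvd_pow_self _ hr0
      have hd2 := hu.prime.dvd_of_dvd_pow hd
      have ha := (hv.dvd_iff.mp hd2).resolve_left hu.not_isUnit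
      exact h (Polynomial.eq_of_monic_of_associated (minpoly.monic (Algebra.IsIntegral.isIntegral (R := F) u))
        (minpoly.monic (Algebra.IsIntegral.isIntegral (R := F) v)) ha.symm)
    · rw [if_neg h2, mul_zero]
  · rw [if_neg h1, zero_mul]

lemma orbit_sum (u : E) (f : E → ℂ) : ∑ σ : E ≃ₐ[F] E, f (σ u) =
    ((Module.finrank F E / (minpoly F u).natDegree : ℕ) : ℂ) * ∑ v : E, if minpoly F u = minpoly F v then f v else 0 := by
  classical
  rw [← Finset.sum_fiberwise (s := Finset.univ) (g := fun σ : E ≃ₐ[F] E => σ u), Finset.mul_sum]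
  refine Finset.sum_congr rfl fun v _ => ?_
  have h1 : ∑ σ ∈ Finset.univ.filter (fun σ : E ≃ₐ[F] E => σ u = v), f (σ u) = ((Finset.univ.filter (fun σ : E ≃ₐ[F] E => σ u = v)).card : ℂ) * f v := by
    rw [Finset.sum_congr rfl (g := fun _ => f v), Finset.sum_const, nsmul_eq_mul]
    intro σ hσ
    rw [(Finset.mem_filter.mp hσ).2]
  rw [h1]
  by_cases h : minpoly F u = minpoly F v
  · rw [if_pos h]
    congr 2
    obtain ⟨τ, hτ⟩ := (Normal.minpoly_eq_iff_mem_orbit E).mp h.symm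
    have hτ' : τ u = v := hτ
    have e : (Finset.univ.filter (fun σ : E ≃ₐ[F] E => σ u = v)).card = Nat.card (IntermediateField.fixingSubgroup (IntermediateField.adjoin F {u})) := by
      rw [← Fintype.card_subtype, ← Nat.card_eq_fintype_card]
      apply Nat.card_congr
      refine (Equiv.subtypeEquiv (Equiv.mulLeft τ) ?_).symm
      intro σ
      rw [IntermediateField.mem_fixingSubgroup_iff]
      constructor
      · intro hh
        show τ (σ u) = v
        rw [hh u (IntermediateField.mem_adjoin_simple_self F u), hτ']
      · intro hh
        have hσ : σ u = u := τ.injective (by rw [hτ']; exact hh)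
        intro x hx
        have : IntermediateField.adjoin F {u} ≤ IntermediateField.fixedField (Subgroup.zpowers σ) := by
          rw [IntermediateField.adjoin_simple_le_iff, IntermediateField.mem_fixedField_iff]
          intro s hs
          obtain ⟨k, rfl⟩ := Subgroup.mem_zpowers_iff.mp hs
          exact MulAction.mem_stabilizer_iff.mp (Subgroup.zpow_mem (MulAction.stabilizer (E ≃ₐ[F] E) u) (MulAction.mem_stabilizer_iff.mpr hσ) k)
        exact (IntermediateField.mem_fixedField_iff _ _).mp (this hx) σ (Subgroup.mem_zpowers σ)
    rw [e, IsGalois.card_fixingSubgroup_eq_finrank]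
    have h2 := Module.finrank_mul_finrank F (IntermediateField.adjoin F {u}) E
    rw [IntermediateField.adjoin.finrank (Algebra.IsIntegral.isIntegral (R := F) u)] at h2
    rw [← h2, Nat.mul_div_cancel_left _ (minpoly.natDegree_pos (Algebra.IsIntegral.isIntegral (R := F) u))]
  · rw [if_neg h, mul_zero]
    have : Finset.univ.filter (fun σ : E ≃ₐ[F] E => σ u = v) = ∅ := by
      rw [Finset.filter_eq_empty_iff]
      intro σ _ hσ
      apply h
      rw [← hσ, minpoly.algEquiv_eq]
    rw [this]; simp

end MK

end

section
open scoped BigOperators ComplexConjugate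
namespace MK

variable {F : Type} [Field F] [Fintype F] [DecidableEq F]
variable {ι μ δ ν κ : Type} [Fintype ι] [Fintype μ] [Fintype δ] [Fintype ν] [Fintype κ]
  [DecidableEq ι] [DecidableEq μ] [DecidableEq δ] [DecidableEq ν] [DecidableEq κ]
variable {E : Type} [Field E] [Fintype E] [DecidableEq E] [Algebra F E]

/-- the class function attached to a function on `E` -/
noncomputable def Rf (φ : E → ℂ) (g : Matrix ι ι F) : ℂ := ∑ ξ : E, φ ξ * DD (cx F ξ) g

lemma deg_mul (hE : Module.finrank F E = Fintype.card ι) [Nonempty ι] (u : E) :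
    1 ≤ Module.finrank F E / (minpoly F u).natDegree ∧
    Fintype.card ι = Fintype.card (Fin (minpoly F u).natDegree) * (Module.finrank F E / (minpoly F u).natDegree) := by
  have h := deg_dvd (F := F) u
  have h1 : 0 < (minpoly F u).natDegree := minpoly.natDegree_pos (Algebra.IsIntegral.isIntegral (R := F) u)
  have h2 : 0 < Module.finrank F E := by rw [hE]; exact Fintype.card_pos
  refine ⟨Nat.div_pos (Nat.le_of_dvd h2 h) h1, ?_⟩
  rw [Fintype.card_fin, Nat.mul_div_cancel' h, hE]

lemma Rf_bil (hE : Module.finrank F E = Fintype.card ι) [Nonempty ι] (φ φ' : E → ℂ) :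
    ∑ g : Matrix ι ι F, Rf φ g * Rf φ' g = (glc (Fintype.card F) (Fintype.card ι) / ((Fintype.card F : ℂ) ^ Fintype.card ι - 1)) *
      ∑ σ : E ≃ₐ[F] E, ∑ u : E, φ u * φ' (σ u) := by
  classical
  have h1 : ∀ u v : E, ∑ g : Matrix ι ι F, DD (cx F u) g * DD (cx F v) g = if minpoly F u = minpoly F v then
      ((Module.finrank F E / (minpoly F u).natDegree : ℕ) : ℂ) * (glc (Fintype.card F) (Fintype.card ι) / ((Fintype.card F : ℂ) ^ Fintype.card ι - 1)) else 0 := by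
    intro u v
    split_ifs with h
    · obtain ⟨a, b⟩ := deg_mul hE u
      rw [← C2 (cx_irr u) _ a b]
      refine Finset.sum_congr rfl fun g _ => ?_
      rw [DD_congr (c := cx F u) (c' := cx F v) (cx_irr u) (by rw [cx_charpoly, cx_charpoly, h]), sq]
    · exact Finset.sum_eq_zero fun g _ => DD_mul_zero h g
  rw [Finset.sum_comm, Finset.mul_sum]
  simp only [Rf, Finset.sum_mul_sum]
  rw [Finset.sum_comm]
  refine Finset.sum_congr rfl fun u _ => ?_
  rw [Finset.sum_comm, ← Finset.mul_sum, orbit_sum u φ']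
  simp only [Finset.mul_sum]
  refine Finset.sum_congr rfl fun v _ => ?_
  calc _ = φ u * φ' v * ∑ g : Matrix ι ι F, DD (cx F u) g * DD (cx F v) g := by
        rw [Finset.mul_sum]
        refine Finset.sum_congr rfl fun g _ => ?_
        ring
    _ = _ := by
        rw [h1]
        split_ifs
        · ring
        · ring

lemma DD_real (c : Matrix δ δ F) (g : Matrix ι ι F) : ∃ z : ℤ, DD c g = z := by
  unfold DD
  split_ifs
  · refine ⟨∏ i ∈ Finset.range (lf c g - 1), (1 - ((Fintype.card F ^ Fintype.card δ : ℕ) : ℤ) ^ (i + 1)), ?_⟩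
    rw [qD]
    push_cast
    rfl
  · exact ⟨0, by simp⟩

lemma Rf_conj (φ : E → ℂ) (g : Matrix ι ι F) : conj (Rf φ g) = Rf (fun ξ => conj (φ ξ)) g := by
  simp only [Rf, map_sum, map_mul]
  refine Finset.sum_congr rfl fun ξ _ => ?_
  obtain ⟨z, hz⟩ := DD_real (cx F ξ) g
  rw [hz, map_intCast]

/-- regular characters -/
def reg (F : Type) [Field F] {E : Type} [Field E] [Algebra F E] (χ : MulChar E ℂ) : Prop :=
  ∀ σ : E ≃ₐ[F] E, σ ≠ 1 → ∃ u : E, χ (σ u) ≠ χ u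

lemma mc_conj (χ : MulChar E ℂ) (u : E) : conj (χ u) = χ⁻¹ u := by
  by_cases h : u = 0
  · subst h; rw [MulChar.map_zero, MulChar.map_zero, map_zero]
  · have h1 : χ u * χ⁻¹ u = 1 := by
      rw [← MulChar.mul_apply, mul_inv_cancel, MulChar.one_apply (Ne.isUnit h)]
    have h2 : χ u ^ (Fintype.card E - 1) = 1 := by
      rw [← map_pow, FiniteField.pow_card_sub_one_eq_one u h, map_one]
    have hne : Fintype.card E - 1 ≠ 0 := by
      have : 1 < Fintype.card E := Fintype.one_lt_card
      omega
    have h3 := Complex.norm_eq_one_of_pow_eq_one h2 hne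
    have h4 : χ u * conj (χ u) = 1 := by
      rw [Complex.mul_conj, Complex.normSq_eq_norm_sq, h3]; simp
    have h0 : χ u ≠ 0 := left_ne_zero_of_mul_eq_one h1
    exact mul_left_cancel₀ h0 (h4.trans h1.symm)

lemma reg_sum {χ : MulChar E ℂ} (hχ : reg F χ) :
    ∑ σ : E ≃ₐ[F] E, ∑ u : E, χ u * χ⁻¹ (σ u) = (Fintype.card E : ℂ) - 1 := by
  classical
  rw [Finset.sum_eq_single 1]
  · have : ∀ u : E, χ u * χ⁻¹ ((1 : E ≃ₐ[F] E) u) = (1 : MulChar E ℂ) u := by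
      intro u
      rw [AlgEquiv.one_apply, ← MulChar.mul_apply, mul_inv_cancel]
    rw [Finset.sum_congr rfl fun u _ => this u, MulChar.sum_one_eq_card_units, Fintype.card_units, Nat.cast_sub Fintype.card_pos, Nat.cast_one]
  · intro σ _ hσ
    let χ' : MulChar E ℂ :=
      { toFun := fun u => χ⁻¹ (σ u)
        map_one' := by simp
        map_mul' := by simp
        map_nonunit' := by
          intro a ha
          have : a = 0 := by simpa using ha
          subst this
          show χ⁻¹ (σ 0) = 0
          rw [map_zero, MulChar.map_zero] }
    have : ∀ u : E, χ u * χ⁻¹ (σ u) = (χ * χ') u := fun u => by rw [MulChar.mul_apply]; rfl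
    rw [Finset.sum_congr rfl fun u _ => this u]
    apply MulChar.sum_eq_zero_of_ne_one
    intro h1
    obtain ⟨u, hu⟩ := hχ σ hσ
    apply hu
    by_cases h0 : u = 0
    · subst h0; simp
    · have h2 : χ u * χ⁻¹ (σ u) = 1 := by
        rw [this, h1, MulChar.one_apply (Ne.isUnit h0)]
      have h3 : χ (σ u) * χ⁻¹ (σ u) = 1 := by
        rw [← MulChar.mul_apply, mul_inv_cancel, MulChar.one_apply]
        exact Ne.isUnit (by simpa using h0)
      have h4 : χ⁻¹ (σ u) ≠ 0 := right_ne_zero_of_mul_eq_one h2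
      exact mul_right_cancel₀ h4 (h3.trans h2.symm)
  · intro h; exact absurd (Finset.mem_univ _) h

lemma cardE (hE : Module.finrank F E = Fintype.card ι) : (Fintype.card E : ℂ) = (Fintype.card F : ℂ) ^ Fintype.card ι := by
  rw [← hE]
  have := Module.card_eq_pow_finrank (K := F) (V := E)
  rw [this]; push_cast; rfl

lemma Rf_sing {φ : E → ℂ} (h0 : φ 0 = 0) {g : Matrix ι ι F} (hg : ¬ IsUnit g) : Rf φ g = 0 := by
  refine Finset.sum_eq_zero fun ξ _ => ?_
  by_cases h : ξ = 0
  · rw [h, h0, zero_mul]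
  · rw [DD_sing h hg, mul_zero]

lemma Rf_norm (hE : Module.finrank F E = Fintype.card ι) [Nonempty ι] {χ : MulChar E ℂ} (hχ : reg F χ) :
    ∑ g : Matrix ι ι F, Rf χ g * conj (Rf χ g) = glc (Fintype.card F) (Fintype.card ι) := by
  have h1 : ∀ g : Matrix ι ι F, conj (Rf χ g) = Rf (χ⁻¹ : MulChar E ℂ) g := by
    intro g
    rw [Rf_conj]
    congr 1
    ext u
    exact mc_conj χ u
  simp only [h1]
  rw [Rf_bil hE, reg_sum hχ, cardE hE]
  have : (Fintype.card F : ℂ) ^ Fintype.card ι - 1 ≠ 0 := by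
    rw [← cardE hE, sub_ne_zero]
    have : 1 < Fintype.card E := Fintype.one_lt_card
    exact_mod_cast this.ne'
  field_simp

lemma Rf_eq_Rth (θ : Eˣ →* ℂˣ) (g : Matrix ι ι F) : Rf (MulChar.ofUnitHom θ) g = Rth (fun u => (θ u : ℂ)) g := by
  classical
  unfold Rf Rth
  rw [← Finset.sum_subset (Finset.subset_univ (Finset.univ.image (Units.val : Eˣ → E))),
      Finset.sum_image (fun a _ b _ h => Units.ext h)]
  · refine Finset.sum_congr rfl fun u _ => ?_
    rw [MulChar.ofUnitHom_coe]
  · intro g _ hg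
    rw [MulChar.map_nonunit, zero_mul]
    rintro ⟨u, hu⟩
    exact hg (Finset.mem_image.mpr ⟨u, Finset.mem_univ _, hu⟩)

end MK

end

section
open scoped BigOperators ComplexConjugate
namespace MK

variable {F : Type} [Field F] [Fintype F] [DecidableEq F]
variable {ι μ δ ν κ : Type} [Fintype ι] [Fintype μ] [Fintype δ] [Fintype ν] [Fintype κ]
  [DecidableEq ι] [DecidableEq μ] [DecidableEq δ] [DecidableEq ν] [DecidableEq κ]
variable {E : Type} [Field E] [Fintype E] [DecidableEq E] [Algebra F E]

lemma prim_aeval [Nonempty ι] {ξ : E} {g : Matrix ι ι F} (h : prim (cx F ξ) g) : Polynomial.aeval ξ g.charpoly = 0 := by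
  obtain ⟨r, hr⟩ := h
  have hr0 : r ≠ 0 := by
    rintro rfl
    have := congrArg Polynomial.natDegree hr
    rw [Matrix.charpoly_natDegree_eq_dim, pow_zero, Polynomial.natDegree_one] at this
    exact Fintype.card_ne_zero this
  rw [hr, cx_charpoly, map_pow, minpoly.aeval, zero_pow hr0]

lemma DD_one [Nonempty ι] (ξ : E) : DD (cx F ξ) (1 : Matrix ι ι F) =
    if ξ = 1 then qD (Fintype.card F) (Fintype.card ι) else 0 := by
  split_ifs with h
  · subst h
    have hirr : Irreducible (1 : Matrix Unit Unit F).charpoly := by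
      rw [Matrix.charpoly_one, Fintype.card_unit, pow_one]
      exact Polynomial.irreducible_X_sub_C 1
    rw [DD_congr (c := (1 : Matrix Unit Unit F)) (c' := cx F (1 : E)) hirr (by
      rw [cx_charpoly, Matrix.charpoly_one, Fintype.card_unit, pow_one, minpoly.one])]
    unfold DD
    rw [if_pos ⟨Fintype.card ι, by rw [Matrix.charpoly_one, Matrix.charpoly_one, Fintype.card_unit, pow_one]⟩]
    rw [lf_eq hirr (l := Fintype.card ι)]
    · simp
    · unfold Ho
      rw [Nat.card_congr (Equiv.subtypeUnivEquiv (by intro x; simp)), Nat.card_eq_fintype_card]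
      change Fintype.card (ι → Unit → F) = _
      simp [Fintype.card_pi]
  · unfold DD
    rw [if_neg]
    intro hp
    have := prim_aeval hp
    rw [Matrix.charpoly_one, map_pow] at this
    have h1 := eq_zero_of_pow_eq_zero this
    simp at h1
    exact h (sub_eq_zero.mp h1)

lemma Rf_one [Nonempty ι] (φ : E → ℂ) : Rf φ (1 : Matrix ι ι F) = φ 1 * qD (Fintype.card F) (Fintype.card ι) := by
  unfold Rf
  simp only [DD_one, mul_ite, mul_zero, Finset.sum_ite_eq', Finset.mem_univ, if_true]

lemma qD_ne (n : ℕ) : qD (Fintype.card F : ℂ) n ≠ 0 := by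
  unfold qD
  rw [Finset.prod_ne_zero_iff]
  intro i _ h
  have h1 : (Fintype.card F : ℂ) ^ (i + 1) = 1 := by linear_combination -h
  have h2 : 1 < Fintype.card F ^ (i + 1) := Nat.one_lt_pow (by omega) Fintype.one_lt_card
  have : Fintype.card F ^ (i + 1) = 1 := by exact_mod_cast h1
  omega

lemma glc_qD (n : ℕ) (hn : 1 ≤ n) : glc (Fintype.card F : ℂ) n / ((Fintype.card F : ℂ) ^ n - 1) =
    (-1) ^ (n - 1) * (Fintype.card F : ℂ) ^ (n * (n - 1) / 2) * qD (Fintype.card F) n := by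
  have hq : (Fintype.card F : ℂ) ^ n - 1 ≠ 0 := by
    intro h
    have h1 : (Fintype.card F : ℂ) ^ n = 1 := by linear_combination h
    have h2 : 1 < Fintype.card F ^ n := Nat.one_lt_pow (by omega) Fintype.one_lt_card
    have : Fintype.card F ^ n = 1 := by exact_mod_cast h1
    omega
  rw [div_eq_iff hq]
  have key : ∀ m : ℕ, glc (Fintype.card F : ℂ) m = (Fintype.card F : ℂ) ^ (m * (m - 1) / 2) * ∏ i ∈ Finset.range m, ((Fintype.card F : ℂ) ^ (i + 1) - 1) := by
    intro m
    unfold glc qN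
    have e1 : ∏ i ∈ Finset.range m, ((Fintype.card F : ℂ) ^ m - (Fintype.card F : ℂ) ^ i) = ∏ i ∈ Finset.range m, ((Fintype.card F : ℂ) ^ i * ((Fintype.card F : ℂ) ^ (m - 1 - i + 1) - 1)) := by
      refine Finset.prod_congr rfl fun i hi => ?_
      have : i < m := Finset.mem_range.mp hi
      rw [mul_sub, ← pow_add, mul_one]
      congr 2
      omega
    rw [e1, Finset.prod_mul_distrib, Finset.prod_pow_eq_pow_sum, Finset.sum_range_id]
    congr 1
    exact Finset.prod_range_reflect (fun i => (Fintype.card F : ℂ) ^ (i + 1) - 1) m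
  obtain ⟨m, rfl⟩ : ∃ m, n = m + 1 := ⟨n - 1, by omega⟩
  rw [key, Finset.prod_range_succ, Nat.add_sub_cancel, qD, Nat.add_sub_cancel]
  have e2 : ∏ i ∈ Finset.range m, ((Fintype.card F : ℂ) ^ (i + 1) - 1) = (-1) ^ m * ∏ i ∈ Finset.range m, (1 - (Fintype.card F : ℂ) ^ (i + 1)) := by
    conv_rhs => rw [← Finset.card_range m, ← Finset.prod_const, Finset.card_range, ← Finset.prod_mul_distrib]
    refine Finset.prod_congr rfl fun i _ => ?_
    ring
  rw [e2]
  ring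

lemma prim_trace [Nonempty ι] (hE : Module.finrank F E = Fintype.card ι) {ξ : E} {g : Matrix ι ι F} (h : prim (cx F ξ) g) :
    g.trace = Algebra.trace F E ξ ∧ g.det = Algebra.norm F ξ := by
  obtain ⟨r, hr⟩ := h
  have hInt := Algebra.IsIntegral.isIntegral (R := F) ξ
  have h1 : (Algebra.leftMulMatrix (Module.finBasis F E) ξ).charpoly = g.charpoly := by
    rw [hr, cx_charpoly]
    have h2 : minpoly F ξ ∣ (Algebra.leftMulMatrix (Module.finBasis F E) ξ).charpoly := by
      apply minpoly.dvd
      have h3 := Matrix.aeval_self_charpoly (Algebra.leftMulMatrix (Module.finBasis F E) ξ)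
      rw [Polynomial.aeval_algHom_apply] at h3
      exact Algebra.leftMulMatrix_injective _ (h3.trans (map_zero _).symm)
    have h4 : Polynomial.aeval (Algebra.leftMulMatrix (Module.finBasis F E) ξ) (minpoly F ξ) = 0 := by
      rw [Polynomial.aeval_algHom_apply, minpoly.aeval, map_zero]
    obtain ⟨s, hs⟩ := charpoly_of_nilp (minpoly.irreducible hInt) (minpoly.monic hInt) (Algebra.leftMulMatrix (Module.finBasis F E) ξ) (n := 1) (by rw [h4, pow_one])
    rw [hs]
    have d1 := congrArg Polynomial.natDegree hs
    have d2 := congrArg Polynomial.natDegree hr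
    rw [Matrix.charpoly_natDegree_eq_dim, Polynomial.natDegree_pow, Fintype.card_fin, hE] at d1
    rw [Matrix.charpoly_natDegree_eq_dim, cx_charpoly, Polynomial.natDegree_pow] at d2
    congr 1
    exact Nat.eq_of_mul_eq_mul_right (minpoly.natDegree_pos hInt) (d1.symm.trans d2)
  constructor
  · rw [Algebra.trace_eq_matrix_trace (Module.finBasis F E)]
    have : Nonempty (Fin (Module.finrank F E)) := ⟨⟨0, by rw [hE]; exact Fintype.card_pos⟩⟩
    rw [Matrix.trace_eq_neg_charpoly_coeff, Matrix.trace_eq_neg_charpoly_coeff, h1, Fintype.card_fin, hE]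
  · rw [Algebra.norm_eq_matrix_det (Module.finBasis F E)]
    rw [Matrix.det_eq_sign_charpoly_coeff, Matrix.det_eq_sign_charpoly_coeff, h1, Fintype.card_fin, hE]

lemma Rf_weight [Nonempty ι] (hE : Module.finrank F E = Fintype.card ι) (φ : E → ℂ) (f : F → F → ℂ) :
    ∑ g : Matrix ι ι F, Rf φ g * f g.trace g.det =
      (glc (Fintype.card F) (Fintype.card ι) / ((Fintype.card F : ℂ) ^ Fintype.card ι - 1)) *
      ∑ ξ : E, φ ξ * f (Algebra.trace F E ξ) (Algebra.norm F ξ) := by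
  unfold Rf
  simp only [Finset.sum_mul]
  rw [Finset.sum_comm, Finset.mul_sum]
  refine Finset.sum_congr rfl fun ξ _ => ?_
  obtain ⟨a, b⟩ := deg_mul hE ξ
  rw [← C1 (cx_irr ξ) _ a b, Finset.sum_mul]
  refine Finset.sum_congr rfl fun g _ => ?_
  by_cases h : prim (cx F ξ) g
  · obtain ⟨h1, h2⟩ := prim_trace hE h
    rw [h1, h2]; ring
  · have : DD (cx F ξ) g = 0 := by unfold DD; rw [if_neg h]
    rw [this]; ring

end MK

end

section
open scoped BigOperators ComplexConjugate
namespace MK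

variable {F : Type} [Field F] [Fintype F] [DecidableEq F]
variable {ι μ δ ν κ : Type} [Fintype ι] [Fintype μ] [Fintype δ] [Fintype ν] [Fintype κ]
  [DecidableEq ι] [DecidableEq μ] [DecidableEq δ] [DecidableEq ν] [DecidableEq κ]
variable {E : Type} [Field E] [Fintype E] [DecidableEq E] [Algebra F E]

lemma Rf_CypI {N : ℕ} (χ : MulChar E ℂ) (hN : ∀ u : Eˣ, u ^ N = 1) (g : Matrix ι ι F) :
    (Rf χ g, conj (Rf χ g)) ∈ CypI N := by
  have h : (Rf χ g, conj (Rf χ g)) = ∑ ξ : E, (χ ξ * DD (cx F ξ) g, conj (χ ξ * DD (cx F ξ) g)) := by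
    unfold Rf
    ext
    · rw [Prod.fst_sum]
    · rw [Prod.snd_sum, map_sum]
  rw [h]
  refine AddSubgroup.sum_mem _ fun ξ _ => ?_
  by_cases h0 : ξ = 0
  · subst h0
    rw [MulChar.map_zero, zero_mul, map_zero]
    exact AddSubgroup.zero_mem _
  obtain ⟨z, hz⟩ := DD_real (cx F ξ) g
  rw [hz]
  have : (χ ξ * (z : ℂ), conj (χ ξ * (z : ℂ))) = z • ((χ ξ, (χ ξ)⁻¹) : ℂ × ℂ) := by
    ext
    · simp [mul_comm]
    · rw [map_mul, mc_conj, Prod.smul_snd]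
      have h1 : χ ξ * χ⁻¹ ξ = 1 := by
        rw [← MulChar.mul_apply, mul_inv_cancel, MulChar.one_apply (isUnit_iff_ne_zero.mpr h0)]
      rw [eq_inv_of_mul_eq_one_right h1]
      simp [mul_comm]
  rw [this]
  refine AddSubgroup.zsmul_mem _ ?_ _
  refine AddSubgroup.subset_closure (show _ ∧ _ from ⟨?_, rfl⟩)
  have := hN (Units.mk0 ξ h0)
  have h2 := congrArg (Units.val) this
  rw [Units.val_pow_eq_pow_val, Units.val_mk0, Units.val_one] at h2
  simp only
  rw [← map_pow, h2, map_one]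

theorem eigen [Nonempty ι] (hE : Module.finrank F E = Fintype.card ι) {χ : MulChar E ℂ} (hχ : reg F χ)
    (f : (Matrix ι ι F)ˣ → ℂ) (hf : ∀ x y, f (x * y) = f (y * x)) :
    ∃ c : ℂ, ∀ y : (Matrix ι ι F)ˣ, ∑ x : (Matrix ι ι F)ˣ, f x * Rf χ ((x⁻¹ * y : (Matrix ι ι F)ˣ) : Matrix ι ι F) = c * Rf χ (y : Matrix ι ι F) := by
  refine abstract_core (G := (Matrix ι ι F)ˣ) (Fintype.card (Matrix ι ι F)ˣ * Fintype.card Eˣ)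
    (Nat.mul_pos Fintype.card_pos Fintype.card_pos) (fun g => by rw [pow_mul, pow_card_eq_one, one_pow])
    (fun g : (Matrix ι ι F)ˣ => Rf χ (g : Matrix ι ι F)) (fun g => Rf_CypI χ (fun u => by rw [mul_comm, pow_mul, pow_card_eq_one, one_pow]) _)
    ?_ ?_ ?_ f hf
  · simp only [Units.val_one]
    rw [Rf_one, map_one, one_mul]
    exact qD_ne _
  · rw [card_glc, ← Rf_norm hE hχ]
    refine (sum_units (fun g => Rf χ g * conj (Rf χ g)) ?_).symm
    intro g hg
    rw [Rf_sing (MulChar.map_zero χ) hg, zero_mul]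
  · intro m ρ
    have := R_int hE χ.toUnitHom ρ
    simp only [← Rf_eq_Rth] at this
    convert this using 6
    exact (MulChar.equivToUnitHom.symm_apply_apply χ).symm

end MK

end

section
open scoped BigOperators ComplexConjugate
namespace MK

variable {F : Type} [Field F] [Fintype F] [DecidableEq F]
variable {ι μ δ ν κ : Type} [Fintype ι] [Fintype μ] [Fintype δ] [Fintype ν] [Fintype κ]
  [DecidableEq ι] [DecidableEq μ] [DecidableEq δ] [DecidableEq ν] [DecidableEq κ]
variable {E : Type} [Field E] [Fintype E] [DecidableEq E] [Algebra F E]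

lemma prim_inv {c c' : Matrix δ δ F} (hc : c * c' = 1) {g g' : Matrix ι ι F} (hg : g * g' = 1) (h : prim c g) : prim c' g' := by
  obtain ⟨r, hr⟩ := h
  refine ⟨r, ?_⟩
  have key : ∀ {τ : Type} [Fintype τ] [DecidableEq τ] {a a' : Matrix τ τ F}, a * a' = 1 → Associated a'.charpoly a.charpoly.reverse := by
    intro τ _ _ a a' h
    have hu : IsUnit a := ⟨⟨a, a', h, mul_eq_one_comm.mp h⟩, rfl⟩
    have e : a' = a⁻¹ := (Matrix.inv_eq_right_inv h).symm
    rw [e, Matrix.charpoly_inv a hu, Matrix.reverse_charpoly, mul_comm]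
    have hd := (Matrix.isUnit_iff_isUnit_det a).mp hu
    refine associated_mul_unit_left _ _ ?_
    refine IsUnit.mul (isUnit_one.neg.pow _) ?_
    exact Polynomial.isUnit_C.mpr (by rw [Ring.inverse_eq_inv']; exact hd.ne_zero.isUnit.inv)
  refine Polynomial.eq_of_monic_of_associated (Matrix.charpoly_monic _) ((Matrix.charpoly_monic _).pow r) ?_
  have h1 := key hg
  have h2 : ∀ r, (c.charpoly ^ r).reverse = c.charpoly.reverse ^ r := by
    intro r
    induction r with
    | zero => rw [pow_zero, pow_zero, ← Polynomial.C_1, Polynomial.reverse_C]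
    | succ r ih => rw [pow_succ, pow_succ, Polynomial.reverse_mul_of_domain, ih]
  rw [hr, h2] at h1
  exact h1.trans ((key hc).symm.pow_pow)

lemma charpoly_cx_inv {ξ : E} (hξ : ξ ≠ 0) {c' : Matrix (Fin (minpoly F ξ).natDegree) (Fin (minpoly F ξ).natDegree) F}
    (h : cx F ξ * c' = 1) : c'.charpoly = minpoly F ξ⁻¹ := by
  have hInt : ∀ ξ : E, IsIntegral F ξ := fun ξ => Algebra.IsIntegral.isIntegral (R := F) ξ
  have key : ∀ {ξ : E} (hξ : ξ ≠ 0), (minpoly F ξ⁻¹).natDegree ≤ (minpoly F ξ).natDegree := by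
    intro ξ hξ
    have : Invertible ξ := invertibleOfNonzero hξ
    have h1 := (Polynomial.eval₂_reverse_eq_zero_iff (algebraMap F E) ξ (minpoly F ξ)).mpr (minpoly.aeval F ξ)
    rw [invOf_eq_inv] at h1
    have h2 := minpoly.dvd F ξ⁻¹ (p := (minpoly F ξ).reverse) h1
    refine (Polynomial.natDegree_le_of_dvd h2 ?_).trans (Polynomial.reverse_natDegree_le _)
    rw [Ne, Polynomial.reverse_eq_zero]
    exact minpoly.ne_zero (hInt ξ)
  have hd : (minpoly F ξ⁻¹).natDegree = (minpoly F ξ).natDegree := by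
    refine le_antisymm (key hξ) ?_
    have := key (inv_ne_zero hξ)
    rwa [inv_inv] at this
  have hu : IsUnit (cx F ξ) := ⟨⟨_, c', h, mul_eq_one_comm.mp h⟩, rfl⟩
  have e : c' = (cx F ξ)⁻¹ := (Matrix.inv_eq_right_inv h).symm
  have hdv : minpoly F ξ⁻¹ ∣ c'.charpoly := by
    apply minpoly.dvd
    rw [e, Matrix.charpoly_inv _ hu, ← Matrix.reverse_charpoly, cx_charpoly, map_mul]
    have : Invertible ξ := invertibleOfNonzero hξ
    have h1 := (Polynomial.eval₂_reverse_eq_zero_iff (algebraMap F E) ξ (minpoly F ξ)).mpr (minpoly.aeval F ξ)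
    rw [invOf_eq_inv] at h1
    rw [Polynomial.aeval_def (p := (minpoly F ξ).reverse), h1, mul_zero]
  refine Polynomial.eq_of_monic_of_dvd_of_natDegree_le (minpoly.monic (hInt _)) (Matrix.charpoly_monic _) hdv ?_
  rw [Matrix.charpoly_natDegree_eq_dim, Fintype.card_fin, hd]

lemma DD_inv' {c c' : Matrix δ δ F} (hc : c * c' = 1) {g g' : Matrix ι ι F} (hg : g * g' = 1) : DD c' g' = DD c g := by
  have hc2 := mul_eq_one_comm.mp hc
  have hg2 := mul_eq_one_comm.mp hg
  have e1 : prim c' g' ↔ prim c g := ⟨prim_inv hc2 hg2, prim_inv hc hg⟩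
  have e2 : Ho c' g' = Ho c g := by
    unfold Ho
    refine Nat.card_congr (Equiv.subtypeEquivRight fun A => ⟨fun h => ?_, fun h => ?_⟩)
    · calc g * A = g * (A * c') * c := by rw [Matrix.mul_assoc, Matrix.mul_assoc A, hc2, Matrix.mul_one]
        _ = A * c := by rw [← h, ← Matrix.mul_assoc, hg, Matrix.one_mul]
    · calc g' * A = g' * (A * c) * c' := by rw [Matrix.mul_assoc, Matrix.mul_assoc A, hc, Matrix.mul_one]
        _ = A * c' := by rw [← h, ← Matrix.mul_assoc, hg2, Matrix.one_mul]
  unfold DD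
  by_cases h : prim c g
  · rw [if_pos h, if_pos (e1.mpr h)]
    unfold lf
    rw [e2]
  · rw [if_neg h, if_neg (fun h' => h (e1.mp h'))]

lemma DD_inv {ξ : E} (hξ : ξ ≠ 0) {g g' : Matrix ι ι F} (hg : g * g' = 1) : DD (cx F ξ⁻¹) g' = DD (cx F ξ) g := by
  obtain ⟨c', hc'⟩ := cx_inv (F := F) hξ
  rw [← DD_inv' hc' hg]
  refine (DD_congr (cx_irr ξ⁻¹) ?_ g').symm
  rw [charpoly_cx_inv hξ hc', cx_charpoly]

lemma Rf_CI (φ : E → ℂ) : CI (fun g : Matrix ι ι F => Rf φ g) := by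
  intro B B' g h1 h2
  unfold Rf
  refine Finset.sum_congr rfl fun ξ _ => ?_
  exact congrArg _ (DD_CI (cx F ξ) B B' g h1 h2)

lemma Rf_inv (χ : MulChar E ℂ) {g g' : Matrix ι ι F} (hg : g * g' = 1) : Rf (χ⁻¹ : MulChar E ℂ) g' = Rf χ g := by
  unfold Rf
  rw [← Equiv.sum_comp (Equiv.inv E)]
  refine Finset.sum_congr rfl fun ξ _ => ?_
  by_cases h : ξ = 0
  · subst h; rw [MulChar.map_zero, zero_mul, Equiv.inv_apply, inv_zero, MulChar.map_zero, zero_mul]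
  · rw [Equiv.inv_apply, DD_inv h hg, MulChar.inv_apply', inv_inv]

end MK

end

section
open scoped BigOperators ComplexConjugate
namespace MK

variable {F : Type} [Field F] [Fintype F] [DecidableEq F]
variable {ι μ δ ν κ : Type} [Fintype ι] [Fintype μ] [Fintype δ] [Fintype ν] [Fintype κ]
  [DecidableEq ι] [DecidableEq μ] [DecidableEq δ] [DecidableEq ν] [DecidableEq κ]
variable {E : Type} [Field E] [Fintype E] [DecidableEq E] [Algebra F E]

/-- the additive character of `E` -/
noncomputable def pE' (ψ : AddChar F ℂ) (E : Type) [Field E] [Algebra F E] : AddChar E ℂ :=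
  ψ.compAddMonoidHom (Algebra.trace F E).toAddMonoidHom

lemma pE'_apply (ψ : AddChar F ℂ) (x : E) : pE' ψ E x = ψ (Algebra.trace F E x) := rfl

lemma pE'_prim {ψ : AddChar F ℂ} (hψ : ψ ≠ 1) : (pE' ψ E).IsPrimitive := by
  apply AddChar.IsPrimitive.of_ne_one
  intro h
  apply hψ
  ext x
  obtain ⟨y, rfl⟩ := Algebra.trace_surjective F E x
  rw [← pE'_apply, h]
  rfl

/-- Fourier transform on `E` -/
noncomputable def hat (ψ : AddChar F ℂ) (φ : E → ℂ) (ξ : E) : ℂ := ∑ η : E, φ η * ψ (Algebra.trace F E (ξ * η))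

lemma hat_char (ψ : AddChar F ℂ) {χ : MulChar E ℂ} (h1 : χ ≠ 1) (ξ : E) :
    hat ψ χ ξ = χ⁻¹ ξ * gaussSum χ (pE' ψ E) := by
  by_cases h : ξ = 0
  · subst h
    unfold hat
    rw [MulChar.map_zero, zero_mul]
    simp only [zero_mul, map_zero, AddChar.map_zero_eq_one, mul_one]
    exact MulChar.sum_eq_zero_of_ne_one h1
  · have := gaussSum_mulShift χ (pE' ψ E) (Units.mk0 ξ h)
    rw [← this, ← mul_assoc, Units.val_mk0]
    have h1 : χ⁻¹ ξ * χ ξ = 1 := by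
      rw [← MulChar.mul_apply, inv_mul_cancel, MulChar.one_apply (isUnit_iff_ne_zero.mpr h)]
    rw [h1, one_mul]
    rfl

/-- Fourier transform on matrices -/
noncomputable def FT (ψ : AddChar F ℂ) (X : Matrix ι ι F → ℂ) (y : Matrix ι ι F) : ℂ := ∑ x, X x * ψ ((x * y).trace)

lemma orth {ψ : AddChar F ℂ} (hψ : ψ ≠ 1) (z : Matrix ι ι F) :
    ∑ y : Matrix ι ι F, ψ ((z * y).trace) = if z = 0 then (Fintype.card (Matrix ι ι F) : ℂ) else 0 := by
  split_ifs with h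
  · subst h; simp
  · have hex : ∃ i j, z i j ≠ 0 := by
      by_contra hc
      push Not at hc
      exact h (by ext i j; exact hc i j)
    obtain ⟨i, j, hij⟩ := hex
    obtain ⟨a, ha⟩ : ∃ a, ψ a ≠ 1 := by
      by_contra hc
      push Not at hc
      exact hψ (by ext a; exact hc a)
    let θ : AddChar (Matrix ι ι F) ℂ := ψ.compAddMonoidHom ((Matrix.traceAddMonoidHom ι F).comp (AddMonoidHom.mulLeft z))
    have hθ : θ ≠ 1 := by
      intro hc
      apply ha
      have := DFunLike.congr_fun hc (Matrix.single j i ((z i j)⁻¹ * a))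
      change ψ ((z * Matrix.single j i ((z i j)⁻¹ * a)).trace) = 1 at this
      rw [Matrix.trace_mul_single] at this
      change ψ (z i j * ((z i j)⁻¹ * a)) = 1 at this
      rwa [mul_inv_cancel_left₀ hij] at this
    exact AddChar.sum_eq_zero_of_ne_one hθ

lemma plancherel {ψ : AddChar F ℂ} (hψ : ψ ≠ 1) (X : Matrix ι ι F → ℂ) :
    ∑ y, FT ψ X y * conj (FT ψ X y) = Fintype.card (Matrix ι ι F) * ∑ x, X x * conj (X x) := by
  have h1 : ∀ y, FT ψ X y * conj (FT ψ X y) = ∑ x, ∑ x', X x * conj (X x') * ψ (((x - x') * y).trace) := by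
    intro y
    unfold FT
    rw [map_sum, Finset.sum_mul_sum]
    refine Finset.sum_congr rfl fun x _ => Finset.sum_congr rfl fun x' _ => ?_
    rw [map_mul, ← AddChar.map_neg_eq_conj, Matrix.sub_mul, Matrix.trace_sub, sub_eq_add_neg, AddChar.map_add_eq_mul]
    ring
  simp only [h1]
  rw [Finset.sum_comm, Finset.mul_sum]
  refine Finset.sum_congr rfl fun x _ => ?_
  rw [Finset.sum_comm]
  simp only [← Finset.mul_sum, orth hψ, sub_eq_zero, mul_ite, mul_zero]
  rw [Finset.sum_ite_eq, if_pos (Finset.mem_univ _)]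
  ring

/-- the transform statement -/
def TS (ι : Type) [Fintype ι] [DecidableEq ι] (ψ : AddChar F ℂ) (φ : E → ℂ) : Prop := ∀ y : Matrix ι ι F,
  FT ψ (Rf φ) y = (-1) ^ (Fintype.card ι - 1) * (Fintype.card F : ℂ) ^ (Fintype.card ι * (Fintype.card ι - 1) / 2) * Rf (hat ψ φ) y

lemma reg_inv {χ : MulChar E ℂ} (hχ : reg F χ) : reg F χ⁻¹ := by
  intro σ hσ
  obtain ⟨u, hu⟩ := hχ σ hσ
  refine ⟨u⁻¹, ?_⟩
  rwa [map_inv₀, MulChar.inv_apply', MulChar.inv_apply', inv_inv, inv_inv]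

lemma Rf_smul (c : ℂ) (φ : E → ℂ) (g : Matrix ι ι F) : Rf (fun ξ => c * φ ξ) g = c * Rf φ g := by
  unfold Rf; rw [Finset.mul_sum]; exact Finset.sum_congr rfl fun _ _ => by ring

theorem TS_reg [Nonempty ι] {ψ : AddChar F ℂ} (hψ : ψ ≠ 1) (hE : Module.finrank F E = Fintype.card ι) {χ : MulChar E ℂ}
    (hχ : reg F χ) (h1 : χ ≠ 1) : TS ι ψ χ := by
  set G := gaussSum χ (pE' ψ E) with hG
  set A : ℂ := (-1) ^ (Fintype.card ι - 1) * (Fintype.card F : ℂ) ^ (Fintype.card ι * (Fintype.card ι - 1) / 2) with hA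
  have hhat : hat ψ χ = fun ξ => G * χ⁻¹ ξ := by
    ext ξ; rw [hat_char ψ h1, mul_comm]
  have hGL : ∀ y : (Matrix ι ι F)ˣ, FT ψ (Rf χ) (y : Matrix ι ι F) = A * G * Rf (χ⁻¹ : MulChar E ℂ) (y : Matrix ι ι F) := by
    obtain ⟨c, hc⟩ := eigen hE (reg_inv hχ) (fun x : (Matrix ι ι F)ˣ => ψ ((x : Matrix ι ι F).trace))
      (fun x y => by simp only [Units.val_mul]; rw [Matrix.trace_mul_comm])
    have h2 : ∀ y : (Matrix ι ι F)ˣ, FT ψ (Rf χ) (y : Matrix ι ι F) = c * Rf (χ⁻¹ : MulChar E ℂ) (y : Matrix ι ι F) := by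
      intro y
      rw [← hc y]
      unfold FT
      rw [sum_units _ (fun g hg => by rw [Rf_sing (MulChar.map_zero χ) hg, zero_mul])]
      rw [← Equiv.sum_comp (Equiv.mulRight y⁻¹)]
      refine Finset.sum_congr rfl fun z _ => ?_
      simp only [Equiv.coe_mulRight, Units.val_mul]
      rw [Matrix.mul_assoc, Units.inv_mul, Matrix.mul_one, mul_comm]
      congr 1
      rw [← Rf_inv χ (g := (z : Matrix ι ι F) * ((y⁻¹ : (Matrix ι ι F)ˣ) : Matrix ι ι F)) (g' := (y : Matrix ι ι F) * ((z⁻¹ : (Matrix ι ι F)ˣ) : Matrix ι ι F))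
        (by rw [← Units.val_mul, ← Units.val_mul, ← Units.val_mul, ← Units.val_one]; congr 1; group)]
      have := Rf_CI (ι := ι) (F := F) (χ⁻¹ : MulChar E ℂ) (z : Matrix ι ι F) ((z⁻¹ : (Matrix ι ι F)ˣ) : Matrix ι ι F)
        ((y : Matrix ι ι F) * ((z⁻¹ : (Matrix ι ι F)ˣ) : Matrix ι ι F)) (Units.mul_inv z) (Units.inv_mul z)
      simp only at this
      rw [← this, Matrix.mul_assoc, Matrix.mul_assoc, Units.inv_mul, Matrix.mul_one]
    have h3 := h2 1
    rw [Units.val_one, Rf_one, map_one, one_mul] at h3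
    have h4 := Rf_weight hE χ (ι := ι) (fun t _ => ψ t)
    rw [glc_qD _ Fintype.card_pos] at h4
    have h5 : FT ψ (Rf χ) (1 : Matrix ι ι F) = A * qD (Fintype.card F) (Fintype.card ι) * G := by
      unfold FT
      simp only [Matrix.mul_one]
      exact h4
    have h6 : c = A * G := by
      have := qD_ne (F := F) (Fintype.card ι)
      apply mul_right_cancel₀ this
      rw [← h3, h5]; ring
    intro y; rw [h2, h6]
  have hGG : G * conj G = (Fintype.card F : ℂ) ^ Fintype.card ι := by
    have h2 := gaussSum_mul_gaussSum_eq_card h1 (pE'_prim (E := E) hψ)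
    have h3 : conj G = gaussSum χ⁻¹ (pE' ψ E)⁻¹ := by
      rw [hG]; unfold gaussSum
      rw [map_sum]
      refine Finset.sum_congr rfl fun u _ => ?_
      rw [map_mul, mc_conj, ← AddChar.map_neg_eq_conj, AddChar.inv_apply]
    rw [h3, h2]
    exact_mod_cast cardE hE
  have hAA : A * conj A * (Fintype.card F : ℂ) ^ Fintype.card ι = Fintype.card (Matrix ι ι F) := by
    have : Fintype.card (Matrix ι ι F) = Fintype.card F ^ (Fintype.card ι * Fintype.card ι) := by
      change Fintype.card (ι → ι → F) = _
      simp [Fintype.card_pi, pow_mul]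
    rw [this, hA]
    push_cast
    simp only [map_mul, map_pow, map_neg, map_one, map_natCast]
    have e1 : ((-1 : ℂ) ^ (Fintype.card ι - 1)) * (-1) ^ (Fintype.card ι - 1) = 1 := by
      rw [← mul_pow]; simp
    have e2 : Fintype.card ι * (Fintype.card ι - 1) / 2 + Fintype.card ι * (Fintype.card ι - 1) / 2 + Fintype.card ι = Fintype.card ι * Fintype.card ι := by
      have := Nat.div_mul_cancel (Nat.even_mul_pred_self (Fintype.card ι)).two_dvd
      have h0 : 0 < Fintype.card ι := Fintype.card_pos
      obtain ⟨m, hm⟩ : ∃ m, Fintype.card ι = m + 1 := ⟨_, (Nat.sub_add_cancel h0).symm⟩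
      rw [hm] at this ⊢
      rw [Nat.add_sub_cancel] at *
      nlinarith
    rw [← e2, pow_add, pow_add]
    linear_combination (Fintype.card F : ℂ) ^ (Fintype.card ι * (Fintype.card ι - 1) / 2) * (Fintype.card F : ℂ) ^ (Fintype.card ι * (Fintype.card ι - 1) / 2) * (Fintype.card F : ℂ) ^ Fintype.card ι * e1
  have hsing : ∀ y : Matrix ι ι F, ¬ IsUnit y → FT ψ (Rf χ) y = 0 := by
    classical
    have h2 := plancherel hψ (ι := ι) (Rf χ)
    rw [Rf_norm hE hχ] at h2
    have h3 : ∑ y : Matrix ι ι F, (A * G * Rf (χ⁻¹ : MulChar E ℂ) y) * conj (A * G * Rf (χ⁻¹ : MulChar E ℂ) y) =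
        Fintype.card (Matrix ι ι F) * glc (Fintype.card F) (Fintype.card ι) := by
      rw [← Rf_norm hE (reg_inv hχ), Finset.mul_sum]
      refine Finset.sum_congr rfl fun y _ => ?_
      rw [map_mul, map_mul, ← hAA, ← hGG]; ring
    have h4 : ∑ y : Matrix ι ι F, ((FT ψ (Rf χ) y * conj (FT ψ (Rf χ) y)) - (A * G * Rf (χ⁻¹ : MulChar E ℂ) y) * conj (A * G * Rf (χ⁻¹ : MulChar E ℂ) y)) = 0 := by
      rw [Finset.sum_sub_distrib, h2, h3, sub_self]
    have h5 : ∀ y : Matrix ι ι F, ((FT ψ (Rf χ) y * conj (FT ψ (Rf χ) y)) - (A * G * Rf (χ⁻¹ : MulChar E ℂ) y) * conj (A * G * Rf (χ⁻¹ : MulChar E ℂ) y)) =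
        ((if IsUnit y then 0 else Complex.normSq (FT ψ (Rf χ) y) : ℝ) : ℂ) := by
      intro y
      split_ifs with h
      · obtain ⟨u, rfl⟩ := h
        rw [hGL, sub_self, Complex.ofReal_zero]
      · rw [Rf_sing (MulChar.map_zero _) h, mul_zero, zero_mul, sub_zero, Complex.mul_conj]
    simp only [h5] at h4
    have h6 : ∑ y : Matrix ι ι F, (if IsUnit y then 0 else Complex.normSq (FT ψ (Rf χ) y) : ℝ) = 0 := by exact_mod_cast h4
    rw [Finset.sum_eq_zero_iff_of_nonneg (fun y _ => by split_ifs; exact le_rfl; exact Complex.normSq_nonneg _)] at h6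
    intro y hy
    have := h6 y (Finset.mem_univ _)
    rw [if_neg hy] at this
    exact Complex.normSq_eq_zero.mp this
  intro y
  rw [hhat, Rf_smul, ← hA]
  by_cases h : IsUnit y
  · obtain ⟨u, rfl⟩ := h
    rw [hGL]; ring
  · rw [hsing y h, Rf_sing (MulChar.map_zero _) h]; ring

end MK

end

section
open scoped BigOperators ComplexConjugate
namespace MK

variable {F : Type} [Field F] [Fintype F] [DecidableEq F]
variable {ι μ δ ν κ : Type} [Fintype ι] [Fintype μ] [Fintype δ] [Fintype ν] [Fintype κ]
  [DecidableEq ι] [DecidableEq μ] [DecidableEq δ] [DecidableEq ν] [DecidableEq κ]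
variable {E : Type} [Field E] [Fintype E] [DecidableEq E] [Algebra F E]

lemma charpoly_shift (g : Matrix ι ι F) (s : F) : (g + Matrix.scalar ι s).charpoly = g.charpoly.comp (Polynomial.X - Polynomial.C s) := by
  have := Matrix.charpoly_sub_scalar g (-s)
  rwa [map_neg, map_neg, sub_neg_eq_add, ← sub_eq_add_neg] at this

lemma DD_shift' (c : Matrix δ δ F) (g : Matrix ι ι F) (s : F) : DD (c + Matrix.scalar δ s) (g + Matrix.scalar ι s) = DD c g := by
  have e1 : prim (c + Matrix.scalar δ s) (g + Matrix.scalar ι s) ↔ prim c g := by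
    unfold prim
    simp only [charpoly_shift, ← Polynomial.pow_comp]
    refine exists_congr fun r => ⟨fun h => ?_, fun h => by rw [h]⟩
    have := congrArg (fun p => p.comp (Polynomial.X + Polynomial.C s)) h
    simpa [Polynomial.comp_assoc] using this
  have e2 : Ho (c + Matrix.scalar δ s) (g + Matrix.scalar ι s) = Ho c g := by
    unfold Ho
    refine Nat.card_congr (Equiv.subtypeEquivRight fun A => ?_)
    have : Matrix.scalar ι s * A = A * Matrix.scalar δ s := by
      ext i j; simp [Matrix.scalar_apply, Matrix.diagonal_mul, Matrix.mul_diagonal, mul_comm]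
    rw [Matrix.add_mul, Matrix.mul_add, this, add_left_inj]
  unfold DD
  by_cases h : prim c g
  · rw [if_pos h, if_pos (e1.mpr h)]
    unfold lf
    rw [e2]
  · rw [if_neg h, if_neg (fun h' => h (e1.mp h'))]

lemma DD_shift (ξ : E) (g : Matrix ι ι F) (s : F) : DD (cx F (ξ + algebraMap F E s)) (g + Matrix.scalar ι s) = DD (cx F ξ) g := by
  rw [← DD_shift' (cx F ξ) g s]
  refine (DD_congr (cx_irr _) ?_ _).symm
  rw [charpoly_shift, cx_charpoly, cx_charpoly, minpoly.add_algebraMap]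

lemma Rf_shift (φ : E → ℂ) (g : Matrix ι ι F) (s : F) : Rf φ (g + Matrix.scalar ι s) = Rf (fun ξ => φ (ξ + algebraMap F E s)) g := by
  unfold Rf
  rw [← Equiv.sum_comp (Equiv.addRight (algebraMap F E s))]
  refine Finset.sum_congr rfl fun ξ _ => ?_
  rw [Equiv.coe_addRight, DD_shift]

lemma Rf_mod [Nonempty ι] (hE : Module.finrank F E = Fintype.card ι) (φ : E → ℂ) (f : F → ℂ) (g : Matrix ι ι F) :
    Rf (fun ξ => f (Algebra.trace F E ξ) * φ ξ) g = f g.trace * Rf φ g := by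
  unfold Rf
  rw [Finset.mul_sum]
  refine Finset.sum_congr rfl fun ξ _ => ?_
  by_cases h : prim (cx F ξ) g
  · rw [(prim_trace hE h).1]; ring
  · have : DD (cx F ξ) g = 0 := by unfold DD; rw [if_neg h]
    rw [this]; ring

lemma Rf_add (φ φ' : E → ℂ) (g : Matrix ι ι F) : Rf (fun ξ => φ ξ + φ' ξ) g = Rf φ g + Rf φ' g := by
  unfold Rf; rw [← Finset.sum_add_distrib]; exact Finset.sum_congr rfl fun _ _ => by ring

/-- functions satisfying the transform statement -/
def Vg (F : Type) [Field F] [Fintype F] [DecidableEq F] (ι : Type) [Fintype ι] [DecidableEq ι] 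
   (E : Type) [Field E] [Fintype E] [DecidableEq E] [Algebra F E] (ψ : AddChar F ℂ) : Submodule ℂ (E → ℂ) where
  carrier := {φ | TS ι ψ φ}
  zero_mem' := by
    intro y
    have h1 : ∀ g : Matrix ι ι F, Rf (0 : E → ℂ) g = 0 := fun g => by unfold Rf; simp
    have h2 : hat ψ (0 : E → ℂ) = 0 := by ext; unfold hat; simp
    unfold FT
    rw [h2, h1]
    simp [h1]
  add_mem' := by
    intro φ φ' h h' y
    have e1 : hat ψ (φ + φ') = fun ξ => hat ψ φ ξ + hat ψ φ' ξ := by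
      ext ξ; unfold hat; rw [← Finset.sum_add_distrib]; exact Finset.sum_congr rfl fun _ _ => by rw [Pi.add_apply]; ring
    have e2 : FT ψ (Rf (φ + φ')) y = FT ψ (Rf φ) y + FT ψ (Rf φ') y := by
      unfold FT; rw [← Finset.sum_add_distrib]; exact Finset.sum_congr rfl fun g _ => by rw [show Rf (φ + φ') g = _ from Rf_add φ φ' g]; ring
    rw [e1, e2, Rf_add, h y, h' y]; ring
  smul_mem' := by
    intro c φ h y
    have e1 : hat ψ (c • φ) = fun ξ => c * hat ψ φ ξ := by
      ext ξ; unfold hat; rw [Finset.mul_sum]; exact Finset.sum_congr rfl fun _ _ => by rw [Pi.smul_apply, smul_eq_mul]; ring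
    have e2 : FT ψ (Rf (c • φ)) y = c * FT ψ (Rf φ) y := by
      unfold FT; rw [Finset.mul_sum]; exact Finset.sum_congr rfl fun g _ => by rw [show Rf (c • φ) g = _ from Rf_smul c φ g]; ring
    rw [e1, e2, Rf_smul, h y]; ring

lemma TS_trans [Nonempty ι] (hE : Module.finrank F E = Fintype.card ι) {ψ : AddChar F ℂ} {φ : E → ℂ} (h : TS ι ψ φ) (s : F) :
    TS ι ψ (fun ξ => φ (ξ + algebraMap F E s)) := by
  intro y
  have e1 : hat ψ (fun ξ => φ (ξ + algebraMap F E s)) = fun ξ => ψ (- (s * Algebra.trace F E ξ)) * hat ψ φ ξ := by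
    ext ξ
    unfold hat
    rw [← Equiv.sum_comp (Equiv.addRight (algebraMap F E s)) (fun η => φ η * ψ (Algebra.trace F E (ξ * η))), Finset.mul_sum]
    refine Finset.sum_congr rfl fun η _ => ?_
    rw [Equiv.coe_addRight, mul_add, map_add, mul_comm ξ (algebraMap F E s), ← Algebra.smul_def, map_smul, smul_eq_mul,
      mul_left_comm, ← AddChar.map_add_eq_mul]
    congr 2; ring
  rw [e1, Rf_mod hE (hat ψ φ) (fun t => ψ (-(s * t)))]
  have e2 : FT ψ (Rf (fun ξ => φ (ξ + algebraMap F E s))) y = ψ (-(s * y.trace)) * FT ψ (Rf φ) y := by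
    unfold FT
    rw [← Equiv.sum_comp (Equiv.addRight (Matrix.scalar ι s)) (fun x => Rf φ x * ψ ((x * y).trace)), Finset.mul_sum]
    refine Finset.sum_congr rfl fun g _ => ?_
    rw [Equiv.coe_addRight, Rf_shift, Matrix.add_mul, Matrix.trace_add, mul_left_comm, ← AddChar.map_add_eq_mul]
    have : (Matrix.scalar ι s * y).trace = s * y.trace := by
      rw [Matrix.scalar_apply, ← Matrix.smul_one_eq_diagonal, Matrix.smul_mul, Matrix.one_mul, Matrix.trace_smul, smul_eq_mul]
    rw [this]
    congr 2; ring
  rw [e2, h y]; ring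

lemma TS_mod [Nonempty ι] (hE : Module.finrank F E = Fintype.card ι) {ψ : AddChar F ℂ} {φ : E → ℂ} (h : TS ι ψ φ) (s : F) :
    TS ι ψ (fun ξ => ψ (s * Algebra.trace F E ξ) * φ ξ) := by
  intro y
  have e1 : hat ψ (fun ξ => ψ (s * Algebra.trace F E ξ) * φ ξ) = fun ξ => hat ψ φ (ξ + algebraMap F E s) := by
    ext ξ
    unfold hat
    refine Finset.sum_congr rfl fun η _ => ?_
    rw [add_mul, map_add, ← Algebra.smul_def, map_smul, smul_eq_mul, AddChar.map_add_eq_mul]; ring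
  rw [e1, ← Rf_shift, ← h]
  unfold FT
  refine Finset.sum_congr rfl fun g _ => ?_
  rw [Rf_mod hE φ (fun t => ψ (s * t)), Matrix.mul_add, Matrix.trace_add]
  have : (g * Matrix.scalar ι s).trace = s * g.trace := by
    rw [Matrix.scalar_apply, ← Matrix.smul_one_eq_diagonal, Matrix.mul_smul, Matrix.mul_one, Matrix.trace_smul, smul_eq_mul]
  rw [this, AddChar.map_add_eq_mul]; ring

end MK

end

section
open scoped BigOperators ComplexConjugate
namespace MK

variable {F : Type} [Field F] [Fintype F] [DecidableEq F]
variable {ι μ δ ν κ : Type} [Fintype ι] [Fintype μ] [Fintype δ] [Fintype ν] [Fintype κ]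
  [DecidableEq ι] [DecidableEq μ] [DecidableEq δ] [DecidableEq ν] [DecidableEq κ]
variable {E : Type} [Field E] [Fintype E] [DecidableEq E] [Algebra F E]

lemma cyc_N (q n : ℕ) (hq : 2 ≤ q) (hn : 2 ≤ n) : ∃ N : ℕ, 1 < N ∧ ∀ d, d ∣ n → d < n → N * (q ^ d - 1) ∣ q ^ n - 1 := by
  refine ⟨(Polynomial.eval (q : ℤ) (Polynomial.cyclotomic n ℤ)).natAbs, ?_, ?_⟩
  · have := Polynomial.sub_one_lt_natAbs_cyclotomic_eval (n := n) (q := q) (by omega) (by omega)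
    omega
  · intro d hd hdn
    have h1 := Polynomial.X_pow_sub_one_mul_cyclotomic_dvd_X_pow_sub_one_of_dvd ℤ (Nat.mem_properDivisors.mpr ⟨hd, hdn⟩)
    have h2 := map_dvd (Polynomial.evalRingHom (q : ℤ)) h1
    simp only [map_mul, map_sub, map_pow, Polynomial.coe_evalRingHom, Polynomial.eval_X, map_one, Polynomial.eval_one, Polynomial.eval_pow, Polynomial.eval_mul, Polynomial.eval_sub] at h2
    have h3 : ∀ k, ((q ^ k - 1 : ℕ) : ℤ) = (q : ℤ) ^ k - 1 := by
      intro k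
      rw [Nat.cast_sub (Nat.one_le_pow _ _ (by omega))]; push_cast; ring
    rw [← h3, ← h3] at h2
    have h4 := Int.natAbs_dvd_natAbs.mpr h2
    rw [Int.natAbs_mul, Int.natAbs_natCast, Int.natAbs_natCast, mul_comm] at h4
    exact h4

lemma exists_u (hn : 2 ≤ Module.finrank F E) : ∃ u : E, u ≠ 0 ∧ u ≠ 1 ∧ (∀ χ : MulChar E ℂ, ¬ reg F χ → χ u = 1) ∧
    ∃ x ∈ IntermediateField.adjoin F {u}, Algebra.trace F E x ≠ 0 := by
  set n := Module.finrank F E with hnn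
  set q := Fintype.card F with hqq
  have hq : 2 ≤ q := Fintype.one_lt_card
  obtain ⟨N, hN1, hN⟩ := cyc_N q n hq hn
  obtain ⟨ζ, hζ⟩ := IsCyclic.exists_generator (α := Eˣ)
  have hcard : Fintype.card Eˣ = q ^ n - 1 := by
    rw [Fintype.card_units, Module.card_eq_pow_finrank (K := F) (V := E)]
  have hord : orderOf ζ = q ^ n - 1 := by
    rw [orderOf_eq_card_of_forall_mem_zpowers hζ, Nat.card_eq_fintype_card, hcard]
  have hpos : 0 < q ^ n - 1 := by rw [← hcard]; exact Fintype.card_pos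
  have hNd : N ∣ q ^ n - 1 := (Dvd.intro _ rfl).trans (hN 1 (one_dvd _) (by omega))
  obtain ⟨M, hM⟩ := hNd
  have hM0 : M ≠ 0 := by rintro rfl; omega
  have hou : orderOf (ζ ^ M) = N := by
    rw [orderOf_pow_of_dvd hM0 (by rw [hord, hM]; exact Dvd.intro_left _ rfl), hord, hM, Nat.mul_div_cancel _ (by omega)]
  refine ⟨((ζ ^ M : Eˣ) : E), Units.ne_zero _, ?_, ?_, ?_⟩
  · intro h
    have : ζ ^ M = 1 := Units.ext h
    rw [this, orderOf_one] at hou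
    omega
  · intro χ hχ
    unfold reg at hχ
    push Not at hχ
    obtain ⟨σ, hσ, h⟩ := hχ
    obtain ⟨i, hi⟩ := (FiniteField.bijective_frobeniusAlgEquivOfAlgebraic_pow F E).2 σ
    have hσx : ∀ x, σ x = x ^ (q ^ (i : ℕ)) := by
      intro x
      rw [← hi]
      simp only [AlgEquiv.coe_pow]
      rw [FiniteField.coe_frobeniusAlgEquivOfAlgebraic_iterate]
    have hi0 : (i : ℕ) ≠ 0 := by
      intro h0
      apply hσ
      ext x
      rw [hσx, h0, pow_zero, pow_one]; rfl
    set z := χ.toUnitHom ζ with hz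
    have hz1 : z ^ (q ^ (i : ℕ) - 1) = 1 := by
      have h1 := h ζ
      rw [hσx, map_pow] at h1
      have h2 : z ^ (q ^ (i : ℕ)) = z := by
        ext; rw [Units.val_pow_eq_pow_val, hz, MulChar.coe_toUnitHom]; exact h1
      have h3 : z ^ (q ^ (i : ℕ) - 1) * z = 1 * z := by
        rw [← pow_succ, Nat.sub_add_cancel (Nat.one_le_pow _ _ (by omega)), h2, one_mul]
      exact mul_right_cancel h3
    have hz2 : z ^ (q ^ n - 1) = 1 := by
      rw [hz, ← map_pow, ← hord, pow_orderOf_eq_one, map_one]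
    have hz3 : z ^ M = 1 := by
      rw [← orderOf_dvd_iff_pow_eq_one] at hz1 hz2 ⊢
      have h1 := Nat.dvd_gcd hz1 hz2
      rw [Nat.pow_sub_one_gcd_pow_sub_one] at h1
      refine h1.trans ?_
      have hlt : (i : ℕ) < n := i.2
      have h2 := hN (Nat.gcd i n) (Nat.gcd_dvd_right _ _) (lt_of_le_of_lt (Nat.gcd_le_left _ (Nat.pos_of_ne_zero hi0)) hlt)
      rw [hM] at h2
      exact Nat.dvd_of_mul_dvd_mul_left (by omega) h2
    rw [← MulChar.coe_toUnitHom, map_pow, ← hz, hz3, Units.val_one]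
  · by_contra hc
    push Not at hc
    set A := IntermediateField.adjoin F {((ζ ^ M : Eˣ) : E)} with hA
    have hfin : (Module.finrank A E : F) = 0 := by
      obtain ⟨a, ha⟩ := Algebra.trace_surjective F A 1
      have h1 := hc (a : E) a.2
      rw [← Algebra.trace_trace (S := A) (a : E)] at h1
      have h2 : Algebra.trace A E (a : E) = Module.finrank A E • a := Algebra.trace_algebraMap a
      rw [h2, map_nsmul, ha, nsmul_eq_mul, mul_one] at h1
      exact h1
    obtain ⟨p, hp⟩ := CharP.exists F
    have hpp : p.Prime := CharP.char_is_prime F p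
    have hpd : p ∣ Module.finrank A E := (CharP.cast_eq_zero_iff F p _).mp hfin
    have hmn : Module.finrank F A * Module.finrank A E = n := Module.finrank_mul_finrank F A E
    obtain ⟨t, ht⟩ := hpd
    set m := Module.finrank F A with hm
    set d := m * t with hd
    have hdn : d * p = n := by rw [← hmn, ht, hd]; ring
    have hu : (ζ ^ M) ^ (q ^ m - 1) = 1 := by
      let uA : A := ⟨((ζ ^ M : Eˣ) : E), IntermediateField.mem_adjoin_simple_self F _⟩
      have : Fintype A := Fintype.ofFinite A
      have hne : uA ≠ 0 := by
        intro h0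
        exact (ζ ^ M).ne_zero (congrArg Subtype.val h0)
      have h1 := FiniteField.pow_card_sub_one_eq_one uA hne
      rw [Module.card_eq_pow_finrank (K := F) (V := A)] at h1
      have h2 := congrArg (Subtype.val) h1
      ext
      rw [Units.val_pow_eq_pow_val]
      exact h2
    have h1 : N ∣ q ^ m - 1 := by rw [← hou]; exact orderOf_dvd_of_pow_eq_one hu
    have h2 : N ∣ q ^ d - 1 := h1.trans (by rw [hd, pow_mul]; simpa using Nat.sub_dvd_pow_sub_pow (q ^ m) 1 t)
    have hd0 : 0 < d := Nat.pos_of_ne_zero (by rintro h; rw [h] at hdn; omega)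
    have h3 := hN d (Dvd.intro _ hdn) (by rw [← hdn]; exact lt_mul_of_one_lt_right hd0 hpp.one_lt)
    have h4 : N ∣ ∑ i ∈ Finset.range p, (q ^ d) ^ i := by
      have h5 : (q ^ d - 1) * ∑ i ∈ Finset.range p, (q ^ d) ^ i = q ^ n - 1 := by
        rw [mul_comm, ← hdn, pow_mul q d p]
        have := Nat.geomSum_eq (m := q ^ d) (hq.trans (Nat.le_self_pow hd0.ne' q)) p
        rw [this, Nat.div_mul_cancel]
        simpa using Nat.sub_dvd_pow_sub_pow (q ^ d) 1 p
      rw [← h5, mul_comm N] at h3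
      have : 1 < q ^ d := Nat.one_lt_pow hd0.ne' hq
      exact Nat.dvd_of_mul_dvd_mul_left (by omega) h3
    have h5 : N ∣ p := by
      have h6 : (q ^ d : ℕ) ≡ 1 [MOD N] := ((Nat.modEq_iff_dvd' (Nat.one_le_pow _ _ (by omega))).mpr h2).symm
      have h7 : ∑ i ∈ Finset.range p, (q ^ d) ^ i ≡ ∑ i ∈ Finset.range p, 1 ^ i [MOD N] := by
        refine Nat.ModEq.sum fun i _ => h6.pow i
      simp only [one_pow, Finset.sum_const, Finset.card_range, smul_eq_mul, mul_one] at h7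
      exact (Nat.modEq_zero_iff_dvd).mp (h7.symm.trans ((Nat.modEq_zero_iff_dvd).mpr h4))
    have hpq : p ∣ q := by
      rw [← CharP.cast_eq_zero_iff F p, hqq]; exact FiniteField.cast_card_eq_zero F
    have h8 : N = p := by
      rcases (Nat.dvd_prime hpp).mp h5 with h | h
      · omega
      · exact h
    have h9 : p ∣ q ^ n - 1 := by rw [← h8]; exact Dvd.intro _ hM.symm
    have h10 : p ∣ q ^ n := hpq.trans (dvd_pow_self _ (by omega))
    have := (Nat.dvd_sub_iff_right (Nat.one_le_pow _ _ (by omega)) h10).mp h9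
    exact hpp.one_lt.ne' (Nat.dvd_one.mp this)

end MK

end

section
open scoped BigOperators ComplexConjugate
namespace MK

variable {F : Type} [Field F] [Fintype F] [DecidableEq F]
variable {ι μ δ ν κ : Type} [Fintype ι] [Fintype μ] [Fintype δ] [Fintype ν] [Fintype κ]
  [DecidableEq ι] [DecidableEq μ] [DecidableEq δ] [DecidableEq ν] [DecidableEq κ]
variable {E : Type} [Field E] [Fintype E] [DecidableEq E] [Algebra F E]

lemma ac_ne (ψ : AddChar F ℂ) (t : F) : ψ t ≠ 0 := by
  intro h
  have := ψ.map_add_eq_mul t (-t)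
  rw [h, zero_mul, add_neg_cancel, AddChar.map_zero_eq_one] at this
  exact one_ne_zero this

lemma char_complete (g : Eˣ → ℂ) (h : ∀ χ : MulChar E ℂ, ∑ ξ : Eˣ, g ξ * χ ξ = 0) (ξ : Eˣ) : g ξ = 0 := by
  classical
  have : Fintype (MulChar E ℂ) := Fintype.ofFinite _
  have key : ∀ a : Eˣ, ∑ χ : MulChar E ℂ, χ a = if a = 1 then (Fintype.card (MulChar E ℂ) : ℂ) else 0 := by
    intro a
    split_ifs with ha
    · subst ha; simp
    · obtain ⟨χ, hχ⟩ := MulChar.exists_apply_ne_one_of_hasEnoughRootsOfUnity E ℂ (a := (a : E)) (fun h => ha (Units.ext h))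
      have h1 : χ a * ∑ χ : MulChar E ℂ, χ a = ∑ χ : MulChar E ℂ, χ a := by
        rw [Finset.mul_sum, ← Equiv.sum_comp (Equiv.mulLeft χ) (fun χ : MulChar E ℂ => χ a)]
        rfl
      have h2 : (χ a - 1) * ∑ χ : MulChar E ℂ, χ a = 0 := by linear_combination h1
      exact (mul_eq_zero.mp h2).resolve_left (sub_ne_zero.mpr hχ)
  have h1 : ∑ χ : MulChar E ℂ, χ ((ξ⁻¹ : Eˣ) : E) * ∑ η : Eˣ, g η * χ η = 0 :=
    Finset.sum_eq_zero fun χ _ => by rw [h, mul_zero]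
  have h2 : ∑ χ : MulChar E ℂ, χ ((ξ⁻¹ : Eˣ) : E) * ∑ η : Eˣ, g η * χ η = ∑ η : Eˣ, g η * ∑ χ : MulChar E ℂ, χ ((ξ⁻¹ * η : Eˣ) : E) := by
    simp only [Finset.mul_sum]
    rw [Finset.sum_comm]
    refine Finset.sum_congr rfl fun η _ => Finset.sum_congr rfl fun χ _ => ?_
    rw [Units.val_mul, map_mul]; ring
  rw [h2] at h1
  simp only [key, inv_mul_eq_one, mul_ite, mul_zero] at h1
  rw [Finset.sum_ite_eq, if_pos (Finset.mem_univ _)] at h1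
  refine (mul_eq_zero.mp h1).resolve_right ?_
  have : Nonempty (MulChar E ℂ) := ⟨1⟩
  exact_mod_cast Fintype.card_ne_zero

lemma units_sum (f : E → ℂ) (h : f 0 = 0) : ∑ x, f x = ∑ x : Eˣ, f x := by
  classical
  rw [← Finset.sum_subset (Finset.subset_univ (Finset.univ.image (Units.val : Eˣ → E))),
      Finset.sum_image (fun a _ b _ h => Units.ext h)]
  intro x _ hx
  by_cases h0 : x = 0
  · rw [h0, h]
  · exact absurd (Finset.mem_image.mpr ⟨Units.mk0 x h0, Finset.mem_univ _, rfl⟩) hx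

lemma ann_zero {ψ : AddChar F ℂ} (hψ : ψ ≠ 1) (hn : 2 ≤ Module.finrank F E) (l : E → ℂ)
    (hl : ∀ χ : MulChar E ℂ, reg F χ → χ ≠ 1 → ∀ s t : F, ∑ ξ : E, l ξ * (ψ (t * Algebra.trace F E ξ) * χ (ξ + algebraMap F E s)) = 0) :
    l = 0 := by
  obtain ⟨u, hu0, hu1, hun, x, hxA, hx⟩ := exists_u (F := F) (E := E) hn
  have hreg1 : ∀ χ : MulChar E ℂ, reg F χ → χ ≠ 1 := by
    rintro χ hχ rfl
    have hc : 1 < Nat.card (E ≃ₐ[F] E) := by rw [IsGalois.card_aut_eq_finrank]; omega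
    have : Nontrivial (E ≃ₐ[F] E) := Finite.one_lt_card_iff_nontrivial.mp hc
    obtain ⟨σ, hσ⟩ := exists_ne (1 : E ≃ₐ[F] E)
    obtain ⟨v, hv⟩ := hχ σ hσ
    apply hv
    by_cases h0 : v = 0
    · rw [h0, map_zero]
    · rw [MulChar.one_apply (isUnit_iff_ne_zero.mpr h0), MulChar.one_apply (isUnit_iff_ne_zero.mpr (by simpa using h0))]
  have step : ∀ (s t : F) (ξ : E), ξ ≠ 0 → l (u * ξ + algebraMap F E s) * ψ (t * Algebra.trace F E (u * ξ)) = l (ξ + algebraMap F E s) * ψ (t * Algebra.trace F E ξ) := by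
    intro s t ξ hξ
    set m : E → ℂ := fun ξ => l (ξ + algebraMap F E s) * ψ (t * Algebra.trace F E ξ) with hm
    have hm1 : ∀ χ : MulChar E ℂ, reg F χ → ∑ ξ : Eˣ, m ξ * χ ξ = 0 := by
      intro χ hχ
      have h1 := hl χ hχ (hreg1 χ hχ) (-s) t
      rw [← Equiv.sum_comp (Equiv.addRight (algebraMap F E s))] at h1
      rw [← units_sum (fun ξ => m ξ * χ ξ) (by rw [MulChar.map_zero, mul_zero])]
      have h2 : ∀ ξ : E, l (Equiv.addRight (algebraMap F E s) ξ) * (ψ (t * Algebra.trace F E (Equiv.addRight (algebraMap F E s) ξ)) * χ (Equiv.addRight (algebraMap F E s) ξ + algebraMap F E (-s))) =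
          ψ (t * Algebra.trace F E (algebraMap F E s)) * (m ξ * χ ξ) := by
        intro ξ
        rw [Equiv.coe_addRight, map_neg, add_neg_cancel_right, map_add, mul_add, AddChar.map_add_eq_mul, hm]; ring
      simp only [h2] at h1
      rw [← Finset.mul_sum] at h1
      exact (mul_eq_zero.mp h1).resolve_left (ac_ne ψ _)
    have h3 := char_complete (fun ξ : Eˣ => m (u * ξ) - m ξ) (fun χ => by
      simp only [sub_mul, Finset.sum_sub_distrib]
      have h4 : χ u * ∑ ξ : Eˣ, m (u * ξ) * χ ξ = ∑ ξ : Eˣ, m ξ * χ ξ := by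
        rw [← Equiv.sum_comp (Equiv.mulLeft (Units.mk0 u hu0)) (fun ξ : Eˣ => m ξ * χ ξ), Finset.mul_sum]
        refine Finset.sum_congr rfl fun ξ _ => ?_
        rw [Equiv.coe_mulLeft, Units.val_mul, Units.val_mk0, map_mul]; ring
      by_cases hr : reg F χ
      · rw [hm1 χ hr] at h4
        rw [hm1 χ hr, sub_zero]
        refine (mul_eq_zero.mp h4).resolve_left ?_
        exact ((isUnit_iff_ne_zero.mpr hu0).map χ).ne_zero
      · rw [hun χ hr, one_mul] at h4
        rw [h4, sub_self]) (Units.mk0 ξ hξ)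
    exact sub_eq_zero.mp h3
  have step0 : ∀ (s : F) (ξ : E), ξ ≠ 0 → l (u * ξ + algebraMap F E s) = l (ξ + algebraMap F E s) := by
    intro s ξ hξ
    have := step s 0 ξ hξ
    simpa using this
  obtain ⟨b, hb⟩ : ∃ b, ψ b ≠ 1 := by
    by_contra hc
    push Not at hc
    exact hψ (by ext a; exact hc a)
  have step1 : ∀ (s : F) (ξ : E), ξ ≠ 0 → l (ξ + algebraMap F E s) ≠ 0 → Algebra.trace F E ((u - 1) * ξ) = 0 := by
    intro s ξ hξ hne
    by_contra htr
    have := step s (b * (Algebra.trace F E ((u - 1) * ξ))⁻¹) ξ hξ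
    rw [step0 s ξ hξ] at this
    have h1 := mul_left_cancel₀ hne this
    have h2 : u * ξ = (u - 1) * ξ + ξ := by ring
    rw [h2, map_add, mul_add, AddChar.map_add_eq_mul, inv_mul_cancel_right₀ htr] at h1
    have h3 : (ψ b - 1) * ψ (b * (Algebra.trace F E ((u - 1) * ξ))⁻¹ * Algebra.trace F E ξ) = 0 := by linear_combination h1
    exact (mul_ne_zero (sub_ne_zero.mpr hb) (ac_ne ψ _)) h3
  have step2 : ∀ (i : ℕ) (s : F) (ξ : E), ξ ≠ 0 → l (ξ + algebraMap F E s) ≠ 0 → l (u ^ i * ξ + algebraMap F E s) ≠ 0 := by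
    intro i
    induction i with
    | zero => intro s ξ h0 h; simpa using h
    | succ i ih =>
      intro s ξ h0 h
      rw [pow_succ', mul_assoc, step0 s _ (mul_ne_zero (pow_ne_zero _ hu0) h0)]
      exact ih s ξ h0 h
  have step3 : ∀ (s : F) (ξ : E), ξ ≠ 0 → l (ξ + algebraMap F E s) ≠ 0 → Algebra.trace F E (x * ξ) = 0 := by
    intro s ξ h0 h
    have hmem : x * (u - 1)⁻¹ ∈ IntermediateField.adjoin F {u} := by
      refine mul_mem hxA (inv_mem (sub_mem (IntermediateField.mem_adjoin_simple_self F u) (one_mem _)))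
    rw [← IntermediateField.mem_toSubalgebra, IntermediateField.adjoin_simple_toSubalgebra_of_isAlgebraic (Algebra.IsAlgebraic.isAlgebraic u),
      Algebra.adjoin_singleton_eq_range_aeval] at hmem
    obtain ⟨P, hP⟩ := hmem
    have hP' : Polynomial.aeval u P = x * (u - 1)⁻¹ := hP
    have e1 : x * ξ = (u - 1) * (Polynomial.aeval u P * ξ) := by
      rw [hP']; field_simp [sub_ne_zero.mpr hu1]
    rw [e1, Polynomial.aeval_eq_sum_range, Finset.sum_mul, Finset.mul_sum, map_sum]
    refine Finset.sum_eq_zero fun i _ => ?_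
    rw [smul_mul_assoc, mul_smul_comm, map_smul, step1 s (u ^ i * ξ) (mul_ne_zero (pow_ne_zero _ hu0) h0) (step2 i s ξ h0 h), smul_zero]
  ext ζ
  by_contra hne
  rw [Pi.zero_apply] at hne
  have step4 : ∀ s : F, ζ ≠ algebraMap F E s → Algebra.trace F E (x * (ζ - algebraMap F E s)) = 0 := by
    intro s hs
    exact step3 s _ (sub_ne_zero.mpr hs) (by rw [sub_add_cancel]; exact hne)
  apply hx
  by_cases hF : ∃ a : F, ζ = algebraMap F E a
  · obtain ⟨a, ha⟩ := hF
    have := step4 (a - 1) (by rw [ha, map_sub, map_one]; intro h; exact one_ne_zero (sub_eq_self.mp h.symm))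
    rwa [ha, map_sub, map_one, sub_sub_cancel, mul_one] at this
  · push Not at hF
    have h0 := step4 0 (hF 0)
    have h1 := step4 1 (hF 1)
    rw [map_zero, sub_zero] at h0
    rw [map_one, mul_sub, map_sub, h0, mul_one, zero_sub, neg_eq_zero] at h1
    exact h1

theorem TS_all [Nonempty ι] {ψ : AddChar F ℂ} (hψ : ψ ≠ 1) (hE : Module.finrank F E = Fintype.card ι) (φ : E → ℂ) : TS ι ψ φ := by
  by_cases hn : 2 ≤ Module.finrank F E
  · suffices h : Vg F ι E ψ = ⊤ by
      have : φ ∈ Vg F ι E ψ := by rw [h]; trivial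
      exact this
    by_contra hc
    obtain ⟨f, hf0, hf⟩ := Submodule.exists_le_ker_of_lt_top _ (lt_top_iff_ne_top.mpr hc)
    apply hf0
    have hfs : ∀ φ : E → ℂ, f φ = ∑ ξ, f (Pi.single ξ 1) * φ ξ := by
      intro φ
      rw [LinearMap.pi_apply_eq_sum_univ f φ]
      refine Finset.sum_congr rfl fun ξ _ => ?_
      rw [smul_eq_mul, mul_comm]
      congr 2
      ext j
      rw [Pi.single_apply]
      by_cases h : ξ = j
      · rw [if_pos h, if_pos h.symm]
      · rw [if_neg h, if_neg (Ne.symm h)]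
    have hl := ann_zero hψ hn (fun ξ => f (Pi.single ξ 1)) (fun χ hχ h1 s t => by
      have h2 := TS_mod hE (TS_trans hE (TS_reg (ι := ι) hψ hE hχ h1) s) t
      have h3 : f _ = 0 := hf (show _ ∈ Vg F ι E ψ from h2)
      rw [hfs] at h3
      exact h3)
    ext φ
    simp only [LinearMap.coe_comp, Function.comp_apply, LinearMap.zero_apply, LinearMap.coe_single]
    exact congrFun hl φ
  · have h1 : Module.finrank F E = 1 := by
      have : 0 < Module.finrank F E := Module.finrank_pos
      omega
    have hc1 : Fintype.card ι = 1 := by omega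
    obtain ⟨i0, hi0⟩ := Fintype.card_eq_one_iff.mp hc1
    have hR : ∀ (φ : E → ℂ) (a : F), Rf φ (Matrix.scalar ι a) = φ (algebraMap F E a) := by
      intro φ a
      have e : Matrix.scalar ι a = 1 + Matrix.scalar ι (a - 1) := by rw [map_sub, map_one]; abel
      rw [e, Rf_shift, Rf_one, map_sub, map_one, add_sub_cancel, hc1]
      simp [qD]
    have hsc : ∀ y : Matrix ι ι F, y = Matrix.scalar ι (y i0 i0) := by
      intro y; ext i j; rw [hi0 i, hi0 j]; simp
    intro y
    rw [hsc y, hR, hc1]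
    set a := y i0 i0
    unfold FT hat
    simp only [Nat.sub_self, pow_zero, mul_zero, Nat.zero_div, one_mul]
    have hbij : Function.Bijective (algebraMap F E) := by
      refine (Fintype.bijective_iff_injective_and_card _).mpr ⟨(algebraMap F E).injective, ?_⟩
      rw [Module.card_eq_pow_finrank (K := F) (V := E), h1, pow_one]
    have hbij2 : Function.Bijective (fun t : F => Matrix.scalar ι t) := by
      refine ⟨fun s t h => ?_, fun y => ⟨y i0 i0, (hsc y).symm⟩⟩
      have := congrFun (congrFun h i0) i0
      simpa using this
    rw [← hbij2.sum_comp, ← hbij.sum_comp]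
    refine Finset.sum_congr rfl fun t _ => ?_
    rw [hR, ← map_mul, ← map_mul, Algebra.trace_algebraMap, h1, one_smul]
    congr 2
    simp [Matrix.trace, hc1, mul_comm]

end MK

end

section
open scoped BigOperators ComplexConjugate
namespace MK

variable {F : Type} [Field F] [Fintype F] [DecidableEq F]
variable {ι μ δ ν κ : Type} [Fintype ι] [Fintype μ] [Fintype δ] [Fintype ν] [Fintype κ]
  [DecidableEq ι] [DecidableEq μ] [DecidableEq δ] [DecidableEq ν] [DecidableEq κ]
variable {E : Type} [Field E] [Fintype E] [DecidableEq E] [Algebra F E]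

section kl
variable {G : Type} [Group G] [Fintype G] [DecidableEq G]

/-- k-fold convolution -/
def kl {k : ℕ} (f : Fin k → G → ℂ) (x : G) : ℂ := ∑ g : Fin k → G, if (List.ofFn g).prod = x then ∏ i, f i (g i) else 0

lemma kl_zero (f : Fin 0 → G → ℂ) (x : G) : kl f x = if x = 1 then 1 else 0 := by
  unfold kl
  rw [Fintype.sum_unique]
  simp [eq_comm]

lemma kl_succ {k : ℕ} (f : Fin (k + 1) → G → ℂ) (x : G) : kl f x = ∑ g, f 0 g * kl (fun i => f i.succ) (g⁻¹ * x) := by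
  unfold kl
  rw [← Equiv.sum_comp (Fin.consEquiv (fun _ => G)), Fintype.sum_prod_type]
  refine Finset.sum_congr rfl fun g _ => ?_
  rw [Finset.mul_sum]
  refine Finset.sum_congr rfl fun h _ => ?_
  have e : (List.ofFn (Fin.consEquiv (fun _ => G) (g, h))).prod = g * (List.ofFn h).prod := by
    rw [List.ofFn_succ, List.prod_cons]; rfl
  rw [e, Fin.prod_univ_succ, mul_ite, mul_zero]
  simp only [eq_inv_mul_iff_mul_eq]
  rfl

lemma kl_conj {k : ℕ} (f : Fin k → G → ℂ) (hf : ∀ i x y, f i (y⁻¹ * x * y) = f i x) (x y : G) : kl f (y⁻¹ * x * y) = kl f x := by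
  induction k generalizing x with
  | zero => rw [kl_zero, kl_zero]; congr 1; simp [mul_assoc, inv_mul_eq_one, eq_comm]
  | succ k ih =>
    rw [kl_succ, kl_succ, ← Equiv.sum_comp (MulAut.conj y⁻¹).toEquiv]
    refine Finset.sum_congr rfl fun g _ => ?_
    have e1 : (MulAut.conj y⁻¹).toEquiv g = y⁻¹ * g * y := by simp
    rw [e1, hf, ← ih (fun i => f i.succ) (fun i => hf i.succ) (g⁻¹ * x)]
    congr 2; group
end kl

/-- local factor -/
noncomputable def fM (α : Fˣ →* ℂˣ) (ψ : AddChar F ℂ) (g : (Matrix ι ι F)ˣ) : ℂ :=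
  (α (Units.map (Matrix.detMonoidHom) g) : ℂ) * ψ ((g : Matrix ι ι F).trace)

/-- local factor -/
noncomputable def fE (α : Fˣ →* ℂˣ) (ψ : AddChar F ℂ) (t : Eˣ) : ℂ :=
  (α (Units.map (Algebra.norm F : E →* F) t) : ℂ) * ψ (Algebra.trace F E t)

lemma ac_sum {k : ℕ} (ψ : AddChar F ℂ) (t : Fin k → F) : ψ (∑ i, t i) = ∏ i, ψ (t i) := by
  induction k with
  | zero => simp
  | succ k ih => rw [Fin.sum_univ_succ, Fin.prod_univ_succ, AddChar.map_add_eq_mul, ih]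

lemma mK_eq {k : ℕ} (α : Fin k → Fˣ →* ℂˣ) (ψ : AddChar F ℂ) (x : (Matrix ι ι F)ˣ) :
    matrixKloosterman α ψ (x : Matrix ι ι F) = kl (fun i => fM (α i) ψ) x := by
  unfold matrixKloosterman kl fM
  refine Finset.sum_congr rfl fun g _ => ?_
  have e : ((((List.ofFn g).prod : (Matrix ι ι F)ˣ) : Matrix ι ι F) = x) = ((List.ofFn g).prod = x) := propext ⟨fun h => Units.ext h, fun h => by rw [h]⟩
  simp only [e]
  congr 1
  rw [Matrix.trace_sum, ac_sum, ← Finset.prod_mul_distrib]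

lemma fK_eq {k : ℕ} (α : Fin k → Fˣ →* ℂˣ) (ψ : AddChar F ℂ) (x : Eˣ) :
    fieldKloosterman α ψ E (x : E) = kl (fun i => fE (α i) ψ) x := by
  unfold fieldKloosterman kl fE
  refine Finset.sum_congr rfl fun g _ => ?_
  have e : (((∏ i, g i : Eˣ) : E) = x) = ((List.ofFn g).prod = x) := by
    rw [List.prod_ofFn]
    exact propext ⟨fun h => Units.ext h, fun h => by rw [h]⟩
  simp only [e]
  congr 1
  rw [map_sum, ac_sum, ← Finset.prod_mul_distrib]

lemma mK_sing {k : ℕ} (α : Fin k → Fˣ →* ℂˣ) (ψ : AddChar F ℂ) (x : Matrix ι ι F) (hx : ¬ IsUnit x) :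
    matrixKloosterman α ψ x = 0 := by
  unfold matrixKloosterman
  refine Finset.sum_eq_zero fun g _ => ?_
  rw [if_neg]
  intro h
  exact hx ⟨_, h⟩

lemma fM_conj (α : Fˣ →* ℂˣ) (ψ : AddChar F ℂ) (x y : (Matrix ι ι F)ˣ) : fM α ψ (y⁻¹ * x * y) = fM α ψ x := by
  unfold fM
  congr 2
  · simp only [map_mul, map_inv]; rw [mul_comm, mul_inv_cancel_left]
  · rw [Units.val_mul, Units.val_mul, Matrix.trace_mul_comm, ← Matrix.mul_assoc, Units.mul_inv, Matrix.one_mul]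

lemma mK_CI {k : ℕ} (α : Fin k → Fˣ →* ℂˣ) (ψ : AddChar F ℂ) : CI (fun x : Matrix ι ι F => matrixKloosterman α ψ x) := by
  intro B B' g h1 h2
  simp only
  let y : (Matrix ι ι F)ˣ := ⟨B, B', h1, h2⟩
  by_cases hg : IsUnit g
  · obtain ⟨x, rfl⟩ := hg
    have : B' * (x : Matrix ι ι F) * B = ((y⁻¹ * x * y : (Matrix ι ι F)ˣ) : Matrix ι ι F) := rfl
    rw [this, mK_eq, mK_eq, kl_conj _ (fun i x y => fM_conj _ _ _ _)]
  · rw [mK_sing _ _ _ hg, mK_sing]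
    rintro ⟨x, hx⟩
    apply hg
    refine ⟨y * x * y⁻¹, ?_⟩
    rw [Units.val_mul, Units.val_mul, hx]
    change B * (B' * g * B) * B' = g
    simp only [Matrix.mul_assoc, h1, Matrix.mul_one]
    rw [← Matrix.mul_assoc, h1, Matrix.one_mul]

lemma DD_zero_unit [Nonempty ι] (hE : Module.finrank F E = Fintype.card ι) (z : (Matrix ι ι F)ˣ) : DD (cx F (0 : E)) (z : Matrix ι ι F) = 0 := by
  unfold DD
  rw [if_neg]
  intro h
  have h1 := (prim_trace hE h).2
  rw [Algebra.norm_zero] at h1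
  exact ((Matrix.isUnit_iff_isUnit_det _).mp z.isUnit).ne_zero h1

lemma Pk [Nonempty ι] {ψ : AddChar F ℂ} (hψ : ψ ≠ 1) (hE : Module.finrank F E = Fintype.card ι) {k : ℕ} (α : Fin k → Fˣ →* ℂˣ) (η : Eˣ) :
    ∑ x : (Matrix ι ι F)ˣ, kl (fun i => fM (α i) ψ) x * DD (cx F (η : E)) (x : Matrix ι ι F) =
    ((-1) ^ (Fintype.card ι - 1) * (Fintype.card F : ℂ) ^ (Fintype.card ι * (Fintype.card ι - 1) / 2)) ^ k * qD (Fintype.card F) (Fintype.card ι) *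
      kl (fun i => fE (α i) ψ) η := by
  set A : ℂ := (-1) ^ (Fintype.card ι - 1) * (Fintype.card F : ℂ) ^ (Fintype.card ι * (Fintype.card ι - 1) / 2) with hA
  induction k generalizing η with
  | zero =>
    simp only [kl_zero, ite_mul, one_mul, zero_mul, Finset.sum_ite_eq', Finset.mem_univ, if_true, Units.val_one, DD_one, Units.val_eq_one, pow_zero, mul_ite, mul_one, mul_zero]
  | succ k ih =>
    have key : ∀ z : (Matrix ι ι F)ˣ, ∑ g : (Matrix ι ι F)ˣ, ψ ((g : Matrix ι ι F).trace) * DD (cx F (η : E)) ((g * z : (Matrix ι ι F)ˣ) : Matrix ι ι F) =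
        A * ∑ ξ : Eˣ, ψ (Algebra.trace F E ((η * ξ⁻¹ : Eˣ) : E)) * DD (cx F (ξ : E)) (z : Matrix ι ι F) := by
      intro z
      have h1 := TS_all (ι := ι) hψ hE (fun ξ : E => if ξ = η then 1 else 0) ((z⁻¹ : (Matrix ι ι F)ˣ) : Matrix ι ι F)
      rw [← hA] at h1
      have hR : ∀ g : Matrix ι ι F, Rf (fun ξ : E => if ξ = η then 1 else 0) g = DD (cx F (η : E)) g := by
        intro g; unfold Rf; simp
      have hh : hat ψ (fun ξ : E => if ξ = η then 1 else 0) = fun ξ => ψ (Algebra.trace F E (ξ * η)) := by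
        ext ξ; unfold hat; simp
      rw [hh] at h1
      unfold FT at h1
      simp only [hR] at h1
      rw [sum_units _ (fun g hg => by rw [DD_sing η.ne_zero hg, zero_mul])] at h1
      rw [← Equiv.sum_comp (Equiv.mulRight z)] at h1
      unfold Rf at h1
      rw [units_sum (fun ξ : E => (fun ξ => ψ (Algebra.trace F E (ξ * η))) ξ * DD (cx F ξ) ((z⁻¹ : (Matrix ι ι F)ˣ) : Matrix ι ι F)) (by simp only []; rw [DD_zero_unit hE, mul_zero]),
        ← Equiv.sum_comp (Equiv.inv Eˣ) (fun x : Eˣ => (fun ξ : E => (fun ξ => ψ (Algebra.trace F E (ξ * η))) ξ * DD (cx F ξ) ((z⁻¹ : (Matrix ι ι F)ˣ) : Matrix ι ι F)) x)] at h1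
      simp only [] at h1
      refine Eq.trans (Finset.sum_congr rfl fun g _ => ?_) (h1.trans ?_)
      · rw [Equiv.coe_mulRight, Units.val_mul, Matrix.mul_assoc, Units.mul_inv, Matrix.mul_one, mul_comm]
      · congr 1
        refine Finset.sum_congr rfl fun ξ _ => ?_
        rw [Equiv.inv_apply, Units.val_inv_eq_inv_val, DD_inv ξ.ne_zero (Units.mul_inv z), Units.val_mul, Units.val_inv_eq_inv_val, mul_comm (η : E)]
    have hdet : ∀ (ξ : Eˣ) (x : (Matrix ι ι F)ˣ), DD (cx F (ξ : E)) (x : Matrix ι ι F) ≠ 0 → Units.map (Matrix.detMonoidHom) x = Units.map (Algebra.norm F : E →* F) ξ := by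
      intro ξ x h
      have hp : prim (cx F (ξ : E)) (x : Matrix ι ι F) := by
        by_contra hc; apply h; unfold DD; rw [if_neg hc]
      ext
      exact (prim_trace hE hp).2
    have s1 : ∑ x : (Matrix ι ι F)ˣ, kl (fun i => fM (α i) ψ) x * DD (cx F (η : E)) (x : Matrix ι ι F) =
       ∑ z : (Matrix ι ι F)ˣ, kl (fun i : Fin k => fM (α i.succ) ψ) z * (α 0 (Units.map (Algebra.norm F : E →* F) η * (Units.map (Matrix.detMonoidHom) z)⁻¹) : ℂ) *
         ∑ g : (Matrix ι ι F)ˣ, ψ ((g : Matrix ι ι F).trace) * DD (cx F (η : E)) ((g * z : (Matrix ι ι F)ˣ) : Matrix ι ι F) := by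
      simp only [kl_succ, Finset.sum_mul, Finset.mul_sum]
      rw [Finset.sum_comm]
      conv_rhs => rw [Finset.sum_comm]
      refine Finset.sum_congr rfl fun g _ => ?_
      rw [← Equiv.sum_comp (Equiv.mulLeft g)]
      refine Finset.sum_congr rfl fun z _ => ?_
      rw [Equiv.coe_mulLeft, inv_mul_cancel_left]
      by_cases h0 : DD (cx F (η : E)) ((g * z : (Matrix ι ι F)ˣ) : Matrix ι ι F) = 0
      · rw [h0]; ring
      · rw [← hdet η _ h0, map_mul (Units.map (Matrix.detMonoidHom (n := ι) (R := F))), mul_inv_cancel_right]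
        unfold fM; ring
    rw [s1]
    simp only [key]
    have s2 : ∑ z : (Matrix ι ι F)ˣ, kl (fun i : Fin k => fM (α i.succ) ψ) z * (α 0 (Units.map (Algebra.norm F : E →* F) η * (Units.map (Matrix.detMonoidHom) z)⁻¹) : ℂ) *
         (A * ∑ ξ : Eˣ, ψ (Algebra.trace F E ((η * ξ⁻¹ : Eˣ) : E)) * DD (cx F (ξ : E)) (z : Matrix ι ι F)) =
        A * ∑ ξ : Eˣ, fE (α 0) ψ (η * ξ⁻¹) * ∑ z : (Matrix ι ι F)ˣ, kl (fun i : Fin k => fM (α i.succ) ψ) z * DD (cx F (ξ : E)) (z : Matrix ι ι F) := by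
      simp only [Finset.mul_sum]
      rw [Finset.sum_comm]
      refine Finset.sum_congr rfl fun ξ _ => Finset.sum_congr rfl fun z _ => ?_
      by_cases h0 : DD (cx F (ξ : E)) (z : Matrix ι ι F) = 0
      · rw [h0]; ring
      · rw [hdet ξ _ h0, ← map_inv, ← map_mul]
        unfold fE; ring
    rw [s2]
    simp only [ih]
    rw [kl_succ, ← Equiv.sum_comp ((Equiv.inv Eˣ).trans (Equiv.mulLeft η)), Finset.mul_sum, Finset.mul_sum]
    refine Finset.sum_congr rfl fun ξ _ => ?_
    simp only [Equiv.trans_apply, Equiv.inv_apply, Equiv.coe_mulLeft]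
    have e : η * (η * ξ⁻¹)⁻¹ = ξ := by rw [mul_inv, inv_inv, mul_inv_cancel_left]
    rw [e, pow_succ, mul_comm η]; ring

end MK

end

section
open scoped BigOperators ComplexConjugate
namespace MK

variable {F : Type} [Field F] [Fintype F] [DecidableEq F]
variable {ι μ δ ν κ : Type} [Fintype ι] [Fintype μ] [Fintype δ] [Fintype ν] [Fintype κ]
  [DecidableEq ι] [DecidableEq μ] [DecidableEq δ] [DecidableEq ν] [DecidableEq κ]
variable {E : Type} [Field E] [Fintype E] [DecidableEq E] [Algebra F E]


/-- block unipotent -/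
def nu (u : Matrix μ ν F) : (Matrix (μ ⊕ ν) (μ ⊕ ν) F)ˣ :=
  ⟨Matrix.fromBlocks 1 u 0 1, Matrix.fromBlocks 1 (-u) 0 1,
    by simp [Matrix.fromBlocks_multiply], by simp [Matrix.fromBlocks_multiply]⟩

/-- block upper triangular unit -/
noncomputable def bl (g : (Matrix μ μ F)ˣ) (h : (Matrix ν ν F)ˣ) (u : Matrix μ ν F) : (Matrix (μ ⊕ ν) (μ ⊕ ν) F)ˣ :=
  ⟨Matrix.fromBlocks g u 0 h, Matrix.fromBlocks (↑g⁻¹ : Matrix μ μ F) (-((↑g⁻¹ : Matrix μ μ F) * u * (↑h⁻¹ : Matrix ν ν F))) 0 (↑h⁻¹ : Matrix ν ν F),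
    by rw [Matrix.fromBlocks_multiply, Matrix.mul_neg, ← Matrix.mul_assoc, ← Matrix.mul_assoc, Units.mul_inv, Matrix.one_mul]; simp only [Matrix.mul_zero, Matrix.zero_mul, Units.mul_inv, add_zero, zero_add, neg_add_cancel, Matrix.fromBlocks_one],
    by rw [Matrix.fromBlocks_multiply, Matrix.neg_mul, Matrix.neg_mul, Matrix.mul_assoc _ (↑h⁻¹ : Matrix ν ν F) (h : Matrix ν ν F), Units.inv_mul]; simp only [neg_zero, Matrix.mul_one, Matrix.mul_zero, Matrix.zero_mul, Units.inv_mul, add_zero, zero_add, add_neg_cancel, Matrix.fromBlocks_one]⟩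

lemma bl_val (g : (Matrix μ μ F)ˣ) (h : (Matrix ν ν F)ˣ) (u : Matrix μ ν F) : ((bl g h u : (Matrix (μ ⊕ ν) (μ ⊕ ν) F)ˣ) : Matrix (μ ⊕ ν) (μ ⊕ ν) F) = Matrix.fromBlocks g u 0 h := rfl
lemma nu_val (u : Matrix μ ν F) : ((nu u : (Matrix (μ ⊕ ν) (μ ⊕ ν) F)ˣ) : Matrix (μ ⊕ ν) (μ ⊕ ν) F) = Matrix.fromBlocks 1 u 0 1 := rfl

lemma nu_add (u v : Matrix μ ν F) : nu u * nu v = nu (u + v) := by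
  ext1
  rw [Units.val_mul, nu_val, nu_val, nu_val]
  simp [Matrix.fromBlocks_multiply, add_comm]

lemma bl_inj : Function.Injective (fun p : (Matrix μ μ F)ˣ × (Matrix ν ν F)ˣ × Matrix μ ν F => bl p.1 p.2.1 p.2.2) := by
  rintro ⟨g, h, u⟩ ⟨g', h', u'⟩ e
  have e1 := congrArg Units.val e
  simp only [bl_val] at e1
  rw [Matrix.fromBlocks_inj] at e1
  obtain ⟨h1, h2, -, h4⟩ := e1
  rw [Prod.mk.injEq, Prod.mk.injEq]
  exact ⟨Units.ext h1, Units.ext h4, h2⟩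

lemma bl_surj (g : (Matrix (μ ⊕ ν) (μ ⊕ ν) F)ˣ) (h : (g : Matrix (μ ⊕ ν) (μ ⊕ ν) F).toBlocks₂₁ = 0) : ∃ a d u, g = bl a d u := by
  have h1 := Matrix.fromBlocks_toBlocks (g : Matrix (μ ⊕ ν) (μ ⊕ ν) F)
  rw [h] at h1
  have h2 := g.isUnit
  rw [← h1, Matrix.isUnit_fromBlocks_zero₂₁] at h2
  obtain ⟨⟨a, ha⟩, ⟨d, hd⟩⟩ := h2
  refine ⟨a, d, (g : Matrix (μ ⊕ ν) (μ ⊕ ν) F).toBlocks₁₂, Units.ext ?_⟩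
  rw [bl_val, ha, hd, h1]

lemma cardM : (Fintype.card (Matrix μ ν F) : ℂ) = (Fintype.card F : ℂ) ^ (Fintype.card μ * Fintype.card ν) := by
  have : Fintype.card (Matrix μ ν F) = Fintype.card F ^ (Fintype.card μ * Fintype.card ν) := by
    rw [← Nat.card_eq_fintype_card]
    change Nat.card (μ → ν → F) = _
    simp [Nat.card_eq_fintype_card, ← pow_mul, mul_comm]
  rw [this, Nat.cast_pow]

lemma tr_block (A : Matrix μ μ F) (B : Matrix μ ν F) (C : Matrix ν μ F) (D : Matrix ν ν F) : (Matrix.fromBlocks A B C D).trace = A.trace + D.trace := by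
  simp [Matrix.trace]

lemma nu_inv (u : Matrix μ ν F) : (nu u)⁻¹ = nu (-u) := by
  rw [inv_eq_iff_mul_eq_one, nu_add, add_neg_cancel]
  ext1
  rw [nu_val, Matrix.fromBlocks_one]; rfl

lemma orth2 {ψ : AddChar F ℂ} (hψ : ψ ≠ 1) (z : Matrix ν μ F) :
    ∑ u : Matrix μ ν F, ψ ((z * u).trace) = if z = 0 then (Fintype.card F : ℂ) ^ (Fintype.card μ * Fintype.card ν) else 0 := by
  by_cases hc' : z = 0
  · rw [if_pos hc', hc', ← cardM]
    simp
  rw [if_neg hc']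
  have hex : ∃ i j, z i j ≠ 0 := by
    by_contra hc
    push Not at hc
    exact hc' (by ext i j; exact hc i j)
  obtain ⟨i, j, hij⟩ := hex
  obtain ⟨a, ha⟩ : ∃ a, ψ a ≠ 1 := by
    by_contra hc
    push Not at hc
    exact hψ (by ext a; exact hc a)
  let θ : AddChar (Matrix μ ν F) ℂ := ψ.compAddMonoidHom ((Matrix.traceAddMonoidHom ν F).comp ⟨⟨fun u => z * u, Matrix.mul_zero z⟩, fun a b => Matrix.mul_add z a b⟩)
  have hθ : θ ≠ 1 := by
    intro hc
    apply ha
    have := DFunLike.congr_fun hc (Matrix.single j i ((z i j)⁻¹ * a))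
    change ψ ((z * Matrix.single j i ((z i j)⁻¹ * a)).trace) = 1 at this
    rw [Matrix.trace_mul_single] at this
    change ψ (z i j * ((z i j)⁻¹ * a)) = 1 at this
    rwa [mul_inv_cancel_left₀ hij] at this
  exact AddChar.sum_eq_zero_of_ne_one hθ

lemma fM_nu (α : Fˣ →* ℂˣ) (ψ : AddChar F ℂ) (g : (Matrix (μ ⊕ ν) (μ ⊕ ν) F)ˣ) (u : Matrix μ ν F) :
    fM α ψ (g * nu u) = fM α ψ g * ψ (((g : Matrix (μ ⊕ ν) (μ ⊕ ν) F).toBlocks₂₁ * u).trace) := by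
  unfold fM
  have h1 : Units.map (Matrix.detMonoidHom) (g * nu u) = Units.map (Matrix.detMonoidHom) g := by
    ext; simp [nu_val]
  rw [h1, mul_assoc, ← AddChar.map_add_eq_mul]
  congr 2
  rw [Units.val_mul, nu_val]
  conv_lhs => rw [← Matrix.fromBlocks_toBlocks (g : Matrix (μ ⊕ ν) (μ ⊕ ν) F), Matrix.fromBlocks_multiply]
  conv_rhs => rw [← Matrix.fromBlocks_toBlocks (g : Matrix (μ ⊕ ν) (μ ⊕ ν) F)]
  rw [tr_block, tr_block]
  simp [Matrix.trace_add]; ring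

lemma fM_bl (α : Fˣ →* ℂˣ) (ψ : AddChar F ℂ) (g : (Matrix μ μ F)ˣ) (h : (Matrix ν ν F)ˣ) (u : Matrix μ ν F) :
    fM α ψ (bl g h u) = fM α ψ g * fM α ψ h := by
  unfold fM
  have h1 : Units.map (Matrix.detMonoidHom) (bl g h u) = Units.map (Matrix.detMonoidHom) g * Units.map (Matrix.detMonoidHom) h := by
    ext; simp [bl_val, Matrix.det_fromBlocks_zero₂₁]
  rw [h1, bl_val, tr_block, AddChar.map_add_eq_mul, map_mul]
  push_cast; ring

lemma bl_inv_mul (g l : (Matrix μ μ F)ˣ) (h m : (Matrix ν ν F)ˣ) (u w : Matrix μ ν F) : ∃ w', (bl g h u)⁻¹ * bl l m w = bl (g⁻¹ * l) (h⁻¹ * m) w' := by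
  refine ⟨(↑g⁻¹ : Matrix μ μ F) * w + (-((↑g⁻¹ : Matrix μ μ F) * u * (↑h⁻¹ : Matrix ν ν F))) * (m : Matrix ν ν F), Units.ext ?_⟩
  rw [Units.val_mul]
  change Matrix.fromBlocks (↑g⁻¹ : Matrix μ μ F) (-((↑g⁻¹ : Matrix μ μ F) * u * (↑h⁻¹ : Matrix ν ν F))) 0 (↑h⁻¹ : Matrix ν ν F) * Matrix.fromBlocks (l : Matrix μ μ F) w 0 (m : Matrix ν ν F) = _
  rw [Matrix.fromBlocks_multiply, bl_val]
  simp

/-- unipotent average -/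
noncomputable def Sk {k : ℕ} (α : Fin k → Fˣ →* ℂˣ) (ψ : AddChar F ℂ) (x : (Matrix (μ ⊕ ν) (μ ⊕ ν) F)ˣ) : ℂ :=
  ∑ u : Matrix μ ν F, kl (fun i => fM (α i) ψ) (x * nu u)

lemma Sk_left {k : ℕ} (α : Fin k → Fˣ →* ℂˣ) (ψ : AddChar F ℂ) (x : (Matrix (μ ⊕ ν) (μ ⊕ ν) F)ˣ) (u : Matrix μ ν F) :
    Sk α ψ (nu u * x) = Sk α ψ x := by
  unfold Sk
  rw [← Equiv.sum_comp (Equiv.addRight u) (fun v => kl (fun i => fM (α i) ψ) (x * nu v))]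
  refine Finset.sum_congr rfl fun v _ => ?_
  rw [Equiv.coe_addRight, ← nu_add, ← mul_assoc, ← kl_conj _ (fun i x y => fM_conj _ _ _ _) _ (nu u)]
  congr 1
  group

lemma Sk_succ {k : ℕ} {ψ : AddChar F ℂ} (hψ : ψ ≠ 1) (α : Fin (k + 1) → Fˣ →* ℂˣ) (x : (Matrix (μ ⊕ ν) (μ ⊕ ν) F)ˣ) :
    Sk α ψ x = ∑ p : (Matrix μ μ F)ˣ × (Matrix ν ν F)ˣ × Matrix μ ν F, fM (α 0) ψ (bl p.1 p.2.1 p.2.2) * Sk (fun i => α i.succ) ψ ((bl p.1 p.2.1 p.2.2)⁻¹ * x) := by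
  have h1 : Sk α ψ x = ∑ g, fM (α 0) ψ g * Sk (fun i => α i.succ) ψ (g⁻¹ * x) := by
    unfold Sk
    simp only [kl_succ, Finset.mul_sum]
    rw [Finset.sum_comm]
    simp only [mul_assoc]
  have h2 : ∀ u : Matrix μ ν F, Sk α ψ x = ∑ g : (Matrix (μ ⊕ ν) (μ ⊕ ν) F)ˣ, fM (α 0) ψ g * ψ (((g : Matrix (μ ⊕ ν) (μ ⊕ ν) F).toBlocks₂₁ * u).trace) * Sk (fun i => α i.succ) ψ (g⁻¹ * x) := by
    intro u
    rw [h1, ← Equiv.sum_comp (Equiv.mulRight (nu u))]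
    refine Finset.sum_congr rfl fun g _ => ?_
    rw [Equiv.coe_mulRight, ← fM_nu]
    have : (g * nu u)⁻¹ * x = (nu u)⁻¹ * (g⁻¹ * x) := by group
    have e : (nu u)⁻¹ = nu (-u) := nu_inv u
    rw [this, e, Sk_left]
  have hq : ((Fintype.card F : ℂ) ^ (Fintype.card μ * Fintype.card ν)) ≠ 0 := pow_ne_zero _ (by simp)
  have h3 : ((Fintype.card F : ℂ) ^ (Fintype.card μ * Fintype.card ν)) * Sk α ψ x = ((Fintype.card F : ℂ) ^ (Fintype.card μ * Fintype.card ν)) *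
      ∑ g : (Matrix (μ ⊕ ν) (μ ⊕ ν) F)ˣ, if (g : Matrix (μ ⊕ ν) (μ ⊕ ν) F).toBlocks₂₁ = 0 then fM (α 0) ψ g * Sk (fun i => α i.succ) ψ (g⁻¹ * x) else 0 := by
    have h4 : ∑ u : Matrix μ ν F, Sk α ψ x = ((Fintype.card F : ℂ) ^ (Fintype.card μ * Fintype.card ν)) * Sk α ψ x := by
      rw [← cardM]; simp
    rw [← h4, Finset.sum_congr rfl (fun u _ => h2 u), Finset.sum_comm, Finset.mul_sum]
    refine Finset.sum_congr rfl fun g _ => ?_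
    rw [← Finset.sum_mul, ← Finset.mul_sum, orth2 hψ]
    split_ifs
    · ring
    · ring
  rw [mul_left_cancel₀ hq h3]
  symm
  refine Fintype.sum_of_injective _ bl_inj _ _ ?_ ?_
  · intro g hg
    rw [if_neg]
    intro h
    obtain ⟨a, d, u, rfl⟩ := bl_surj g h
    exact hg ⟨⟨a, d, u⟩, rfl⟩
  · rintro ⟨a, d, u⟩
    simp only
    rw [if_pos]
    rw [bl_val, Matrix.toBlocks_fromBlocks₂₁]

lemma Sk_zero {k : ℕ} {ψ : AddChar F ℂ} (hψ : ψ ≠ 1) (α : Fin k → Fˣ →* ℂˣ) (x : (Matrix (μ ⊕ ν) (μ ⊕ ν) F)ˣ)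
    (hx : (x : Matrix (μ ⊕ ν) (μ ⊕ ν) F).toBlocks₂₁ ≠ 0) : Sk α ψ x = 0 := by
  induction k generalizing x with
  | zero =>
    unfold Sk
    refine Finset.sum_eq_zero fun u _ => ?_
    rw [kl_zero, if_neg]
    intro h
    apply hx
    rw [mul_eq_one_iff_eq_inv] at h
    have e : (nu u)⁻¹ = nu (-u) := nu_inv u
    rw [h, e, nu_val, Matrix.toBlocks_fromBlocks₂₁]
  | succ k ih =>
    rw [Sk_succ hψ]
    refine Finset.sum_eq_zero fun p _ => ?_
    rw [ih, mul_zero]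
    intro h
    apply hx
    obtain ⟨a, d, u, h1⟩ := bl_surj _ h
    rw [inv_mul_eq_iff_eq_mul] at h1
    rw [h1, Units.val_mul, bl_val, bl_val, Matrix.fromBlocks_multiply, Matrix.toBlocks_fromBlocks₂₁]
    simp

lemma Sk_bl {k : ℕ} {ψ : AddChar F ℂ} (hψ : ψ ≠ 1) (α : Fin k → Fˣ →* ℂˣ) (l : (Matrix μ μ F)ˣ) (m : (Matrix ν ν F)ˣ) (w : Matrix μ ν F) :
    Sk α ψ (bl l m w) = (Fintype.card F : ℂ) ^ (k * (Fintype.card μ * Fintype.card ν)) * (kl (fun i => fM (α i) ψ) l * kl (fun i => fM (α i) ψ) m) := by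
  induction k generalizing l m w with
  | zero =>
    unfold Sk
    simp only [kl_zero]
    rw [zero_mul, pow_zero, one_mul]
    have key : ∀ u : Matrix μ ν F, bl l m w * nu u = 1 ↔ (l = 1 ∧ m = 1) ∧ u = -w := by
      intro u
      rw [Units.ext_iff, Units.val_mul, bl_val, nu_val, Matrix.fromBlocks_multiply, Units.val_one, ← Matrix.fromBlocks_one, Matrix.fromBlocks_inj]
      simp only [Matrix.mul_one, Matrix.mul_zero, Matrix.zero_mul, add_zero, zero_add, Units.val_eq_one, true_and]
      constructor
      · rintro ⟨rfl, h2, rfl⟩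
        refine ⟨⟨rfl, rfl⟩, ?_⟩
        rw [Units.val_one, Matrix.one_mul] at h2
        exact eq_neg_of_add_eq_zero_left h2
      · rintro ⟨⟨rfl, rfl⟩, rfl⟩
        refine ⟨rfl, ?_, rfl⟩
        rw [Units.val_one, Matrix.one_mul, neg_add_cancel]
    simp only [key]
    by_cases h1 : l = 1 <;> by_cases h2 : m = 1 <;> simp [h1, h2]
  | succ k ih =>
    rw [Sk_succ hψ, Fintype.sum_prod_type, kl_succ, kl_succ, Finset.sum_mul_sum, Finset.mul_sum]
    refine Finset.sum_congr rfl fun g _ => ?_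
    rw [Fintype.sum_prod_type, Finset.mul_sum]
    refine Finset.sum_congr rfl fun h _ => ?_
    have e : ∀ u : Matrix μ ν F, fM (α 0) ψ (bl g h u) * Sk (fun i => α i.succ) ψ ((bl g h u)⁻¹ * bl l m w) =
        fM (α 0) ψ g * fM (α 0) ψ h * ((Fintype.card F : ℂ) ^ (k * (Fintype.card μ * Fintype.card ν)) *
          (kl (fun i => fM (α i.succ) ψ) (g⁻¹ * l) * kl (fun i => fM (α i.succ) ψ) (h⁻¹ * m))) := by
      intro u
      obtain ⟨w', hw'⟩ := bl_inv_mul g l h m u w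
      rw [hw', ih, fM_bl]
    simp only [e]
    rw [Finset.sum_const, Finset.card_univ, nsmul_eq_mul, cardM, add_mul, pow_add, one_mul]
    ring

end MK

end

section
open scoped BigOperators ComplexConjugate
namespace MK

variable {F : Type} [Field F] [Fintype F] [DecidableEq F]
variable {ι μ δ ν κ : Type} [Fintype ι] [Fintype μ] [Fintype δ] [Fintype ν] [Fintype κ]
  [DecidableEq ι] [DecidableEq μ] [DecidableEq δ] [DecidableEq ν] [DecidableEq κ]
variable {E : Type} [Field E] [Fintype E] [DecidableEq E] [Algebra F E]


lemma KM_block {k : ℕ} {ψ : AddChar F ℂ} (hψ : ψ ≠ 1) (α : Fin k → Fˣ →* ℂˣ) (h : Matrix μ μ F) (x : Matrix ν ν F) :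
    ∑ u : Matrix μ ν F, matrixKloosterman α ψ (Matrix.fromBlocks h u 0 x) =
      (Fintype.card F : ℂ) ^ (k * (Fintype.card μ * Fintype.card ν)) * (matrixKloosterman α ψ h * matrixKloosterman α ψ x) := by
  by_cases hu : IsUnit h ∧ IsUnit x
  · obtain ⟨⟨l, rfl⟩, ⟨m, rfl⟩⟩ := hu
    rw [mK_eq, mK_eq, ← Sk_bl hψ α l m 0]
    unfold Sk
    let e : Matrix μ ν F ≃ Matrix μ ν F := ⟨fun u => (l : Matrix μ μ F) * u, fun u => (↑l⁻¹ : Matrix μ μ F) * u,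
      fun u => by simp only [← Matrix.mul_assoc, Units.inv_mul, Matrix.one_mul],
      fun u => by simp only [← Matrix.mul_assoc, Units.mul_inv, Matrix.one_mul]⟩
    rw [← Equiv.sum_comp e]
    refine Finset.sum_congr rfl fun u _ => ?_
    rw [← mK_eq, Units.val_mul, bl_val, nu_val, Matrix.fromBlocks_multiply]
    simp only [Matrix.mul_zero, Matrix.zero_mul, Matrix.mul_one, add_zero, zero_add]
    rfl
  · have h1 : ∀ u : Matrix μ ν F, matrixKloosterman α ψ (Matrix.fromBlocks h u 0 x) = 0 := by
      intro u
      apply mK_sing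
      rwa [Matrix.isUnit_fromBlocks_zero₂₁]
    simp only [h1, Finset.sum_const_zero]
    by_cases h2 : IsUnit h
    · rw [mK_sing α ψ x (fun h3 => hu ⟨h2, h3⟩), mul_zero, mul_zero]
    · rw [mK_sing α ψ h h2, zero_mul, mul_zero]

lemma KM_reindex {k : ℕ} (α : Fin k → Fˣ →* ℂˣ) (ψ : AddChar F ℂ) (e : ι ≃ κ) (g : Matrix ι ι F) :
    matrixKloosterman α ψ (Matrix.reindex e e g) = matrixKloosterman α ψ g := by
  unfold matrixKloosterman
  let r : Matrix ι ι F ≃* Matrix κ κ F := (Matrix.reindexAlgEquiv F F e).toMulEquiv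
  have hr : ∀ x, r x = Matrix.reindex e e x := fun x => rfl
  let ee : (Matrix ι ι F)ˣ ≃ (Matrix κ κ F)ˣ := (Units.mapEquiv r).toEquiv
  have hee : ∀ x, ee x = Units.map r.toMonoidHom x := fun x => rfl
  rw [← Equiv.sum_comp (Equiv.piCongrRight (fun _ : Fin k => ee))]
  refine Finset.sum_congr rfl fun x _ => ?_
  have e1 : (List.ofFn (Equiv.piCongrRight (fun _ : Fin k => ee) x)).prod = Units.map r.toMonoidHom (List.ofFn x).prod := by
    rw [map_list_prod, List.map_ofFn]; rfl
  have e2 : (((List.ofFn (Equiv.piCongrRight (fun _ : Fin k => ee) x)).prod : Matrix κ κ F) = Matrix.reindex e e g) = (((List.ofFn x).prod : Matrix ι ι F) = g) := by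
    rw [e1]
    apply propext
    constructor
    · intro h; exact r.injective h
    · intro h; rw [← h]; rfl
  simp only [e2]
  congr 1
  congr 1
  · refine Finset.prod_congr rfl fun i _ => ?_
    congr 2
    ext
    change (Matrix.reindex e e (x i : Matrix ι ι F)).det = (x i : Matrix ι ι F).det
    rw [Matrix.det_reindex_self]
  · congr 1
    have : ∑ i, ((Equiv.piCongrRight (fun _ : Fin k => ee) x i : (Matrix κ κ F)ˣ) : Matrix κ κ F) = Matrix.reindexAlgEquiv F F e (∑ i, (x i : Matrix ι ι F)) := by
      rw [map_sum]; rfl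
    rw [this]
    change ∑ j, (∑ i, (x i : Matrix ι ι F)) (e.symm j) (e.symm j) = _
    exact Equiv.sum_comp e.symm (fun j => (∑ i, (x i : Matrix ι ι F)) j j)

lemma sylv {l : Matrix μ μ F} {m : Matrix ν ν F} (h : IsCoprime l.charpoly m.charpoly) :
    Function.Surjective (fun v : Matrix μ ν F => l * v - v * m) := by
  apply Finite.surjective_of_injective
  have hz : ∀ v : Matrix μ ν F, l * v = v * m → v = 0 := by
    intro v hv
    have hp : ∀ p : Polynomial F, (Polynomial.aeval l p) * v = v * (Polynomial.aeval m p) := by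
      intro p
      induction p using Polynomial.induction_on' with
      | add p q hp hq => rw [map_add, map_add, Matrix.add_mul, Matrix.mul_add, hp, hq]
      | monomial n a =>
        rw [Polynomial.aeval_monomial, Polynomial.aeval_monomial, ← Algebra.smul_def, ← Algebra.smul_def, Matrix.smul_mul, Matrix.mul_smul]
        congr 1
        induction n with
        | zero => simp
        | succ n ih => rw [pow_succ', pow_succ, Matrix.mul_assoc, ih, ← Matrix.mul_assoc, hv, Matrix.mul_assoc, ← pow_succ, ← pow_succ']
    obtain ⟨a, b, hab⟩ := h
    have h1 := congrArg (Polynomial.aeval m) hab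
    rw [map_add, map_mul, map_mul, Matrix.aeval_self_charpoly, mul_zero, add_zero, map_one] at h1
    have h2 := hp l.charpoly
    rw [Matrix.aeval_self_charpoly, Matrix.zero_mul] at h2
    have h3 : Polynomial.aeval m l.charpoly * Polynomial.aeval m a = 1 := mul_eq_one_comm.mp h1
    rw [← Matrix.mul_one v, ← h3, ← Matrix.mul_assoc, ← h2, Matrix.zero_mul]
  intro v w hvw
  simp only at hvw
  have := hz (v - w) (by rw [Matrix.mul_sub, Matrix.sub_mul]; exact sub_eq_sub_iff_sub_eq_sub.mp hvw)
  exact sub_eq_zero.mp this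

lemma KM_cop {k : ℕ} (hk : 1 ≤ k) {ψ : AddChar F ℂ} (hψ : ψ ≠ 1) (α : Fin k → Fˣ →* ℂˣ) {l : Matrix μ μ F} {m : Matrix ν ν F} (h : IsCoprime l.charpoly m.charpoly) :
    matrixKloosterman α ψ (Matrix.fromBlocks l 0 0 m) =
      (Fintype.card F : ℂ) ^ ((k - 1) * (Fintype.card μ * Fintype.card ν)) * (matrixKloosterman α ψ l * matrixKloosterman α ψ m) := by
  have h1 : ∀ u : Matrix μ ν F, matrixKloosterman α ψ (Matrix.fromBlocks l u 0 m) = matrixKloosterman α ψ (Matrix.fromBlocks l 0 0 m) := by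
    intro u
    obtain ⟨v, hv⟩ := sylv h u
    simp only at hv
    have := mK_CI α ψ (nu (-v) : Matrix (μ ⊕ ν) (μ ⊕ ν) F) (nu v : Matrix (μ ⊕ ν) (μ ⊕ ν) F) (Matrix.fromBlocks l u 0 m)
      (by rw [← nu_inv, Units.inv_mul]) (by rw [← nu_inv, Units.mul_inv])
    simp only at this
    rw [← this, nu_val, nu_val, Matrix.fromBlocks_multiply, Matrix.fromBlocks_multiply]
    congr 1
    simp only [Matrix.mul_zero, Matrix.zero_mul, Matrix.mul_one, Matrix.one_mul, add_zero, zero_add, Matrix.mul_neg]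
    congr 1
    · rw [← hv]; abel
    · rw [neg_zero, zero_add]
  have h2 := KM_block hψ α l m
  simp only [h1] at h2
  rw [Finset.sum_const, Finset.card_univ, nsmul_eq_mul, cardM] at h2
  have hq : ((Fintype.card F : ℂ) ^ (Fintype.card μ * Fintype.card ν)) ≠ 0 := pow_ne_zero _ (by simp)
  apply mul_left_cancel₀ hq
  rw [h2]
  conv_rhs => rw [← mul_assoc, ← pow_add]
  congr 2
  obtain ⟨k', rfl⟩ := Nat.exists_eq_add_of_le hk
  rw [Nat.add_sub_cancel_left]; ring

end MK

end

section
open scoped BigOperators ComplexConjugate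
namespace MK

variable {F : Type} [Field F] [Fintype F] [DecidableEq F]
variable {ι μ δ ν κ : Type} [Fintype ι] [Fintype μ] [Fintype δ] [Fintype ν] [Fintype κ]
  [DecidableEq ι] [DecidableEq μ] [DecidableEq δ] [DecidableEq ν] [DecidableEq κ]
variable {E : Type} [Field E] [Fintype E] [DecidableEq E] [Algebra F E]


/-- Euler derivation -/
noncomputable def th (f : PowerSeries ℂ) : PowerSeries ℂ := PowerSeries.mk fun n => (n : ℂ) * PowerSeries.coeff n f

lemma th_mul (f g : PowerSeries ℂ) : th (f * g) = th f * g + f * th g := by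
  ext n
  simp only [th, map_add, PowerSeries.coeff_mul, PowerSeries.coeff_mk, Finset.mul_sum]
  rw [← Finset.sum_add_distrib]
  refine Finset.sum_congr rfl fun p hp => ?_
  rw [← Finset.HasAntidiagonal.mem_antidiagonal.mp hp]; push_cast; ring

lemma th_rescale (a : ℂ) (f : PowerSeries ℂ) : th (PowerSeries.rescale a f) = PowerSeries.rescale a (th f) := by
  ext n
  simp only [th, PowerSeries.coeff_rescale, PowerSeries.coeff_mk]; ring

lemma th_one : th 1 = 0 := by
  ext n
  simp only [th, PowerSeries.coeff_mk, PowerSeries.coeff_one, map_zero]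
  split_ifs with h
  · rw [h]; simp
  · simp

lemma th_uniq {s f g : PowerSeries ℂ} (hs : PowerSeries.coeff 0 s = 0) (hf : th f = s * f) (hg : th g = s * g)
    (h0 : PowerSeries.coeff 0 f = PowerSeries.coeff 0 g) : f = g := by
  ext n
  induction n using Nat.strong_induction_on with
  | _ n ih =>
    by_cases hn : n = 0
    · rw [hn, h0]
    have h1 := congrArg (PowerSeries.coeff n) hf
    have h2 := congrArg (PowerSeries.coeff n) hg
    rw [PowerSeries.coeff_mul, th, PowerSeries.coeff_mk] at h1 h2
    have h3 : (n : ℂ) * PowerSeries.coeff n f = (n : ℂ) * PowerSeries.coeff n g := by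
      rw [h1, h2]
      refine Finset.sum_congr rfl fun p hp => ?_
      by_cases hp0 : p.1 = 0
      · rw [hp0, hs, zero_mul, zero_mul]
      · rw [ih p.2 (by have := Finset.HasAntidiagonal.mem_antidiagonal.mp hp; omega)]
    exact mul_left_cancel₀ (by exact_mod_cast hn) h3

/-- complete homogeneous -/
noncomputable def hh {k : ℕ} (ω : Fin k → ℂ) (b : ℕ) : ℂ := ∑ d ∈ Finset.Nat.antidiagonalTuple k b, ∏ i, ω i ^ d i

/-- power sums -/
noncomputable def pp {k : ℕ} (ω : Fin k → ℂ) : PowerSeries ℂ := PowerSeries.mk fun m => if m = 0 then 0 else ∑ i, ω i ^ m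

lemma hh_succ {k : ℕ} (ω : Fin (k + 1) → ℂ) : PowerSeries.mk (hh ω) = PowerSeries.mk (fun n => ω 0 ^ n) * PowerSeries.mk (hh (fun i => ω i.succ)) := by
  ext n
  rw [PowerSeries.coeff_mul]
  simp only [PowerSeries.coeff_mk]
  unfold hh
  simp only [Finset.mul_sum]
  rw [Finset.sum_sigma']
  refine Finset.sum_bij' (fun d _ => ⟨(d 0, ∑ i : Fin k, d i.succ), fun i => d i.succ⟩) (fun x _ => Fin.cons x.1.1 x.2) ?_ ?_ ?_ ?_ ?_
  · intro d hd
    rw [Finset.Nat.mem_antidiagonalTuple, Fin.sum_univ_succ] at hd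
    rw [Finset.mem_sigma, Finset.HasAntidiagonal.mem_antidiagonal, Finset.Nat.mem_antidiagonalTuple]
    exact ⟨hd, rfl⟩
  · intro x hx
    rw [Finset.mem_sigma, Finset.HasAntidiagonal.mem_antidiagonal, Finset.Nat.mem_antidiagonalTuple] at hx
    rw [Finset.Nat.mem_antidiagonalTuple, Fin.sum_univ_succ]
    simp only [Fin.cons_zero, Fin.cons_succ]
    rw [hx.2, hx.1]
  · intro d hd
    exact Fin.cons_self_tail d
  · rintro ⟨⟨i, j⟩, x⟩ hx
    rw [Finset.mem_sigma, Finset.HasAntidiagonal.mem_antidiagonal, Finset.Nat.mem_antidiagonalTuple] at hx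
    obtain ⟨h1, h2⟩ := hx
    simp only at h2
    subst h2
    simp
  · intro d hd
    rw [Fin.prod_univ_succ]

lemma geom_th (w : ℂ) : th (PowerSeries.mk fun n => w ^ n) = (PowerSeries.mk fun m => if m = 0 then 0 else w ^ m) * PowerSeries.mk fun n => w ^ n := by
  ext n
  rw [PowerSeries.coeff_mul]
  simp only [th, PowerSeries.coeff_mk]
  rw [Finset.Nat.sum_antidiagonal_eq_sum_range_succ (fun i j => (if i = 0 then 0 else w ^ i) * w ^ j), Finset.sum_range_succ']
  rw [if_pos rfl, zero_mul, add_zero]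
  have : ∀ i ∈ Finset.range n, (if i + 1 = 0 then 0 else w ^ (i + 1)) * w ^ (n - (i + 1)) = w ^ n := by
    intro i hi
    rw [if_neg (Nat.succ_ne_zero i), ← pow_add]
    congr 1
    have := Finset.mem_range.mp hi
    omega
  rw [Finset.sum_congr rfl this]
  simp

lemma hh_th {k : ℕ} (ω : Fin k → ℂ) : th (PowerSeries.mk (hh ω)) = pp ω * PowerSeries.mk (hh ω) := by
  induction k with
  | zero =>
    have h1 : PowerSeries.mk (hh ω) = 1 := by
      ext n
      rw [PowerSeries.coeff_mk, PowerSeries.coeff_one, hh]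
      rcases n with _ | n <;> simp
    have h2 : pp ω = 0 := by ext n; simp [pp]
    rw [h1, h2, th_one, zero_mul]
  | succ k ih =>
    have h2 : pp ω = (PowerSeries.mk fun m => if m = 0 then 0 else ω 0 ^ m) + pp (fun i => ω i.succ) := by
      ext n
      simp only [pp, map_add, PowerSeries.coeff_mk]
      split_ifs
      · simp
      · rw [Fin.sum_univ_succ]
    rw [hh_succ, th_mul, geom_th, ih, h2]; ring

lemma hh_zero {k : ℕ} (ω : Fin k → ℂ) : hh ω 0 = 1 := by
  rw [hh, Finset.Nat.antidiagonalTuple_zero_right]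
  simp

lemma ps_main {k : ℕ} (ω : Fin k → ℂ) (e b : PowerSeries ℂ) (Q ε : ℂ) (h : e * b = 1)
    (hπ : ∀ r, 1 ≤ r → (Q ^ r - 1) * PowerSeries.coeff r (-(th e * b)) = ε ^ r * ∑ i, ω i ^ r) (r : ℕ) :
    PowerSeries.coeff r (e * PowerSeries.rescale Q b) = ε ^ r * hh ω r := by
  set π : PowerSeries ℂ := -(th e * b) with hpi
  have h1 : th e = -(π * e) := by
    rw [hpi]; linear_combination (-th e) * h
  have h2 : th b = π * b := by
    have h3 := congrArg th h
    rw [th_mul, th_one] at h3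
    rw [hpi]
    linear_combination b * h3 - th b * h
  have h4 : th (e * PowerSeries.rescale Q b) = (PowerSeries.rescale Q π - π) * (e * PowerSeries.rescale Q b) := by
    rw [th_mul, th_rescale, h2, h1, map_mul]; ring
  have h5 : PowerSeries.rescale Q π - π = PowerSeries.rescale ε (pp ω) := by
    ext m
    rw [map_sub, PowerSeries.coeff_rescale, PowerSeries.coeff_rescale, pp, PowerSeries.coeff_mk]
    by_cases hm : m = 0
    · subst hm; simp
    · rw [if_neg hm, ← hπ m (by omega)]; ring
  have h6 : e * PowerSeries.rescale Q b = PowerSeries.rescale ε (PowerSeries.mk (hh ω)) := by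
    refine th_uniq (s := PowerSeries.rescale ε (pp ω)) ?_ ?_ ?_ ?_
    · simp [pp]
    · rw [h4, h5]
    · rw [th_rescale, hh_th, map_mul]
    · have h7 := congrArg (PowerSeries.coeff 0) h
      rw [PowerSeries.coeff_mul] at h7 ⊢
      simp [hh_zero] at h7 ⊢
      exact h7
  rw [h6, PowerSeries.coeff_rescale, PowerSeries.coeff_mk]

end MK

end

section
open scoped BigOperators ComplexConjugate
namespace MK

variable {F : Type} [Field F] [Fintype F] [DecidableEq F]
variable {ι μ δ ν κ : Type} [Fintype ι] [Fintype μ] [Fintype δ] [Fintype ν] [Fintype κ]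
  [DecidableEq ι] [DecidableEq μ] [DecidableEq δ] [DecidableEq ν] [DecidableEq κ]
variable {E : Type} [Field E] [Fintype E] [DecidableEq E] [Algebra F E]


open Classical in
/-- indicator of primary matrices -/
noncomputable def ip (c : Matrix δ δ F) (g : Matrix ι ι F) : ℂ := if prim c g then 1 else 0

lemma ip_CI (c : Matrix δ δ F) {X : Matrix ι ι F → ℂ} (hX : CI X) : CI (fun g => ip c g * X g) := by
  intro B B' g h1 h2
  have e1 : prim c (B' * g * B) ↔ prim c g := by unfold prim; rw [charpoly_conj h1]
  simp only
  rw [hX B B' g h1 h2]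
  congr 1
  unfold ip
  by_cases hp : prim c g
  · rw [if_pos hp, if_pos (e1.mpr hp)]
  · rw [if_neg hp, if_neg (fun h => hp (e1.mp h))]

lemma ip_block {c : Matrix δ δ F} (hc : Irreducible c.charpoly) (j : ℕ) (u : Matrix (Pw δ j) ν F) (x : Matrix ν ν F) (e : Pw δ j ⊕ ν ≃ ι) :
    ip c (Matrix.reindex e e (Matrix.fromBlocks (hz c j) u 0 x)) = ip c x := by
  have h1 := prim_reindex c (Matrix.fromBlocks (hz c j) u 0 x) e
  rw [prim_block hc] at h1
  unfold ip
  by_cases hp : prim c x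
  · rw [if_pos hp, if_pos (h1.mpr hp)]
  · rw [if_neg hp, if_neg (fun h => hp (h1.mp h))]

/-- multiplicative family of class functions -/
structure MF (c : Matrix δ δ F) (k : ℕ) (X : ∀ r, Matrix (Pw δ r) (Pw δ r) F → ℂ) (κ : ℕ → ℂ) : Prop where
  ci : ∀ r, CI (X r)
  mul : ∀ r j i (e : Pw δ j ⊕ Pw δ i ≃ Pw δ r) (x : Matrix (Pw δ i) (Pw δ i) F),
    ∑ u, X r (Matrix.reindex e e (Matrix.fromBlocks (hz c j) u 0 x)) =
      (Fintype.card F : ℂ) ^ ((k + 1) * (Fintype.card (Pw δ j) * Fintype.card (Pw δ i))) * (κ j * X i x)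

/-- normalisation -/
noncomputable def nz (F δ : Type) [Fintype F] [Fintype δ] (k r : ℕ) : ℂ :=
  (Fintype.card F : ℂ) ^ (k * ((Fintype.card δ * r) * (Fintype.card δ * r - 1) / 2))

lemma nz_ne (k r : ℕ) : nz F δ k r ≠ 0 := pow_ne_zero _ (by simp)

lemma choose_split (m n : ℕ) : (m + n) * (m + n - 1) / 2 = m * (m - 1) / 2 + n * (n - 1) / 2 + m * n := by
  have h : ∀ m : ℕ, m * (m - 1) / 2 * 2 = m * (m - 1) := fun m => Nat.div_mul_cancel (Nat.even_mul_pred_self m).two_dvd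
  have h1 := h m
  have h2 := h n
  have h3 := h (m + n)
  have : (m + n) * (m + n - 1) = m * (m - 1) + n * (n - 1) + 2 * (m * n) := by
    rcases m with _ | m
    · simp
    rcases n with _ | n
    · simp
    have e : m + 1 + (n + 1) - 1 = m + n + 1 := by omega
    rw [e, Nat.add_sub_cancel, Nat.add_sub_cancel]; ring
  omega

lemma nz_split (k j i : ℕ) : nz F δ k (j + i) = nz F δ k j * nz F δ k i * (Fintype.card F : ℂ) ^ (k * (Fintype.card (Pw δ j) * Fintype.card (Pw δ i))) := by
  unfold nz
  rw [← pow_add, ← pow_add, card_Pw, card_Pw, mul_add (Fintype.card δ), choose_split]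
  congr 1; ring

/-- normalised sums -/
noncomputable def bbs (c : Matrix δ δ F) (k : ℕ) (X : ∀ r, Matrix (Pw δ r) (Pw δ r) F → ℂ) (r : ℕ) : ℂ :=
  (∑ g, ip c g * X r g) / (nz F δ k r * glc (Fintype.card F) (Fintype.card (Pw δ r)))

/-- normalised values -/
noncomputable def ees (F δ : Type) [Fintype F] [Fintype δ] (k : ℕ) (κ : ℕ → ℂ) (j : ℕ) : ℂ :=
  qe ((Fintype.card F ^ Fintype.card δ : ℕ) : ℂ) j * κ j / nz F δ k j

lemma mom {c : Matrix δ δ F} (hc : Irreducible c.charpoly) {k : ℕ} {X : ∀ r, Matrix (Pw δ r) (Pw δ r) F → ℂ} {κ : ℕ → ℂ} (h : MF c k X κ) (j i : ℕ) :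
    ∑ g, ip c g * X (j + i) g * (Fr (hz c j) g : ℂ) = nz F δ k (j + i) * glc (Fintype.card F) (Fintype.card (Pw δ (j + i))) * (κ j / nz F δ k j) * bbs c k X i := by
  have hq := two_le_card (F := F)
  have e : Pw δ j ⊕ Pw δ i ≃ Pw δ (j + i) := Fintype.equivOfCardEq (by rw [Fintype.card_sum, card_Pw, card_Pw, card_Pw, mul_add])
  rw [L3' _ (ip_CI c (h.ci (j + i))) (hz c j) e, Finset.sum_comm]
  simp only [ip_block hc]
  simp only [← Finset.mul_sum, h.mul]
  have h1 : ∀ x : Matrix (Pw δ i) (Pw δ i) F, ip c x * ((Fintype.card F : ℂ) ^ ((k + 1) * (Fintype.card (Pw δ j) * Fintype.card (Pw δ i))) * (κ j * X i x)) =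
     ((Fintype.card F : ℂ) ^ ((k + 1) * (Fintype.card (Pw δ j) * Fintype.card (Pw δ i))) * κ j) * (ip c x * X i x) := by intro x; ring
  simp only [h1]
  rw [← Finset.mul_sum]
  unfold bbs
  rw [nz_split]
  have n1 := nz_ne (F := F) (δ := δ) k j
  have n2 := nz_ne (F := F) (δ := δ) k i
  have n3 := glc_ne hq (Fintype.card (Pw δ i))
  have n4 : (Fintype.card F : ℂ) ≠ 0 := by simp
  have n5 : (Fintype.card F : ℂ) ^ (Fintype.card (Pw δ j) * Fintype.card (Pw δ i)) ≠ 0 := pow_ne_zero _ n4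
  rw [add_mul, one_mul, pow_add]
  field_simp

lemma comb {c : Matrix δ δ F} (hc : Irreducible c.charpoly) {k : ℕ} {X : ∀ r, Matrix (Pw δ r) (Pw δ r) F → ℂ} {κ : ℕ → ℂ} (h : MF c k X κ)
    (r : ℕ) (w f : ℕ → ℂ) (hf : ∀ l, l ≤ r → (1 ≤ r → 1 ≤ l) → ∑ j ∈ Finset.range (r + 1), w j * qe ((Fintype.card F ^ Fintype.card δ : ℕ) : ℂ) j *
      qN ((Fintype.card F ^ Fintype.card δ : ℕ) : ℂ) (((Fintype.card F ^ Fintype.card δ : ℕ) : ℂ) ^ l) j = f l) :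
    ∑ p ∈ Finset.HasAntidiagonal.antidiagonal r, w p.1 * ees F δ k κ p.1 * bbs c k X p.2 =
      (∑ g, ip c g * X r g * f (lf c g)) / (nz F δ k r * glc (Fintype.card F) (Fintype.card (Pw δ r))) := by
  have hq := two_le_card (F := F)
  have n1 := nz_ne (F := F) (δ := δ) k r
  have n3 := glc_ne hq (Fintype.card (Pw δ r))
  rw [eq_div_iff (mul_ne_zero n1 n3)]
  have h1 : ∀ g : Matrix (Pw δ r) (Pw δ r) F, ip c g * X r g * f (lf c g) = ∑ j ∈ Finset.range (r + 1), w j * qe ((Fintype.card F ^ Fintype.card δ : ℕ) : ℂ) j *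
      (ip c g * X r g * (Fr (hz c j) g : ℂ)) := by
    intro g
    by_cases hp : prim c g
    · rw [← hf (lf c g), Finset.mul_sum]
      · refine Finset.sum_congr rfl fun j _ => ?_
        rw [Fr_lf hc]; ring
      · obtain ⟨s, hs⟩ := hp
        have := lf_le_r hc hs
        have h2 := prim_card hs
        rw [card_Pw] at h2
        have hne := nonempty_of_irr hc
        exact this.trans (le_of_eq (Nat.eq_of_mul_eq_mul_left Fintype.card_pos h2).symm)
      · intro hr
        have hne := nonempty_of_irr hc
        have : Nonempty (Pw δ r) := by
          rw [← Fintype.card_pos_iff, card_Pw]; exact Nat.mul_pos Fintype.card_pos hr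
        exact lf_pos hc hp
    · have : ip c g = 0 := by unfold ip; rw [if_neg hp]
      rw [this]; simp
  simp only [h1]
  rw [Finset.sum_comm, Finset.Nat.sum_antidiagonal_eq_sum_range_succ (fun i j => w i * ees F δ k κ i * bbs c k X j), Finset.sum_mul]
  refine Finset.sum_congr rfl fun j hj => ?_
  obtain ⟨i, rfl⟩ := Nat.exists_eq_add_of_le (Nat.lt_succ_iff.mp (Finset.mem_range.mp hj))
  rw [← Finset.mul_sum, mom hc h, Nat.add_sub_cancel_left]
  unfold ees
  have n2 := nz_ne (F := F) (δ := δ) k j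
  field_simp

end MK

end

section
open scoped BigOperators ComplexConjugate
namespace MK

variable {F : Type} [Field F] [Fintype F] [DecidableEq F]
variable {ι μ δ ν κ : Type} [Fintype ι] [Fintype μ] [Fintype δ] [Fintype ν] [Fintype κ]
  [DecidableEq ι] [DecidableEq μ] [DecidableEq δ] [DecidableEq ν] [DecidableEq κ]
variable {E : Type} [Field E] [Fintype E] [DecidableEq E] [Algebra F E]


lemma Q_ne {c : Matrix δ δ F} (hc : Irreducible c.charpoly) (i : ℕ) : (1 - ((Fintype.card F ^ Fintype.card δ : ℕ) : ℂ) ^ (i + 1)) ≠ 0 :=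
  one_sub_pow_ne (two_le_Q hc) i

lemma bbs_zero {c : Matrix δ δ F} {k : ℕ} {X : ∀ r, Matrix (Pw δ r) (Pw δ r) F → ℂ} (hX : ∀ g, X 0 g = 1) : bbs c k X 0 = 1 := by
  unfold bbs nz
  rw [card_Pw]
  have hi : IsEmpty (Pw δ 0) := by rw [← Fintype.card_eq_zero_iff, card_Pw, mul_zero]
  have h1 : ∀ g : Matrix (Pw δ 0) (Pw δ 0) F, ip c g = 1 := by
    intro g
    unfold ip
    rw [if_pos]
    exact ⟨0, by rw [Matrix.charpoly, Matrix.det_isEmpty, pow_zero]⟩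
  have h2 : Fintype.card (Matrix (Pw δ 0) (Pw δ 0) F) = 1 := by rw [Fintype.card_eq_one_iff]; exact ⟨0, fun y => Subsingleton.elim _ _⟩
  simp [h1, hX, glc, qN, h2]

lemma ees_zero {k : ℕ} {κ : ℕ → ℂ} (h : κ 0 = 1) : ees F δ k κ 0 = 1 := by
  unfold ees nz qe; simp [h]

lemma eb_one {c : Matrix δ δ F} (hc : Irreducible c.charpoly) {k : ℕ} {X : ∀ r, Matrix (Pw δ r) (Pw δ r) F → ℂ} {κ : ℕ → ℂ} (h : MF c k X κ)
    (h0 : κ 0 = 1) (hX : ∀ g, X 0 g = 1) : PowerSeries.mk (ees F δ k κ) * PowerSeries.mk (bbs c k X) = 1 := by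
  ext r
  simp only [PowerSeries.coeff_mul, PowerSeries.coeff_mk, PowerSeries.coeff_one]
  by_cases hr : r = 0
  · subst hr
    simp [ees_zero h0, bbs_zero hX]
  rw [if_neg hr]
  have h1 := comb hc h r (fun _ => 1) (fun _ => 0) (by
    intro l hl hl1
    have h2 := qS_eq _ (Q_ne hc) l (r + 1) (by omega) 1
    simp only [one_pow, mul_one] at h2
    simp only [one_mul]
    rw [h2]
    apply Finset.prod_eq_zero (i := 0)
    · rw [Finset.mem_range]; exact hl1 (by omega)
    · simp)
  simp only [one_mul, mul_zero, Finset.sum_const_zero, zero_div] at h1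
  exact h1

/-- number of regular primary elements -/
noncomputable def nreg (c : Matrix δ δ F) (r : ℕ) : ℂ := ∑ g : Matrix (Pw δ r) (Pw δ r) F, ip c g * (if lf c g = 1 then 1 else 0)

lemma nreg_sum {c : Matrix δ δ F} (hc : Irreducible c.charpoly) {k : ℕ} {X : ∀ r, Matrix (Pw δ r) (Pw δ r) F → ℂ} {κ : ℕ → ℂ} (h : MF c k X κ)
    (r : ℕ) (hr : 1 ≤ r) (v : ℂ) (hv : ∀ g, prim c g → lf c g = 1 → X r g = v) :
    PowerSeries.coeff r (PowerSeries.rescale ((Fintype.card F ^ Fintype.card δ : ℕ) : ℂ)⁻¹ (PowerSeries.mk (ees F δ k κ)) * PowerSeries.mk (bbs c k X)) =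
      v / nz F δ k r * ((1 - ((Fintype.card F ^ Fintype.card δ : ℕ) : ℂ)⁻¹) * nreg c r / glc (Fintype.card F) (Fintype.card (Pw δ r))) := by
  set Q : ℂ := ((Fintype.card F ^ Fintype.card δ : ℕ) : ℂ) with hQ
  have hQ0 : Q ≠ 0 := by rw [hQ]; simp
  simp only [PowerSeries.coeff_mul, PowerSeries.coeff_mk, PowerSeries.coeff_rescale]
  rw [comb hc h r (fun j => Q⁻¹ ^ j) (fun l => if l = 1 then 1 - Q⁻¹ else 0) (by
    intro l hl hl1
    have h2 := qS_eq _ (Q_ne hc) l (r + 1) (by omega) Q⁻¹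
    rw [← hQ] at h2 ⊢
    simp only [mul_comm (Q⁻¹ ^ _) (qe Q _)]
    rw [h2]
    have := hl1 hr
    split_ifs with hl2
    · rw [hl2]; simp
    · apply Finset.prod_eq_zero (i := 1)
      · rw [Finset.mem_range]; omega
      · rw [pow_one, mul_inv_cancel₀ hQ0, sub_self])]
  unfold nreg
  have h3 : ∀ g : Matrix (Pw δ r) (Pw δ r) F, ip c g * X r g * (if lf c g = 1 then 1 - Q⁻¹ else 0) = (1 - Q⁻¹) * v * (ip c g * (if lf c g = 1 then 1 else 0)) := by
    intro g
    unfold ip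
    by_cases hp : prim c g
    · by_cases hl : lf c g = 1
      · rw [if_pos hp, if_pos hl, if_pos hl, hv g hp hl]; ring
      · rw [if_neg hl, if_neg hl]; ring
    · rw [if_neg hp]; ring
  simp only [h3]
  rw [← Finset.mul_sum]
  have hq := two_le_card (F := F)
  have n1 := nz_ne (F := F) (δ := δ) k r
  have n3 := glc_ne hq (Fintype.card (Pw δ r))
  field_simp

lemma MF_one (c : Matrix δ δ F) : MF c 0 (fun _ _ => 1) (fun _ => 1) where
  ci := fun r B B' g _ _ => rfl
  mul := by
    intro r j i e x
    simp only [Finset.sum_const, Finset.card_univ, nsmul_eq_mul, mul_one, zero_add, one_mul]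
    exact cardM

lemma nreg_eq {c : Matrix δ δ F} (hc : Irreducible c.charpoly) (r : ℕ) (hr : 1 ≤ r) :
    (1 - ((Fintype.card F ^ Fintype.card δ : ℕ) : ℂ)⁻¹) * nreg c r / glc (Fintype.card F) (Fintype.card (Pw δ r)) = ((Fintype.card F ^ Fintype.card δ : ℕ) : ℂ)⁻¹ ^ r := by
  have h1 := nreg_sum hc (MF_one c) r hr 1 (fun _ _ _ => rfl)
  have h2 := eb_one hc (MF_one c) rfl (fun _ => rfl)
  have hn : nz F δ 0 r = 1 := by unfold nz; simp
  rw [hn, div_one, one_mul] at h1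
  rw [← h1]
  have hQne := Q_ne hc
  set Q : ℂ := ((Fintype.card F ^ Fintype.card δ : ℕ) : ℂ) with hQ
  have hQ0 : Q ≠ 0 := by rw [hQ]; simp
  set e := PowerSeries.mk (ees F δ 0 (fun _ => 1)) with he
  set b := PowerSeries.mk (bbs c 0 (fun _ _ => 1)) with hb
  have hee : ∀ j, ees F δ 0 (fun _ => 1) j = qe Q j := by intro j; unfold ees nz; simp [hQ]
  have h3 : e = PowerSeries.rescale Q⁻¹ e - PowerSeries.C Q⁻¹ * (PowerSeries.X * PowerSeries.rescale Q⁻¹ e) := by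
    ext j
    rw [map_sub, PowerSeries.coeff_C_mul, PowerSeries.coeff_rescale]
    rcases j with _ | j
    · simp
    · rw [PowerSeries.coeff_succ_X_mul, PowerSeries.coeff_rescale, he, PowerSeries.coeff_mk, PowerSeries.coeff_mk, hee, hee]
      have h4 : qe Q j = (1 - Q ^ (j + 1)) * qe Q (j + 1) := by
        unfold qe
        rw [Finset.prod_range_succ]
        have := hQne j
        field_simp
      rw [h4, pow_succ Q⁻¹, inv_pow]
      field_simp
      ring
  have h4 : PowerSeries.rescale Q⁻¹ e * b = 1 + PowerSeries.C Q⁻¹ * (PowerSeries.X * (PowerSeries.rescale Q⁻¹ e * b)) := by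
    rw [← h2]
    nth_rewrite 2 [h3]
    ring
  have h5 : ∀ r, PowerSeries.coeff r (PowerSeries.rescale Q⁻¹ e * b) = Q⁻¹ ^ r := by
    intro r
    induction r with
    | zero => rw [h4]; simp
    | succ r ih =>
      rw [h4, map_add, PowerSeries.coeff_C_mul, PowerSeries.coeff_succ_X_mul, ih, PowerSeries.coeff_one, if_neg (by omega), zero_add, pow_succ, mul_comm]
  exact h5 r

end MK

end

section
open scoped BigOperators ComplexConjugate
namespace MK

variable {F : Type} [Field F] [Fintype F] [DecidableEq F]
variable {ι μ δ ν κ : Type} [Fintype ι] [Fintype μ] [Fintype δ] [Fintype ν] [Fintype κ]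
  [DecidableEq ι] [DecidableEq μ] [DecidableEq δ] [DecidableEq ν] [DecidableEq κ]
variable {E : Type} [Field E] [Fintype E] [DecidableEq E] [Algebra F E]


lemma KM_empty [IsEmpty ι] {k : ℕ} (α : Fin k → Fˣ →* ℂˣ) (ψ : AddChar F ℂ) (x : Matrix ι ι F) : matrixKloosterman α ψ x = 1 := by
  unfold matrixKloosterman
  have h : ∀ g : (Matrix ι ι F)ˣ, g = 1 := fun g => Units.ext (Subsingleton.elim _ _)
  have hs : Subsingleton (Matrix ι ι F)ˣ := ⟨fun a b => by rw [h a, h b]⟩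
  rw [Fintype.sum_subsingleton _ (fun _ => 1), if_pos (Subsingleton.elim _ _)]
  simp [Matrix.trace]

lemma MF_K {k : ℕ} {ψ : AddChar F ℂ} (hψ : ψ ≠ 1) (α : Fin (k + 1) → Fˣ →* ℂˣ) (c : Matrix δ δ F) :
    MF c k (fun _ g => matrixKloosterman α ψ g) (fun j => matrixKloosterman α ψ (hz c j)) where
  ci := fun r => mK_CI α ψ
  mul := by
    intro r j i e x
    simp only [KM_reindex]
    exact KM_block hψ α _ _

lemma pi_eq {k : ℕ} {ψ : AddChar F ℂ} (hψ : ψ ≠ 1) (α : Fin (k + 1) → Fˣ →* ℂˣ) {c : Matrix δ δ F} (hc : Irreducible c.charpoly)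
    (r : ℕ) (hr : 1 ≤ r) (hE : Module.finrank F E = Fintype.card δ * r) (ξ : E) (hξ : ξ ≠ 0) (hm : minpoly F ξ = c.charpoly) :
    (((Fintype.card F ^ Fintype.card δ : ℕ) : ℂ) ^ r - 1) *
    PowerSeries.coeff r (-(th (PowerSeries.mk (ees F δ k (fun j => matrixKloosterman α ψ (hz c j)))) * PowerSeries.mk (bbs c k (fun _ g => matrixKloosterman α ψ g)))) =
      ((-1) ^ (Fintype.card δ * r - 1)) ^ k * fieldKloosterman α ψ E ξ := by
  have hne := nonempty_of_irr hc
  have hn1 : 1 ≤ Fintype.card δ * r := Nat.mul_pos Fintype.card_pos hr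
  have hPw : Nonempty (Pw δ r) := by rw [← Fintype.card_pos_iff, card_Pw]; exact hn1
  have h1 := comb hc (MF_K hψ α c) r (fun j => (j : ℂ)) (fun l => - qD ((Fintype.card F ^ Fintype.card δ : ℕ) : ℂ) l) (by
    intro l hl hl1
    rw [qD_eq _ (Q_ne hc) l (r + 1) (hl1 hr) (by omega), neg_neg])
  simp only [map_neg, PowerSeries.coeff_mul, th, PowerSeries.coeff_mk]
  rw [h1]
  have h2 : ∀ g : Matrix (Pw δ r) (Pw δ r) F, ip c g * matrixKloosterman α ψ g * - qD ((Fintype.card F ^ Fintype.card δ : ℕ) : ℂ) (lf c g) =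
      - (matrixKloosterman α ψ g * DD (cx F ξ) g) := by
    intro g
    rw [DD_congr hc (by rw [cx_charpoly, hm])]
    unfold ip DD
    by_cases hp : prim c g
    · rw [if_pos hp, if_pos hp]; ring
    · rw [if_neg hp, if_neg hp]; ring
  simp only [h2]
  rw [Finset.sum_neg_distrib, sum_units (fun g => matrixKloosterman α ψ g * DD (cx F ξ) g) (fun g hg => by simp only [DD_sing hξ hg, mul_zero])]
  simp only [mK_eq]
  obtain ⟨u, rfl⟩ : ∃ u : Eˣ, ξ = u := ⟨Units.mk0 ξ hξ, rfl⟩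
  rw [Pk hψ (by rw [hE, card_Pw]), fK_eq, card_Pw]
  have h3 := glc_qD (F := F) (Fintype.card δ * r) hn1
  have hq := two_le_card (F := F)
  have n1 := nz_ne (F := F) (δ := δ) k r
  have n3 := glc_ne hq (Fintype.card δ * r)
  have n4 : (Fintype.card F : ℂ) ^ (Fintype.card δ * r) - 1 ≠ 0 := by
    have h5 := Q_ne hc (r - 1)
    rw [Nat.sub_add_cancel hr] at h5
    push_cast at h5
    rw [← pow_mul] at h5
    intro h6; apply h5; linear_combination -h6
  have h4 : nz F δ k r = ((Fintype.card F : ℂ) ^ ((Fintype.card δ * r) * (Fintype.card δ * r - 1) / 2)) ^ k := by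
    unfold nz; rw [← pow_mul, mul_comm]
  push_cast
  rw [← pow_mul, neg_div, neg_neg]
  rw [div_eq_iff n4] at h3
  generalize (Fintype.card F : ℂ) ^ (Fintype.card δ * r) - 1 = w at *
  generalize ((-1 : ℂ) ^ (Fintype.card δ * r - 1)) = s at *
  generalize ((Fintype.card F : ℂ) ^ ((Fintype.card δ * r) * (Fintype.card δ * r - 1) / 2)) = t at *
  rw [← mul_div_assoc, div_eq_iff (mul_ne_zero n1 n3), h4, h3, pow_succ, mul_pow]
  ring

lemma main_one {k : ℕ} {ψ : AddChar F ℂ} (hψ : ψ ≠ 1) (α : Fin (k + 1) → Fˣ →* ℂˣ) {c : Matrix δ δ F} (hc : Irreducible c.charpoly)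
    (ω : Fin (k + 1) → ℂ) (hω : ∀ r, 1 ≤ r → ((-1) ^ (Fintype.card δ * r - 1)) ^ k * ((-1 : ℂ) ^ k * ∑ i, ω i ^ r) = (((Fintype.card F ^ Fintype.card δ : ℕ) : ℂ) ^ r - 1) *
    PowerSeries.coeff r (-(th (PowerSeries.mk (ees F δ k (fun j => matrixKloosterman α ψ (hz c j)))) * PowerSeries.mk (bbs c k (fun _ g => matrixKloosterman α ψ g)))))
    (r : ℕ) (hr : 1 ≤ r) (v : ℂ) (hv : ∀ g : Matrix (Pw δ r) (Pw δ r) F, prim c g → lf c g = 1 → matrixKloosterman α ψ g = v) :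
    v = (-1) ^ (k * (Fintype.card δ * r)) * (Fintype.card F : ℂ) ^ (k * ((Fintype.card δ * r) * (Fintype.card δ * r - 1) / 2)) * hh ω r := by
  have hne := nonempty_of_irr hc
  have h1 := nreg_sum hc (MF_K hψ α c) r hr v hv
  rw [nreg_eq hc r hr] at h1
  have hi : IsEmpty (Pw δ 0) := by rw [← Fintype.card_eq_zero_iff, card_Pw, mul_zero]
  have h2 := eb_one hc (MF_K hψ α c) (KM_empty α ψ _) (fun g => KM_empty α ψ _)
  set e := (PowerSeries.mk (ees F δ k (fun j => matrixKloosterman α ψ (hz c j)))) with he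
  set b := PowerSeries.mk (bbs c k (fun _ g => matrixKloosterman α ψ g)) with hb
  set Q : ℂ := ((Fintype.card F ^ Fintype.card δ : ℕ) : ℂ) with hQ
  have hQ0 : Q ≠ 0 := by rw [hQ]; simp
  have h3 := ps_main ω e b Q ((-1) ^ (Fintype.card δ * k)) h2 (by
    intro r hr
    rw [← hω r hr, ← mul_assoc, ← pow_mul, ← pow_mul, ← pow_add]
    congr 1
    obtain ⟨n, hn⟩ : ∃ n, Fintype.card δ * r = n + 1 := ⟨Fintype.card δ * r - 1, by have := Nat.mul_pos (Fintype.card_pos (α := δ)) hr; omega⟩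
    have h5 : Fintype.card δ * k * r = (Fintype.card δ * r) * k := by ring
    rw [h5, hn, Nat.add_sub_cancel]
    congr 1; ring) r
  have h4 : PowerSeries.coeff r (e * PowerSeries.rescale Q b) = Q ^ r * PowerSeries.coeff r (PowerSeries.rescale Q⁻¹ e * b) := by
    simp only [PowerSeries.coeff_mul, PowerSeries.coeff_rescale, Finset.mul_sum]
    refine Finset.sum_congr rfl fun p hp => ?_
    rw [← Finset.HasAntidiagonal.mem_antidiagonal.mp hp, pow_add, inv_pow]
    have := pow_ne_zero p.1 hQ0
    field_simp
  rw [h4, h1, inv_pow] at h3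
  have n1 := nz_ne (F := F) (δ := δ) k r
  have n2 := pow_ne_zero r hQ0
  field_simp at h3
  rw [h3, ← pow_mul]
  unfold nz
  rw [show Fintype.card δ * k * r = k * (Fintype.card δ * r) by ring]
  ring

end MK

end

section
open scoped BigOperators ComplexConjugate
namespace MK

variable {F : Type} [Field F] [Fintype F] [DecidableEq F]
variable {ι μ δ ν κ : Type} [Fintype ι] [Fintype μ] [Fintype δ] [Fintype ν] [Fintype κ]
  [DecidableEq ι] [DecidableEq μ] [DecidableEq δ] [DecidableEq ν] [DecidableEq κ]
variable {E : Type} [Field E] [Fintype E] [DecidableEq E] [Algebra F E]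


lemma ker_card {c : Matrix δ δ F} (hc : Irreducible c.charpoly) (g : Matrix ι ι F) :
    Nat.card {v : ι → F // (Polynomial.aeval g c.charpoly).mulVec v = 0} ≤ Ho c g := by
  obtain ⟨e0, he0⟩ := exists_ne_vec hc
  unfold Ho
  refine Nat.card_le_card_of_surjective (fun A : {A : Matrix ι δ F // g * A = A * c} => ⟨A.1.mulVec e0, ?_⟩) ?_
  · rw [Matrix.mulVec_mulVec, aeval_intertwine A.2, Matrix.aeval_self_charpoly, Matrix.mul_zero, Matrix.zero_mulVec]
  · rintro ⟨v, hv⟩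
    obtain ⟨A, e, he, hAe, hA⟩ := exists_intertwiner' hc g hv
    obtain ⟨p, rfl⟩ := cyc_surj hc he0 e
    refine ⟨⟨A * Polynomial.aeval c p, ?_⟩, ?_⟩
    · rw [← Matrix.mul_assoc, hA, Matrix.mul_assoc, Matrix.mul_assoc]
      congr 1
      have := congrArg (Polynomial.aeval c) (mul_comm Polynomial.X p)
      simpa using this
    · apply Subtype.ext
      simp only
      rw [← Matrix.mulVec_mulVec, hAe]

lemma ker_pow_le {V : Type} [AddCommGroup V] [Module F V] [FiniteDimensional F V] (N : V →ₗ[F] V) (i : ℕ) :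
    Module.finrank F (LinearMap.ker (N ^ i)) ≤ i * Module.finrank F (LinearMap.ker N) := by
  induction i with
  | zero =>
    have h : LinearMap.ker (N ^ 0) = ⊥ := by ext x; simp
    rw [h]; simp
  | succ i ih =>
    have h : LinearMap.ker (N ^ (i + 1)) = Submodule.comap (N ^ i) (LinearMap.ker N) := by
      rw [pow_succ']; rfl
    have h1 := LinearMap.lift_rank_comap_le (f := N ^ i) (LinearMap.ker N)
    simp only [Cardinal.lift_id] at h1
    rw [← h, ← Module.finrank_eq_rank, ← Module.finrank_eq_rank, ← Module.finrank_eq_rank] at h1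
    norm_cast at h1
    rw [add_mul, one_mul]
    omega

lemma exists_cyc {c : Matrix δ δ F} (hc : Irreducible c.charpoly) {g : Matrix ι ι F} {r : ℕ} (hr : 1 ≤ r)
    (hg : g.charpoly = c.charpoly ^ r) (hl : lf c g = 1) :
    ∃ v : ι → F, ∀ p : Polynomial F, (Polynomial.aeval g p).mulVec v = 0 ↔ g.charpoly ∣ p := by
  have hne := nonempty_of_irr hc
  set N : (ι → F) →ₗ[F] (ι → F) := Matrix.toLin' (Polynomial.aeval g c.charpoly) with hN
  have h1 : Module.finrank F (LinearMap.ker N) ≤ Fintype.card δ := by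
    have h2 := ker_card hc g
    rw [Ho_lf hc, hl, pow_one] at h2
    have h3 : Nat.card {v : ι → F // (Polynomial.aeval g c.charpoly).mulVec v = 0} = Nat.card (LinearMap.ker N) := by
      apply Nat.card_congr
      exact Equiv.subtypeEquivRight (fun v => by rw [LinearMap.mem_ker, hN, Matrix.toLin'_apply])
    rw [h3, Module.natCard_eq_pow_finrank (K := F), Nat.card_eq_fintype_card] at h2
    exact (Nat.pow_le_pow_iff_right two_le_card).mp h2
  have h4 : LinearMap.ker (N ^ (r - 1)) ≠ ⊤ := by
    intro h
    have h5 := ker_pow_le N (r - 1)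
    rw [h, finrank_top, Module.finrank_fintype_fun_eq_card, prim_card hg] at h5
    have h6 := Nat.mul_le_mul_left (r - 1) h1
    have h7 : (r - 1) * Fintype.card δ < Fintype.card δ * r := by
      rw [mul_comm (Fintype.card δ)]; exact Nat.mul_lt_mul_of_pos_right (by omega) Fintype.card_pos
    omega
  obtain ⟨v, hv⟩ : ∃ v, (N ^ (r - 1)) v ≠ 0 := by
    by_contra hcon
    push Not at hcon
    exact h4 (by rw [eq_top_iff]; intro x _; exact hcon x)
  have hv' : (Polynomial.aeval g (c.charpoly ^ (r - 1))).mulVec v ≠ 0 := by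
    rw [map_pow]
    rw [hN, ← Matrix.toLin'_pow, Matrix.toLin'_apply] at hv
    exact hv
  refine ⟨v, fun p => ⟨fun hp => ?_, ?_⟩⟩
  · have hd : EuclideanDomain.gcd p (c.charpoly ^ r) ∣ c.charpoly ^ r := EuclideanDomain.gcd_dvd_right _ _
    obtain ⟨i, hi, has⟩ := (dvd_prime_pow hc.prime r).mp hd
    have hdv : (Polynomial.aeval g (EuclideanDomain.gcd p (c.charpoly ^ r))).mulVec v = 0 := by
      rw [EuclideanDomain.gcd_eq_gcd_ab p, map_add, Matrix.add_mulVec, mul_comm p, ← hg, map_mul, mul_comm g.charpoly, map_mul, ← Matrix.mulVec_mulVec, hp,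
        Matrix.aeval_self_charpoly]
      simp
    have key : ∀ z, EuclideanDomain.gcd p (c.charpoly ^ r) ∣ z → (Polynomial.aeval g z).mulVec v = 0 := by
      rintro z ⟨w, rfl⟩
      rw [mul_comm, map_mul, ← Matrix.mulVec_mulVec, hdv, Matrix.mulVec_zero]
    by_cases hir : i = r
    · rw [hg, ← hir]
      exact has.symm.dvd.trans (EuclideanDomain.gcd_dvd_left _ _)
    · exact absurd (key _ (has.dvd.trans (pow_dvd_pow _ (by omega)))) hv'
  · rintro ⟨w, rfl⟩
    rw [map_mul, Matrix.aeval_self_charpoly, zero_mul, Matrix.zero_mulVec]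

lemma cyc_surj' {g : Matrix ι ι F} {v : ι → F} (hv : ∀ p : Polynomial F, (Polynomial.aeval g p).mulVec v = 0 ↔ g.charpoly ∣ p)
    (z : ι → F) : ∃ h : Polynomial F, (Polynomial.aeval g h).mulVec v = z := by
  let Φ : Polynomial F →ₗ[F] (ι → F) :=
    { toFun := fun h => (Polynomial.aeval g h).mulVec v
      map_add' := fun a b => by simp [Matrix.add_mulVec]
      map_smul' := fun a b => by simp [Matrix.smul_mulVec] }
  let Ψ : (Fin (Fintype.card ι) → F) →ₗ[F] (ι → F) :=
    Φ ∘ₗ (Polynomial.degreeLT F (Fintype.card ι)).subtype ∘ₗ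
      (Polynomial.degreeLTEquiv F (Fintype.card ι)).symm.toLinearMap
  have hinj : Function.Injective Ψ := by
    rw [injective_iff_map_eq_zero]
    intro a ha
    have h1 := (hv _).mp ha
    have h2 := ((Polynomial.degreeLTEquiv F (Fintype.card ι)).symm a).2
    rw [Polynomial.mem_degreeLT] at h2
    have h3 := Polynomial.eq_zero_of_dvd_of_degree_lt h1 (by
      refine lt_of_lt_of_le h2 ?_
      rw [Matrix.charpoly_degree_eq_dim])
    have h4 : (Polynomial.degreeLTEquiv F (Fintype.card ι)).symm a = 0 := Subtype.ext h3
    simpa using h4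
  have hsurj : Function.Surjective Ψ :=
    (LinearMap.injective_iff_surjective_of_finrank_eq_finrank (by simp)).mp hinj
  obtain ⟨a, ha⟩ := hsurj z
  exact ⟨_, ha⟩

lemma cyc_conj {g g' : Matrix ι ι F} (h : g.charpoly = g'.charpoly) {v v' : ι → F} (hv : ∀ p : Polynomial F, (Polynomial.aeval g p).mulVec v = 0 ↔ g.charpoly ∣ p)
    (hv' : ∀ p : Polynomial F, (Polynomial.aeval g' p).mulVec v' = 0 ↔ g'.charpoly ∣ p) :
    ∃ B B' : Matrix ι ι F, B * B' = 1 ∧ B' * B = 1 ∧ B' * g * B = g' := by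
  let Φ : Polynomial F →ₗ[F] (ι → F) :=
    { toFun := fun h => (Polynomial.aeval g h).mulVec v
      map_add' := fun a b => by simp [Matrix.add_mulVec]
      map_smul' := fun a b => by simp [Matrix.smul_mulVec] }
  let Φ' : Polynomial F →ₗ[F] (ι → F) :=
    { toFun := fun h => (Polynomial.aeval g' h).mulVec v'
      map_add' := fun a b => by simp [Matrix.add_mulVec]
      map_smul' := fun a b => by simp [Matrix.smul_mulVec] }
  have hΦ : Function.Surjective Φ := cyc_surj' hv
  have hΦ' : Function.Surjective Φ' := cyc_surj' hv'
  have hk : LinearMap.ker Φ = LinearMap.ker Φ' := by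
    ext p
    rw [LinearMap.mem_ker, LinearMap.mem_ker]
    exact (hv p).trans (by rw [h]; exact (hv' p).symm)
  let T : (ι → F) ≃ₗ[F] (ι → F) := (Φ.quotKerEquivOfSurjective hΦ).symm ≪≫ₗ Submodule.quotEquivOfEq _ _ hk ≪≫ₗ Φ'.quotKerEquivOfSurjective hΦ'
  have hT : ∀ p, T (Φ p) = Φ' p := by
    intro p
    have : (Φ.quotKerEquivOfSurjective hΦ).symm (Φ p) = Submodule.Quotient.mk p := by
      rw [LinearEquiv.symm_apply_eq]; rfl
    simp only [T, LinearEquiv.trans_apply, this]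
    rfl
  have hTg : ∀ z, T (g.mulVec z) = g'.mulVec (T z) := by
    intro z
    obtain ⟨p, rfl⟩ := hΦ z
    have e1 : g.mulVec (Φ p) = Φ (Polynomial.X * p) := by
      change g.mulVec ((Polynomial.aeval g p).mulVec v) = (Polynomial.aeval g (Polynomial.X * p)).mulVec v
      simp [← Matrix.mulVec_mulVec]
    have e2 : g'.mulVec (Φ' p) = Φ' (Polynomial.X * p) := by
      change g'.mulVec ((Polynomial.aeval g' p).mulVec v') = (Polynomial.aeval g' (Polynomial.X * p)).mulVec v'
      simp [← Matrix.mulVec_mulVec]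
    rw [e1, hT, hT, e2]
  have h1 : LinearMap.toMatrix' (T.symm : (ι → F) →ₗ[F] (ι → F)) * LinearMap.toMatrix' (T : (ι → F) →ₗ[F] (ι → F)) = 1 := by
    rw [← LinearMap.toMatrix'_comp]; simp
  have h2 : LinearMap.toMatrix' (T : (ι → F) →ₗ[F] (ι → F)) * LinearMap.toMatrix' (T.symm : (ι → F) →ₗ[F] (ι → F)) = 1 := by
    rw [← LinearMap.toMatrix'_comp]; simp
  refine ⟨LinearMap.toMatrix' (T.symm : (ι → F) →ₗ[F] (ι → F)), LinearMap.toMatrix' (T : (ι → F) →ₗ[F] (ι → F)), h1, h2, ?_⟩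
  have h3 : LinearMap.toMatrix' (T : (ι → F) →ₗ[F] (ι → F)) * g = g' * LinearMap.toMatrix' (T : (ι → F) →ₗ[F] (ι → F)) := by
    apply matrix_ext_mulVec
    intro z
    rw [← Matrix.mulVec_mulVec, ← Matrix.mulVec_mulVec, LinearMap.toMatrix'_mulVec, LinearMap.toMatrix'_mulVec]
    exact hTg z
  rw [h3, Matrix.mul_assoc, h2, Matrix.mul_one]

lemma reg_same {c : Matrix δ δ F} (hc : Irreducible c.charpoly) {g g' : Matrix ι ι F} {r : ℕ} (hr : 1 ≤ r)
    (hg : g.charpoly = c.charpoly ^ r) (hl : lf c g = 1) (hg' : g'.charpoly = c.charpoly ^ r) (hl' : lf c g' = 1)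
    {X : Matrix ι ι F → ℂ} (hX : CI X) : X g' = X g := by
  obtain ⟨v, hv⟩ := exists_cyc hc hr hg hl
  obtain ⟨v', hv'⟩ := exists_cyc hc hr hg' hl'
  obtain ⟨B, B', h1, h2, h3⟩ := cyc_conj (by rw [hg, hg']) hv hv'
  rw [← h3, hX B B' g h1 h2]

end MK

end

section
open scoped BigOperators ComplexConjugate
namespace MK

variable {F : Type} [Field F] [Fintype F] [DecidableEq F]
variable {ι μ δ ν κ : Type} [Fintype ι] [Fintype μ] [Fintype δ] [Fintype ν] [Fintype κ]
  [DecidableEq ι] [DecidableEq μ] [DecidableEq δ] [DecidableEq ν] [DecidableEq κ]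
variable {E : Type} [Field E] [Fintype E] [DecidableEq E] [Algebra F E]


lemma jb_charpoly {a : ℕ} (y : Matrix (Fin a) (Fin a) F) (b : ℕ) (ha : 0 < a) : (jordanBlock y b).charpoly = y.charpoly ^ b := by
  have hT : (jordanBlock y b).BlockTriangular (Prod.fst : Fin b × Fin a → Fin b) := by
    intro p q h
    unfold jordanBlock
    rw [if_neg (by intro h2; rw [h2] at h; exact lt_irrefl _ h), if_neg]
    intro h2
    have : (q.1 : ℕ) < p.1 := h
    omega
  rw [hT.charpoly]
  have h1 : Finset.image (Prod.fst : Fin b × Fin a → Fin b) Finset.univ = Finset.univ := by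
    ext i
    simp only [Finset.mem_image, Finset.mem_univ, true_and, iff_true]
    exact ⟨(i, ⟨0, ha⟩), rfl⟩
  rw [h1]
  have h2 : ∀ i : Fin b, ((jordanBlock y b).toSquareBlock Prod.fst i).charpoly = y.charpoly := by
    intro i
    let e : {p : Fin b × Fin a // p.1 = i} ≃ Fin a :=
      { toFun := fun p => p.1.2
        invFun := fun j => ⟨(i, j), rfl⟩
        left_inv := by rintro ⟨⟨p, q⟩, rfl⟩; rfl
        right_inv := fun j => rfl }
    rw [← Matrix.charpoly_reindex e]
    congr 1
    ext p q
    simp [Matrix.toSquareBlock_def, jordanBlock, e]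
  simp [h2]

lemma der_zero {c : Matrix δ δ F} (hc : Irreducible c.charpoly) (A Z : Matrix δ δ F) (h : c * A + Z = A * c) (hZ : c * Z = Z * c) : Z = 0 := by
  have h1 : ∀ p : Polynomial F, A * Polynomial.aeval c p = Polynomial.aeval c p * A + Polynomial.aeval c (Polynomial.derivative p) * Z := by
    intro p
    have hp : ∀ p : Polynomial F, Polynomial.aeval c p * c = c * Polynomial.aeval c p := by
      intro p
      have := congrArg (Polynomial.aeval c) (mul_comm p Polynomial.X)
      simpa using this
    induction p using Polynomial.induction_on with
    | C a =>
      simp [Algebra.algebraMap_eq_smul_one]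
    | add p q hp hq => simp only [map_add, mul_add, add_mul, hp, hq]; abel
    | monomial n a ih =>
      have e : (Polynomial.C a * Polynomial.X ^ (n + 1) : Polynomial F) = (Polynomial.C a * Polynomial.X ^ n) * Polynomial.X := by ring
      rw [e]
      generalize (Polynomial.C a * Polynomial.X ^ n : Polynomial F) = p at *
      rw [Polynomial.derivative_mul, Polynomial.derivative_X, mul_one, map_add, map_mul, map_mul, Polynomial.aeval_X, ← mul_assoc, ih, add_mul, add_mul,
        mul_assoc _ A c, ← h, mul_add, mul_assoc _ Z c, ← hZ, ← mul_assoc, ← mul_assoc]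
      abel
  have h2 := h1 c.charpoly
  rw [Matrix.aeval_self_charpoly, mul_zero, zero_mul, zero_add] at h2
  obtain ⟨u, w, huw⟩ : IsCoprime c.charpoly (Polynomial.derivative c.charpoly) := PerfectField.separable_of_irreducible hc
  have h3 := congrArg (Polynomial.aeval c) huw
  rw [map_add, map_mul, map_mul, Matrix.aeval_self_charpoly, mul_zero, zero_add, map_one] at h3
  rw [← one_mul Z, ← h3, mul_assoc, ← h2, mul_zero]

lemma jb_lf {a : ℕ} {y : Matrix (Fin a) (Fin a) F} (hy : Irreducible y.charpoly) (b : ℕ) (hb : 1 ≤ b) : lf y (jordanBlock y b) = 1 := by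
  have hne := nonempty_of_irr hy
  have ha : 0 < a := by rw [← Fintype.card_fin a]; exact Fintype.card_pos
  have hne2 : Nonempty (Fin b × Fin a) := ⟨(⟨0, hb⟩, ⟨0, ha⟩)⟩
  apply le_antisymm _ (lf_pos hy ⟨b, jb_charpoly y b ha⟩)
  have h0 : Ho y (jordanBlock y b) ≤ Ho y y := by
    unfold Ho
    have key : ∀ A : Matrix (Fin b × Fin a) (Fin a) F, jordanBlock y b * A = A * y →
      ∀ m i : ℕ, b ≤ i + m → ∀ (hi : i < b) , (y * (Matrix.of fun p q => A (⟨i, hi⟩, p) q) = (Matrix.of fun p q => A (⟨i, hi⟩, p) q) * y) ∧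
        (1 ≤ i → (Matrix.of fun p q => A (⟨i, hi⟩, p) q) = 0) := by
      intro A hA
      have hrec : ∀ (i : ℕ) (hi : i < b), y * (Matrix.of fun p q => A (⟨i, hi⟩, p) q) + (Matrix.of fun p q => if h : i + 1 < b then A (⟨i + 1, h⟩, p) q else 0)
          = (Matrix.of fun p q => A (⟨i, hi⟩, p) q) * y := by
        intro i hi
        ext p q
        have h1 := congrFun (congrFun hA (⟨i, hi⟩, p)) q
        rw [Matrix.mul_apply, Matrix.mul_apply, Fintype.sum_prod_type] at h1
        rw [Matrix.add_apply, Matrix.mul_apply, Matrix.mul_apply]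
        simp only [Matrix.of_apply]
        rw [← h1]
        have h2 : ∀ x : Fin b, ∑ x1, jordanBlock y b (⟨i, hi⟩, p) (x, x1) * A (x, x1) q =
          (if x = ⟨i, hi⟩ then ∑ x1, y p x1 * A (x, x1) q else 0) + (if (x : ℕ) = i + 1 then A (x, p) q else 0) := by
          intro x
          unfold jordanBlock
          simp only
          by_cases hx : x = ⟨i, hi⟩
          · subst hx; simp
          · rw [if_neg hx, zero_add]
            simp only [if_neg (Ne.symm hx)]
            by_cases hx2 : (x : ℕ) = i + 1
            · rw [if_pos hx2]; simp [hx2]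
            · rw [if_neg hx2]; simp [Ne.symm hx2]
        simp only [h2]
        rw [Finset.sum_add_distrib]
        congr 1
        · simp
        · split_ifs with h
          · rw [Finset.sum_eq_single ⟨i + 1, h⟩]
            · simp
            · intro x _ hx; rw [if_neg]; intro h3; exact hx (Fin.ext h3)
            · simp
          · symm; apply Finset.sum_eq_zero; intro x _; rw [if_neg]; intro h3; have := x.2; omega
      intro m
      induction m with
      | zero => intro i h1 h2; omega
      | succ m ih =>
        intro i h1 hi
        have hnext : (Matrix.of fun p q => if h : i + 1 < b then A (⟨i + 1, h⟩, p) q else 0) = (0 : Matrix (Fin a) (Fin a) F) := by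
          by_cases h : i + 1 < b
          · simp only [h, dif_pos]
            exact (ih (i + 1) (by omega) h).2 (by omega)
          · simp only [h, dif_neg, not_false_eq_true]; rfl
        have hcom := hrec i hi
        rw [hnext, add_zero] at hcom
        refine ⟨hcom, fun h1i => ?_⟩
        have hprev := hrec (i - 1) (by omega)
        have e : i - 1 + 1 = i := by omega
        simp only [e, hi, dif_pos] at hprev
        exact der_zero hy _ _ hprev hcom
    refine Nat.card_le_card_of_injective (fun A => ⟨Matrix.of fun p q => A.1 (⟨0, hb⟩, p) q, (key A.1 A.2 b 0 (by omega) hb).1⟩) ?_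
    rintro ⟨A, hA⟩ ⟨B, hB⟩ hAB
    apply Subtype.ext
    simp only [Subtype.mk.injEq] at hAB ⊢
    ext ⟨i, p⟩ q
    by_cases hi : (i : ℕ) = 0
    · have : i = ⟨0, hb⟩ := Fin.ext hi
      rw [this]; exact congrFun (congrFun hAB p) q
    · have h1 := congrFun (congrFun ((key A hA b i (by omega) i.2).2 (by omega)) p) q
      have h2 := congrFun (congrFun ((key B hB b i (by omega) i.2).2 (by omega)) p) q
      exact h1.trans h2.symm
  rw [Ho_lf hy, Ho_lf hy] at h0
  have h1 := (Nat.pow_le_pow_iff_right (two_le_Q hy)).mp h0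
  rwa [lf_eq hy (g := y) (l := 1) (by rw [Ho_self hy, pow_one])] at h1

end MK

end

section
open scoped BigOperators ComplexConjugate
namespace MK

variable {F : Type} [Field F] [Fintype F] [DecidableEq F]
variable {ι μ δ ν κ : Type} [Fintype ι] [Fintype μ] [Fintype δ] [Fintype ν] [Fintype κ]
  [DecidableEq ι] [DecidableEq μ] [DecidableEq δ] [DecidableEq ν] [DecidableEq κ]
variable {E : Type} [Field E] [Fintype E] [DecidableEq E] [Algebra F E]


/-- splitting of a sigma type over `Fin (s+1)` -/
def sgf {s : ℕ} (I : Fin (s + 1) → Type) : I 0 ⊕ (Σ i : Fin s, I i.succ) → Σ i : Fin (s + 1), I i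
  | Sum.inl x => ⟨0, x⟩
  | Sum.inr p => ⟨p.1.succ, p.2⟩

lemma sgf_bij {s : ℕ} (I : Fin (s + 1) → Type) : Function.Bijective (sgf I) := by
  constructor
  · rintro (x | ⟨i, x⟩) (y | ⟨j, y⟩) h
    · simp only [sgf, Sigma.mk.injEq, heq_eq_eq, true_and] at h; rw [h]
    · simp only [sgf, Sigma.mk.injEq] at h; exact absurd h.1.symm (Fin.succ_ne_zero j)
    · simp only [sgf, Sigma.mk.injEq] at h; exact absurd h.1 (Fin.succ_ne_zero i)
    · simp only [sgf, Sigma.mk.injEq, Fin.succ_inj] at h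
      obtain ⟨h1, h2⟩ := h
      subst h1
      rw [eq_of_heq h2]
  · rintro ⟨i, x⟩
    induction i using Fin.cases with
    | zero => exact ⟨Sum.inl x, rfl⟩
    | succ i => exact ⟨Sum.inr ⟨i, x⟩, rfl⟩

lemma multi {k : ℕ} {ψ : AddChar F ℂ} (hψ : ψ ≠ 1) (α : Fin (k + 1) → Fˣ →* ℂˣ) : ∀ {s : ℕ} (I : Fin s → Type) [∀ j, Fintype (I j)] [∀ j, DecidableEq (I j)]
    (M : ∀ j, Matrix (I j) (I j) F) (hcop : ∀ j₁ j₂, j₁ ≠ j₂ → IsCoprime (M j₁).charpoly (M j₂).charpoly) (t : Fin s → ℂ)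
    (ht : ∀ j, matrixKloosterman α ψ (M j) = (Fintype.card F : ℂ) ^ (k * (Fintype.card (I j) * (Fintype.card (I j) - 1) / 2)) * t j),
    (Matrix.blockDiagonal' M).charpoly = ∏ j, (M j).charpoly ∧
    matrixKloosterman α ψ (Matrix.blockDiagonal' M) =
      (Fintype.card F : ℂ) ^ (k * ((∑ j, Fintype.card (I j)) * ((∑ j, Fintype.card (I j)) - 1) / 2)) * ∏ j, t j := by
  intro s
  induction s with
  | zero =>
    intro I _ _ M hcop t ht
    have : IsEmpty (Σ j : Fin 0, I j) := ⟨fun x => x.1.elim0⟩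
    refine ⟨?_, ?_⟩
    · rw [Matrix.charpoly, Matrix.det_isEmpty]; simp
    · rw [KM_empty]; simp
  | succ s ih =>
    intro I _ _ M hcop t ht
    obtain ⟨ih1, ih2⟩ := ih (fun j => I j.succ) (fun j => M j.succ) (fun j₁ j₂ h => hcop _ _ (fun h2 => h (Fin.succ_injective _ h2)))
      (fun j => t j.succ) (fun j => ht j.succ)
    let e := Equiv.ofBijective _ (sgf_bij I)
    have h1 : Matrix.blockDiagonal' M = Matrix.reindex e e (Matrix.fromBlocks (M 0) 0 0 (Matrix.blockDiagonal' (fun j : Fin s => M j.succ))) := by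
      rw [← Equiv.symm_apply_eq]
      ext (x | ⟨i, x⟩) (y | ⟨j, y⟩)
      · simp [e, sgf, Matrix.blockDiagonal'_apply]
      · simp [e, sgf, Matrix.blockDiagonal'_apply, (Fin.succ_ne_zero j).symm]
      · simp [e, sgf, Matrix.blockDiagonal'_apply]
      · by_cases hij : i = j
        · subst hij; simp [e, sgf, Matrix.blockDiagonal'_apply]
        · simp [e, sgf, Matrix.blockDiagonal'_apply, hij]
    have hco : IsCoprime (M 0).charpoly (Matrix.blockDiagonal' (fun j : Fin s => M j.succ)).charpoly := by
      rw [ih1]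
      exact IsCoprime.prod_right fun j _ => hcop _ _ (Fin.succ_ne_zero j).symm
    constructor
    · rw [h1, Matrix.charpoly_reindex, Matrix.charpoly_fromBlocks_zero₂₁, ih1, Fin.prod_univ_succ]
    · rw [h1, KM_reindex, KM_cop (by omega) hψ α hco, ih2, ht 0, Fin.prod_univ_succ, Fin.sum_univ_succ, choose_split, Fintype.card_sigma, Nat.add_sub_cancel]
      rw [mul_add, mul_add, pow_add, pow_add]
      ring

lemma main_jb {k : ℕ} {ψ : AddChar F ℂ} (hψ : ψ ≠ 1) (α : Fin (k + 1) → Fˣ →* ℂˣ) {a : ℕ} (y : (Matrix (Fin a) (Fin a) F)ˣ)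
    (hy : Irreducible (y : Matrix (Fin a) (Fin a) F).charpoly) (b : ℕ) (hb : 1 ≤ b)
    (E : Type) [Field E] [Fintype E] [Algebra F E] (hE : Module.finrank F E = a) (η : E)
    (hη : Polynomial.aeval η (y : Matrix (Fin a) (Fin a) F).charpoly = 0)
    (Em : ℕ → Type) [∀ m, Field (Em m)] [∀ m, Fintype (Em m)] [∀ m, DecidableEq (Em m)] [∀ m, Algebra F (Em m)] [∀ m, Algebra E (Em m)]
    [∀ m, IsScalarTower F E (Em m)] (hEm : ∀ m, 1 ≤ m → Module.finrank E (Em m) = m) (ω : Fin (k + 1) → ℂ)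
    (hω : ∀ m, 1 ≤ m → (∑ i, ω i ^ m) = (-1 : ℂ) ^ k * fieldKloosterman α ψ (Em m) (algebraMap E (Em m) η)) :
    matrixKloosterman α ψ (jordanBlock (y : Matrix (Fin a) (Fin a) F) b) = 
      (-1) ^ (k * (a * b)) * (Fintype.card F : ℂ) ^ (k * ((a * b) * (a * b - 1) / 2)) * hh ω b := by
  have hne := nonempty_of_irr hy
  have ha : 0 < a := by rw [← Fintype.card_fin a]; exact Fintype.card_pos
  have hmin : ∀ m, Polynomial.aeval (algebraMap E (Em m) η) (y : Matrix (Fin a) (Fin a) F).charpoly = 0 := by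
    intro m
    rw [Polynomial.aeval_algebraMap_apply, hη, map_zero]
  have hη0 : η ≠ 0 := by
    rintro rfl
    rw [← Polynomial.coeff_zero_eq_aeval_zero'] at hη
    have h1 := Matrix.det_eq_sign_charpoly_coeff (y : Matrix (Fin a) (Fin a) F)
    rw [(map_eq_zero _).mp hη, mul_zero] at h1
    have h2 := (Matrix.isUnit_iff_isUnit_det _).mp y.isUnit
    rw [h1] at h2
    exact not_isUnit_zero h2
  have hv : ∀ g : Matrix (Pw (Fin a) b) (Pw (Fin a) b) F, prim (y : Matrix (Fin a) (Fin a) F) g → lf (y : Matrix (Fin a) (Fin a) F) g = 1 →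
      matrixKloosterman α ψ g = matrixKloosterman α ψ (jordanBlock (y : Matrix (Fin a) (Fin a) F) b) := by
    intro g hp hl
    obtain ⟨r, hr⟩ := hp
    have h1 := prim_card hr
    rw [card_Pw] at h1
    have h2 : b = r := Nat.eq_of_mul_eq_mul_left Fintype.card_pos h1
    rw [← h2] at hr
    let e : Fin b × Fin a ≃ Pw (Fin a) b := Fintype.equivOfCardEq (by rw [card_Pw, Fintype.card_prod, Fintype.card_fin, Fintype.card_fin, mul_comm])
    rw [← KM_reindex α ψ e]
    refine reg_same (X := fun x => matrixKloosterman α ψ x) hy hb ?_ ?_ hr hl (mK_CI α ψ)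
    · rw [Matrix.charpoly_reindex, jb_charpoly _ _ ha]
    · have h3 := jb_lf hy b hb
      unfold lf at h3 ⊢
      rw [Ho_reindex, h3]
  have h := main_one hψ α hy ω (by
    intro r hr
    rw [hω r hr, ← mul_assoc ((-1 : ℂ) ^ k), ← pow_add, (Even.add_self k).neg_one_pow, one_mul]
    symm
    apply pi_eq hψ α hy r hr
    · rw [← Module.finrank_mul_finrank F E (Em r), hE, hEm r hr, Fintype.card_fin]
    · exact (map_ne_zero _).mpr hη0
    · exact (minpoly.eq_of_irreducible_of_monic hy (hmin r) (Matrix.charpoly_monic _)).symm) b hb _ hv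
  rw [Fintype.card_fin] at h
  exact h

end MK

end

/-- for a regular element `y = diag(J_{(b₁)}(y₁),…,J_{(b_s)}(y_s))`,
`K(α,ψ,y) = (-1)^((k-1)n) q^((k-1)n(n-1)/2) ∏_j h_{b_j}(ω_{j,1},…,ω_{j,k})`, where `h_b` is
the complete homogeneous symmetric polynomial of degree `b`. -/
theorem matrix_kloosterman_regular_symmetric_powers
    {F : Type} [Field F] [Fintype F] [DecidableEq F]
    (ψ : AddChar F ℂ) (hψ : ∃ a : F, ψ a ≠ 1)
    {k : ℕ} (hk : 1 ≤ k) (α : Fin k → Fˣ →* ℂˣ)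
    {s : ℕ} (a : Fin s → ℕ)
    (y : ∀ j, (Matrix (Fin (a j)) (Fin (a j)) F)ˣ)
    (hirr : ∀ j, Irreducible (Matrix.charpoly (y j : Matrix (Fin (a j)) (Fin (a j)) F)))
    (hcop : ∀ j₁ j₂, j₁ ≠ j₂ →
      IsCoprime (Matrix.charpoly (y j₁ : Matrix (Fin (a j₁)) (Fin (a j₁)) F))
        (Matrix.charpoly (y j₂ : Matrix (Fin (a j₂)) (Fin (a j₂)) F)))
    (b : Fin s → ℕ) (hb : ∀ j, 1 ≤ b j)
    {n : ℕ} (hn : n = ∑ j, a j * b j)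
    (E : Fin s → Type) [∀ j, Field (E j)] [∀ j, Fintype (E j)] [∀ j, DecidableEq (E j)]
    [∀ j, Algebra F (E j)] (hE : ∀ j, Module.finrank F (E j) = a j)
    (η : ∀ j, E j)
    (hη : ∀ j, Polynomial.aeval (η j)
      (Matrix.charpoly (y j : Matrix (Fin (a j)) (Fin (a j)) F)) = 0)
    (Em : Fin s → ℕ → Type) [∀ j m, Field (Em j m)] [∀ j m, Fintype (Em j m)]
    [∀ j m, DecidableEq (Em j m)] [∀ j m, Algebra F (Em j m)] [∀ j m, Algebra (E j) (Em j m)]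
    [∀ j m, IsScalarTower F (E j) (Em j m)]
    (hEm : ∀ j m, 1 ≤ m → Module.finrank (E j) (Em j m) = m)
    (ω : Fin s → Fin k → ℂ)
    (hω : ∀ j m, 1 ≤ m →
      (∑ i, ω j i ^ m) = (-1 : ℂ) ^ (k - 1) *
        fieldKloosterman α ψ (Em j m) (algebraMap (E j) (Em j m) (η j))) :
    matrixKloosterman α ψ
      (Matrix.blockDiagonal'
        (fun j => jordanBlock (y j : Matrix (Fin (a j)) (Fin (a j)) F) (b j)))
    = (-1 : ℂ) ^ ((k - 1) * n) *
        (Fintype.card F : ℂ) ^ ((k - 1) * (n * (n - 1) / 2)) *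
        ∏ j, ∑ d ∈ Finset.Nat.antidiagonalTuple k (b j), ∏ i, ω j i ^ d i := by
  obtain ⟨k, rfl⟩ : ∃ k', k = k' + 1 := ⟨k - 1, by omega⟩
  rw [Nat.add_sub_cancel] at hω ⊢
  have hψ1 : ψ ≠ 1 := by
    rintro rfl
    obtain ⟨x, hx⟩ := hψ
    exact hx (AddChar.one_apply x)
  have ha : ∀ j, 0 < a j := by
    intro j
    have hne := MK.nonempty_of_irr (hirr j)
    rw [← Fintype.card_fin (a j)]; exact Fintype.card_pos
  have hc : ∀ j, Fintype.card (Fin (b j) × Fin (a j)) = a j * b j := by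
    intro j; rw [Fintype.card_prod, Fintype.card_fin, Fintype.card_fin, mul_comm]
  have h := (MK.multi hψ1 α (fun j => Fin (b j) × Fin (a j)) (fun j => jordanBlock (y j : Matrix (Fin (a j)) (Fin (a j)) F) (b j))
    (by
      intro j₁ j₂ h
      rw [MK.jb_charpoly _ _ (ha j₁), MK.jb_charpoly _ _ (ha j₂)]
      exact (hcop j₁ j₂ h).pow)
    (fun j => (-1) ^ (k * (a j * b j)) * MK.hh (ω j) (b j))
    (by
      intro j
      rw [hc, MK.main_jb hψ1 α (y j) (hirr j) (b j) (hb j) (E j) (hE j) (η j) (hη j) (Em j) (hEm j) (ω j) (hω j)]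
      ring)).2
  refine h.trans ?_
  have hsum : ∑ j, Fintype.card (Fin (b j) × Fin (a j)) = n := by
    rw [hn]; exact Finset.sum_congr rfl fun j _ => hc j
  rw [hsum, Finset.prod_mul_distrib, Finset.prod_pow_eq_pow_sum, ← Finset.mul_sum, ← hn]
  unfold MK.hh
  ring
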